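/- Let n ≥ 1 and m = 1, and let α be a multi-index with |α| = 1 (so X^α is one of the vector fields ∂_{x'_j} or x'_j ∂_{x''_1}). There exists a constant C = C(n,α) such that for every nonzero a ∈ ℝ^n, every f ∈ C_c^∞(ℝ^{n+1}), and every s > 0, μ_a({x ∈ ℝ^{n+1} : |R_{α,a}f(x)| > s}) ≤ C s^{−1} ‖f‖_{L^1(ℝ^{n+1}, dμ_a)}; that is, the first-order Riesz transforms are of weak type (1,1) with respect to dμ_a, uniformly in a. -/

import Mathlib

noncomputable section
open MeasureTheory Real Set Filter

/-- `ℝ^{n+m}` written as pairs `x = (x', x'')`. -/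
abbrev Ep (n m : ℕ) := EuclideanSpace ℝ (Fin n) × EuclideanSpace ℝ (Fin m)

/-- Euclidean dot product. -/
def dotp {n : ℕ} (a b : EuclideanSpace ℝ (Fin n)) : ℝ := ∑ i, a i * b i

/-- The measure `dμ_a = e^{2a·x'} dx` on `ℝ^{n+m}`. -/
def muG {n m : ℕ} (a : EuclideanSpace ℝ (Fin n)) : Measure (Ep n m) :=
  volume.withDensity fun x => ENNReal.ofReal (Real.exp (2 * dotp a x.1))

/-- Scaled Hermite heat kernel `k_{t,λ}(x',y')`. -/
def hermiteK (n : ℕ) {m : ℕ} (t : ℝ) (lam : EuclideanSpace ℝ (Fin m))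
    (x' y' : EuclideanSpace ℝ (Fin n)) : ℝ :=
  (‖lam‖ / (2 * π * Real.sinh (2 * ‖lam‖ * t))) ^ ((n : ℝ) / 2) *
    Real.exp (-(‖lam‖ / 2) * (Real.cosh (2 * ‖lam‖ * t) / Real.sinh (2 * ‖lam‖ * t)) *
        ‖x' - y'‖ ^ 2 - ‖lam‖ * Real.tanh (‖lam‖ * t) * dotp x' y')

/-- Grushin heat kernel `H_t(x,y) = (2π)^{-m} ∫ k_{t,λ}(x',y') e^{-iλ·(x''-y'')} dλ`. -/
def grushinH {n m : ℕ} (t : ℝ) (x y : Ep n m) : ℂ :=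
  ((((2 * π) ^ m)⁻¹ : ℝ) : ℂ) * ∫ lam : EuclideanSpace ℝ (Fin m),
    ((hermiteK n t lam x.1 y.1 : ℝ) : ℂ) *
      Complex.exp (-Complex.I * ((dotp lam (x.2 - y.2) : ℝ) : ℂ))

/-- Drifted Grushin heat kernel `H_{t,a}(x,y) = e^{-|a|²t} e^{-a·(x'+y')} H_t(x,y)`. -/
def driftH {n m : ℕ} (a : EuclideanSpace ℝ (Fin n)) (t : ℝ) (x y : Ep n m) : ℂ :=
  ((Real.exp (-‖a‖ ^ 2 * t) * Real.exp (-dotp a (x.1 + y.1)) : ℝ) : ℂ) * grushinH t x y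

/-- The drifted heat semigroup `e^{-tG_a} f(x) = ∫ H_{t,a}(x,y) f(y) e^{2a·y'} dy`. -/
def heatOp {n m : ℕ} (a : EuclideanSpace ℝ (Fin n)) (t : ℝ) (f : Ep n m → ℂ)
    (x : Ep n m) : ℂ :=
  ∫ y : Ep n m, driftH a t x y * f y * ((Real.exp (2 * dotp a y.1) : ℝ) : ℂ)

/-- The Grushin vector fields on `ℝ^{n+1}`: `X_j = ∂_{x'_j}` and `X_{j,1} = x'_j ∂_{x''}`. -/
def vf {n : ℕ} : (Fin n ⊕ Fin n × Fin 1) → (Ep n 1 → ℂ) → (Ep n 1 → ℂ)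
  | Sum.inl j => fun f x =>
      deriv (fun s : ℝ => f (x.1 + s • EuclideanSpace.single j 1, x.2)) 0
  | Sum.inr jk => fun f x =>
      ((x.1 jk.1 : ℝ) : ℂ) *
        deriv (fun s : ℝ => f (x.1, x.2 + s • EuclideanSpace.single jk.2 1)) 0

/-- `X^α` for a multi-index `α` (a fixed ordering of the compositions). -/
def Xalpha {n : ℕ} (α : Fin n ⊕ Fin n × Fin 1 → ℕ) : (Ep n 1 → ℂ) → (Ep n 1 → ℂ) :=
  ((Finset.univ : Finset (Fin n ⊕ Fin n × Fin 1)).toList).foldr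
    (fun i F => (vf i)^[α i] ∘ F) id

/-- The Riesz transform
`R_{α,a} f(x) = Γ(k/2)⁻¹ ∫₀^∞ t^{k/2-1} X^α (e^{-tG_a} f)(x) dt`, where `k = |α|`. -/
def grushinRiesz {n : ℕ} (a : EuclideanSpace ℝ (Fin n)) (α : Fin n ⊕ Fin n × Fin 1 → ℕ)
    (f : Ep n 1 → ℂ) (x : Ep n 1) : ℂ :=
  ((Real.Gamma (((∑ i, α i : ℕ) : ℝ) / 2))⁻¹ : ℝ) *
    ∫ t in Set.Ioi (0 : ℝ),
      ((t ^ ((((∑ i, α i : ℕ) : ℝ) / 2) - 1) : ℝ) : ℂ) * Xalpha α (heatOp a t f) x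


namespace GR

/-! ### Part 1: special functions of one variable -/

/-- `sinh (2u) / (2u)` extended analytically to `u = 0`. -/
def hh (u : ℝ) : ℝ := ∫ θ in (0:ℝ)..1, Real.cosh (2 * u * θ)
def hh1 (u : ℝ) : ℝ := ∫ θ in (0:ℝ)..1, 2 * θ * Real.sinh (2 * u * θ)
def hh2 (u : ℝ) : ℝ := ∫ θ in (0:ℝ)..1, 2 * θ * (2 * θ * Real.cosh (2 * u * θ))

lemma hh_eq {u : ℝ} (hu : u ≠ 0) : hh u = Real.sinh (2 * u) / (2 * u) := by
  unfold hh
  have h : ∀ θ ∈ uIcc (0:ℝ) 1, HasDerivAt (fun θ => Real.sinh (2 * u * θ) / (2 * u))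
      (Real.cosh (2 * u * θ)) θ := by
    intro θ _
    have h1 : HasDerivAt (fun θ : ℝ => 2 * u * θ) (2 * u) θ := by
      simpa using (hasDerivAt_id θ).const_mul (2 * u)
    exact (((Real.hasDerivAt_sinh _).comp θ h1).div_const (2 * u)).congr_deriv (by field_simp)
  rw [intervalIntegral.integral_eq_sub_of_hasDerivAt h
    (Continuous.intervalIntegrable (by fun_prop) _ _)]
  simp

lemma hasDerivAt_hh (u : ℝ) : HasDerivAt hh (hh1 u) u := by
  have := (intervalIntegral.hasDerivAt_integral_of_dominated_loc_of_deriv_le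
    (μ := volume) (a := (0:ℝ)) (b := 1) (x₀ := u) (s := Metric.ball u 1)
    (F := fun u θ => Real.cosh (2 * u * θ))
    (F' := fun u θ => 2 * θ * Real.sinh (2 * u * θ))
    (bound := fun _ => 2 * Real.cosh (2 * (|u| + 1)))
    (Metric.ball_mem_nhds u one_pos)
    (Eventually.of_forall fun v => (by fun_prop : Continuous _).aestronglyMeasurable)
    (Continuous.intervalIntegrable (by fun_prop) _ _)
    (by fun_prop : Continuous _).aestronglyMeasurable
    ?_ (by simp) ?_).2
  · exact this
  · refine Eventually.of_forall fun θ hθ v hv => ?_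
    rw [uIoc_of_le zero_le_one] at hθ
    have hv' : |v| ≤ |u| + 1 := by
      have : |v - u| < 1 := by simpa [Real.dist_eq] using hv
      have := abs_sub_abs_le_abs_sub v u
      linarith
    have h1 : |2 * v * θ| ≤ |2 * (|u| + 1)| := by
      rw [abs_mul, abs_mul, abs_mul, abs_of_pos hθ.1, abs_two, abs_of_nonneg (by positivity : 0 ≤ |u| + 1)]
      nlinarith [hθ.1, hθ.2, abs_nonneg v]
    have h2 : |Real.sinh (2 * v * θ)| ≤ Real.cosh (2 * v * θ) := by
      rw [Real.abs_sinh, ← Real.cosh_abs]; exact (Real.sinh_lt_cosh _).le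
    have h3 := Real.cosh_le_cosh.2 h1
    rw [Real.norm_eq_abs, abs_mul, abs_mul, abs_two, abs_of_pos hθ.1]
    have := abs_nonneg (Real.sinh (2 * v * θ))
    have := Real.cosh_pos (2 * (|u| + 1))
    nlinarith [hθ.1, hθ.2]
  · refine Eventually.of_forall fun θ hθ v hv => ?_
    have h1 : HasDerivAt (fun v : ℝ => 2 * v * θ) (2 * θ) v := by
      simpa using ((hasDerivAt_id v).const_mul 2).mul_const θ
    exact ((Real.hasDerivAt_cosh _).comp v h1).congr_deriv (by ring)

lemma hasDerivAt_hh1 (u : ℝ) : HasDerivAt hh1 (hh2 u) u := by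
  have := (intervalIntegral.hasDerivAt_integral_of_dominated_loc_of_deriv_le
    (μ := volume) (a := (0:ℝ)) (b := 1) (x₀ := u) (s := Metric.ball u 1)
    (F := fun u θ => 2 * θ * Real.sinh (2 * u * θ))
    (F' := fun u θ => 2 * θ * (2 * θ * Real.cosh (2 * u * θ)))
    (bound := fun _ => 4 * Real.cosh (2 * (|u| + 1)))
    (Metric.ball_mem_nhds u one_pos)
    (Eventually.of_forall fun v => (by fun_prop : Continuous _).aestronglyMeasurable)
    (Continuous.intervalIntegrable (by fun_prop) _ _)
    (by fun_prop : Continuous _).aestronglyMeasurable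
    ?_ (by simp) ?_).2
  · exact this
  · refine Eventually.of_forall fun θ hθ v hv => ?_
    rw [uIoc_of_le zero_le_one] at hθ
    have hv' : |v| ≤ |u| + 1 := by
      have : |v - u| < 1 := by simpa [Real.dist_eq] using hv
      have := abs_sub_abs_le_abs_sub v u
      linarith
    have h1 : |2 * v * θ| ≤ |2 * (|u| + 1)| := by
      rw [abs_mul, abs_mul, abs_mul, abs_of_pos hθ.1, abs_two, abs_of_nonneg (by positivity : 0 ≤ |u| + 1)]
      nlinarith [hθ.1, hθ.2, abs_nonneg v]
    have h3 := Real.cosh_le_cosh.2 h1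
    have h4 := Real.cosh_pos (2 * v * θ)
    rw [Real.norm_eq_abs, abs_of_nonneg (by have := hθ.1.le; positivity)]
    have h5 : 2 * θ * (2 * θ) ≤ 4 := by nlinarith [hθ.1, hθ.2]
    calc 2 * θ * (2 * θ * Real.cosh (2 * v * θ)) = (2 * θ * (2 * θ)) * Real.cosh (2 * v * θ) := by ring
      _ ≤ 4 * Real.cosh (2 * v * θ) := by gcongr
      _ ≤ _ := by gcongr
  · refine Eventually.of_forall fun θ hθ v hv => ?_
    have h1 : HasDerivAt (fun v : ℝ => 2 * v * θ) (2 * θ) v := by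
      simpa using ((hasDerivAt_id v).const_mul 2).mul_const θ
    exact (((Real.hasDerivAt_sinh _).comp v h1).const_mul (2 * θ)).congr_deriv (by ring)

lemma one_le_hh (u : ℝ) : 1 ≤ hh u := by
  have : ∫ θ in (0:ℝ)..1, (1:ℝ) ≤ hh u := by
    apply intervalIntegral.integral_mono_on zero_le_one (by simp)
      (Continuous.intervalIntegrable (by fun_prop) _ _)
    intro θ _; exact Real.one_le_cosh _
  simpa using this

lemma hh_pos (u : ℝ) : 0 < hh u := lt_of_lt_of_le one_pos (one_le_hh u)

lemma abs_sinh_le_mul_cosh (v : ℝ) : |Real.sinh v| ≤ |v| * Real.cosh v := by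
  rw [Real.abs_sinh, ← Real.cosh_abs]
  have h : ∀ x : ℝ, 0 ≤ x → Real.sinh x ≤ x * Real.cosh x := by
    intro x hx
    have hmono : MonotoneOn (fun x => x * Real.cosh x - Real.sinh x) (Ici 0) := by
      apply monotoneOn_of_deriv_nonneg (convex_Ici 0) (by fun_prop) (by fun_prop)
      intro y hy
      simp only [interior_Ici, mem_Ioi] at hy
      have : HasDerivAt (fun x => x * Real.cosh x - Real.sinh x)
          (1 * Real.cosh y + y * Real.sinh y - Real.cosh y) y :=
        ((hasDerivAt_id y).mul (Real.hasDerivAt_cosh y)).sub (Real.hasDerivAt_sinh y)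
      rw [this.deriv]
      have := Real.sinh_pos_iff.2 hy
      nlinarith
    have := hmono (mem_Ici.2 le_rfl) (mem_Ici.2 hx) hx
    simp at this; linarith
  exact h _ (abs_nonneg v)

lemma abs_hh1_le (u : ℝ) : |hh1 u| ≤ 4 * |u| * hh u := by
  unfold hh1 hh
  rw [← intervalIntegral.integral_const_mul, ← Real.norm_eq_abs]
  apply intervalIntegral.norm_integral_le_of_norm_le zero_le_one
  · refine Eventually.of_forall fun θ hθ => ?_
    have := abs_sinh_le_mul_cosh (2 * u * θ)
    rw [Real.norm_eq_abs, abs_mul, abs_mul, abs_two, abs_of_pos hθ.1]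
    rw [abs_mul (2 * u), abs_mul, abs_two, abs_of_pos hθ.1] at this
    have hc := Real.cosh_pos (2 * u * θ)
    have hu := abs_nonneg u
    calc 2 * θ * |Real.sinh (2 * u * θ)| ≤ 2 * θ * (2 * |u| * θ * Real.cosh (2 * u * θ)) := by
          have := hθ.1.le; gcongr
      _ = (θ * θ) * (4 * |u| * Real.cosh (2 * u * θ)) := by ring
      _ ≤ 1 * (4 * |u| * Real.cosh (2 * u * θ)) := by
          have h1 : θ * θ ≤ 1 := by nlinarith [hθ.1, hθ.2]
          gcongr
      _ = _ := by ring
  · exact Continuous.intervalIntegrable (by fun_prop) _ _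

lemma abs_hh1_le' (u : ℝ) : |hh1 u| ≤ 2 * hh u := by
  unfold hh1 hh
  rw [← intervalIntegral.integral_const_mul, ← Real.norm_eq_abs]
  apply intervalIntegral.norm_integral_le_of_norm_le zero_le_one
  · refine Eventually.of_forall fun θ hθ => ?_
    have h2 : |Real.sinh (2 * u * θ)| ≤ Real.cosh (2 * u * θ) := by
      rw [Real.abs_sinh, ← Real.cosh_abs]; exact (Real.sinh_lt_cosh _).le
    rw [Real.norm_eq_abs, abs_mul, abs_mul, abs_two, abs_of_pos hθ.1]
    have := hθ.1.le
    have := abs_nonneg (Real.sinh (2 * u * θ))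
    nlinarith [hθ.1, hθ.2]
  · exact Continuous.intervalIntegrable (by fun_prop) _ _

lemma abs_hh2_le (u : ℝ) : |hh2 u| ≤ 4 * hh u := by
  unfold hh2 hh
  rw [← intervalIntegral.integral_const_mul, ← Real.norm_eq_abs]
  apply intervalIntegral.norm_integral_le_of_norm_le zero_le_one
  · refine Eventually.of_forall fun θ hθ => ?_
    have h4 := Real.cosh_pos (2 * u * θ)
    rw [Real.norm_eq_abs, abs_of_nonneg (by have := hθ.1.le; positivity)]
    have h5 : 2 * θ * (2 * θ) ≤ 4 := by nlinarith [hθ.1, hθ.2]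
    calc 2 * θ * (2 * θ * Real.cosh (2 * u * θ)) = (2 * θ * (2 * θ)) * Real.cosh (2 * u * θ) := by ring
      _ ≤ 4 * Real.cosh (2 * u * θ) := by gcongr
  · exact Continuous.intervalIntegrable (by fun_prop) _ _

/-- exponential lower bound -/
lemma exp_le_hh (u : ℝ) : Real.exp |u| / 4 ≤ hh u := by
  have h0 : ∀ a b : ℝ, IntervalIntegrable (fun θ : ℝ => Real.cosh (2 * u * θ)) volume a b :=
    fun a b => Continuous.intervalIntegrable (by fun_prop) _ _
  unfold hh
  rw [← intervalIntegral.integral_add_adjacent_intervals (h0 0 (1/2)) (h0 (1/2) 1)]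
  have h1 : 0 ≤ ∫ θ in (0:ℝ)..(1/2), Real.cosh (2 * u * θ) :=
    intervalIntegral.integral_nonneg (by norm_num) fun θ _ => (Real.cosh_pos _).le
  have h2 : ∫ θ in (1/2:ℝ)..1, Real.exp |u| / 2 ≤ ∫ θ in (1/2:ℝ)..1, Real.cosh (2 * u * θ) := by
    apply intervalIntegral.integral_mono_on (by norm_num) (by simp) (h0 _ _)
    intro θ hθ
    rw [← Real.cosh_abs, Real.cosh_eq]
    have : |u| ≤ |2 * u * θ| := by
      rw [abs_mul, abs_mul, abs_two, abs_of_nonneg (by linarith [hθ.1] : 0 ≤ θ)]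
      nlinarith [hθ.1, abs_nonneg u]
    have := Real.exp_le_exp.2 this
    have := Real.exp_pos (-|2 * u * θ|)
    linarith
  simp at h2
  linarith

/-- `u tanh u` and its derivatives -/
def cc (u : ℝ) : ℝ := u * (Real.sinh u / Real.cosh u)
def cc1 (u : ℝ) : ℝ := Real.sinh u / Real.cosh u + u * (1 / Real.cosh u ^ 2)
def cc2 (u : ℝ) : ℝ := 2 * (1 / Real.cosh u ^ 2) -
  2 * (u * (Real.sinh u / Real.cosh u) * (1 / Real.cosh u ^ 2))

lemma hasDerivAt_th (u : ℝ) : HasDerivAt (fun u => Real.sinh u / Real.cosh u)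
    (1 / Real.cosh u ^ 2) u := by
  refine ((Real.hasDerivAt_sinh u).div (Real.hasDerivAt_cosh u) (Real.cosh_pos u).ne').congr_deriv ?_
  have := Real.cosh_sq u
  congr 1
  nlinarith

lemma hasDerivAt_cc (u : ℝ) : HasDerivAt cc (cc1 u) u := by
  exact ((hasDerivAt_id u).mul (hasDerivAt_th u)).congr_deriv (by simp [cc1])

lemma hasDerivAt_cc1 (u : ℝ) : HasDerivAt cc1 (cc2 u) u := by
  have h1 : HasDerivAt (fun u => 1 / Real.cosh u ^ 2)
      (-2 * (Real.sinh u / Real.cosh u) * (1 / Real.cosh u ^ 2)) u := by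
    have := ((Real.hasDerivAt_cosh u).fun_pow 2).fun_inv (pow_ne_zero 2 (Real.cosh_pos u).ne')
    simp only [one_div]
    refine this.congr_deriv ?_
    have := (Real.cosh_pos u).ne'
    simp; field_simp
  refine ((hasDerivAt_th u).add ((hasDerivAt_id u).mul h1)).congr_deriv ?_
  simp only [cc2, id]; ring

lemma abs_th_le_one (u : ℝ) : |Real.sinh u / Real.cosh u| ≤ 1 := by
  rw [abs_div, abs_of_pos (Real.cosh_pos u), div_le_one (Real.cosh_pos u), Real.abs_sinh, ← Real.cosh_abs]
  exact (Real.sinh_lt_cosh _).le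

lemma abs_th_le (u : ℝ) : |Real.sinh u / Real.cosh u| ≤ |u| := by
  rw [abs_div, abs_of_pos (Real.cosh_pos u), div_le_iff₀ (Real.cosh_pos u)]
  exact abs_sinh_le_mul_cosh u

lemma sech_sq_le (u : ℝ) : (1 + u ^ 2) * (1 / Real.cosh u ^ 2) ≤ 1 := by
  have h := Real.cosh_sq u
  have h2 : u ^ 2 ≤ Real.sinh u ^ 2 := by
    rw [sq_le_sq, Real.abs_sinh]; exact Real.self_le_sinh_iff.2 (abs_nonneg u)
  have := Real.cosh_pos u
  rw [mul_one_div, div_le_one (by positivity)]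
  linarith

lemma cc_abs_le (u : ℝ) : |cc u| ≤ |u| := by
  unfold cc; rw [abs_mul]
  nlinarith [abs_th_le_one u, abs_nonneg u]

lemma cc1_abs_le (u : ℝ) : |cc1 u| ≤ 2 * |u| := by
  unfold cc1
  have h1 := abs_th_le u
  have h2 := sech_sq_le u
  have h3 : 0 < 1 / Real.cosh u ^ 2 := by have := Real.cosh_pos u; positivity
  refine (abs_add_le _ _).trans ?_
  rw [abs_mul, abs_of_pos h3]
  have : 1 / Real.cosh u ^ 2 ≤ 1 := by nlinarith [sq_nonneg u]
  nlinarith [abs_nonneg u]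

lemma cc1_abs_le' (u : ℝ) : |cc1 u| ≤ 2 := by
  unfold cc1
  have h1 := abs_th_le_one u
  have h2 := sech_sq_le u
  have h3 : 0 < 1 / Real.cosh u ^ 2 := by have := Real.cosh_pos u; positivity
  refine (abs_add_le _ _).trans ?_
  rw [abs_mul, abs_of_pos h3]
  have : |u| ≤ 1 + u ^ 2 := by rw [← sq_abs u]; nlinarith [sq_nonneg (|u| - 1)]
  nlinarith [abs_nonneg u]

lemma cc2_abs_le (u : ℝ) : |cc2 u| ≤ 4 := by
  unfold cc2
  have h1 := abs_th_le u
  have h2 := sech_sq_le u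
  have h3 : 0 < 1 / Real.cosh u ^ 2 := by have := Real.cosh_pos u; positivity
  have h4 : |u * (Real.sinh u / Real.cosh u)| ≤ u ^ 2 := by
    rw [abs_mul, ← sq_abs]; nlinarith [abs_nonneg u]
  refine (abs_sub _ _).trans ?_
  rw [abs_mul, abs_mul, abs_mul, abs_of_pos h3, abs_two]
  nlinarith [abs_nonneg u, sq_nonneg u]

lemma th_lower {u : ℝ} (hu : 0 ≤ u) : u / (1 + u) ≤ Real.sinh u / Real.cosh u := by
  have hm : MonotoneOn (fun x => (1 + x) * Real.sinh x - x * Real.cosh x) (Ici 0) := by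
    apply monotoneOn_of_deriv_nonneg (convex_Ici 0) (by fun_prop) (by fun_prop)
    intro y hy
    simp only [interior_Ici, mem_Ioi] at hy
    have : HasDerivAt (fun x => (1 + x) * Real.sinh x - x * Real.cosh x)
        ((1 * Real.sinh y + (1 + y) * Real.cosh y) - (1 * Real.cosh y + y * Real.sinh y)) y :=
      (((hasDerivAt_id y).const_add 1).mul (Real.hasDerivAt_sinh y)).sub
        ((hasDerivAt_id y).mul (Real.hasDerivAt_cosh y))
    rw [this.deriv]
    have h1 := Real.sinh_pos_iff.2 hy
    have h2 := Real.sinh_lt_cosh y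
    nlinarith
  have := hm (mem_Ici.2 le_rfl) (mem_Ici.2 hu) hu
  simp at this
  rw [div_le_div_iff₀ (by linarith) (Real.cosh_pos u)]
  linarith

lemma cc_even (u : ℝ) : cc (-u) = cc u := by simp [cc]; ring
lemma hh_even (u : ℝ) : hh (-u) = hh u := by
  unfold hh
  congr 1; ext θ
  rw [← Real.cosh_neg]; congr 1; ring

lemma cc_abs (u : ℝ) : cc |u| = cc u := by
  rcases abs_choice u with h | h <;> rw [h]; exact cc_even u
lemma hh_abs (u : ℝ) : hh |u| = hh u := by
  rcases abs_choice u with h | h <;> rw [h]; exact hh_even u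

lemma cc_lower (u : ℝ) : u ^ 2 / (1 + |u|) ≤ cc u := by
  rw [← cc_abs, ← sq_abs]; unfold cc
  have := th_lower (abs_nonneg u)
  calc |u| ^ 2 / (1 + |u|) = |u| * (|u| / (1 + |u|)) := by ring
    _ ≤ _ := by gcongr

/-- `u coth u - 1 ≥ u²/(4(1+|u|))`. -/
lemma bb_lower (u : ℝ) : u ^ 2 / (1 + |u|) / 4 ≤ 1 / hh u + cc u - 1 := by
  rw [← cc_abs, ← sq_abs, ← hh_abs]
  generalize hx : |u| = x
  have hx0 : 0 ≤ x := hx ▸ abs_nonneg u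
  rcases hx0.eq_or_lt with rfl | hx0
  · simp [cc, hh]
  have hs := Real.sinh_pos_iff.2 hx0
  have hc := Real.cosh_pos x
  have hcs := Real.cosh_sq x
  have e : 1 / hh x + cc x - 1 = (x * Real.cosh x - Real.sinh x) / Real.sinh x := by
    rw [hh_eq hx0.ne', Real.sinh_two_mul]; unfold cc
    field_simp
    nlinarith
  rw [e, div_div, div_le_div_iff₀ (by positivity) hs]
  have hm : MonotoneOn (fun x => (1 + x) * (x * Real.cosh x - Real.sinh x) * 4 - x ^ 2 * Real.sinh x) (Ici 0) := by
    apply monotoneOn_of_deriv_nonneg (convex_Ici 0) (by fun_prop) (by fun_prop)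
    intro y hy
    simp only [interior_Ici, mem_Ioi] at hy
    have : HasDerivAt (fun x => (1 + x) * (x * Real.cosh x - Real.sinh x) * 4 - x ^ 2 * Real.sinh x)
        ((1 * (y * Real.cosh y - Real.sinh y) + (1 + y) * ((1 * Real.cosh y + y * Real.sinh y) - Real.cosh y)) * 4
          - (2 * y * Real.sinh y + y ^ 2 * Real.cosh y)) y := by
      refine ((((hasDerivAt_id y).const_add 1).mul
        (((hasDerivAt_id y).mul (Real.hasDerivAt_cosh y)).sub (Real.hasDerivAt_sinh y))).mul_const 4).sub ?_
      exact ((hasDerivAt_pow 2 y).mul (Real.hasDerivAt_sinh y)).congr_deriv (by simp)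
    rw [this.deriv]
    have h1 := Real.sinh_pos_iff.2 hy
    have h2 := th_lower hy.le
    rw [div_le_div_iff₀ (by linarith) (Real.cosh_pos y)] at h2
    have h3 := abs_sinh_le_mul_cosh y
    rw [abs_of_pos h1, abs_of_pos hy] at h3
    nlinarith [mul_le_mul_of_nonneg_left h2 hy.le, mul_pos hy h1, mul_pos (mul_pos hy hy) h1]
  have := hm (mem_Ici.2 le_rfl) (mem_Ici.2 hx0.le) hx0.le
  simp at this
  nlinarith

end GR

namespace GR

/-! ### Part 2: symbols and the oscillatory integral -/

/-- Phase exponent. -/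
def Ph (N d e u : ℝ) : ℝ := N * Real.log (hh u) + ((1 / hh u + cc u) * d ^ 2 + cc u * e ^ 2) / 4
def Bf (N d e u : ℝ) : ℝ := Real.exp (-Ph N d e u)

def ss1 (u : ℝ) : ℝ := -hh1 u / hh u ^ 2
def ss2 (u : ℝ) : ℝ := (-hh2 u * hh u ^ 2 - -hh1 u * (2 * hh u * hh1 u)) / (hh u ^ 2) ^ 2

lemma hasDerivAt_ss (u : ℝ) : HasDerivAt (fun u => 1 / hh u) (ss1 u) u := by
  simp only [one_div]
  exact (hasDerivAt_hh u).fun_inv (hh_pos u).ne'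

lemma hasDerivAt_ss1 (u : ℝ) : HasDerivAt ss1 (ss2 u) u := by
  refine ((hasDerivAt_hh1 u).neg.div ((hasDerivAt_hh u).pow 2)
    (pow_ne_zero 2 (hh_pos u).ne')).congr_deriv ?_
  simp [ss2]

lemma ss_le_one (u : ℝ) : 1 / hh u ≤ 1 := by
  rw [div_le_one (hh_pos u)]; exact one_le_hh u
lemma ss_pos (u : ℝ) : 0 < 1 / hh u := by have := hh_pos u; positivity

lemma abs_ss1_le (u : ℝ) : |ss1 u| ≤ 4 * |u| := by
  unfold ss1
  have h := one_le_hh u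
  rw [abs_div, abs_neg, abs_of_pos (by positivity : 0 < hh u ^ 2), div_le_iff₀ (by positivity)]
  have h2 := abs_hh1_le u
  have : hh u ≤ hh u ^ 2 := by nlinarith
  calc |hh1 u| ≤ 4 * |u| * hh u := h2
    _ ≤ _ := by gcongr

lemma abs_ss1_le' (u : ℝ) : |ss1 u| ≤ 2 := by
  unfold ss1
  have h := one_le_hh u
  rw [abs_div, abs_neg, abs_of_pos (by positivity : 0 < hh u ^ 2), div_le_iff₀ (by positivity)]
  have h2 := abs_hh1_le' u
  nlinarith

lemma abs_ss2_le (u : ℝ) : |ss2 u| ≤ 12 := by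
  unfold ss2
  have h := one_le_hh u
  have h1 := abs_hh1_le' u
  have h2 := abs_hh2_le u
  rw [abs_div, abs_of_pos (by positivity : 0 < (hh u ^ 2) ^ 2), div_le_iff₀ (by positivity)]
  refine (abs_sub _ _).trans ?_
  simp only [abs_mul, abs_neg, abs_pow, abs_two, abs_of_pos (hh_pos u)]
  have h3 : |hh1 u| * |hh1 u| ≤ 4 * hh u ^ 2 := by nlinarith [abs_nonneg (hh1 u)]
  calc |hh2 u| * hh u ^ 2 + |hh1 u| * (2 * hh u * |hh1 u|)
      = |hh2 u| * hh u ^ 2 + 2 * hh u * (|hh1 u| * |hh1 u|) := by ring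
    _ ≤ (4 * hh u) * hh u ^ 2 + 2 * hh u * (4 * hh u ^ 2) := by gcongr
    _ = 12 * hh u ^ 3 := by ring
    _ ≤ 12 * (hh u ^ 2) ^ 2 := by
      have : hh u ^ 3 ≤ hh u ^ 4 := pow_le_pow_right₀ h (by norm_num)
      nlinarith

/-- derivative of `log hh` -/
def ll1 (u : ℝ) : ℝ := hh1 u / hh u
def ll2 (u : ℝ) : ℝ := (hh2 u * hh u - hh1 u * hh1 u) / hh u ^ 2

lemma hasDerivAt_ll (u : ℝ) : HasDerivAt (fun u => Real.log (hh u)) (ll1 u) u :=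
  (hasDerivAt_hh u).log (hh_pos u).ne'
lemma hasDerivAt_ll1 (u : ℝ) : HasDerivAt ll1 (ll2 u) u :=
  (hasDerivAt_hh1 u).div (hasDerivAt_hh u) (hh_pos u).ne'
lemma abs_ll1_le (u : ℝ) : |ll1 u| ≤ 4 * |u| := by
  unfold ll1
  rw [abs_div, abs_of_pos (hh_pos u), div_le_iff₀ (hh_pos u)]; exact abs_hh1_le u
lemma abs_ll2_le (u : ℝ) : |ll2 u| ≤ 8 := by
  unfold ll2
  have h := hh_pos u
  have h1 := abs_hh1_le' u
  have h2 := abs_hh2_le u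
  rw [abs_div, abs_of_pos (by positivity : 0 < hh u ^ 2), div_le_iff₀ (by positivity)]
  refine (abs_sub _ _).trans ?_
  rw [abs_mul, abs_mul, abs_of_pos h]
  have h3 : |hh1 u| * |hh1 u| ≤ 4 * hh u ^ 2 := by nlinarith [abs_nonneg (hh1 u)]
  nlinarith

def Ph1 (N d e u : ℝ) : ℝ := N * ll1 u + ((ss1 u + cc1 u) * d ^ 2 + cc1 u * e ^ 2) / 4
def Ph2 (N d e u : ℝ) : ℝ := N * ll2 u + ((ss2 u + cc2 u) * d ^ 2 + cc2 u * e ^ 2) / 4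

lemma hasDerivAt_Ph (N d e u : ℝ) : HasDerivAt (Ph N d e) (Ph1 N d e u) u :=
  ((hasDerivAt_ll u).const_mul N).add
    (((((hasDerivAt_ss u).add (hasDerivAt_cc u)).mul_const (d ^ 2)).add
      ((hasDerivAt_cc u).mul_const (e ^ 2))).div_const 4)

lemma hasDerivAt_Ph1 (N d e u : ℝ) : HasDerivAt (Ph1 N d e) (Ph2 N d e u) u :=
  ((hasDerivAt_ll1 u).const_mul N).add
    (((((hasDerivAt_ss1 u).add (hasDerivAt_cc1 u)).mul_const (d ^ 2)).add
      ((hasDerivAt_cc1 u).mul_const (e ^ 2))).div_const 4)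

lemma abs_Ph1_le {N d e : ℝ} (hN : 0 ≤ N) (hd : 0 ≤ d) (he : 0 ≤ e) (u : ℝ) :
    |Ph1 N d e u| ≤ (4 * N + 2) * (|u| * (1 + d + e) ^ 2) := by
  unfold Ph1
  have h1 := abs_ll1_le u
  have h2 := abs_ss1_le u
  have h3 := cc1_abs_le u
  have h4 : |ss1 u + cc1 u| ≤ 6 * |u| := (abs_add_le _ _).trans (by linarith)
  have hu := abs_nonneg u
  calc |N * ll1 u + ((ss1 u + cc1 u) * d ^ 2 + cc1 u * e ^ 2) / 4|
      ≤ N * |ll1 u| + (|ss1 u + cc1 u| * d ^ 2 + |cc1 u| * e ^ 2) / 4 := by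
        refine (abs_add_le _ _).trans ?_
        rw [abs_mul, abs_of_nonneg hN, abs_div, abs_of_pos (by norm_num : (0:ℝ) < 4)]
        gcongr
        refine (abs_add_le _ _).trans ?_
        rw [abs_mul, abs_mul, abs_of_nonneg (sq_nonneg d), abs_of_nonneg (sq_nonneg e)]
    _ ≤ N * (4 * |u|) + (6 * |u| * d ^ 2 + 2 * |u| * e ^ 2) / 4 := by gcongr
    _ = |u| * (4 * N + (6 * d ^ 2 + 2 * e ^ 2) / 4) := by ring
    _ ≤ |u| * ((4 * N + 2) * (1 + d + e) ^ 2) := by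
        gcongr
        have h5 : 1 ≤ (1 + d + e) ^ 2 := by nlinarith
        have h6 : d ^ 2 + e ^ 2 ≤ (1 + d + e) ^ 2 := by nlinarith [mul_nonneg hd he]
        nlinarith
    _ = _ := by ring

lemma abs_Ph2_le {N d e : ℝ} (hN : 0 ≤ N) (hd : 0 ≤ d) (he : 0 ≤ e) (u : ℝ) :
    |Ph2 N d e u| ≤ (8 * N + 4) * (1 + d + e) ^ 2 := by
  unfold Ph2
  have h1 := abs_ll2_le u
  have h2 := abs_ss2_le u
  have h3 := cc2_abs_le u
  have h4 : |ss2 u + cc2 u| ≤ 16 := (abs_add_le _ _).trans (by linarith)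
  calc |N * ll2 u + ((ss2 u + cc2 u) * d ^ 2 + cc2 u * e ^ 2) / 4|
      ≤ N * |ll2 u| + (|ss2 u + cc2 u| * d ^ 2 + |cc2 u| * e ^ 2) / 4 := by
        refine (abs_add_le _ _).trans ?_
        rw [abs_mul, abs_of_nonneg hN, abs_div, abs_of_pos (by norm_num : (0:ℝ) < 4)]
        gcongr
        refine (abs_add_le _ _).trans ?_
        rw [abs_mul, abs_mul, abs_of_nonneg (sq_nonneg d), abs_of_nonneg (sq_nonneg e)]
    _ ≤ N * 8 + (16 * d ^ 2 + 4 * e ^ 2) / 4 := by gcongr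
    _ ≤ _ := by
        have h5 : 1 ≤ (1 + d + e) ^ 2 := by nlinarith
        have h6 : d ^ 2 + e ^ 2 ≤ (1 + d + e) ^ 2 := by nlinarith [mul_nonneg hd he]
        nlinarith

lemma Bf_le {N d e : ℝ} (hN : 1 / 2 ≤ N) (hd : 0 ≤ d) (he : 0 ≤ e) (u : ℝ) :
    Bf N d e u ≤ Real.exp 1 * (Real.exp (-(d ^ 2 / 4)) * Real.exp (-((1 + d + e) * |u| / 8))) := by
  unfold Bf
  rw [← Real.exp_add, ← Real.exp_add, Real.exp_le_exp]
  unfold Ph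
  have hu := abs_nonneg u
  have h1 : |u| - Real.log 4 ≤ Real.log (hh u) := by
    rw [← Real.log_exp |u|, ← Real.log_div (Real.exp_pos _).ne' (by norm_num)]
    exact Real.log_le_log (by positivity) (exp_le_hh u)
  have h1' : 0 ≤ Real.log (hh u) := Real.log_nonneg (one_le_hh u)
  have h2 : (1 / 2) * (|u| - Real.log 4) ≤ N * Real.log (hh u) := by nlinarith
  have h4 : Real.log 4 ≤ 3 / 2 := by
    have : Real.log 4 = 2 * Real.log 2 := by
      rw [show (4:ℝ) = 2 ^ 2 by norm_num, Real.log_pow]; norm_num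
    rw [this]; linarith [Real.log_two_lt_d9]
  have key : ∀ x : ℝ, 0 ≤ x → 2 * |u| * x - (1 + |u|) ≤ u ^ 2 / (1 + |u|) * x ^ 2 := by
    intro x hx
    have : u ^ 2 / (1 + |u|) * x ^ 2 = (|u| * x) ^ 2 / (1 + |u|) := by
      rw [← sq_abs u]; ring
    rw [this, le_div_iff₀ (by positivity)]
    nlinarith [sq_nonneg (|u| * x - (1 + |u|))]
  have h5 := mul_le_mul_of_nonneg_right (bb_lower u) (sq_nonneg d)
  have h6 := mul_le_mul_of_nonneg_right (cc_lower u) (sq_nonneg e)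
  have h7 := key d hd
  have h8 := key e he
  have h9 : 0 ≤ u ^ 2 / (1 + |u|) * e ^ 2 := by positivity
  have h10 : u ^ 2 / (1 + |u|) / 4 * d ^ 2 = (u ^ 2 / (1 + |u|) * d ^ 2) / 4 := by ring
  rw [h10] at h5
  have h11 : (1 / hh u + cc u - 1) * d ^ 2 = (1 / hh u + cc u) * d ^ 2 - d ^ 2 := by ring
  rw [h11] at h5
  have h12 : (1 + d + e) * |u| / 8 = |u| / 8 + |u| * d / 8 + |u| * e / 8 := by ring
  rw [h12]
  have : Real.log 4 / 2 + 1 / 8 ≤ 1 := by linarith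
  nlinarith

lemma Bf_pos (N d e u : ℝ) : 0 < Bf N d e u := Real.exp_pos _

lemma hasDerivAt_Bf (N d e u : ℝ) : HasDerivAt (Bf N d e) (-(Ph1 N d e u) * Bf N d e u) u :=
  ((hasDerivAt_Ph N d e u).neg.exp).congr_deriv (by simp [Bf]; ring)

/-- Symbols. -/
def IsSym (W M : ℝ) (m : ℕ) (P : ℝ → ℝ) : Prop :=
  ∃ P1 P2 : ℝ → ℝ, (∀ u, HasDerivAt P (P1 u) u) ∧ (∀ u, HasDerivAt P1 (P2 u) u) ∧
    ∀ u, |P u| ≤ M * (1 + W * |u|) ^ m ∧ |P1 u| ≤ M * W * (1 + W * |u|) ^ m ∧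
      |P2 u| ≤ M * W ^ 2 * (1 + W * |u|) ^ m

lemma IsSym.continuous {W M : ℝ} {m : ℕ} {P : ℝ → ℝ} (h : IsSym W M m P) : Continuous P := by
  obtain ⟨P1, P2, h1, _⟩ := h
  exact continuous_iff_continuousAt.2 fun u => (h1 u).continuousAt

lemma IsSym.mono {W M M' : ℝ} {m m' : ℕ} {P : ℝ → ℝ} (hW : 0 ≤ W) (hM : 0 ≤ M) (h : IsSym W M m P)
    (hMM : M ≤ M') (hm : m ≤ m') : IsSym W M' m' P := by
  obtain ⟨P1, P2, h1, h2, h3⟩ := h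
  refine ⟨P1, P2, h1, h2, fun u => ?_⟩
  obtain ⟨a, b, c⟩ := h3 u
  have hw : 1 ≤ 1 + W * |u| := by nlinarith [mul_nonneg hW (abs_nonneg u)]
  have hp : (1 + W * |u|) ^ m ≤ (1 + W * |u|) ^ m' := pow_le_pow_right₀ hw hm
  have hM' : 0 ≤ M' := hM.trans hMM
  exact ⟨a.trans (by gcongr), b.trans (by gcongr), c.trans (by gcongr)⟩

lemma IsSym.const {W : ℝ} (c : ℝ) (hW : 0 ≤ W) : IsSym W |c| 0 (fun _ => c) :=
  ⟨fun _ => 0, fun _ => 0, fun u => hasDerivAt_const _ _, fun u => hasDerivAt_const _ _,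
    fun u => ⟨by simp, by simpa using by positivity, by simpa using by positivity⟩⟩

lemma IsSym.add {W M M' : ℝ} {m : ℕ} {P Q : ℝ → ℝ} (h : IsSym W M m P) (h' : IsSym W M' m Q) :
    IsSym W (M + M') m (fun u => P u + Q u) := by
  obtain ⟨P1, P2, h1, h2, h3⟩ := h
  obtain ⟨Q1, Q2, k1, k2, k3⟩ := h'
  refine ⟨fun u => P1 u + Q1 u, fun u => P2 u + Q2 u, fun u => (h1 u).add (k1 u),
    fun u => (h2 u).add (k2 u), fun u => ?_⟩
  obtain ⟨a, b, c⟩ := h3 u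
  obtain ⟨a', b', c'⟩ := k3 u
  exact ⟨(abs_add_le _ _).trans (by nlinarith), (abs_add_le _ _).trans (by nlinarith),
    (abs_add_le _ _).trans (by nlinarith)⟩

lemma IsSym.mul {W M M' : ℝ} {m m' : ℕ} {P Q : ℝ → ℝ} (hW : 0 ≤ W) (hM : 0 ≤ M) (hM' : 0 ≤ M')
    (h : IsSym W M m P) (h' : IsSym W M' m' Q) :
    IsSym W (4 * (M * M')) (m + m') (fun u => P u * Q u) := by
  obtain ⟨P1, P2, h1, h2, h3⟩ := h
  obtain ⟨Q1, Q2, k1, k2, k3⟩ := h'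
  refine ⟨fun u => P1 u * Q u + P u * Q1 u,
    fun u => (P2 u * Q u + P1 u * Q1 u) + (P1 u * Q1 u + P u * Q2 u), fun u => (h1 u).mul (k1 u),
    fun u => ((h2 u).mul (k1 u)).add ((h1 u).mul (k2 u)), fun u => ?_⟩
  obtain ⟨a, b, c⟩ := h3 u
  obtain ⟨a', b', c'⟩ := k3 u
  have hw : 0 ≤ 1 + W * |u| := by positivity
  have hA : 0 ≤ (M * M') * (1 + W * |u|) ^ (m + m') := by positivity
  have t : ∀ {x y X Y : ℝ}, |x| ≤ X → |y| ≤ Y → |x * y| ≤ X * Y := fun hx hy => by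
    rw [abs_mul]; exact mul_le_mul hx hy (abs_nonneg _) ((abs_nonneg _).trans hx)
  refine ⟨(t a a').trans ?_, (abs_add_le _ _).trans ((add_le_add (t b a') (t a b')).trans ?_),
    (abs_add_le _ _).trans ((add_le_add ((abs_add_le _ _).trans (add_le_add (t c a') (t b b')))
      ((abs_add_le _ _).trans (add_le_add (t b b') (t a c')))).trans ?_)⟩
  · rw [pow_add] at *; nlinarith
  · rw [pow_add] at *; nlinarith [mul_nonneg hW hA]
  · rw [pow_add] at *; nlinarith [mul_nonneg (sq_nonneg W) hA]

lemma IsSym.smul {W M : ℝ} {m : ℕ} {P : ℝ → ℝ} (c : ℝ) (h : IsSym W M m P) :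
    IsSym W (|c| * M) m (fun u => c * P u) := by
  obtain ⟨P1, P2, h1, h2, h3⟩ := h
  refine ⟨fun u => c * P1 u, fun u => c * P2 u, fun u => (h1 u).const_mul c,
    fun u => (h2 u).const_mul c, fun u => ?_⟩
  obtain ⟨a, b, d⟩ := h3 u
  simp only [abs_mul, mul_assoc] at *
  exact ⟨by gcongr, by gcongr, by gcongr⟩

lemma isSym_id {W : ℝ} (hW : 1 ≤ W) : IsSym W (1 / W) 1 (fun u => u) := by
  have hW0 : 0 < W := by linarith
  refine ⟨fun _ => 1, fun _ => 0, fun u => hasDerivAt_id u, fun u => hasDerivAt_const _ _,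
    fun u => ⟨?_, ?_, ?_⟩⟩
  · rw [pow_one, mul_add, one_div, inv_mul_cancel_left₀ hW0.ne']
    have : 0 < W⁻¹ := by positivity
    linarith
  · rw [one_div, inv_mul_cancel₀ hW0.ne', pow_one, abs_one]
    nlinarith [mul_nonneg hW0.le (abs_nonneg u)]
  · rw [abs_zero]; positivity

lemma isSym_ss {W : ℝ} (hW : 1 ≤ W) : IsSym W 12 0 (fun u => 1 / hh u) := by
  refine ⟨ss1, ss2, hasDerivAt_ss, hasDerivAt_ss1, fun u => ⟨?_, ?_, ?_⟩⟩
  · rw [abs_of_pos (ss_pos u)]; linarith [ss_le_one u]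
  · have := abs_ss1_le' u; simp; linarith
  · have := abs_ss2_le u; simp; nlinarith

lemma isSym_cc {W : ℝ} (hW : 1 ≤ W) : IsSym W (4 / W) 1 cc := by
  have hW0 : 0 < W := by linarith
  have e : 4 / W * W = 4 := by field_simp
  refine ⟨cc1, cc2, hasDerivAt_cc, hasDerivAt_cc1, fun u => ⟨?_, ?_, ?_⟩⟩
  · have := cc_abs_le u
    have h2 : 4 / W * (1 + W * |u|) ^ 1 = 4 / W + (4 / W * W) * |u| := by ring
    rw [h2, e]
    have : 0 < 4 / W := by positivity
    linarith [abs_nonneg u]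
  · rw [e]; have := cc1_abs_le' u
    nlinarith [mul_nonneg hW0.le (abs_nonneg u)]
  · have := cc2_abs_le u
    have h2 : 4 / W * W ^ 2 * (1 + W * |u|) ^ 1 = (4 / W * W) * W * (1 + W * |u|) := by ring
    rw [h2, e]
    nlinarith [mul_nonneg hW0.le (abs_nonneg u), mul_nonneg hW0.le (mul_nonneg hW0.le (abs_nonneg u))]

/-- constant for exponential decay -/
def Kc (m : ℕ) : ℝ := Real.exp 1 * ((m + 2).factorial * 8 ^ (m + 2) * Real.exp 1)
lemma Kc_pos (m : ℕ) : 0 < Kc m := by unfold Kc; positivity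

lemma decay {N d e : ℝ} (hN : 1 / 2 ≤ N) (hd : 0 ≤ d) (he : 0 ≤ e) (m : ℕ) (u : ℝ) :
    (1 + (1 + d + e) * |u|) ^ m * Bf N d e u ≤
      Kc m * Real.exp (-(d ^ 2 / 4)) * (1 + ((1 + d + e) * u) ^ 2)⁻¹ := by
  have hB := Bf_le hN hd he u
  set W := 1 + d + e
  have hW : 0 < W := by positivity
  set v := W * |u|
  have hv : 0 ≤ v := by positivity
  have e1 : (W * u) ^ 2 = v ^ 2 := by simp only [v, mul_pow, sq_abs]
  rw [e1]
  have h1 : (1 + v) ^ (m + 2) * Real.exp (-(v / 8)) ≤ (m + 2).factorial * 8 ^ (m + 2) * Real.exp 1 := by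
    have h := Real.pow_div_factorial_le_exp (x := (1 + v) / 8) (by positivity) (m + 2)
    rw [div_pow, div_div, div_le_iff₀ (by positivity)] at h
    have h2 : Real.exp ((1 + v) / 8) * Real.exp (-(v / 8)) ≤ Real.exp 1 := by
      rw [← Real.exp_add, Real.exp_le_exp]; linarith
    calc (1 + v) ^ (m + 2) * Real.exp (-(v / 8))
        ≤ (Real.exp ((1 + v) / 8) * (8 ^ (m + 2) * (m + 2).factorial)) * Real.exp (-(v / 8)) := by gcongr
      _ = ((m + 2).factorial * 8 ^ (m + 2)) * (Real.exp ((1 + v) / 8) * Real.exp (-(v / 8))) := by ring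
      _ ≤ _ := by gcongr
  have h2 : 1 + v ^ 2 ≤ (1 + v) ^ 2 := by nlinarith
  rw [← div_eq_mul_inv, le_div_iff₀ (by positivity)]
  calc (1 + v) ^ m * Bf N d e u * (1 + v ^ 2)
      ≤ (1 + v) ^ m * (Real.exp 1 * (Real.exp (-(d ^ 2 / 4)) * Real.exp (-(v / 8)))) * (1 + v) ^ 2 := by
        have := Bf_pos N d e u
        gcongr
    _ = Real.exp 1 * Real.exp (-(d ^ 2 / 4)) * ((1 + v) ^ (m + 2) * Real.exp (-(v / 8))) := by ring
    _ ≤ Real.exp 1 * Real.exp (-(d ^ 2 / 4)) * ((m + 2).factorial * 8 ^ (m + 2) * Real.exp 1) := by gcongr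
    _ = _ := by unfold Kc; ring

lemma integrable_cau {W : ℝ} (hW : 0 < W) : Integrable (fun u : ℝ => (1 + (W * u) ^ 2)⁻¹) :=
  integrable_inv_one_add_sq.comp_mul_left' hW.ne'

lemma integral_cau {W : ℝ} (hW : 0 < W) : ∫ u : ℝ, (1 + (W * u) ^ 2)⁻¹ = π / W := by
  rw [Measure.integral_comp_mul_left (fun u : ℝ => (1 + u ^ 2)⁻¹) W, integral_univ_inv_one_add_sq,
    abs_of_pos (by positivity), smul_eq_mul]
  ring

/-- integrability from decay -/
lemma int_bound {N d e M : ℝ} {m : ℕ} (hN : 1 / 2 ≤ N) (hd : 0 ≤ d) (he : 0 ≤ e) (hM : 0 ≤ M)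
    {F : ℝ → ℝ} (hF : AEStronglyMeasurable F) (h : ∀ u, |F u| ≤ M * (1 + (1 + d + e) * |u|) ^ m * Bf N d e u) :
    Integrable F ∧ ∫ u, |F u| ≤ π * Kc m * M * Real.exp (-(d ^ 2 / 4)) / (1 + d + e) := by
  have hW : 0 < 1 + d + e := by positivity
  have hb : ∀ u, |F u| ≤ M * (Kc m * Real.exp (-(d ^ 2 / 4))) * (1 + ((1 + d + e) * u) ^ 2)⁻¹ := by
    intro u
    refine (h u).trans ?_
    rw [mul_assoc, mul_assoc]
    exact mul_le_mul_of_nonneg_left (decay hN hd he m u) hM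
  have hi := (integrable_cau hW).const_mul (M * (Kc m * Real.exp (-(d ^ 2 / 4))))
  have hF' : Integrable F := hi.mono' hF (Eventually.of_forall fun u => by simpa using hb u)
  refine ⟨hF', (integral_mono hF'.abs hi hb).trans ?_⟩
  rw [integral_const_mul, integral_cau hW]
  apply le_of_eq; ring

lemma osc_ibp {F F1 : ℝ → ℝ} (z : ℝ) (hF : ∀ u, HasDerivAt F (F1 u) u) (i0 : Integrable F)
    (i1 : Integrable F1) :
    Complex.I * z * ∫ u : ℝ, (F u : ℂ) * Complex.exp (-Complex.I * ((u * z : ℝ) : ℂ)) =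
      ∫ u : ℝ, (F1 u : ℂ) * Complex.exp (-Complex.I * ((u * z : ℝ) : ℂ)) := by
  have hn : ∀ u : ℝ, ‖Complex.exp (-Complex.I * ((u * z : ℝ) : ℂ))‖ = 1 := by
    intro u
    rw [show -Complex.I * ((u * z : ℝ) : ℂ) = ((-(u * z) : ℝ) : ℂ) * Complex.I by push_cast; ring]
    exact Complex.norm_exp_ofReal_mul_I _
  have hv : ∀ u : ℝ, HasDerivAt (fun u : ℝ => Complex.exp (-Complex.I * ((u * z : ℝ) : ℂ)))
      (Complex.exp (-Complex.I * ((u * z : ℝ) : ℂ)) * (-Complex.I * z)) u := by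
    intro u
    have h1 : HasDerivAt (fun u : ℝ => ((u * z : ℝ) : ℂ)) ((1 * z : ℝ) : ℂ) u :=
      ((hasDerivAt_id u).mul_const z).ofReal_comp
    exact ((h1.const_mul (-Complex.I)).cexp).congr_deriv (by push_cast; ring)
  have cont : Continuous (fun u : ℝ => Complex.exp (-Complex.I * ((u * z : ℝ) : ℂ))) := by fun_prop
  have big : ∀ {G : ℝ → ℝ}, Integrable G →
      Integrable (fun u : ℝ => (G u : ℂ) * Complex.exp (-Complex.I * ((u * z : ℝ) : ℂ))) := by
    intro G hG
    exact hG.ofReal.mul_bdd cont.aestronglyMeasurable (Eventually.of_forall fun u => (hn u).le)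
  have := integral_mul_deriv_eq_deriv_mul_of_integrable (u := fun u : ℝ => (F u : ℂ))
    (v := fun u : ℝ => Complex.exp (-Complex.I * ((u * z : ℝ) : ℂ)))
    (fun u _ => (hF u).ofReal_comp) (fun u _ => hv u)
    (by
      have := (big i0).mul_const (-Complex.I * z)
      refine this.congr (Eventually.of_forall fun u => ?_)
      simp [mul_assoc]) (big i1) (big i0)
  rw [← neg_eq_iff_eq_neg] at this
  rw [← this, ← integral_const_mul, ← integral_neg]
  congr 1; ext u; ring

/-- The constant in Lemma O. -/
def Oc (N : ℝ) (m : ℕ) : ℝ := 2 * π * Kc (m + 2) * (3 * (8 * N + 5) ^ 2)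

lemma Kc_mono {m m' : ℕ} (h : m ≤ m') : Kc m ≤ Kc m' := by
  unfold Kc
  have h1 : ((m + 2).factorial : ℝ) ≤ (m' + 2).factorial := by
    exact_mod_cast Nat.factorial_le (by omega)
  have h2 : (8:ℝ) ^ (m + 2) ≤ 8 ^ (m' + 2) := pow_le_pow_right₀ (by norm_num) (by omega)
  gcongr

lemma Oc_pos {N : ℝ} (hN : 1 / 2 ≤ N) (m : ℕ) : 0 < Oc N m := by
  have := Kc_pos (m + 2); have := Real.pi_pos
  unfold Oc; positivity

lemma sym_integrable {N d e M : ℝ} {m : ℕ} {P : ℝ → ℝ} (hN : 1 / 2 ≤ N) (hd : 0 ≤ d) (he : 0 ≤ e)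
    (hM : 0 ≤ M) (hP : IsSym (1 + d + e) M m P) : Integrable (fun u => P u * Bf N d e u) := by
  have hc : Continuous (Bf N d e) := continuous_iff_continuousAt.2 fun u =>
    (hasDerivAt_Bf N d e u).continuousAt
  refine (int_bound hN hd he hM (m := m) (hP.continuous.mul hc).aestronglyMeasurable fun u => ?_).1
  obtain ⟨P1, P2, _, _, h3⟩ := hP
  rw [Pi.mul_apply, abs_mul, abs_of_pos (Bf_pos _ _ _ _)]
  have := (Bf_pos N d e u)
  gcongr; exact (h3 u).1

/-- **Lemma O.** -/
lemma osc {N d e M : ℝ} {m : ℕ} {P : ℝ → ℝ} (hN : 1 / 2 ≤ N) (hd : 0 ≤ d) (he : 0 ≤ e)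
    (hM : 0 ≤ M) (hP : IsSym (1 + d + e) M m P) (z : ℝ) :
    ‖∫ u : ℝ, ((P u * Bf N d e u : ℝ) : ℂ) * Complex.exp (-Complex.I * ((u * z : ℝ) : ℂ))‖ ≤
      Oc N m * M * Real.exp (-(d ^ 2 / 4)) * ((1 + d + e) / ((1 + d + e) ^ 2 + z ^ 2)) := by
  have hPm := hP
  obtain ⟨P1, P2, h1, h2, h3⟩ := hP
  have hP2 : Measurable P2 := by
    have : P2 = deriv P1 := funext fun u => (h2 u).deriv.symm
    rw [this]; exact measurable_deriv _
  have cP : Continuous P := hPm.continuous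
  have cP1 : Continuous P1 := continuous_iff_continuousAt.2 fun u => (h2 u).continuousAt
  have cB : Continuous (Bf N d e) := continuous_iff_continuousAt.2 fun u =>
    (hasDerivAt_Bf N d e u).continuousAt
  have cPh1 : Continuous (Ph1 N d e) := continuous_iff_continuousAt.2 fun u =>
    (hasDerivAt_Ph1 N d e u).continuousAt
  have mPh2 : Measurable (Ph2 N d e) := by
    have : Ph2 N d e = deriv (Ph1 N d e) := funext fun u => (hasDerivAt_Ph1 N d e u).deriv.symm
    rw [this]; exact measurable_deriv _
  have hN0 : 0 ≤ N := by linarith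
  set W := 1 + d + e with hWdef
  have hW : 1 ≤ W := by linarith
  have hW0 : 0 < W := by linarith
  set L := 8 * N + 4 with hL
  have hL0 : 0 < L := by linarith
  have b1 : ∀ u, |Ph1 N d e u| ≤ L * W * (1 + W * |u|) := by
    intro u
    refine (abs_Ph1_le hN0 hd he u).trans ?_
    have : 0 ≤ |u| := abs_nonneg u
    calc (4 * N + 2) * (|u| * W ^ 2) ≤ L * (|u| * W ^ 2) := by gcongr; linarith
      _ = L * W * (W * |u|) := by ring
      _ ≤ _ := by gcongr; linarith
  have b2 : ∀ u, |Ph2 N d e u| ≤ L * W ^ 2 := fun u => abs_Ph2_le hN0 hd he u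
  let F : ℝ → ℝ := fun u => P u * Bf N d e u
  let F1 : ℝ → ℝ := fun u => (P1 u - P u * Ph1 N d e u) * Bf N d e u
  let F2 : ℝ → ℝ := fun u => (P2 u - (P1 u * Ph1 N d e u + P u * Ph2 N d e u) -
    (P1 u - P u * Ph1 N d e u) * Ph1 N d e u) * Bf N d e u
  have dF : ∀ u, HasDerivAt F (F1 u) u := fun u =>
    ((h1 u).mul (hasDerivAt_Bf N d e u)).congr_deriv (by simp only [F1]; ring)
  have dF1 : ∀ u, HasDerivAt F1 (F2 u) u := fun u =>
    (((h2 u).sub ((h1 u).mul (hasDerivAt_Ph1 N d e u))).mul (hasDerivAt_Bf N d e u)).congr_deriv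
      (by simp only [F2, Pi.sub_apply, Pi.mul_apply]; ring)
  have w1 : ∀ u, 1 ≤ 1 + W * |u| := fun u => by
    have := mul_nonneg hW0.le (abs_nonneg u); linarith
  have i0 := int_bound hN hd he hM (m := m) (F := F) (cP.mul cB).aestronglyMeasurable (fun u => by
    simp only [F]
    rw [abs_mul, abs_of_pos (Bf_pos _ _ _ _)]
    have := (Bf_pos N d e u)
    gcongr; exact (h3 u).1)
  have q1 : ∀ u, |P1 u - P u * Ph1 N d e u| ≤ (1 + L) * M * W * (1 + W * |u|) ^ (m + 1) := by
    intro u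
    obtain ⟨a, b, c⟩ := h3 u
    have hw := w1 u
    refine (abs_sub _ _).trans ?_
    rw [abs_mul]
    calc |P1 u| + |P u| * |Ph1 N d e u| ≤ M * W * (1 + W * |u|) ^ m
          + (M * (1 + W * |u|) ^ m) * (L * W * (1 + W * |u|)) := by gcongr; exact b1 u
      _ ≤ M * W * (1 + W * |u|) ^ (m + 1) + (M * (1 + W * |u|) ^ m) * (L * W * (1 + W * |u|)) := by
          gcongr <;> first | exact hw | omega
      _ = _ := by ring
  have i1 := int_bound hN hd he (M := (1 + L) * M * W) (by positivity) (m := m + 1) (F := F1)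
    ((cP1.sub (cP.mul cPh1)).mul cB).aestronglyMeasurable (fun u => by
      simp only [F1]
      rw [abs_mul, abs_of_pos (Bf_pos _ _ _ _)]
      have := (Bf_pos N d e u)
      gcongr; exact q1 u)
  have q2 : ∀ u, |P2 u - (P1 u * Ph1 N d e u + P u * Ph2 N d e u) -
      (P1 u - P u * Ph1 N d e u) * Ph1 N d e u| ≤ 3 * (1 + L) ^ 2 * M * W ^ 2 * (1 + W * |u|) ^ (m + 2) := by
    intro u
    obtain ⟨a, b, c⟩ := h3 u
    have hw := w1 u
    have hw0 : 0 ≤ 1 + W * |u| := by linarith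
    refine (abs_sub _ _).trans ?_
    refine (add_le_add_left (abs_sub _ _) _).trans ?_
    refine (add_le_add_left (add_le_add_right (abs_add_le _ _) _) _).trans ?_
    simp only [abs_mul]
    have p1 : (1 + W * |u|) ^ m ≤ (1 + W * |u|) ^ (m + 2) := pow_le_pow_right₀ hw (by omega)
    have p2 : (1 + W * |u|) ^ (m + 1) ≤ (1 + W * |u|) ^ (m + 2) := pow_le_pow_right₀ hw (by omega)
    calc |P2 u| + (|P1 u| * |Ph1 N d e u| + |P u| * |Ph2 N d e u|) +
          |P1 u - P u * Ph1 N d e u| * |Ph1 N d e u|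
        ≤ M * W ^ 2 * (1 + W * |u|) ^ m + ((M * W * (1 + W * |u|) ^ m) * (L * W * (1 + W * |u|)) +
          (M * (1 + W * |u|) ^ m) * (L * W ^ 2)) +
          ((1 + L) * M * W * (1 + W * |u|) ^ (m + 1)) * (L * W * (1 + W * |u|)) := by
          gcongr
          · exact b1 u
          · exact b2 u
          · exact q1 u
          · exact b1 u
      _ = M * W ^ 2 * ((1 + L) * (1 + W * |u|) ^ m + L * (1 + W * |u|) ^ (m + 1) +
          (1 + L) * L * (1 + W * |u|) ^ (m + 2)) := by ring
      _ ≤ M * W ^ 2 * ((1 + L) * (1 + W * |u|) ^ (m + 2) + L * (1 + W * |u|) ^ (m + 2) +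
          (1 + L) * L * (1 + W * |u|) ^ (m + 2)) := by gcongr
      _ = M * W ^ 2 * (1 + W * |u|) ^ (m + 2) * (1 + 3 * L + L ^ 2) := by ring
      _ ≤ M * W ^ 2 * (1 + W * |u|) ^ (m + 2) * (3 * (1 + L) ^ 2) := by gcongr; nlinarith
      _ = _ := by ring
  have i2 := int_bound hN hd he (M := 3 * (1 + L) ^ 2 * M * W ^ 2) (by positivity) (m := m + 2) (F := F2)
    (((hP2.sub ((cP1.measurable.mul cPh1.measurable).add (cP.measurable.mul mPh2))).sub
      ((cP1.measurable.sub (cP.measurable.mul cPh1.measurable)).mul cPh1.measurable)).mul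
        cB.measurable).aestronglyMeasurable (fun u => by
      simp only [F2]
      rw [abs_mul, abs_of_pos (Bf_pos _ _ _ _)]
      have := (Bf_pos N d e u)
      gcongr; exact q2 u)
  have nb : ∀ G : ℝ → ℝ, ‖∫ u : ℝ, (G u : ℂ) * Complex.exp (-Complex.I * ((u * z : ℝ) : ℂ))‖ ≤ ∫ u, |G u| := by
    intro G
    refine (norm_integral_le_integral_norm _).trans (le_of_eq ?_)
    congr 1; ext u
    rw [norm_mul, show -Complex.I * ((u * z : ℝ) : ℂ) = ((-(u * z) : ℝ) : ℂ) * Complex.I by push_cast; ring,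
      Complex.norm_exp_ofReal_mul_I, mul_one, Complex.norm_real, Real.norm_eq_abs]
  have e2 : Complex.I * z * (Complex.I * z * ∫ u : ℝ, (F u : ℂ) * Complex.exp (-Complex.I * ((u * z : ℝ) : ℂ)))
      = ∫ u : ℝ, (F2 u : ℂ) * Complex.exp (-Complex.I * ((u * z : ℝ) : ℂ)) := by
    rw [osc_ibp z dF i0.1 i1.1, osc_ibp z dF1 i1.1 i2.1]
  set I := ∫ u : ℝ, (F u : ℂ) * Complex.exp (-Complex.I * ((u * z : ℝ) : ℂ)) with hI
  have f1 : ‖I‖ ≤ π * Kc m * M * Real.exp (-(d ^ 2 / 4)) / W := (nb F).trans i0.2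
  have f2 : z ^ 2 * ‖I‖ ≤ π * Kc (m + 2) * (3 * (1 + L) ^ 2 * M * W ^ 2) * Real.exp (-(d ^ 2 / 4)) / W := by
    have := (nb F2).trans i2.2
    rw [← e2] at this
    simp only [norm_mul, Complex.norm_I, Complex.norm_real, Real.norm_eq_abs, one_mul] at this
    rwa [← mul_assoc, ← sq, sq_abs] at this
  change ‖I‖ ≤ _
  rw [← mul_div_assoc, le_div_iff₀ (by positivity)]
  have hE := Real.exp_pos (-(d ^ 2 / 4))
  set E := Real.exp (-(d ^ 2 / 4))
  have hpi := Real.pi_pos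
  have hK := Kc_pos m
  have hK2 := Kc_mono (show m ≤ m + 2 by omega)
  have g1 : W ^ 2 * ‖I‖ ≤ π * Kc (m + 2) * (3 * (1 + L) ^ 2) * M * E * W := by
    calc W ^ 2 * ‖I‖ ≤ W ^ 2 * (π * Kc m * M * E / W) := by gcongr
      _ = π * Kc m * M * E * W := by field_simp
      _ ≤ π * (Kc (m + 2) * (3 * (1 + L) ^ 2)) * M * E * W := by
          gcongr
          have : 1 ≤ 3 * (1 + L) ^ 2 := by nlinarith
          nlinarith
      _ = _ := by ring
  have g2 : z ^ 2 * ‖I‖ ≤ π * Kc (m + 2) * (3 * (1 + L) ^ 2) * M * E * W := by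
    refine f2.trans (le_of_eq ?_)
    field_simp
  have : Oc N m * M * E * W = 2 * (π * Kc (m + 2) * (3 * (1 + L) ^ 2) * M * E * W) := by
    unfold Oc; rw [hL]; ring
  rw [this]
  linarith

end GR

namespace GR

/-! ### Part 3: the kernel at time one -/

variable {n : ℕ}

abbrev EE (n : ℕ) := EuclideanSpace ℝ (Fin n)
abbrev Kap (n : ℕ) := Fin n ⊕ Fin n × Fin 1

lemma continuous_hh : Continuous hh :=
  continuous_iff_continuousAt.2 fun u => (hasDerivAt_hh u).continuousAt
lemma continuous_cc : Continuous cc :=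
  continuous_iff_continuousAt.2 fun u => (hasDerivAt_cc u).continuousAt
lemma continuous_ss : Continuous fun u => 1 / hh u :=
  continuous_iff_continuousAt.2 fun u => (hasDerivAt_ss u).continuousAt
lemma Bf_cont {X : Type*} [TopologicalSpace X] (N : ℝ) {f g h : X → ℝ} (hf : Continuous f)
    (hg : Continuous g) (hh' : Continuous h) : Continuous fun x => Bf N (f x) (g x) (h x) := by
  unfold Bf Ph
  have k4 : Continuous fun p => Real.log (hh (h p)) :=
    (continuous_hh.comp hh').log fun u => (hh_pos _).ne'
  have k3 : Continuous fun p => 1 / hh (h p) := continuous_ss.comp hh'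
  have k2 : Continuous fun p => cc (h p) := continuous_cc.comp hh'
  fun_prop

/-- symbol of the vector field applied to the kernel -/
def sy (κ : Kap n) (a x y : EE n) (u : ℝ) : ℝ :=
  match κ with
  | Sum.inl j => -(1 / hh u * (x j - y j) / 2) - cc u * x j - a j
  | Sum.inr j => u * x j.1

def om (κ : Kap n) : ℂ :=
  match κ with
  | Sum.inl _ => 1
  | Sum.inr _ => -Complex.I

lemma norm_om (κ : Kap n) : ‖om κ‖ = 1 := by
  cases κ <;> simp [om]

def NN (n : ℕ) : ℝ := (n : ℝ) / 2
lemma half_le_NN (hn : 1 ≤ n) : 1 / 2 ≤ NN n := by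
  unfold NN
  have : (1:ℝ) ≤ n := by exact_mod_cast hn
  linarith

def cn (n : ℕ) : ℝ := (4 * π) ^ (-NN n) * (2 * π)⁻¹
lemma cn_pos : 0 < cn n := by unfold cn; have := Real.pi_pos; positivity

def osI (κ : Kap n) (a x y : EE n) (z : ℝ) : ℂ :=
  ∫ u : ℝ, ((sy κ a x y u * Bf (NN n) ‖x - y‖ ‖x + y‖ u : ℝ) : ℂ) *
    Complex.exp (-Complex.I * ((u * z : ℝ) : ℂ))

def rho (κ : Kap n) (a x y : EE n) (z : ℝ) : ℂ :=
  om κ * ((cn n * Real.exp (-‖a‖ ^ 2 + inner ℝ a (x - y)) : ℝ) : ℂ) * osI κ a x y z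

def cau (w z : ℝ) : ℝ := w / (w ^ 2 + z ^ 2)

lemma coord_le (x : EE n) (j : Fin n) : |x j| ≤ ‖x‖ := by
  simpa using PiLp.norm_apply_le x j

lemma two_norm_le (x y : EE n) : 2 * ‖x‖ ≤ ‖x - y‖ + ‖x + y‖ := by
  have : ‖(2:ℝ) • x‖ ≤ ‖x - y‖ + ‖x + y‖ := by
    rw [show (2:ℝ) • x = (x - y) + (x + y) by rw [two_smul]; abel]
    exact norm_add_le _ _
  rwa [norm_smul, Real.norm_eq_abs, abs_two] at this

lemma two_norm_le' (x y : EE n) : 2 * ‖y‖ ≤ ‖x - y‖ + ‖x + y‖ := by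
  have := two_norm_le y x
  rwa [norm_sub_rev, add_comm y x] at this

lemma isSym_sy (κ : Kap n) (a x y : EE n) :
    IsSym (1 + ‖x - y‖ + ‖x + y‖) (6 * (1 + ‖x - y‖ + ‖a‖)) 1 (sy κ a x y) := by
  have hx := two_norm_le x y
  set W := 1 + ‖x - y‖ + ‖x + y‖ with hWd
  have n1 := norm_nonneg (x - y)
  have n2 := norm_nonneg (x + y)
  have n3 := norm_nonneg a
  have hW : 1 ≤ W := by linarith
  have hW0 : 0 < W := by linarith
  cases κ with
  | inl j =>
    have h1 := (isSym_ss hW).smul (-((x j - y j) / 2))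
    have h2 := (isSym_cc hW).smul (-(x j))
    have h3 := IsSym.const (W := W) (-(a j)) hW0.le
    have h1' := h1.mono (m' := 1) hW0.le (by positivity) le_rfl (by omega)
    have h3' := h3.mono (m' := 1) hW0.le (by positivity) le_rfl (by omega)
    have h4 := (h1'.add h2).add h3'
    have e : sy (Sum.inl j) a x y = fun u => -((x j - y j) / 2) * (1 / hh u) + -(x j) * cc u + -(a j) := by
      ext u; simp only [sy]; ring
    rw [e]
    refine h4.mono hW0.le (by positivity) ?_ le_rfl
    have b1 : |-((x j - y j) / 2)| ≤ ‖x - y‖ / 2 := by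
      rw [abs_neg, abs_div, abs_two]
      have := coord_le (x - y) j
      simp only [PiLp.sub_apply] at this
      linarith
    have b2 : |-(x j)| * (4 / W) ≤ 4 := by
      rw [abs_neg, mul_div_assoc', div_le_iff₀ hW0]
      have := coord_le x j
      have := norm_nonneg x
      linarith
    have b3 : |-(a j)| ≤ ‖a‖ := by rw [abs_neg]; exact coord_le a j
    linarith
  | inr j =>
    have h1 := (isSym_id hW).smul (x j.1)
    have e : sy (Sum.inr j) a x y = fun u => x j.1 * u := by
      ext u; simp only [sy]; ring
    rw [e]
    refine h1.mono hW0.le (by positivity) ?_ le_rfl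
    have : |x j.1| * (1 / W) ≤ 1 := by
      rw [mul_one_div, div_le_iff₀ hW0]
      have := coord_le x j.1
      have := norm_nonneg x
      linarith
    linarith

/-- comparison of Cauchy kernels -/
lemma cau_comp {W w K z : ℝ} (hw : 0 < w) (h1 : w ≤ W) (h2 : W ≤ K * w) (hK : 1 ≤ K) :
    cau W z ≤ K * cau w z := by
  unfold cau
  have hW : 0 < W := by linarith
  rw [mul_div_assoc', div_le_div_iff₀ (by positivity) (by positivity)]
  have a1 : W * w ^ 2 ≤ K * w * W ^ 2 := by
    calc W * w ^ 2 = w * (W * w) := by ring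
      _ ≤ w * (W * W) := by gcongr
      _ ≤ K * (w * (W * W)) := le_mul_of_one_le_left (by positivity) hK
      _ = _ := by ring
  have a2 : W * z ^ 2 ≤ K * w * z ^ 2 := by gcongr
  linarith

lemma cau_comp_large {W w K s z : ℝ} (hw : 0 < w) (hs : 1 ≤ s) (h1 : w ≤ W) (h2 : W ≤ K * s * w) (hK : 1 ≤ K) :
    cau W z ≤ K * (s * w / (s * w ^ 2 + z ^ 2)) := by
  unfold cau
  have hW : 0 < W := by linarith
  rw [mul_div_assoc', div_le_div_iff₀ (by positivity) (by positivity)]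
  have a1 : W * (s * w ^ 2) ≤ K * (s * w) * W ^ 2 := by
    calc W * (s * w ^ 2) = (s * w) * (W * w) := by ring
      _ ≤ (s * w) * (W * W) := by gcongr
      _ ≤ K * ((s * w) * (W * W)) := le_mul_of_one_le_left (by positivity) hK
      _ = _ := by ring
  have a2 : W * z ^ 2 ≤ K * (s * w) * z ^ 2 := by
    calc W * z ^ 2 ≤ (K * s * w) * z ^ 2 := by gcongr
      _ = _ := by ring
  linarith

lemma cau_nonneg {w : ℝ} (hw : 0 ≤ w) (z : ℝ) : 0 ≤ cau w z := by unfold cau; positivity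

lemma W_lower (x y : EE n) : 1 + ‖y‖ ≤ 1 + ‖x - y‖ + ‖x + y‖ := by
  have := two_norm_le' x y; have := norm_nonneg y; linarith
lemma W_upper (x y : EE n) : 1 + ‖x - y‖ + ‖x + y‖ ≤ 2 * (1 + ‖x - y‖) * (1 + ‖y‖) := by
  have h : ‖x + y‖ ≤ ‖x - y‖ + 2 * ‖y‖ := by
    calc ‖x + y‖ = ‖(x - y) + (2:ℝ) • y‖ := by congr 1; rw [two_smul]; abel
      _ ≤ ‖x - y‖ + ‖(2:ℝ) • y‖ := norm_add_le _ _
      _ = _ := by rw [norm_smul]; simp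
  have := norm_nonneg y; have := norm_nonneg (x - y)
  nlinarith [mul_nonneg (norm_nonneg y) (norm_nonneg (x - y))]

lemma sq_expand (a D : EE n) : -‖a‖ ^ 2 + inner ℝ a D - ‖D‖ ^ 2 / 4 = -(‖D - (2:ℝ) • a‖ ^ 2 / 4) := by
  rw [norm_sub_sq_real, norm_smul, inner_smul_right, real_inner_comm]
  simp; ring

/-- general bound for kernels built from a symbol -/
lemma rho_gen (hn : 1 ≤ n) (a x y : EE n) (z : ℝ) {P : ℝ → ℝ} {M : ℝ} {m : ℕ} (hM : 0 ≤ M)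
    (hP : IsSym (1 + ‖x - y‖ + ‖x + y‖) M m P) :
    Real.exp (-‖a‖ ^ 2 + inner ℝ a (x - y)) *
      ‖∫ u : ℝ, ((P u * Bf (NN n) ‖x - y‖ ‖x + y‖ u : ℝ) : ℂ) *
        Complex.exp (-Complex.I * ((u * z : ℝ) : ℂ))‖ ≤
    Oc (NN n) m * M * Real.exp (-(‖(x - y) - (2:ℝ) • a‖ ^ 2 / 4)) * cau (1 + ‖x - y‖ + ‖x + y‖) z := by
  have h := osc (half_le_NN hn) (norm_nonneg (x - y)) (norm_nonneg (x + y)) hM hP z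
  refine (mul_le_mul_of_nonneg_left h (Real.exp_pos _).le).trans (le_of_eq ?_)
  have e : Real.exp (-(‖(x - y) - (2:ℝ) • a‖ ^ 2 / 4)) =
      Real.exp (-‖a‖ ^ 2 + inner ℝ a (x - y)) * Real.exp (-(‖x - y‖ ^ 2 / 4)) := by
    rw [← sq_expand, ← Real.exp_add]; congr 1
  rw [e]
  unfold cau
  ring

lemma poly_gauss (k : ℕ) (s : ℝ) (hs : 0 ≤ s) : (1 + s) ^ k * Real.exp (-(s ^ 2 / 16)) ≤
    k.factorial * Real.exp 9 := by
  have h := Real.pow_div_factorial_le_exp (x := 1 + s) (by positivity) k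
  rw [div_le_iff₀ (by positivity)] at h
  calc (1 + s) ^ k * Real.exp (-(s ^ 2 / 16)) ≤ (Real.exp (1 + s) * k.factorial) * Real.exp (-(s ^ 2 / 16)) := by
        gcongr
    _ = k.factorial * Real.exp ((1 + s) + -(s ^ 2 / 16)) := by rw [Real.exp_add (1 + s)]; ring
    _ ≤ _ := by
        gcongr
        nlinarith [sq_nonneg (s - 8)]

/-- Gaussian-Cauchy majorant. -/
def GG (x y : EE n) (z : ℝ) : ℝ := Real.exp (-(‖x - y‖ ^ 2 / 16)) * cau (1 + ‖y‖) z

lemma GG_nonneg (x y : EE n) (z : ℝ) : 0 ≤ GG x y z :=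
  mul_nonneg (Real.exp_pos _).le (cau_nonneg (by positivity) z)

def Cs : ℝ := 2 * Real.exp 1 * (Nat.factorial 3 * Real.exp 9) * 4

lemma Cs_pos : 0 < Cs := by unfold Cs; positivity

/-- small drift: absorb polynomial -/
lemma small_absorb (a x y : EE n) (z : ℝ) (ha : ‖a‖ ≤ 1) :
    (1 + ‖x - y‖ + ‖a‖) ^ 2 * Real.exp (-(‖(x - y) - (2:ℝ) • a‖ ^ 2 / 4)) *
      cau (1 + ‖x - y‖ + ‖x + y‖) z ≤ Cs * GG x y z := by
  have hy := norm_nonneg y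
  have hD := norm_nonneg (x - y)
  have hc := cau_comp (z := z) (by positivity) (W_lower x y) (W_upper x y) (by nlinarith)
  have he : Real.exp (-(‖(x - y) - (2:ℝ) • a‖ ^ 2 / 4)) ≤ Real.exp 1 * Real.exp (-(‖x - y‖ ^ 2 / 8)) := by
    rw [← Real.exp_add, Real.exp_le_exp]
    have h1 : ‖x - y‖ ≤ ‖(x - y) - (2:ℝ) • a‖ + 2 := by
      calc ‖x - y‖ = ‖((x - y) - (2:ℝ) • a) + (2:ℝ) • a‖ := by congr 1; abel
        _ ≤ ‖(x - y) - (2:ℝ) • a‖ + ‖(2:ℝ) • a‖ := norm_add_le _ _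
        _ ≤ _ := by rw [norm_smul]; simp; linarith
    have := norm_nonneg ((x - y) - (2:ℝ) • a)
    nlinarith [sq_nonneg (‖(x - y) - (2:ℝ) • a‖ - 2)]
  set d := ‖x - y‖
  have hp := poly_gauss 3 d hD
  have h2 : (1 + d + ‖a‖) ^ 2 ≤ 4 * (1 + d) ^ 2 := by
    have := norm_nonneg a
    nlinarith
  have hq := cau_nonneg (w := 1 + ‖y‖) (by positivity) z
  have hq' := cau_nonneg (w := 1 + d + ‖x + y‖) (by positivity) z
  calc (1 + d + ‖a‖) ^ 2 * Real.exp (-(‖(x - y) - (2:ℝ) • a‖ ^ 2 / 4)) * cau (1 + d + ‖x + y‖) z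
      ≤ (4 * (1 + d) ^ 2) * (Real.exp 1 * Real.exp (-(d ^ 2 / 8))) * (2 * (1 + d) * cau (1 + ‖y‖) z) := by
        gcongr
    _ = 2 * Real.exp 1 * ((1 + d) ^ 3 * Real.exp (-(d ^ 2 / 16))) * 4 *
          (Real.exp (-(d ^ 2 / 16)) * cau (1 + ‖y‖) z) := by
        rw [show -(d ^ 2 / 8) = -(d ^ 2 / 16) + -(d ^ 2 / 16) by ring, Real.exp_add]; ring
    _ ≤ 2 * Real.exp 1 * ((Nat.factorial 3) * Real.exp 9) * 4 *
          (Real.exp (-(d ^ 2 / 16)) * cau (1 + ‖y‖) z) := by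
        gcongr
    _ = _ := by unfold Cs GG; ring

lemma norm_rho (κ : Kap n) (a x y : EE n) (z : ℝ) :
    ‖rho κ a x y z‖ = cn n * (Real.exp (-‖a‖ ^ 2 + inner ℝ a (x - y)) * ‖osI κ a x y z‖) := by
  unfold rho
  rw [norm_mul, norm_mul, norm_om, Complex.norm_real, Real.norm_eq_abs,
    abs_of_pos (mul_pos cn_pos (Real.exp_pos _))]
  ring

def C1 (n : ℕ) : ℝ := cn n * (Oc (NN n) 1 * 6 * Cs)
lemma C1_pos (hn : 1 ≤ n) : 0 < C1 n := by
  have := Oc_pos (half_le_NN hn) 1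
  have := Cs_pos
  have := cn_pos (n := n)
  unfold C1; positivity

/-- (E1s) -/
lemma rho_small (hn : 1 ≤ n) (κ : Kap n) (a x y : EE n) (z : ℝ) (ha : ‖a‖ ≤ 1) :
    ‖rho κ a x y z‖ ≤ C1 n * GG x y z := by
  have h := rho_gen hn a x y z (by positivity) (isSym_sy κ a x y)
  have hO := Oc_pos (half_le_NN hn) 1
  rw [norm_rho]
  unfold C1
  rw [mul_assoc]
  refine mul_le_mul_of_nonneg_left ?_ cn_pos.le
  refine h.trans ?_
  have h2 := small_absorb a x y z ha
  have h3 : 1 + ‖x - y‖ + ‖a‖ ≤ (1 + ‖x - y‖ + ‖a‖) ^ 2 := by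
    have := norm_nonneg a; have := norm_nonneg (x - y); nlinarith
  have hq' := cau_nonneg (w := 1 + ‖x - y‖ + ‖x + y‖) (by positivity) z
  calc _ ≤ Oc (NN n) 1 * (6 * (1 + ‖x - y‖ + ‖a‖) ^ 2) *
        Real.exp (-(‖(x - y) - (2:ℝ) • a‖ ^ 2 / 4)) * cau (1 + ‖x - y‖ + ‖x + y‖) z := by gcongr
    _ = Oc (NN n) 1 * 6 * ((1 + ‖x - y‖ + ‖a‖) ^ 2 *
        Real.exp (-(‖(x - y) - (2:ℝ) • a‖ ^ 2 / 4)) * cau (1 + ‖x - y‖ + ‖x + y‖) z) := by ring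
    _ ≤ Oc (NN n) 1 * 6 * (Cs * GG x y z) := by gcongr
    _ = _ := by ring

def C2 (n : ℕ) : ℝ := cn n * (Oc (NN n) 1 * 6 * (4 * (Nat.factorial 2 * Real.exp 9) * 8))
lemma C2_pos (hn : 1 ≤ n) : 0 < C2 n := by
  have := Oc_pos (half_le_NN hn) 1
  have := cn_pos (n := n)
  unfold C2; positivity

/-- (E1l) -/
lemma rho_large (hn : 1 ≤ n) (κ : Kap n) (a x y : EE n) (z : ℝ) (ha : 1 ≤ ‖a‖) :
    ‖rho κ a x y z‖ ≤ C2 n * (‖a‖ * Real.exp (-(‖(x - y) - (2:ℝ) • a‖ ^ 2 / 8)) *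
      (‖a‖ * (1 + ‖y‖) / (‖a‖ * (1 + ‖y‖) ^ 2 + z ^ 2))) := by
  have h := rho_gen hn a x y z (by positivity) (isSym_sy κ a x y)
  have hO := Oc_pos (half_le_NN hn) 1
  rw [norm_rho]
  unfold C2
  rw [mul_assoc]
  refine mul_le_mul_of_nonneg_left ?_ cn_pos.le
  refine h.trans ?_
  have hy := norm_nonneg y
  have hD := norm_nonneg (x - y)
  have h1 : ‖x - y‖ ≤ ‖(x - y) - (2:ℝ) • a‖ + 2 * ‖a‖ := by
    calc ‖x - y‖ = ‖((x - y) - (2:ℝ) • a) + (2:ℝ) • a‖ := by congr 1; abel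
      _ ≤ ‖(x - y) - (2:ℝ) • a‖ + ‖(2:ℝ) • a‖ := norm_add_le _ _
      _ ≤ _ := by rw [norm_smul]; simp
  set s := ‖(x - y) - (2:ℝ) • a‖ with hsd
  have hs : 0 ≤ s := norm_nonneg _
  have h2 : 1 + ‖x - y‖ + ‖a‖ ≤ 4 * ‖a‖ * (1 + s) := by nlinarith
  have h3 : 1 + ‖x - y‖ + ‖x + y‖ ≤ (8 * (1 + s)) * ‖a‖ * (1 + ‖y‖) := by
    refine (W_upper x y).trans ?_
    refine mul_le_mul_of_nonneg_right ?_ (by positivity)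
    nlinarith
  have hc := cau_comp_large (z := z) (by positivity) ha (W_lower x y) h3 (by nlinarith)
  have hp := poly_gauss 2 s hs
  have hq' := cau_nonneg (w := 1 + ‖x - y‖ + ‖x + y‖) (by positivity) z
  set R := ‖a‖ * (1 + ‖y‖) / (‖a‖ * (1 + ‖y‖) ^ 2 + z ^ 2) with hR
  have hR0 : 0 ≤ R := by positivity
  calc Oc (NN n) 1 * (6 * (1 + ‖x - y‖ + ‖a‖)) * Real.exp (-(s ^ 2 / 4)) * cau (1 + ‖x - y‖ + ‖x + y‖) z
      ≤ Oc (NN n) 1 * (6 * (4 * ‖a‖ * (1 + s))) * Real.exp (-(s ^ 2 / 8 + s ^ 2 / 16)) * ((8 * (1 + s)) * R) := by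
        gcongr; nlinarith
    _ = Oc (NN n) 1 * 6 * (4 * ((1 + s) ^ 2 * Real.exp (-(s ^ 2 / 16))) * 8) *
          (‖a‖ * Real.exp (-(s ^ 2 / 8)) * R) := by
        rw [neg_add, Real.exp_add]; ring
    _ ≤ Oc (NN n) 1 * 6 * (4 * (Nat.factorial 2 * Real.exp 9) * 8) *
          (‖a‖ * Real.exp (-(s ^ 2 / 8)) * R) := by
        gcongr

/-- measurability of the kernel -/
lemma continuous_sy (κ : Kap n) : Continuous fun p : (EE n × EE n × EE n × ℝ) × ℝ =>
    sy κ p.1.1 p.1.2.1 p.1.2.2.1 p.2 := by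
  have k3 : Continuous fun p : (EE n × EE n × EE n × ℝ) × ℝ => 1 / hh p.2 :=
    continuous_ss.comp (by fun_prop : Continuous fun p : (EE n × EE n × EE n × ℝ) × ℝ => p.2)
  have k2 : Continuous fun p : (EE n × EE n × EE n × ℝ) × ℝ => cc p.2 := continuous_cc.comp (by fun_prop)
  cases κ with
  | inl j =>
    simp only [sy]
    have : ∀ j : Fin n, Continuous fun x : EE n => x j := fun j => by fun_prop
    fun_prop
  | inr j => simp only [sy]; fun_prop

lemma measurable_rho (κ : Kap n) : Measurable fun p : EE n × EE n × EE n × ℝ =>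
    rho κ p.1 p.2.1 p.2.2.1 p.2.2.2 := by
  unfold rho
  have h1 : StronglyMeasurable fun p : EE n × EE n × EE n × ℝ => osI κ p.1 p.2.1 p.2.2.1 p.2.2.2 := by
    unfold osI
    refine StronglyMeasurable.integral_prod_right (f := fun (p : EE n × EE n × EE n × ℝ) (u : ℝ) =>
      ((sy κ p.1 p.2.1 p.2.2.1 u * Bf (NN n) ‖p.2.1 - p.2.2.1‖ ‖p.2.1 + p.2.2.1‖ u : ℝ) : ℂ) *
    Complex.exp (-Complex.I * ((u * p.2.2.2 : ℝ) : ℂ))) ?_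
    apply Continuous.stronglyMeasurable
    have k1 := continuous_sy κ
    have k2 : Continuous fun p : (EE n × EE n × EE n × ℝ) × ℝ =>
      Bf (NN n) ‖p.1.2.1 - p.1.2.2.1‖ ‖p.1.2.1 + p.1.2.2.1‖ p.2 :=
      Bf_cont _ (by fun_prop) (by fun_prop) continuous_snd
    have k3 : Continuous fun p : (EE n × EE n × EE n × ℝ) × ℝ =>
        Complex.exp (-Complex.I * ((p.2 * p.1.2.2.2 : ℝ) : ℂ)) := by fun_prop
    exact (Complex.continuous_ofReal.comp (k1.mul k2)).mul k3
  refine Measurable.mul (Continuous.measurable (by fun_prop)) h1.measurable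

end GR

namespace GR

/-! ### Part 4: differences of the kernel at time one -/

variable {n : ℕ}

def dsy (κ : Kap n) (v : EE n) (u : ℝ) : ℝ :=
  match κ with
  | Sum.inl j => v j / 2 * (1 / hh u)
  | Sum.inr _ => 0

def qsy (a x y v : EE n) (u : ℝ) : ℝ :=
  -inner ℝ a v + inner ℝ (x - y) v / 2 * (1 / hh u) + -inner ℝ y v * cc u

def psy (κ : Kap n) (a x y v : EE n) (u : ℝ) : ℝ :=
  sy κ a x y u * qsy a x y v u + dsy κ v u

lemma isSym_qsy (a x y v : EE n) :
    IsSym (1 + ‖x - y‖ + ‖x + y‖) (6 * (1 + ‖x - y‖ + ‖a‖) * ‖v‖) 1 (qsy a x y v) := by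
  have hx := two_norm_le' x y
  set W := 1 + ‖x - y‖ + ‖x + y‖ with hWd
  have n1 := norm_nonneg (x - y)
  have n2 := norm_nonneg (x + y)
  have n3 := norm_nonneg a
  have n4 := norm_nonneg v
  have hW : 1 ≤ W := by linarith
  have hW0 : 0 < W := by linarith
  have h1 := ((isSym_ss hW).smul (inner ℝ (x - y) v / 2)).mono (m' := 1) hW0.le (by positivity) le_rfl (by omega)
  have h2 := (isSym_cc hW).smul (-inner ℝ y v)
  have h3 := (IsSym.const (W := W) (-inner ℝ a v) hW0.le).mono (m' := 1) hW0.le (by positivity) le_rfl (by omega)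
  refine ((h3.add h1).add h2).mono hW0.le (by positivity) ?_ le_rfl
  have b1 : |inner ℝ (x - y) v / 2| ≤ ‖x - y‖ * ‖v‖ / 2 := by
    rw [abs_div, abs_two]
    have := abs_real_inner_le_norm (x - y) v
    linarith
  have b2 : |-inner ℝ y v| * (4 / W) ≤ 4 * ‖v‖ := by
    rw [abs_neg, mul_div_assoc', div_le_iff₀ hW0]
    have h := abs_real_inner_le_norm y v
    have := norm_nonneg y
    have : ‖y‖ * ‖v‖ ≤ W * ‖v‖ := by gcongr; linarith
    linarith
  have b3 : |-inner ℝ a v| ≤ ‖a‖ * ‖v‖ := by rw [abs_neg]; exact abs_real_inner_le_norm a v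
  nlinarith [mul_nonneg n3 n4]

lemma isSym_dsy (κ : Kap n) (v : EE n) {W : ℝ} (hW : 1 ≤ W) : IsSym W (6 * ‖v‖) 2 (dsy κ v) := by
  have hW0 : 0 ≤ W := by linarith
  cases κ with
  | inl j =>
    refine ((isSym_ss hW).smul (v j / 2)).mono hW0 (by positivity) ?_ (by omega)
    rw [abs_div, abs_two]
    have := coord_le v j
    linarith
  | inr j =>
    exact (IsSym.const (W := W) 0 hW0).mono hW0 (by positivity) (by simp) (by omega)

lemma isSym_psy (κ : Kap n) (a x y v : EE n) :
    IsSym (1 + ‖x - y‖ + ‖x + y‖) (150 * (1 + ‖x - y‖ + ‖a‖) ^ 2 * ‖v‖) 2 (psy κ a x y v) := by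
  have n1 := norm_nonneg (x - y)
  have n2 := norm_nonneg (x + y)
  have n3 := norm_nonneg a
  have n4 := norm_nonneg v
  have h := (IsSym.mul (by positivity) (by positivity) (by positivity) (isSym_sy κ a x y) (isSym_qsy a x y v)).add
    (isSym_dsy κ v (W := 1 + ‖x - y‖ + ‖x + y‖) (by linarith))
  refine h.mono (by positivity) (by positivity) ?_ le_rfl
  have : 1 ≤ (1 + ‖x - y‖ + ‖a‖) ^ 2 := by nlinarith
  have : ‖v‖ ≤ (1 + ‖x - y‖ + ‖a‖) ^ 2 * ‖v‖ := le_mul_of_one_le_left n4 this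
  nlinarith

lemma isSym_usy (κ : Kap n) (a x y : EE n) :
    IsSym (1 + ‖x - y‖ + ‖x + y‖) (24 * (1 + ‖x - y‖ + ‖a‖) ^ 2 / (1 + ‖y‖)) 2 (fun u => u * sy κ a x y u) := by
  have n1 := norm_nonneg (x - y)
  have n2 := norm_nonneg (x + y)
  have n3 := norm_nonneg a
  have h := IsSym.mul (by positivity) (by positivity) (by positivity)
    (isSym_id (W := 1 + ‖x - y‖ + ‖x + y‖) (by linarith)) (isSym_sy κ a x y)
  refine h.mono (by positivity) (by positivity) ?_ le_rfl
  have h1 := W_lower x y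
  have h2 : 1 / (1 + ‖x - y‖ + ‖x + y‖) ≤ 1 / (1 + ‖y‖) := one_div_le_one_div_of_le (by positivity) h1
  have h3 : 1 + ‖x - y‖ + ‖a‖ ≤ (1 + ‖x - y‖ + ‖a‖) ^ 2 := by nlinarith
  calc 4 * (1 / (1 + ‖x - y‖ + ‖x + y‖) * (6 * (1 + ‖x - y‖ + ‖a‖)))
      ≤ 4 * (1 / (1 + ‖y‖) * (6 * (1 + ‖x - y‖ + ‖a‖) ^ 2)) := by gcongr
    _ = _ := by ring

/-- the integrand along the segment -/
def hseg (κ : Kap n) (a x y : EE n) (z u : ℝ) : ℂ :=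
  ((Real.exp (-‖a‖ ^ 2 + inner ℝ a (x - y)) : ℝ) : ℂ) *
    (((sy κ a x y u * Bf (NN n) ‖x - y‖ ‖x + y‖ u : ℝ) : ℂ) *
      Complex.exp (-Complex.I * ((u * z : ℝ) : ℂ)))

def dseg (κ : Kap n) (a x y v : EE n) (z ζ u : ℝ) : ℂ :=
  ((Real.exp (-‖a‖ ^ 2 + inner ℝ a (x - y)) : ℝ) : ℂ) *
    (((psy κ a x y v u * Bf (NN n) ‖x - y‖ ‖x + y‖ u : ℝ) : ℂ) *
      Complex.exp (-Complex.I * ((u * z : ℝ) : ℂ)) +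
    (-Complex.I * ζ) * (((u * sy κ a x y u * Bf (NN n) ‖x - y‖ ‖x + y‖ u : ℝ) : ℂ) *
      Complex.exp (-Complex.I * ((u * z : ℝ) : ℂ))))

lemma rho_eq_hseg (κ : Kap n) (a x y : EE n) (z : ℝ) :
    rho κ a x y z = om κ * (cn n : ℂ) * ∫ u, hseg κ a x y z u := by
  unfold rho hseg osI
  rw [integral_const_mul]
  push_cast; ring

lemma hasDerivAt_seg (κ : Kap n) (a x y v : EE n) (z ζ u θ : ℝ) :
    HasDerivAt (fun θ : ℝ => hseg κ a x (y + θ • v) (z + θ * ζ) u)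
      (dseg κ a x (y + θ • v) v (z + θ * ζ) ζ u) θ := by
  have hy : HasDerivAt (fun θ : ℝ => y + θ • v) v θ := by
    simpa using ((hasDerivAt_id θ).smul_const v).const_add y
  have hD : HasDerivAt (fun θ : ℝ => x - (y + θ • v)) (-v) θ := hy.const_sub x
  have hS : HasDerivAt (fun θ : ℝ => x + (y + θ • v)) v θ := hy.const_add x
  have hz : HasDerivAt (fun θ : ℝ => z + θ * ζ) ζ θ := by
    simpa using ((hasDerivAt_id θ).mul_const ζ).const_add z
  have h1 : HasDerivAt (fun θ : ℝ => Real.exp (-‖a‖ ^ 2 + inner ℝ a (x - (y + θ • v))))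
      (Real.exp (-‖a‖ ^ 2 + inner ℝ a (x - (y + θ • v))) * -inner ℝ a v) θ := by
    have : HasDerivAt (fun θ : ℝ => inner ℝ a (x - (y + θ • v))) (-inner ℝ a v) θ := by
      have := (hasDerivAt_const θ a).inner ℝ hD
      simpa using this
    exact (this.const_add _).exp
  have h2 : HasDerivAt (fun θ : ℝ => sy κ a x (y + θ • v) u) (dsy κ v u) θ := by
    cases κ with
    | inl j =>
      have hj : HasDerivAt (fun θ : ℝ => (y + θ • v) j) (v j) θ := by
        simpa using ((hasDerivAt_id θ).mul_const (v j)).const_add (y j)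
      exact ((((((hj.const_sub (x j)).const_mul (1 / hh u)).div_const 2).neg).sub_const _).sub_const _).congr_deriv
        (by simp only [dsy]; ring)
    | inr j => exact hasDerivAt_const _ _
  have h3 : HasDerivAt (fun θ : ℝ => Bf (NN n) ‖x - (y + θ • v)‖ ‖x + (y + θ • v)‖ u)
      (Bf (NN n) ‖x - (y + θ • v)‖ ‖x + (y + θ • v)‖ u *
        (inner ℝ (x - (y + θ • v)) v / 2 * (1 / hh u) + -inner ℝ (y + θ • v) v * cc u)) θ := by
    unfold Bf Ph
    refine ((((((hD.norm_sq).const_mul (1 / hh u + cc u)).add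
      ((hS.norm_sq).const_mul (cc u))).div_const 4).const_add _).neg.exp).congr_deriv ?_
    simp only [Pi.neg_apply, Pi.add_apply, inner_neg_right, inner_add_left, inner_sub_left]
    ring
  have h4 : HasDerivAt (fun θ : ℝ => Complex.exp (-Complex.I * ((u * (z + θ * ζ) : ℝ) : ℂ)))
      (Complex.exp (-Complex.I * ((u * (z + θ * ζ) : ℝ) : ℂ)) * (-Complex.I * ((u * ζ : ℝ) : ℂ))) θ :=
    (((hz.const_mul u).ofReal_comp).const_mul (-Complex.I)).cexp
  have := (h1.ofReal_comp).mul (((h2.mul h3).ofReal_comp).mul h4)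
  refine this.congr_deriv ?_
  unfold dseg psy qsy
  simp only [Pi.mul_apply]
  push_cast
  ring

lemma continuous_seg (κ : Kap n) (a x y v : EE n) (z ζ : ℝ) :
    Continuous fun p : ℝ × ℝ => dseg κ a x (y + p.1 • v) v (z + p.1 * ζ) ζ p.2 := by
  have k2 : Continuous fun p : ℝ × ℝ => cc p.2 := continuous_cc.comp continuous_snd
  have k3 : Continuous fun p : ℝ × ℝ => 1 / hh p.2 := continuous_ss.comp continuous_snd
  have k4 : Continuous fun p : ℝ × ℝ => sy κ a x (y + p.1 • v) p.2 := by
    cases κ with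
    | inl j => simp only [sy]; fun_prop
    | inr j => simp only [sy]; fun_prop
  have k5 : Continuous fun p : ℝ × ℝ => dsy κ v p.2 := by
    cases κ with
    | inl j => simp only [dsy]; fun_prop
    | inr j => simp only [dsy]; fun_prop
  have k6 : Continuous fun p : ℝ × ℝ => Bf (NN n) ‖x - (y + p.1 • v)‖ ‖x + (y + p.1 • v)‖ p.2 :=
    Bf_cont _ (by fun_prop) (by fun_prop) continuous_snd
  have k7 : Continuous fun p : ℝ × ℝ => psy κ a x (y + p.1 • v) v p.2 := by
    unfold psy qsy; fun_prop
  unfold dseg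
  fun_prop

lemma sym_pt {N d e M : ℝ} {m : ℕ} {P : ℝ → ℝ} (hN : 1 / 2 ≤ N) (hd : 0 ≤ d) (he : 0 ≤ e)
    (hM : 0 ≤ M) (hP : IsSym (1 + d + e) M m P) (u : ℝ) :
    |P u * Bf N d e u| ≤ M * Kc m * (1 + u ^ 2)⁻¹ := by
  obtain ⟨P1, P2, _, _, h3⟩ := hP
  have hB := Bf_pos N d e u
  have h := decay hN hd he m u
  have hK := Kc_pos m
  rw [abs_mul, abs_of_pos hB]
  have h5 : Real.exp (-(d ^ 2 / 4)) ≤ 1 := by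
    rw [Real.exp_le_one_iff]; nlinarith
  have hin : (1 + ((1 + d + e) * u) ^ 2)⁻¹ ≤ (1 + u ^ 2)⁻¹ := by
    refine inv_anti₀ (by positivity) ?_
    rw [mul_pow]
    have : 1 ≤ (1 + d + e) ^ 2 := by nlinarith
    nlinarith [sq_nonneg u]
  calc |P u| * Bf N d e u ≤ (M * (1 + (1 + d + e) * |u|) ^ m) * Bf N d e u := by
        gcongr; exact (h3 u).1
    _ = M * ((1 + (1 + d + e) * |u|) ^ m * Bf N d e u) := by ring
    _ ≤ M * (Kc m * Real.exp (-(d ^ 2 / 4)) * (1 + ((1 + d + e) * u) ^ 2)⁻¹) := by gcongr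
    _ ≤ M * (Kc m * 1 * (1 + u ^ 2)⁻¹) := by
        refine mul_le_mul_of_nonneg_left ?_ hM
        refine mul_le_mul ?_ hin (by positivity) (by positivity)
        exact mul_le_mul_of_nonneg_left h5 hK.le
    _ = _ := by ring

lemma norm_cexp_I (s : ℝ) : ‖Complex.exp (-Complex.I * (s : ℂ))‖ = 1 := by
  rw [show -Complex.I * (s : ℂ) = ((-s : ℝ) : ℂ) * Complex.I by push_cast; ring]
  exact Complex.norm_exp_ofReal_mul_I _

def C4 (n : ℕ) : ℝ := cn n * (Oc (NN n) 2 * 150 * Cs)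
lemma C4_pos (hn : 1 ≤ n) : 0 < C4 n := by
  have := Oc_pos (half_le_NN hn) 2
  have := Cs_pos
  have := cn_pos (n := n)
  unfold C4; positivity

lemma dseg_bound (hn : 1 ≤ n) (κ : Kap n) (a x y v : EE n) (z ζ : ℝ) (ha : ‖a‖ ≤ 1) :
    cn n * ‖∫ u, dseg κ a x y v z ζ u‖ ≤ C4 n * ((‖v‖ + |ζ| / (1 + ‖y‖)) * GG x y z) := by
  have hN := half_le_NN hn
  have n1 := norm_nonneg (x - y)
  have n2 := norm_nonneg (x + y)
  have n3 := norm_nonneg v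
  have s1 := isSym_psy κ a x y v
  have s2 := isSym_usy κ a x y
  have b1 := rho_gen hn a x y z (by positivity) s1
  have b2 := rho_gen hn a x y z (by positivity) s2
  have hb := small_absorb a x y z ha
  have hO := Oc_pos hN 2
  set E := Real.exp (-‖a‖ ^ 2 + inner ℝ a (x - y)) with hE
  have hE0 : 0 < E := Real.exp_pos _
  have hfac : ∀ P : ℝ → ℝ, Integrable (fun u => P u * Bf (NN n) ‖x - y‖ ‖x + y‖ u) →
      Integrable (fun u : ℝ => ((P u * Bf (NN n) ‖x - y‖ ‖x + y‖ u : ℝ) : ℂ) *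
        Complex.exp (-Complex.I * ((u * z : ℝ) : ℂ))) := by
    intro P hP
    have cont : Continuous (fun u : ℝ => Complex.exp (-Complex.I * ((u * z : ℝ) : ℂ))) := by fun_prop
    exact hP.ofReal.mul_bdd (c := 1) cont.aestronglyMeasurable
      (Eventually.of_forall fun u => (norm_cexp_I _).le)
  have i1 := hfac _ (sym_integrable hN n1 n2 (by positivity) s1)
  have i2 := hfac _ (sym_integrable hN n1 n2 (by positivity) s2)
  have e : ∫ u, dseg κ a x y v z ζ u = (E : ℂ) * ((∫ u : ℝ, ((psy κ a x y v u * Bf (NN n) ‖x - y‖ ‖x + y‖ u : ℝ) : ℂ) *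
        Complex.exp (-Complex.I * ((u * z : ℝ) : ℂ))) + (-Complex.I * ζ) *
        ∫ u : ℝ, ((u * sy κ a x y u * Bf (NN n) ‖x - y‖ ‖x + y‖ u : ℝ) : ℂ) *
        Complex.exp (-Complex.I * ((u * z : ℝ) : ℂ))) := by
    unfold dseg
    rw [integral_const_mul, integral_add i1 (i2.const_mul _), integral_const_mul]
  rw [e]
  set I1 := ∫ u : ℝ, ((psy κ a x y v u * Bf (NN n) ‖x - y‖ ‖x + y‖ u : ℝ) : ℂ) *
        Complex.exp (-Complex.I * ((u * z : ℝ) : ℂ))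
  set I2 := ∫ u : ℝ, ((u * sy κ a x y u * Bf (NN n) ‖x - y‖ ‖x + y‖ u : ℝ) : ℂ) *
        Complex.exp (-Complex.I * ((u * z : ℝ) : ℂ))
  set H := (1 + ‖x - y‖ + ‖a‖) ^ 2 * Real.exp (-(‖(x - y) - (2:ℝ) • a‖ ^ 2 / 4)) *
      cau (1 + ‖x - y‖ + ‖x + y‖) z with hH
  have hG := GG_nonneg x y z
  have b1' : E * ‖I1‖ ≤ Oc (NN n) 2 * 150 * ‖v‖ * H := b1.trans (le_of_eq (by rw [hH]; ring))
  have b2' : E * ‖I2‖ ≤ Oc (NN n) 2 * 24 / (1 + ‖y‖) * H := b2.trans (le_of_eq (by rw [hH]; ring))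
  have hHn : 0 ≤ H := by
    have := cau_nonneg (w := 1 + ‖x - y‖ + ‖x + y‖) (by positivity) z
    rw [hH]; positivity
  unfold C4
  rw [mul_assoc (cn n)]
  refine mul_le_mul_of_nonneg_left ?_ cn_pos.le
  rw [norm_mul, Complex.norm_real, Real.norm_eq_abs, abs_of_pos hE0]
  calc E * ‖I1 + -Complex.I * ζ * I2‖ ≤ E * (‖I1‖ + |ζ| * ‖I2‖) := by
        gcongr
        refine (norm_add_le _ _).trans ?_
        simp [norm_mul]
    _ = E * ‖I1‖ + |ζ| * (E * ‖I2‖) := by ring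
    _ ≤ Oc (NN n) 2 * 150 * ‖v‖ * H + |ζ| * (Oc (NN n) 2 * 24 / (1 + ‖y‖) * H) := by gcongr
    _ ≤ Oc (NN n) 2 * 150 * ‖v‖ * H + |ζ| * (Oc (NN n) 2 * 150 / (1 + ‖y‖) * H) := by gcongr; norm_num
    _ = Oc (NN n) 2 * 150 * (‖v‖ + |ζ| / (1 + ‖y‖)) * H := by ring
    _ ≤ Oc (NN n) 2 * 150 * (‖v‖ + |ζ| / (1 + ‖y‖)) * (Cs * GG x y z) := by gcongr
    _ = _ := by ring

lemma dseg_dom (hn : 1 ≤ n) (κ : Kap n) (a x y v : EE n) (z ζ : ℝ) :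
    ∃ K, ∀ θ ∈ Icc (0:ℝ) 1, ∀ u, ‖dseg κ a x (y + θ • v) v (z + θ * ζ) ζ u‖ ≤ K * (1 + u ^ 2)⁻¹ := by
  have hN := half_le_NN hn
  set R := ‖x - y‖ + ‖v‖ with hR
  refine ⟨Real.exp (‖a‖ * R) * (150 * (1 + R + ‖a‖) ^ 2 * ‖v‖ * Kc 2 + |ζ| * (24 * (1 + R + ‖a‖) ^ 2 * Kc 2)), ?_⟩
  intro θ hθ u
  have hK := Kc_pos 2
  set y' := y + θ • v
  have hD : ‖x - y'‖ ≤ R := by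
    calc ‖x - y'‖ = ‖(x - y) - θ • v‖ := by congr 1; simp only [y']; abel
      _ ≤ ‖x - y‖ + ‖θ • v‖ := norm_sub_le _ _
      _ ≤ _ := by
        rw [norm_smul, Real.norm_eq_abs, abs_of_nonneg hθ.1]
        have := norm_nonneg v
        nlinarith [hθ.2]
  have hR0 : 0 ≤ R := by positivity
  have n1 := norm_nonneg (x - y')
  have b1 := sym_pt hN n1 (norm_nonneg (x + y')) (by positivity) (isSym_psy κ a x y' v) u
  have b2 := sym_pt hN n1 (norm_nonneg (x + y')) (by positivity) (isSym_usy κ a x y') u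
  have hE : Real.exp (-‖a‖ ^ 2 + inner ℝ a (x - y')) ≤ Real.exp (‖a‖ * R) := by
    rw [Real.exp_le_exp]
    have := real_inner_le_norm a (x - y')
    have : ‖a‖ * ‖x - y'‖ ≤ ‖a‖ * R := by gcongr
    nlinarith [sq_nonneg ‖a‖]
  unfold dseg
  rw [norm_mul, Complex.norm_real, Real.norm_eq_abs, abs_of_pos (Real.exp_pos _), mul_assoc (Real.exp (‖a‖ * R))]
  refine mul_le_mul hE ?_ (norm_nonneg _) (Real.exp_pos _).le
  refine (norm_add_le _ _).trans ?_
  have e1 : ‖(-Complex.I * (ζ:ℂ))‖ = |ζ| := by simp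
  rw [norm_mul, norm_mul (-Complex.I * (ζ:ℂ)), e1, norm_mul _ (Complex.exp _), norm_cexp_I, Complex.norm_real, Complex.norm_real,
    Real.norm_eq_abs, Real.norm_eq_abs, mul_one, mul_one]
  calc _ ≤ 150 * (1 + ‖x - y'‖ + ‖a‖) ^ 2 * ‖v‖ * Kc 2 * (1 + u ^ 2)⁻¹ +
        |ζ| * (24 * (1 + ‖x - y'‖ + ‖a‖) ^ 2 / (1 + ‖y'‖) * Kc 2 * (1 + u ^ 2)⁻¹) := by gcongr
    _ ≤ 150 * (1 + R + ‖a‖) ^ 2 * ‖v‖ * Kc 2 * (1 + u ^ 2)⁻¹ +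
        |ζ| * (24 * (1 + R + ‖a‖) ^ 2 * Kc 2 * (1 + u ^ 2)⁻¹) := by
        gcongr
        refine (div_le_self (by positivity) (by have := norm_nonneg y'; linarith)).trans ?_
        gcongr
    _ = _ := by ring

/-- (E2s) -/
lemma rho_diff (hn : 1 ≤ n) (κ : Kap n) (a x y v : EE n) (z ζ : ℝ) (ha : ‖a‖ ≤ 1) :
    ‖rho κ a x (y + v) (z + ζ) - rho κ a x y z‖ ≤
      ∫ θ in (0:ℝ)..1, C4 n * ((‖v‖ + |ζ| / (1 + ‖y + θ • v‖)) * GG x (y + θ • v) (z + θ * ζ)) := by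
  have hN := half_le_NN hn
  have hcont := continuous_seg κ a x y v z ζ
  obtain ⟨K, hK⟩ := dseg_dom hn κ a x y v z ζ
  have hpt : ∀ u, ∫ θ in (0:ℝ)..1, dseg κ a x (y + θ • v) v (z + θ * ζ) ζ u =
      hseg κ a x (y + v) (z + ζ) u - hseg κ a x y z u := by
    intro u
    rw [intervalIntegral.integral_eq_sub_of_hasDerivAt
      (f := fun θ : ℝ => hseg κ a x (y + θ • v) (z + θ * ζ) u)
      (fun θ _ => hasDerivAt_seg κ a x y v z ζ u θ)
      (Continuous.intervalIntegrable (Continuous.comp (g := fun p : ℝ × ℝ => dseg κ a x (y + p.1 • v) v (z + p.1 * ζ) ζ p.2)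
        (f := fun θ : ℝ => (θ, u)) hcont (by fun_prop)) _ _)]
    simp
  have hint : ∀ (y : EE n) (z : ℝ), Integrable (hseg κ a x y z) := by
    intro y z
    unfold hseg
    refine Integrable.const_mul ?_ _
    have cont : Continuous (fun u : ℝ => Complex.exp (-Complex.I * ((u * z : ℝ) : ℂ))) := by fun_prop
    exact (sym_integrable hN (norm_nonneg (x - y)) (norm_nonneg (x + y)) (by positivity)
      (isSym_sy κ a x y)).ofReal.mul_bdd (c := 1) cont.aestronglyMeasurable
      (Eventually.of_forall fun u => (norm_cexp_I _).le)
  have hprod : Integrable (Function.uncurry fun (u θ : ℝ) => dseg κ a x (y + θ • v) v (z + θ * ζ) ζ u)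
      (volume.prod (volume.restrict (Ioc (0:ℝ) 1))) := by
    have hd : Integrable (fun p : ℝ × ℝ => (K * (1 + p.1 ^ 2)⁻¹) * (1:ℝ)) (volume.prod (volume.restrict (Ioc (0:ℝ) 1))) :=
      Integrable.mul_prod (integrable_inv_one_add_sq.const_mul K) (integrable_const 1)
    have hm : Continuous (Function.uncurry fun (u θ : ℝ) => dseg κ a x (y + θ • v) v (z + θ * ζ) ζ u) :=
      Continuous.comp (g := fun p : ℝ × ℝ => dseg κ a x (y + p.1 • v) v (z + p.1 * ζ) ζ p.2)
        (f := fun p : ℝ × ℝ => (p.2, p.1)) hcont (by fun_prop)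
    refine hd.mono' hm.aestronglyMeasurable ?_
    have : ∀ᵐ p : ℝ × ℝ ∂(volume.prod (volume.restrict (Ioc (0:ℝ) 1))), p.2 ∈ Ioc (0:ℝ) 1 := by
      have h0 : ∀ᵐ θ : ℝ ∂(volume.restrict (Ioc (0:ℝ) 1)), θ ∈ Ioc (0:ℝ) 1 := ae_restrict_mem measurableSet_Ioc
      exact Measure.quasiMeasurePreserving_snd.ae h0
    filter_upwards [this] with p hp
    rw [mul_one]
    exact hK p.2 ⟨hp.1.le, hp.2⟩ p.1
  have hswap : ∫ u, (hseg κ a x (y + v) (z + ζ) u - hseg κ a x y z u) =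
      ∫ θ in (0:ℝ)..1, ∫ u, dseg κ a x (y + θ • v) v (z + θ * ζ) ζ u := by
    rw [intervalIntegral.integral_of_le zero_le_one, ← integral_integral_swap hprod]
    congr 1; ext u
    rw [← hpt u, intervalIntegral.integral_of_le zero_le_one]
  have e : rho κ a x (y + v) (z + ζ) - rho κ a x y z =
      om κ * (cn n : ℂ) * ∫ θ in (0:ℝ)..1, ∫ u, dseg κ a x (y + θ • v) v (z + θ * ζ) ζ u := by
    rw [rho_eq_hseg, rho_eq_hseg, ← mul_sub, ← integral_sub (hint _ _) (hint _ _), hswap]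
  rw [e, norm_mul, norm_mul, norm_om, one_mul, Complex.norm_real, Real.norm_eq_abs, abs_of_pos cn_pos]
  have hG : Continuous fun θ : ℝ => C4 n * ((‖v‖ + |ζ| / (1 + ‖y + θ • v‖)) * GG x (y + θ • v) (z + θ * ζ)) := by
    unfold GG cau
    have h1 : ∀ θ : ℝ, 1 + ‖y + θ • v‖ ≠ 0 := fun θ => by positivity
    have h2 : ∀ θ : ℝ, (1 + ‖y + θ • v‖) ^ 2 + (z + θ * ζ) ^ 2 ≠ 0 := fun θ => by positivity
    fun_prop (disch := assumption)
  rw [← abs_of_pos (cn_pos (n := n)), ← Real.norm_eq_abs, ← Complex.norm_real, ← norm_mul,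
    ← intervalIntegral.integral_const_mul]
  refine intervalIntegral.norm_integral_le_of_norm_le zero_le_one ?_ (hG.intervalIntegrable _ _)
  refine Eventually.of_forall fun θ _ => ?_
  rw [norm_mul, Complex.norm_real, Real.norm_eq_abs, abs_of_pos cn_pos]
  exact dseg_bound hn κ a x (y + θ • v) v (z + θ * ζ) ζ ha

end GR

namespace GR

/-! ### Part 5: representation of the heat operator -/

variable {n : ℕ}

def e1 : EuclideanSpace ℝ (Fin 1) ≃ᵐ ℝ :=
  (MeasurableEquiv.toLp 2 (Fin 1 → ℝ)).symm.trans (MeasurableEquiv.funUnique (Fin 1) ℝ)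
lemma e1_apply (l : EuclideanSpace ℝ (Fin 1)) : e1 l = l 0 := rfl
lemma mp_e1 : MeasurePreserving e1 :=
  (EuclideanSpace.volume_preserving_symm_measurableEquiv_toLp (Fin 1)).trans
    (volume_preserving_funUnique (Fin 1) ℝ)
lemma norm_e1 (l : EuclideanSpace ℝ (Fin 1)) : ‖l‖ = |l 0| := by
  rw [EuclideanSpace.norm_eq]; simp [Real.sqrt_sq_eq_abs]

lemma dotp_eq (a b : EE n) : dotp a b = inner ℝ a b := by
  simp only [dotp, PiLp.inner_apply]
  refine Finset.sum_congr rfl fun i _ => ?_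
  simp [mul_comm]

lemma hermiteK_eq {t : ℝ} (ht : 0 < t) (l : EuclideanSpace ℝ (Fin 1)) (hl : l 0 ≠ 0) (x y : EE n) :
    hermiteK n t l x y = (4 * π * t) ^ (-NN n) *
      Bf (NN n) ‖(√t)⁻¹ • x - (√t)⁻¹ • y‖ ‖(√t)⁻¹ • x + (√t)⁻¹ • y‖ (l 0 * t) := by
  have hst : 0 < √t := Real.sqrt_pos.2 ht
  have hsq : √t ^ 2 = t := Real.sq_sqrt ht.le
  unfold hermiteK Bf Ph
  rw [norm_e1, dotp_eq, ← hh_abs, ← cc_abs, abs_mul, abs_of_pos ht]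
  generalize hv : |l 0| = v
  have hv0 : 0 < v := hv ▸ abs_pos.2 hl
  have hw : 0 < v * t := by positivity
  rw [← smul_sub, ← smul_add, norm_smul, norm_smul, Real.norm_eq_abs, abs_of_pos (inv_pos.2 hst),
    mul_pow, mul_pow, inv_pow, hsq]
  have hD : inner ℝ x y = (‖x + y‖ ^ 2 - ‖x - y‖ ^ 2) / 4 := by
    rw [norm_add_sq_real, norm_sub_sq_real]; ring
  rw [hD, neg_add, Real.exp_add, ← mul_assoc]
  have hpi := Real.pi_pos
  have hH := hh_pos (v * t)
  have hs : Real.sinh (2 * v * t) = 2 * (v * t) * hh (v * t) := by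
    rw [hh_eq hw.ne', mul_div_cancel₀ _ (by positivity), mul_assoc]
  have hs0 : 0 < Real.sinh (v * t) := Real.sinh_pos_iff.2 hw
  have hc0 := Real.cosh_pos (v * t)
  congr 1
  · rw [hs]
    have e : v / (2 * π * (2 * (v * t) * hh (v * t))) = (4 * π * t * hh (v * t))⁻¹ := by
      field_simp; ring
    rw [e, Real.inv_rpow (by positivity), ← Real.rpow_neg (by positivity),
      Real.mul_rpow (by positivity) hH.le]
    congr 1
    rw [Real.rpow_def_of_pos hH]; unfold NN; ring_nf
  · congr 1
    have h1 : 1 / hh (v * t) = 2 * (v * t) / (2 * Real.sinh (v * t) * Real.cosh (v * t)) := by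
      rw [hh_eq hw.ne', ← Real.sinh_two_mul]; field_simp
    have h2 : Real.cosh (2 * v * t) / Real.sinh (2 * v * t) =
        (Real.cosh (v * t) ^ 2 + Real.sinh (v * t) ^ 2) / (2 * Real.sinh (v * t) * Real.cosh (v * t)) := by
      rw [mul_assoc, Real.sinh_two_mul, Real.cosh_two_mul]
    rw [h1, h2, Real.tanh_eq_sinh_div_cosh]
    unfold cc
    have h3 := Real.cosh_sq (v * t)
    generalize Real.cosh (v * t) = c at *
    generalize Real.sinh (v * t) = s at *
    field_simp
    rw [h3]
    ring

def DI (x y : EE n) (z : ℝ) : ℂ :=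
  ∫ u : ℝ, ((Bf (NN n) ‖x - y‖ ‖x + y‖ u : ℝ) : ℂ) * Complex.exp (-Complex.I * ((u * z : ℝ) : ℂ))

def DD (a x y : EE n) (z : ℝ) : ℂ :=
  ((cn n * Real.exp (-‖a‖ ^ 2 - inner ℝ a (x + y)) : ℝ) : ℂ) * DI x y z

lemma driftH_eq {t : ℝ} (ht : 0 < t) (a : EE n) (x y : Ep n 1) :
    driftH a t x y = ((t ^ (-NN n - 1) : ℝ) : ℂ) *
      DD (√t • a) ((√t)⁻¹ • x.1) ((√t)⁻¹ • y.1) ((x.2 0 - y.2 0) / t) := by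
  have hst : 0 < √t := Real.sqrt_pos.2 ht
  have hsq : √t ^ 2 = t := Real.sq_sqrt ht.le
  have hpi := Real.pi_pos
  unfold driftH grushinH DD DI
  set B : ℝ → ℝ := Bf (NN n) ‖(√t)⁻¹ • x.1 - (√t)⁻¹ • y.1‖ ‖(√t)⁻¹ • x.1 + (√t)⁻¹ • y.1‖ with hB
  set z := x.2 0 - y.2 0 with hz
  have h1 : ∫ lam : EuclideanSpace ℝ (Fin 1), ((hermiteK n t lam x.1 y.1 : ℝ) : ℂ) *
      Complex.exp (-Complex.I * ((dotp lam (x.2 - y.2) : ℝ) : ℂ)) =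
      ∫ l : ℝ, (((4 * π * t) ^ (-NN n) * B (l * t) : ℝ) : ℂ) *
        Complex.exp (-Complex.I * (((l * t) * (z / t) : ℝ) : ℂ)) := by
    rw [← mp_e1.integral_comp' (g := fun l : ℝ => (((4 * π * t) ^ (-NN n) * B (l * t) : ℝ) : ℂ) *
        Complex.exp (-Complex.I * (((l * t) * (z / t) : ℝ) : ℂ)))]
    refine integral_congr_ae ?_
    have h0 : ∀ᵐ l : EuclideanSpace ℝ (Fin 1), e1 l ≠ 0 := by
      have : ∀ᵐ l : ℝ, l ≠ 0 := by simp [ae_iff]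
      exact mp_e1.quasiMeasurePreserving.ae this
    filter_upwards [h0] with l hl
    rw [e1_apply] at hl
    rw [hermiteK_eq ht l hl, e1_apply]
    congr 3
    have : l 0 * t * (z / t) = l 0 * z := by field_simp
    rw [this]; simp [dotp, hz]
  rw [h1, Measure.integral_comp_mul_right (fun u : ℝ => (((4 * π * t) ^ (-NN n) * B u : ℝ) : ℂ) *
        Complex.exp (-Complex.I * ((u * (z / t) : ℝ) : ℂ)))]
  have h2 : ∀ u : ℝ, (((4 * π * t) ^ (-NN n) * B u : ℝ) : ℂ) *
        Complex.exp (-Complex.I * ((u * (z / t) : ℝ) : ℂ)) = (((4 * π * t) ^ (-NN n) : ℝ) : ℂ) * ((B u : ℂ) *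
        Complex.exp (-Complex.I * ((u * (z / t) : ℝ) : ℂ))) := by
    intro u; push_cast; ring
  simp_rw [h2]
  rw [integral_const_mul]
  have h3 : -‖√t • a‖ ^ 2 - inner ℝ (√t • a) ((√t)⁻¹ • x.1 + (√t)⁻¹ • y.1) =
      -‖a‖ ^ 2 * t + -dotp a (x.1 + y.1) := by
    rw [← smul_add, inner_smul_left, inner_smul_right, norm_smul, mul_pow, dotp_eq,
      Real.norm_eq_abs, sq_abs, hsq]
    simp only [RCLike.conj_to_real]
    field_simp
    ring
  rw [h3, ← Real.exp_add, pow_one, abs_of_pos (inv_pos.2 ht)]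
  generalize (∫ u : ℝ, (B u : ℂ) * Complex.exp (-Complex.I * ((u * (z / t) : ℝ) : ℂ))) = I0
  unfold cn
  rw [Real.mul_rpow (by positivity) ht.le, Real.rpow_sub ht, Real.rpow_one, Complex.real_smul]
  push_cast
  field_simp

end GR

namespace GR

/-! ### Part 6: derivative of the heat operator -/

variable {n : ℕ}

lemma integrable_osc {g : ℝ → ℝ} (hg : Integrable g) (z : ℝ) :
    Integrable fun u : ℝ => (g u : ℂ) * Complex.exp (-Complex.I * ((u * z : ℝ) : ℂ)) := by
  have cont : Continuous (fun u : ℝ => Complex.exp (-Complex.I * ((u * z : ℝ) : ℂ))) := by fun_prop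
  exact hg.ofReal.mul_bdd (c := 1) cont.aestronglyMeasurable
      (Eventually.of_forall fun u => (norm_cexp_I _).le)

lemma integrable_Bf (hn : 1 ≤ n) {d e : ℝ} (hd : 0 ≤ d) (he : 0 ≤ e) : Integrable (Bf (NN n) d e) := by
  have := sym_integrable (half_le_NN hn) hd he (by positivity) (IsSym.const (W := 1 + d + e) 1 (by positivity))
  simpa using this

lemma hasDerivAt_DI_z (hn : 1 ≤ n) (x y : EE n) (z : ℝ) :
    HasDerivAt (fun z => DI x y z) (-Complex.I * ∫ u : ℝ, ((u * Bf (NN n) ‖x - y‖ ‖x + y‖ u : ℝ) : ℂ) *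
      Complex.exp (-Complex.I * ((u * z : ℝ) : ℂ))) z := by
  have hN := half_le_NN hn
  set d := ‖x - y‖ with hdd
  set e := ‖x + y‖ with hee
  have hd : 0 ≤ d := norm_nonneg _
  have he : 0 ≤ e := norm_nonneg _
  have hW : 1 ≤ 1 + d + e := by linarith
  have hi : Integrable (fun u => u * Bf (NN n) d e u) :=
    sym_integrable hN hd he (by positivity) (isSym_id hW)
  have hBi := integrable_Bf hn hd he
  rw [← integral_const_mul]
  refine (hasDerivAt_integral_of_dominated_loc_of_deriv_le (s := univ)
    (F := fun z u => ((Bf (NN n) d e u : ℝ) : ℂ) * Complex.exp (-Complex.I * ((u * z : ℝ) : ℂ)))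
    (F' := fun z u => -Complex.I * (((u * Bf (NN n) d e u : ℝ) : ℂ) * Complex.exp (-Complex.I * ((u * z : ℝ) : ℂ))))
    (bound := fun u => ‖u * Bf (NN n) d e u‖) univ_mem ?_ (integrable_osc hBi z) ?_ ?_ hi.norm ?_).2
  · exact Eventually.of_forall fun z => (integrable_osc hBi z).aestronglyMeasurable
  · exact ((integrable_osc hi z).const_mul _).aestronglyMeasurable
  · refine Eventually.of_forall fun u z _ => ?_
    rw [norm_mul, norm_mul, norm_cexp_I, Complex.norm_real]; simp
  · refine Eventually.of_forall fun u z _ => ?_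
    have h : HasDerivAt (fun z : ℝ => Complex.exp (-Complex.I * ((u * z : ℝ) : ℂ)))
      (Complex.exp (-Complex.I * ((u * z : ℝ) : ℂ)) * (-Complex.I * ((u * 1 : ℝ) : ℂ))) z :=
      ((((hasDerivAt_id z).const_mul u).ofReal_comp).const_mul (-Complex.I)).cexp
    refine (h.const_mul _).congr_deriv ?_
    push_cast; ring

lemma hasDerivAt_DD_z (hn : 1 ≤ n) (a x y : EE n) (z : ℝ) (j : Fin n × Fin 1) :
    HasDerivAt (fun z => (x j.1 : ℂ) * DD a x y z)
      ((Real.exp (-(2 * inner ℝ a x)) : ℝ) * rho (Sum.inr j) a x y z) z := by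
  have h := ((hasDerivAt_DI_z hn x y z).const_mul
    ((cn n * Real.exp (-‖a‖ ^ 2 - inner ℝ a (x + y)) : ℝ) : ℂ)).const_mul (x j.1 : ℂ)
  refine h.congr_deriv ?_
  unfold rho osI
  have e : ∀ u : ℝ, ((sy (Sum.inr j) a x y u * Bf (NN n) ‖x - y‖ ‖x + y‖ u : ℝ) : ℂ) *
      Complex.exp (-Complex.I * ((u * z : ℝ) : ℂ)) = (x j.1 : ℂ) *
      (((u * Bf (NN n) ‖x - y‖ ‖x + y‖ u : ℝ) : ℂ) * Complex.exp (-Complex.I * ((u * z : ℝ) : ℂ))) := by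
    intro u; simp only [sy]; push_cast; ring
  simp_rw [e]
  rw [integral_const_mul]
  have e2 : Real.exp (-‖a‖ ^ 2 - inner ℝ a (x + y)) =
      Real.exp (-(2 * inner ℝ a x)) * Real.exp (-‖a‖ ^ 2 + inner ℝ a (x - y)) := by
    rw [← Real.exp_add, inner_add_right, inner_sub_right]; congr 1; ring
  rw [e2]
  simp only [om]
  push_cast
  ring

/-- integrand for the derivative in `x` -/
def kseg (a x y : EE n) (z u : ℝ) : ℂ :=
  ((Real.exp (-‖a‖ ^ 2 - inner ℝ a (x + y)) : ℝ) : ℂ) * (((Bf (NN n) ‖x - y‖ ‖x + y‖ u : ℝ) : ℂ) *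
    Complex.exp (-Complex.I * ((u * z : ℝ) : ℂ)))
def kseg' (j : Fin n) (a x y : EE n) (z u : ℝ) : ℂ :=
  ((Real.exp (-‖a‖ ^ 2 - inner ℝ a (x + y)) : ℝ) : ℂ) * (((sy (Sum.inl j) a x y u * Bf (NN n) ‖x - y‖ ‖x + y‖ u : ℝ) : ℂ) *
    Complex.exp (-Complex.I * ((u * z : ℝ) : ℂ)))

lemma hasDerivAt_kseg (j : Fin n) (a x y : EE n) (z u s : ℝ) :
    HasDerivAt (fun s : ℝ => kseg a (x + s • EuclideanSpace.single j 1) y z u)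
      (kseg' j a (x + s • EuclideanSpace.single j 1) y z u) s := by
  set v : EE n := EuclideanSpace.single j 1 with hv
  have hx : HasDerivAt (fun θ : ℝ => x + θ • v) v s := by
    simpa using ((hasDerivAt_id s).smul_const v).const_add x
  have hD : HasDerivAt (fun θ : ℝ => (x + θ • v) - y) v s := hx.sub_const y
  have hS : HasDerivAt (fun θ : ℝ => (x + θ • v) + y) v s := hx.add_const y
  have iv : ∀ b : EE n, inner ℝ b v = b j := fun b => by simp [hv, EuclideanSpace.inner_single_right]
  have h1 : HasDerivAt (fun θ : ℝ => Real.exp (-‖a‖ ^ 2 - inner ℝ a ((x + θ • v) + y)))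
      (Real.exp (-‖a‖ ^ 2 - inner ℝ a ((x + s • v) + y)) * -a j) s := by
    have : HasDerivAt (fun θ : ℝ => inner ℝ a ((x + θ • v) + y)) (a j) s := by
      have := (hasDerivAt_const s a).inner ℝ hS
      simpa [iv] using this
    exact (this.const_sub _).exp
  have h3 : HasDerivAt (fun θ : ℝ => Bf (NN n) ‖(x + θ • v) - y‖ ‖(x + θ • v) + y‖ u)
      (Bf (NN n) ‖(x + s • v) - y‖ ‖(x + s • v) + y‖ u *
        (-(1 / hh u * ((x + s • v) j - y j) / 2) - cc u * (x + s • v) j)) s := by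
    unfold Bf Ph
    refine ((((((hD.norm_sq).const_mul (1 / hh u + cc u)).add
      ((hS.norm_sq).const_mul (cc u))).div_const 4).const_add _).neg.exp).congr_deriv ?_
    simp only [Pi.neg_apply, Pi.add_apply, iv, PiLp.add_apply, PiLp.sub_apply]
    ring
  have := (h1.ofReal_comp).mul ((h3.ofReal_comp).mul_const (Complex.exp (-Complex.I * ((u * z : ℝ) : ℂ))))
  refine this.congr_deriv ?_
  unfold kseg'
  simp only [sy]
  push_cast
  ring

lemma kseg'_dom (hn : 1 ≤ n) (j : Fin n) (a x y : EE n) (z s : ℝ) :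
    ∃ K, ∀ θ ∈ Metric.ball s 1, ∀ u, ‖kseg' j a (x + θ • EuclideanSpace.single j 1) y z u‖ ≤ K * (1 + u ^ 2)⁻¹ := by
  have hN := half_le_NN hn
  set v : EE n := EuclideanSpace.single j 1 with hv
  have nv : ‖v‖ = 1 := by simp [hv]
  set R := ‖x‖ + ‖y‖ + |s| + 1 with hR
  refine ⟨Real.exp (‖a‖ * R) * (6 * (1 + R + ‖a‖) * Kc 1), ?_⟩
  intro θ hθ u
  have hK := Kc_pos 1
  rw [Metric.mem_ball, Real.dist_eq] at hθ
  have hθ' : |θ| ≤ |s| + 1 := by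
    have := abs_sub_abs_le_abs_sub θ s
    linarith
  have hxx : ‖x + θ • v‖ ≤ ‖x‖ + |s| + 1 := by
    refine (norm_add_le _ _).trans ?_
    rw [norm_smul, nv, Real.norm_eq_abs]; linarith
  set x' := x + θ • v
  have hD : ‖x' - y‖ ≤ R := (norm_sub_le _ _).trans (by linarith)
  have hS : ‖x' + y‖ ≤ R := (norm_add_le _ _).trans (by linarith)
  have hR0 : 0 ≤ R := by positivity
  have b1 := sym_pt hN (norm_nonneg (x' - y)) (norm_nonneg (x' + y)) (by positivity) (isSym_sy (Sum.inl j) a x' y) u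
  have hE : Real.exp (-‖a‖ ^ 2 - inner ℝ a (x' + y)) ≤ Real.exp (‖a‖ * R) := by
    rw [Real.exp_le_exp]
    have := neg_le_of_abs_le (abs_real_inner_le_norm a (x' + y))
    have : ‖a‖ * ‖x' + y‖ ≤ ‖a‖ * R := by gcongr
    nlinarith [sq_nonneg ‖a‖]
  unfold kseg'
  rw [norm_mul, Complex.norm_real, Real.norm_eq_abs, abs_of_pos (Real.exp_pos _), mul_assoc (Real.exp (‖a‖ * R)),
    norm_mul, norm_cexp_I, Complex.norm_real, Real.norm_eq_abs, mul_one]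
  refine mul_le_mul hE (b1.trans ?_) (abs_nonneg _) (Real.exp_pos _).le
  gcongr

lemma hasDerivAt_DD_x (hn : 1 ≤ n) (j : Fin n) (a x y : EE n) (z s : ℝ) :
    HasDerivAt (fun s : ℝ => DD a (x + s • EuclideanSpace.single j 1) y z)
      ((Real.exp (-(2 * inner ℝ a (x + s • EuclideanSpace.single j 1))) : ℝ) *
        rho (Sum.inl j) a (x + s • EuclideanSpace.single j 1) y z) s := by
  have hN := half_le_NN hn
  have e1 : ∀ x : EE n, DD a x y z = (cn n : ℂ) * ∫ u, kseg a x y z u := by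
    intro x
    unfold DD DI kseg
    rw [integral_const_mul]; push_cast; ring
  have e2 : ∀ x : EE n, (Real.exp (-(2 * inner ℝ a x)) : ℝ) * rho (Sum.inl j) a x y z =
      (cn n : ℂ) * ∫ u, kseg' j a x y z u := by
    intro x
    unfold rho osI kseg'
    rw [integral_const_mul]
    have e2 : Real.exp (-‖a‖ ^ 2 - inner ℝ a (x + y)) =
        Real.exp (-(2 * inner ℝ a x)) * Real.exp (-‖a‖ ^ 2 + inner ℝ a (x - y)) := by
      rw [← Real.exp_add, inner_add_right, inner_sub_right]; congr 1; ring
    rw [e2]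
    simp only [om]
    push_cast; ring
  have i1 : ∀ x, Integrable (kseg a x y z) := fun x =>
    (integrable_osc (integrable_Bf hn (norm_nonneg _) (norm_nonneg _)) z).const_mul _
  have i2 : ∀ x, Integrable (kseg' j a x y z) := fun x =>
    (integrable_osc (sym_integrable hN (norm_nonneg (x - y)) (norm_nonneg (x + y)) (by positivity)
      (isSym_sy _ a x y)) z).const_mul _
  simp_rw [e1, e2]
  refine HasDerivAt.const_mul _ ?_
  obtain ⟨K, hK⟩ := kseg'_dom hn j a x y z s
  refine (hasDerivAt_integral_of_dominated_loc_of_deriv_le (s := Metric.ball s 1)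
    (F := fun s u => kseg a (x + s • EuclideanSpace.single j 1) y z u)
    (F' := fun s u => kseg' j a (x + s • EuclideanSpace.single j 1) y z u)
    (bound := fun u => K * (1 + u ^ 2)⁻¹) (Metric.ball_mem_nhds s one_pos) ?_ (i1 _) ?_ ?_
    (integrable_inv_one_add_sq.const_mul K) ?_).2
  · exact Eventually.of_forall fun z => (i1 _).aestronglyMeasurable
  · exact (i2 _).aestronglyMeasurable
  · exact Eventually.of_forall fun u θ hθ => hK θ hθ u
  · exact Eventually.of_forall fun u θ hθ => hasDerivAt_kseg j a x y z u θ

/-- global bound -/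
lemma rho_bdd (hn : 1 ≤ n) (κ : Kap n) (a : EE n) :
    ∃ C, 0 ≤ C ∧ ∀ x y z, ‖rho κ a x y z‖ ≤ C := by
  rcases le_total ‖a‖ 1 with h | h
  · refine ⟨C1 n, (C1_pos hn).le, fun x y z => (rho_small hn κ a x y z h).trans ?_⟩
    refine mul_le_of_le_one_right (C1_pos hn).le ?_
    unfold GG cau
    have e : Real.exp (-(‖x - y‖ ^ 2 / 16)) ≤ 1 := by rw [Real.exp_le_one_iff]; have := sq_nonneg ‖x - y‖; linarith
    have e2 : (1 + ‖y‖) / ((1 + ‖y‖) ^ 2 + z ^ 2) ≤ 1 := by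
      have := norm_nonneg y
      rw [div_le_one (by positivity)]; nlinarith [sq_nonneg z]
    exact mul_le_one₀ e (by positivity) e2
  · have hC := C2_pos hn
    refine ⟨C2 n * ‖a‖, by positivity, fun x y z => (rho_large hn κ a x y z h).trans ?_⟩
    refine mul_le_mul_of_nonneg_left ?_ hC.le
    have e : Real.exp (-(‖(x - y) - (2:ℝ) • a‖ ^ 2 / 8)) ≤ 1 := by
      rw [Real.exp_le_one_iff]; have := sq_nonneg ‖(x - y) - (2:ℝ) • a‖; linarith
    have e2 : ‖a‖ * (1 + ‖y‖) / (‖a‖ * (1 + ‖y‖) ^ 2 + z ^ 2) ≤ 1 := by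
      have := norm_nonneg y
      rw [div_le_one (by positivity)]
      have : 1 + ‖y‖ ≤ (1 + ‖y‖) ^ 2 := by nlinarith
      have : ‖a‖ * (1 + ‖y‖) ≤ ‖a‖ * (1 + ‖y‖) ^ 2 := by gcongr
      nlinarith [sq_nonneg z]
    rw [mul_assoc]
    refine mul_le_of_le_one_right (norm_nonneg a) (mul_le_one₀ e (by positivity) e2)

end GR

namespace GR

/-! ### Part 7: derivative of the heat operator, continued -/

variable {n : ℕ}

def rr (κ : Kap n) (a : EE n) (t : ℝ) (x y : EE n) (z : ℝ) : ℂ :=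
  ((t ^ (-NN n - 3 / 2) : ℝ) : ℂ) * rho κ (√t • a) ((√t)⁻¹ • x) ((√t)⁻¹ • y) (z / t)

lemma measurable_rr (κ : Kap n) : Measurable fun p : EE n × ℝ × EE n × EE n × ℝ =>
    rr κ p.1 p.2.1 p.2.2.1 p.2.2.2.1 p.2.2.2.2 := by
  unfold rr
  have h : Measurable fun p : EE n × ℝ × EE n × EE n × ℝ =>
    ((√p.2.1 • p.1, (√p.2.1)⁻¹ • p.2.2.1, (√p.2.1)⁻¹ • p.2.2.2.1, p.2.2.2.2 / p.2.1) : EE n × EE n × EE n × ℝ) := by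
    fun_prop
  have h2 := (measurable_rho κ).comp h
  have h3 : Measurable fun p : EE n × ℝ × EE n × EE n × ℝ => ((p.2.1 ^ (-NN n - 3 / 2) : ℝ) : ℂ) := by
    fun_prop
  exact h3.mul h2

lemma measurable_DI : Measurable fun p : EE n × EE n × ℝ => DI p.1 p.2.1 p.2.2 := by
  have h1 : StronglyMeasurable fun p : EE n × EE n × ℝ => DI p.1 p.2.1 p.2.2 := by
    unfold DI
    have hc : Continuous fun q : (EE n × EE n × ℝ) × ℝ =>
        ((Bf (NN n) ‖q.1.1 - q.1.2.1‖ ‖q.1.1 + q.1.2.1‖ q.2 : ℝ) : ℂ) *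
        Complex.exp (-Complex.I * ((q.2 * q.1.2.2 : ℝ) : ℂ)) := by
      have := Bf_cont (X := (EE n × EE n × ℝ) × ℝ) (NN n) (f := fun q => ‖q.1.1 - q.1.2.1‖)
        (g := fun q => ‖q.1.1 + q.1.2.1‖) (h := fun q => q.2) (by fun_prop) (by fun_prop) (by fun_prop)
      fun_prop
    exact StronglyMeasurable.integral_prod_right (f := fun (p : EE n × EE n × ℝ) (u : ℝ) =>
        ((Bf (NN n) ‖p.1 - p.2.1‖ ‖p.1 + p.2.1‖ u : ℝ) : ℂ) *
        Complex.exp (-Complex.I * ((u * p.2.2 : ℝ) : ℂ))) hc.stronglyMeasurable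
  exact h1.measurable

lemma DI_bdd (hn : 1 ≤ n) (x y : EE n) (z : ℝ) : ‖DI x y z‖ ≤ Kc 0 * π := by
  unfold DI
  have hb : ∀ u, ‖((Bf (NN n) ‖x - y‖ ‖x + y‖ u : ℝ) : ℂ) * Complex.exp (-Complex.I * ((u * z : ℝ) : ℂ))‖ ≤
      Kc 0 * (1 + u ^ 2)⁻¹ := by
    intro u
    rw [norm_mul, norm_cexp_I, mul_one, Complex.norm_real, Real.norm_eq_abs]
    have := sym_pt (half_le_NN hn) (norm_nonneg (x - y)) (norm_nonneg (x + y)) (by positivity)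
      (IsSym.const (W := 1 + ‖x - y‖ + ‖x + y‖) 1 (by positivity)) u
    simpa using this
  refine (norm_integral_le_of_norm_le (integrable_inv_one_add_sq.const_mul _) (Eventually.of_forall hb)).trans ?_
  rw [integral_const_mul, integral_univ_inv_one_add_sq]

lemma measurable_DD : Measurable fun p : EE n × EE n × EE n × ℝ => DD p.1 p.2.1 p.2.2.1 p.2.2.2 := by
  unfold DD
  have h2 := (measurable_DI (n := n)).comp
    (by fun_prop : Measurable fun p : EE n × EE n × EE n × ℝ => (p.2.1, p.2.2.1, p.2.2.2))
  have h3 : Measurable fun p : EE n × EE n × EE n × ℝ =>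
      ((cn n * Real.exp (-‖p.1‖ ^ 2 - inner ℝ p.1 (p.2.1 + p.2.2.1)) : ℝ) : ℂ) := by
    have : Continuous fun p : EE n × EE n × EE n × ℝ =>
      ((cn n * Real.exp (-‖p.1‖ ^ 2 - inner ℝ p.1 (p.2.1 + p.2.2.1)) : ℝ) : ℂ) := by fun_prop
    exact this.measurable
  exact h3.mul h2

/-- abstract differentiation under the integral -/
lemma deriv_under {X : Type*} [MeasurableSpace X] {μ : Measure X} {k k' : ℝ → X → ℂ} {φ : X → ℂ} {C : ℝ}
    (hφ : Integrable φ μ) (hk : ∀ s, Measurable (k s)) (hk' : Measurable (k' 0))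
    (hi : Integrable (fun y => k 0 y * φ y) μ) (hd : ∀ s y, HasDerivAt (fun s => k s y) (k' s y) s)
    (hb : ∀ s, |s| < 1 → ∀ y, ‖k' s y‖ ≤ C) :
    HasDerivAt (fun s => ∫ y, k s y * φ y ∂μ) (∫ y, k' 0 y * φ y ∂μ) 0 := by
  refine (hasDerivAt_integral_of_dominated_loc_of_deriv_le (s := Metric.ball 0 1)
    (F := fun s y => k s y * φ y) (F' := fun s y => k' s y * φ y)
    (bound := fun y => C * ‖φ y‖) (Metric.ball_mem_nhds 0 one_pos) ?_ hi ?_ ?_ (hφ.norm.const_mul C) ?_).2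
  · exact Eventually.of_forall fun s => (hk s).aestronglyMeasurable.mul hφ.1
  · exact hk'.aestronglyMeasurable.mul hφ.1
  · refine Eventually.of_forall fun y s hs => ?_
    rw [norm_mul]
    exact mul_le_mul_of_nonneg_right (hb s (by simpa using hs) y) (norm_nonneg _)
  · exact Eventually.of_forall fun y s hs => (hd s y).mul_const _

lemma hasDerivAt_drift (hn : 1 ≤ n) (j : Fin n) {t : ℝ} (ht : 0 < t) (a : EE n) (x y : Ep n 1) (s : ℝ) :
    HasDerivAt (fun s : ℝ => driftH a t (x.1 + s • EuclideanSpace.single j 1, x.2) y)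
      ((Real.exp (-(2 * inner ℝ a (x.1 + s • EuclideanSpace.single j 1))) : ℝ) *
        rr (Sum.inl j) a t (x.1 + s • EuclideanSpace.single j 1) y.1 (x.2 0 - y.2 0)) s := by
  have hst : 0 < √t := Real.sqrt_pos.2 ht
  have e : ∀ s : ℝ, (√t)⁻¹ • (x.1 + s • EuclideanSpace.single j 1) =
      (√t)⁻¹ • x.1 + ((√t)⁻¹ * s) • (EuclideanSpace.single j 1 : EE n) := by
    intro s; rw [smul_add, smul_smul]
  simp_rw [driftH_eq ht]
  have h := hasDerivAt_DD_x hn j (√t • a) ((√t)⁻¹ • x.1) ((√t)⁻¹ • y.1) ((x.2 0 - y.2 0) / t) ((√t)⁻¹ * s)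
  have h2 : HasDerivAt (fun s => (√t)⁻¹ * s) ((√t)⁻¹) s := by
    simpa using (hasDerivAt_id s).const_mul (√t)⁻¹
  have h3 := (h.scomp s h2).const_mul ((t ^ (-NN n - 1) : ℝ) : ℂ)
  simp only [Function.comp_def] at h3
  simp_rw [e]
  refine h3.congr_deriv ?_
  unfold rr
  rw [← e s]
  have e3 : inner ℝ (√t • a) ((√t)⁻¹ • (x.1 + s • EuclideanSpace.single j 1)) =
      inner ℝ a (x.1 + s • EuclideanSpace.single j 1) := by
    rw [inner_smul_left, inner_smul_right]; simp; field_simp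
  have e4 : t ^ (-NN n - 3 / 2) = t ^ (-NN n - 1) * (√t)⁻¹ := by
    rw [Real.sqrt_eq_rpow, ← Real.rpow_neg ht.le, ← Real.rpow_add ht]; congr 1; norm_num; ring
  rw [e3, e4, Complex.real_smul]
  push_cast
  ring

lemma hasDerivAt_drift' (hn : 1 ≤ n) (j : Fin n × Fin 1) {t : ℝ} (ht : 0 < t) (a : EE n) (x y : Ep n 1) (s : ℝ) :
    HasDerivAt (fun s : ℝ => (x.1 j.1 : ℂ) * driftH a t (x.1, x.2 + s • EuclideanSpace.single j.2 1) y)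
      ((Real.exp (-(2 * inner ℝ a x.1)) : ℝ) *
        rr (Sum.inr j) a t x.1 y.1 (x.2 0 + s - y.2 0)) s := by
  have hst : 0 < √t := Real.sqrt_pos.2 ht
  have hsq : √t * √t = t := Real.mul_self_sqrt ht.le
  have hj : j.2 = 0 := Subsingleton.elim _ _
  have e : ∀ s : ℝ, (x.2 + s • (EuclideanSpace.single j.2 1 : EuclideanSpace ℝ (Fin 1))) 0 = x.2 0 + s := by
    intro s; simp [hj]
  simp_rw [driftH_eq ht, e]
  have h := hasDerivAt_DD_z hn (√t • a) ((√t)⁻¹ • x.1) ((√t)⁻¹ • y.1) ((x.2 0 + s - y.2 0) / t) j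
  have h2 : HasDerivAt (fun s => (x.2 0 + s - y.2 0) / t) (t⁻¹) s := by
    simpa using (((hasDerivAt_id s).const_add (x.2 0)).sub_const (y.2 0)).div_const t
  have h3 := (h.scomp s h2).const_mul ((√t * t ^ (-NN n - 1) : ℝ) : ℂ)
  simp only [Function.comp_def] at h3
  have e5 : ∀ w : ℂ, (x.1 j.1 : ℂ) * (((t ^ (-NN n - 1) : ℝ) : ℂ) * w) =
      ((√t * t ^ (-NN n - 1) : ℝ) : ℂ) * ((((√t)⁻¹ • x.1) j.1 : ℝ) * w) := by
    intro w
    have : (√t : ℂ) ≠ 0 := by exact_mod_cast hst.ne'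
    simp only [PiLp.smul_apply, smul_eq_mul]
    push_cast
    field_simp
  simp_rw [e5]
  refine h3.congr_deriv ?_
  unfold rr
  have e3 : inner ℝ (√t • a) ((√t)⁻¹ • x.1) = inner ℝ a x.1 := by
    rw [inner_smul_left, inner_smul_right]; simp; field_simp
  have e4 : t ^ (-NN n - 3 / 2) = √t * t ^ (-NN n - 1) * t⁻¹ := by
    rw [Real.sqrt_eq_rpow, ← Real.rpow_neg_one, ← Real.rpow_add ht, ← Real.rpow_add ht]; congr 1; ring
  rw [e3, e4, Complex.real_smul]
  push_cast
  ring

lemma integrable_driftH (hn : 1 ≤ n) {t : ℝ} (ht : 0 < t) (a : EE n) (x : Ep n 1) {f : Ep n 1 → ℂ}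
    (hf : Continuous f) (hc : HasCompactSupport f) :
    Integrable fun y : Ep n 1 => driftH a t x y * (f y * ((Real.exp (2 * dotp a y.1) : ℝ) : ℂ)) := by
  have hst : 0 < √t := Real.sqrt_pos.2 ht
  have e : ∀ y : Ep n 1, driftH a t x y * (f y * ((Real.exp (2 * dotp a y.1) : ℝ) : ℂ)) =
      DI ((√t)⁻¹ • x.1) ((√t)⁻¹ • y.1) ((x.2 0 - y.2 0) / t) *
      (f y * ((t ^ (-NN n - 1) * (cn n * Real.exp (-‖√t • a‖ ^ 2 - inner ℝ (√t • a) ((√t)⁻¹ • x.1 + (√t)⁻¹ • y.1)))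
        * Real.exp (2 * inner ℝ a y.1) : ℝ) : ℂ)) := by
    intro y
    rw [driftH_eq ht, dotp_eq, DD]; push_cast; ring
  simp_rw [e]
  have i1 : Integrable fun y : Ep n 1 => (f y * ((t ^ (-NN n - 1) * (cn n * Real.exp (-‖√t • a‖ ^ 2 - inner ℝ (√t • a) ((√t)⁻¹ • x.1 + (√t)⁻¹ • y.1)))
        * Real.exp (2 * inner ℝ a y.1) : ℝ) : ℂ)) :=
    Continuous.integrable_of_hasCompactSupport (by fun_prop) hc.mul_right
  refine i1.bdd_mul (c := Kc 0 * π) ?_ (Eventually.of_forall fun y => DI_bdd hn _ _ _)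
  exact ((measurable_DI (n := n)).comp (by fun_prop : Measurable fun y : Ep n 1 =>
    (((√t)⁻¹ • x.1, (√t)⁻¹ • y.1, (x.2 0 - y.2 0) / t) : EE n × EE n × ℝ))).aestronglyMeasurable

lemma measurable_driftH {t : ℝ} (ht : 0 < t) (a : EE n) (x : Ep n 1) : Measurable fun y : Ep n 1 => driftH a t x y := by
  simp_rw [driftH_eq ht]
  exact ((measurable_DD (n := n)).comp (by fun_prop : Measurable fun y : Ep n 1 =>
    ((√t • a, (√t)⁻¹ • x.1, (√t)⁻¹ • y.1, (x.2 0 - y.2 0) / t) : EE n × EE n × EE n × ℝ))).const_mul _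

lemma vf_heat (hn : 1 ≤ n) (κ : Kap n) {t : ℝ} (ht : 0 < t) (a : EE n) (x : Ep n 1) {f : Ep n 1 → ℂ}
    (hf : Continuous f) (hc : HasCompactSupport f) :
    vf κ (heatOp a t f) x = ((Real.exp (-(2 * inner ℝ a x.1)) : ℝ) : ℂ) *
      ∫ y : Ep n 1, rr κ a t x.1 y.1 (x.2 0 - y.2 0) * (f y * ((Real.exp (2 * inner ℝ a y.1) : ℝ) : ℂ)) := by
  have hφ : Integrable fun y : Ep n 1 => f y * ((Real.exp (2 * dotp a y.1) : ℝ) : ℂ) := by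
    simp_rw [dotp_eq]
    exact Continuous.integrable_of_hasCompactSupport (by fun_prop) hc.mul_right
  have hh0 : ∀ x, heatOp a t f x = ∫ y : Ep n 1, driftH a t x y * (f y * ((Real.exp (2 * dotp a y.1) : ℝ) : ℂ)) := by
    intro x; unfold heatOp; simp_rw [mul_assoc]
  obtain ⟨C, hC0, hC⟩ := rho_bdd hn κ (√t • a)
  have hrb : ∀ x y z, ‖rr κ a t x y z‖ ≤ t ^ (-NN n - 3 / 2) * C := by
    intro x y z
    unfold rr
    rw [norm_mul, Complex.norm_real, Real.norm_eq_abs, abs_of_pos (by positivity)]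
    gcongr; exact hC _ _ _
  have hrm : ∀ x : Ep n 1, Measurable fun y : Ep n 1 => ((Real.exp (-(2 * inner ℝ a x.1)) : ℝ) : ℂ) *
      rr κ a t x.1 y.1 (x.2 0 - y.2 0) := by
    intro x
    exact ((measurable_rr κ).comp (by fun_prop : Measurable fun y : Ep n 1 =>
      ((a, t, x.1, y.1, (x.2 0 - y.2 0)) : EE n × ℝ × EE n × EE n × ℝ))).const_mul _
  cases κ with
  | inl j =>
    simp only [vf]
    simp_rw [hh0]
    have := deriv_under (k := fun s y => driftH a t (x.1 + s • EuclideanSpace.single j 1, x.2) y)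
      (k' := fun s y => (Real.exp (-(2 * inner ℝ a (x.1 + s • EuclideanSpace.single j 1))) : ℝ) *
        rr (Sum.inl j) a t (x.1 + s • EuclideanSpace.single j 1) y.1 (x.2 0 - y.2 0))
      (C := Real.exp (2 * (‖a‖ * (‖x.1‖ + 1))) * (t ^ (-NN n - 3 / 2) * C)) hφ
      (fun s => measurable_driftH ht a _) (by simpa using hrm x)
      (by simpa using integrable_driftH hn ht a x hf hc) (fun s y => hasDerivAt_drift hn j ht a x y s) ?_
    · rw [this.deriv, ← integral_const_mul]
      refine integral_congr_ae (Eventually.of_forall fun y => ?_)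
      simp only [zero_smul, add_zero, dotp_eq]
      ring
    · intro s hs y
      rw [norm_mul, Complex.norm_real, Real.norm_eq_abs, abs_of_pos (Real.exp_pos _)]
      refine mul_le_mul ?_ (hrb _ _ _) (norm_nonneg _) (Real.exp_pos _).le
      rw [Real.exp_le_exp]
      have h1 := neg_le_of_abs_le (abs_real_inner_le_norm a (x.1 + s • EuclideanSpace.single j 1))
      have h2 : ‖x.1 + s • (EuclideanSpace.single j 1 : EE n)‖ ≤ ‖x.1‖ + 1 := by
        refine (norm_add_le _ _).trans ?_
        rw [norm_smul]; simp; exact hs.le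
      have : ‖a‖ * ‖x.1 + s • (EuclideanSpace.single j 1 : EE n)‖ ≤ ‖a‖ * (‖x.1‖ + 1) := by gcongr
      linarith
  | inr j =>
    simp only [vf]
    simp_rw [hh0]
    rw [← deriv_const_mul_field, ← integral_const_mul]
    have := deriv_under (k := fun s y => (x.1 j.1 : ℂ) * driftH a t (x.1, x.2 + s • EuclideanSpace.single j.2 1) y)
      (k' := fun s y => (Real.exp (-(2 * inner ℝ a x.1)) : ℝ) *
        rr (Sum.inr j) a t x.1 y.1 (x.2 0 + s - y.2 0))
      (C := Real.exp (-(2 * inner ℝ a x.1)) * (t ^ (-NN n - 3 / 2) * C)) hφ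
      (fun s => (measurable_driftH ht a _).const_mul _) (by simpa using hrm x)
      (by simpa [mul_assoc] using (integrable_driftH hn ht a x hf hc).const_mul _)
      (fun s y => hasDerivAt_drift' hn j ht a x y s) ?_
    · simp_rw [← integral_const_mul]
      simp_rw [mul_assoc] at this
      rw [this.deriv]
      refine integral_congr_ae (Eventually.of_forall fun y => ?_)
      simp only [add_zero, dotp_eq]
    · intro s hs y
      rw [norm_mul, Complex.norm_real, Real.norm_eq_abs, abs_of_pos (Real.exp_pos _)]
      exact mul_le_mul_of_nonneg_left (hrb _ _ _) (Real.exp_pos _).le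

end GR

namespace GR

/-! ### Part 8: abstract Calderón–Zygmund decomposition -/

section CZ
open scoped ENNReal
variable {X ι : Type*} [MeasurableSpace X]

def czV (μ : Measure X) (c : ℕ → X → ι) (f : X → ℂ) (k : ℕ) (i : ι) : ℝ≥0∞ :=
  ∫⁻ y in c k ⁻¹' {i}, ‖f y‖ₑ ∂μ

def czBad (μ : Measure X) (c : ℕ → X → ι) (f : X → ℂ) (σ : ℝ≥0∞) (k : ℕ) (i : ι) : Prop :=
  σ * μ (c k ⁻¹' {i}) < czV μ c f k i

def czav (μ : Measure X) (c : ℕ → X → ι) (f : X → ℂ) (k : ℕ) (i : ι) : ℂ :=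
  ((μ (c k ⁻¹' {i})).toReal⁻¹ : ℝ) • ∫ y in c k ⁻¹' {i}, f y ∂μ

def czB (μ : Measure X) (c : ℕ → X → ι) (f : X → ℂ) (σ : ℝ≥0∞) : Set X :=
  {x | ∃ k, czBad μ c f σ k (c k x)}

def cztau (μ : Measure X) (c : ℕ → X → ι) (f : X → ℂ) (σ : ℝ≥0∞) (x : X) : ℕ :=
  sInf {k | czBad μ c f σ k (c k x)}

def czP (μ : Measure X) (c : ℕ → X → ι) (f : X → ℂ) (σ : ℝ≥0∞) (j : ℕ × ι) : Set X :=
  {x | x ∈ czB μ c f σ ∧ cztau μ c f σ x = j.1 ∧ c j.1 x = j.2}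

open Classical in
def czg (μ : Measure X) (c : ℕ → X → ι) (f : X → ℂ) (σ : ℝ≥0∞) (x : X) : ℂ :=
  if x ∈ czB μ c f σ then
    (if cztau μ c f σ x = 0 then 0 else czav μ c f (cztau μ c f σ x) (c (cztau μ c f σ x) x))
  else f x

variable {μ : Measure X} {c : ℕ → X → ι} {f : X → ℂ} {σ : ℝ≥0∞}

lemma cz_nest (hnest : ∀ k x y, c (k+1) x = c (k+1) y → c k x = c k y) {k j : ℕ} (h : j ≤ k)
    {x y : X} (hxy : c k x = c k y) : c j x = c j y := by
  induction k with
  | zero => obtain rfl : j = 0 := by omega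
            exact hxy
  | succ k ih =>
    rcases Nat.lt_or_ge j (k+1) with h1 | h1
    · exact ih (by omega) (hnest k x y hxy)
    · obtain rfl : j = k + 1 := by omega
      exact hxy

lemma cz_tau_bad {x : X} (hx : x ∈ czB μ c f σ) :
    czBad μ c f σ (cztau μ c f σ x) (c (cztau μ c f σ x) x) :=
  Nat.sInf_mem (s := {k | czBad μ c f σ k (c k x)}) hx

lemma cz_tau_lt {x : X} {k : ℕ} (h : k < cztau μ c f σ x) : ¬ czBad μ c f σ k (c k x) :=
  Nat.notMem_of_lt_sInf (s := {k | czBad μ c f σ k (c k x)}) h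

lemma cz_P_eq (hnest : ∀ k x y, c (k+1) x = c (k+1) y → c k x = c k y) {j : ℕ × ι} {x : X}
    (hx : x ∈ czP μ c f σ j) : czP μ c f σ j = c j.1 ⁻¹' {j.2} := by
  apply Subset.antisymm
  · intro y hy; exact hy.2.2
  · intro y hy
    obtain ⟨h1, h2, h3⟩ := hx
    have hy' : c j.1 y = j.2 := hy
    have hb : czBad μ c f σ j.1 (c j.1 y) := by
      have := cz_tau_bad h1
      rw [h2, h3] at this; rw [hy']; exact this
    refine ⟨⟨_, hb⟩, ?_, hy'⟩
    apply le_antisymm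
    · exact Nat.sInf_le hb
    · by_contra hlt
      push Not at hlt
      have h4 := cz_tau_bad (x := y) ⟨_, hb⟩
      have h5 : c (cztau μ c f σ y) y = c (cztau μ c f σ y) x :=
        cz_nest hnest hlt.le (by rw [hy', h3])
      rw [h5] at h4
      exact cz_tau_lt (by rw [h2]; exact hlt) h4

lemma cz_disj : Pairwise (Function.onFun Disjoint (czP μ c f σ)) := by
  intro i j hij
  rw [Function.onFun, Set.disjoint_left]
  rintro x ⟨_, h2, h3⟩ ⟨_, h5, h6⟩
  apply hij
  have : i.1 = j.1 := h2.symm.trans h5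
  refine Prod.ext this ?_
  rw [← h3, ← h6, this]

lemma cz_union : ⋃ j, czP μ c f σ j = czB μ c f σ := by
  ext x
  simp only [mem_iUnion]
  constructor
  · rintro ⟨j, hj⟩; exact hj.1
  · intro hx; exact ⟨(cztau μ c f σ x, c (cztau μ c f σ x) x), hx, rfl, rfl⟩

section meas
variable [Countable ι]

lemma cz_meas_pre (hcm : ∀ k i, MeasurableSet (c k ⁻¹' {i})) (k : ℕ) (A : Set ι) : MeasurableSet (c k ⁻¹' A) := by
  have : c k ⁻¹' A = ⋃ i ∈ A, c k ⁻¹' {i} := by ext; simp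
  rw [this]
  exact MeasurableSet.biUnion (to_countable _) fun i _ => hcm k i

lemma cz_meas_B (hcm : ∀ k i, MeasurableSet (c k ⁻¹' {i})) : MeasurableSet (czB μ c f σ) := by
  have : czB μ c f σ = ⋃ k, c k ⁻¹' {i | czBad μ c f σ k i} := by ext; simp [czB]
  rw [this]
  exact MeasurableSet.iUnion fun k => cz_meas_pre hcm k _

lemma cz_meas_tau (hcm : ∀ k i, MeasurableSet (c k ⁻¹' {i})) : Measurable (cztau μ c f σ) := by
  apply measurable_to_countable'
  intro k
  have h1 : ∀ k, MeasurableSet {x | czBad μ c f σ k (c k x)} := fun k =>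
    cz_meas_pre hcm k {i | czBad μ c f σ k i}
  have : cztau μ c f σ ⁻¹' {k} = ({x | czBad μ c f σ k (c k x)} ∩ ⋂ j ∈ Finset.range k, {x | czBad μ c f σ j (c j x)}ᶜ)
      ∪ ((czB μ c f σ)ᶜ ∩ {_x | k = 0}) := by
    ext x
    simp only [mem_preimage, mem_singleton_iff, mem_union, mem_inter_iff, mem_iInter, mem_compl_iff, mem_ofPred_eq,
      Finset.mem_range]
    constructor
    · rintro rfl
      by_cases hx : x ∈ czB μ c f σ
      · exact Or.inl ⟨cz_tau_bad hx, fun j hj => cz_tau_lt hj⟩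
      · refine Or.inr ⟨hx, ?_⟩
        have : {k | czBad μ c f σ k (c k x)} = ∅ := by
          ext k; simp only [mem_ofPred_eq, mem_empty_iff_false, iff_false]
          intro h; exact hx ⟨k, h⟩
        rw [cztau, this, Nat.sInf_empty]
    · rintro (⟨h1, h2⟩ | ⟨h1, rfl⟩)
      · apply le_antisymm
        · exact Nat.sInf_le h1
        · by_contra hlt
          push Not at hlt
          exact h2 _ hlt (cz_tau_bad ⟨k, h1⟩)
      · have : {k | czBad μ c f σ k (c k x)} = ∅ := by
          ext k; simp only [mem_ofPred_eq, mem_empty_iff_false, iff_false]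
          intro h; exact h1 ⟨k, h⟩
        rw [cztau, this, Nat.sInf_empty]
  rw [this]
  exact ((h1 k).inter (Finset.measurableSet_biInter _ fun j _ => (h1 j).compl)).union
    ((cz_meas_B hcm).compl.inter (MeasurableSet.const _))

lemma cz_meas_P (hcm : ∀ k i, MeasurableSet (c k ⁻¹' {i})) (j : ℕ × ι) : MeasurableSet (czP μ c f σ j) := by
  have : czP μ c f σ j = czB μ c f σ ∩ (cztau μ c f σ ⁻¹' {j.1} ∩ c j.1 ⁻¹' {j.2}) := by
    rfl
  rw [this]
  exact (cz_meas_B hcm).inter ((cz_meas_tau hcm (measurableSet_singleton _)).inter (hcm _ _))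

lemma cz_meas_g (hcm : ∀ k i, MeasurableSet (c k ⁻¹' {i})) (hf : Measurable f) : Measurable (czg μ c f σ) := by
  unfold czg
  refine Measurable.ite (cz_meas_B hcm) ?_ hf
  refine Measurable.ite (cz_meas_tau hcm (measurableSet_singleton _)) measurable_const ?_
  letI : MeasurableSpace ι := ⊤
  have hck : ∀ k, Measurable (c k) := fun k => measurable_to_countable' (hcm k)
  have h : Measurable fun p : ℕ × X => czav μ c f p.1 (c p.1 p.2) := by
    apply measurable_from_prod_countable_right
    intro k
    exact (measurable_from_top (f := czav μ c f k)).comp (hck k)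
  exact h.comp (g := fun p : ℕ × X => czav μ c f p.1 (c p.1 p.2)) (f := fun x => (cztau μ c f σ x, x)) ((cz_meas_tau hcm).prodMk measurable_id)

end meas

lemma czav_mul {k : ℕ} {i : ι} (h0 : μ (c k ⁻¹' {i}) ≠ 0) (ht : μ (c k ⁻¹' {i}) ≠ ⊤) :
    ‖czav μ c f k i‖ₑ * μ (c k ⁻¹' {i}) ≤ czV μ c f k i := by
  unfold czav czV
  rw [enorm_smul, mul_right_comm]
  have : ‖((μ (c k ⁻¹' {i})).toReal⁻¹ : ℝ)‖ₑ * μ (c k ⁻¹' {i}) = 1 := by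
    rw [enorm_inv (by rw [ENNReal.toReal_ne_zero]; exact ⟨h0, ht⟩), Real.enorm_eq_ofReal ENNReal.toReal_nonneg,
      ENNReal.ofReal_toReal ht, ENNReal.inv_mul_cancel h0 ht]
  rw [this, one_mul]
  exact enorm_integral_le_lintegral_enorm _

lemma cz_g_on {j : ℕ × ι} {x : X} (hx : x ∈ czP μ c f σ j) :
    czg μ c f σ x = if j.1 = 0 then 0 else czav μ c f j.1 j.2 := by
  obtain ⟨h1, h2, h3⟩ := hx
  unfold czg
  rw [if_pos h1, h2, h3]

section bounds
variable [Countable ι]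

lemma cz_g_cell (hcm : ∀ k i, MeasurableSet (c k ⁻¹' {i}))
  (hnest : ∀ k x y, c (k+1) x = c (k+1) y → c k x = c k y)
  (hpos : ∀ k x, μ (c k ⁻¹' {c k x}) ≠ 0) (hfin : ∀ k x, μ (c k ⁻¹' {c k x}) ≠ ⊤) (j : ℕ × ι) :
    ∫⁻ y in czP μ c f σ j, ‖czg μ c f σ y‖ₑ ∂μ ≤ ∫⁻ y in czP μ c f σ j, ‖f y‖ₑ ∂μ := by
  rcases (czP μ c f σ j).eq_empty_or_nonempty with h | ⟨x, hx⟩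
  · rw [h]; simp
  · have h1 : ∫⁻ y in czP μ c f σ j, ‖czg μ c f σ y‖ₑ ∂μ =
        ∫⁻ y in czP μ c f σ j, ‖(if j.1 = 0 then 0 else czav μ c f j.1 j.2)‖ₑ ∂μ := by
      apply setLIntegral_congr_fun (cz_meas_P hcm j)
      intro y hy
      simp only
      rw [cz_g_on hy]
    rw [h1]
    split_ifs with h0
    · simp
    · rw [setLIntegral_const, cz_P_eq hnest hx]
      have h3 := hx.2.2
      have := hpos j.1 x
      have h4 := hfin j.1 x
      rw [h3] at this h4
      exact czav_mul this h4

lemma cz_g_L1 (hcm : ∀ k i, MeasurableSet (c k ⁻¹' {i}))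
  (hnest : ∀ k x y, c (k+1) x = c (k+1) y → c k x = c k y)
  (hpos : ∀ k x, μ (c k ⁻¹' {c k x}) ≠ 0) (hfin : ∀ k x, μ (c k ⁻¹' {c k x}) ≠ ⊤) : ∫⁻ y, ‖czg μ c f σ y‖ₑ ∂μ ≤ ∫⁻ y, ‖f y‖ₑ ∂μ := by
  have hB := cz_meas_B (μ := μ) (f := f) (σ := σ) hcm
  rw [← lintegral_add_compl _ hB, ← lintegral_add_compl (fun y => ‖f y‖ₑ) hB]
  apply add_le_add
  · rw [← cz_union, lintegral_iUnion (cz_meas_P hcm) cz_disj, lintegral_iUnion (cz_meas_P hcm) cz_disj]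
    exact ENNReal.tsum_le_tsum fun j => cz_g_cell hcm hnest hpos hfin j
  · apply le_of_eq
    apply setLIntegral_congr_fun hB.compl
    intro y hy
    simp only [czg]
    rw [if_neg hy]

lemma cz_g_bdd (hcm : ∀ k i, MeasurableSet (c k ⁻¹' {i}))
  (hnest : ∀ k x y, c (k+1) x = c (k+1) y → c k x = c k y)
  (hpos : ∀ k x, μ (c k ⁻¹' {c k x}) ≠ 0) (hfin : ∀ k x, μ (c k ⁻¹' {c k x}) ≠ ⊤) {D : ℝ≥0∞} (hD1 : 1 ≤ D)
    (hdbl : ∀ k x, μ (c k ⁻¹' {c k x}) ≤ D * μ (c (k+1) ⁻¹' {c (k+1) x}))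
    (hLeb : ∀ x, (∀ k, ¬ czBad μ c f σ k (c k x)) → ‖f x‖ₑ ≤ σ) (x : X) :
    ‖czg μ c f σ x‖ₑ ≤ D * σ := by
  by_cases hx : x ∈ czB μ c f σ
  · have hx' : x ∈ czP μ c f σ (cztau μ c f σ x, c (cztau μ c f σ x) x) := ⟨hx, rfl, rfl⟩
    rw [cz_g_on hx']
    simp only
    split_ifs with h0
    · simp
    · obtain ⟨k, hk⟩ := Nat.exists_eq_succ_of_ne_zero h0
      rw [Nat.succ_eq_add_one] at hk
      have h1 := czav_mul (f := f) (hpos (k+1) x) (hfin (k+1) x)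
      have h2 : czV μ c f (k+1) (c (k+1) x) ≤ czV μ c f k (c k x) := by
        apply lintegral_mono_set
        intro y hy
        exact hnest k y x hy
      have h3 : czV μ c f k (c k x) ≤ σ * μ (c k ⁻¹' {c k x}) := by
        have := cz_tau_lt (μ := μ) (c := c) (f := f) (σ := σ) (x := x) (k := k) (by omega)
        unfold czBad at this
        push Not at this
        exact this
      have h4 : ‖czav μ c f (k+1) (c (k+1) x)‖ₑ * μ (c (k+1) ⁻¹' {c (k+1) x}) ≤
          (D * σ) * μ (c (k+1) ⁻¹' {c (k+1) x}) := by
        calc _ ≤ _ := h1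
          _ ≤ _ := h2
          _ ≤ _ := h3
          _ ≤ σ * (D * μ (c (k+1) ⁻¹' {c (k+1) x})) := by gcongr; exact hdbl k x
          _ = _ := by ring
      rw [hk]
      exact (ENNReal.mul_le_mul_iff_left (hpos (k+1) x) (hfin (k+1) x)).1 h4
  · unfold czg
    rw [if_neg hx]
    refine (hLeb x fun k hk => hx ⟨k, hk⟩).trans ?_
    calc σ = 1 * σ := (one_mul _).symm
      _ ≤ D * σ := by gcongr

end bounds

lemma cz_b_cell [Countable ι] (hcm : ∀ k i, MeasurableSet (c k ⁻¹' {i}))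
    (hnest : ∀ k x y, c (k+1) x = c (k+1) y → c k x = c k y)
    (hpos : ∀ k x, μ (c k ⁻¹' {c k x}) ≠ 0) (hfin : ∀ k x, μ (c k ⁻¹' {c k x}) ≠ ⊤)
    (hfi : Integrable f μ) {j : ℕ × ι} (hj : j.1 ≠ 0) :
    ∫ y in czP μ c f σ j, (f y - czg μ c f σ y) ∂μ = 0 := by
  rcases (czP μ c f σ j).eq_empty_or_nonempty with h | ⟨x, hx⟩
  · rw [h]; simp
  have h3 := hx.2.2
  have h0 := hpos j.1 x
  have ht := hfin j.1 x
  rw [h3] at h0 ht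
  have h1 : ∫ y in czP μ c f σ j, (f y - czg μ c f σ y) ∂μ =
      ∫ y in czP μ c f σ j, (f y - czav μ c f j.1 j.2) ∂μ := by
    apply setIntegral_congr_fun (cz_meas_P hcm j)
    intro y hy
    simp only
    rw [cz_g_on hy, if_neg hj]
  rw [h1, cz_P_eq hnest hx, integral_sub hfi.integrableOn (by
    have : IsFiniteMeasure (μ.restrict (c j.1 ⁻¹' {j.2})) := ⟨by simpa using ht.lt_top⟩
    exact integrable_const _), setIntegral_const]
  unfold czav
  rw [Measure.real, smul_smul, mul_inv_cancel₀ (by rw [ENNReal.toReal_ne_zero]; exact ⟨h0, ht⟩), one_smul, sub_self]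

lemma cz_star_le [Countable ι]
    (hcm : ∀ k i, MeasurableSet (c k ⁻¹' {i}))
    (hnest : ∀ k x y, c (k+1) x = c (k+1) y → c k x = c k y)
    {S : ℕ → ι → Set X} {D : ℝ≥0∞}
    (hS : ∀ k x, μ (S k (c k x)) ≤ D * μ (c k ⁻¹' {c k x})) :
    σ * μ (⋃ j : {j // (czP μ c f σ j).Nonempty}, S j.1.1 j.1.2) ≤ D * ∫⁻ y, ‖f y‖ₑ ∂μ := by
  calc σ * μ (⋃ j : {j // (czP μ c f σ j).Nonempty}, S j.1.1 j.1.2)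
      ≤ σ * ∑' j : {j // (czP μ c f σ j).Nonempty}, μ (S j.1.1 j.1.2) := by
        gcongr; exact measure_iUnion_le _
    _ = ∑' j : {j // (czP μ c f σ j).Nonempty}, σ * μ (S j.1.1 j.1.2) := ENNReal.tsum_mul_left.symm
    _ ≤ ∑' j : {j // (czP μ c f σ j).Nonempty}, D * ∫⁻ y in czP μ c f σ j, ‖f y‖ₑ ∂μ := by
        apply ENNReal.tsum_le_tsum
        rintro ⟨j, x, hx⟩
        have h3 := hx.2.2
        have h1 := hS j.1 x
        rw [h3] at h1
        have h2 := cz_tau_bad hx.1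
        rw [hx.2.1, h3] at h2
        calc σ * μ (S j.1 j.2) ≤ σ * (D * μ (c j.1 ⁻¹' {j.2})) := by gcongr
          _ = D * (σ * μ (c j.1 ⁻¹' {j.2})) := by ring
          _ ≤ D * czV μ c f j.1 j.2 := by gcongr; exact h2.le
          _ = _ := by rw [cz_P_eq hnest hx, czV]
    _ = D * ∑' j : {j // (czP μ c f σ j).Nonempty}, ∫⁻ y in czP μ c f σ j, ‖f y‖ₑ ∂μ := ENNReal.tsum_mul_left
    _ ≤ D * ∑' j, ∫⁻ y in czP μ c f σ j, ‖f y‖ₑ ∂μ := by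
        gcongr
        exact ENNReal.tsum_comp_le_tsum_of_injective Subtype.val_injective (fun j => ∫⁻ y in czP μ c f σ j, ‖f y‖ₑ ∂μ)
    _ ≤ _ := by
        gcongr
        rw [← lintegral_iUnion (cz_meas_P hcm) cz_disj]
        exact setLIntegral_le_lintegral _ _

open Classical in
/-- reference kernel on a cell -/
def czK (μ : Measure X) (c : ℕ → X → ι) (f : X → ℂ) (σ : ℝ≥0∞) (K : X → X → ℂ) (j : ℕ × ι) (x : X) : ℂ :=
  if h : (czP μ c f σ j).Nonempty ∧ j.1 ≠ 0 then K x h.1.some else 0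

lemma czK_meas {K : X → X → ℂ} (hK : Measurable (Function.uncurry K)) (j : ℕ × ι) :
    Measurable (czK μ c f σ K j) := by
  unfold czK
  split_ifs with h
  · exact hK.comp (measurable_id.prodMk measurable_const)
  · exact measurable_const

/-- The bad part estimate. -/
lemma cz_bad_part [SFinite μ] [Countable ι]
    (hcm : ∀ k i, MeasurableSet (c k ⁻¹' {i}))
    (hnest : ∀ k x y, c (k+1) x = c (k+1) y → c k x = c k y)
    (hpos : ∀ k x, μ (c k ⁻¹' {c k x}) ≠ 0) (hfin : ∀ k x, μ (c k ⁻¹' {c k x}) ≠ ⊤)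
    {S : ℕ → ι → Set X} (hSm : ∀ k i, MeasurableSet (S k i))
    {K : X → X → ℂ} (hK : Measurable (Function.uncurry K)) (hKb : ∀ x, ∃ M : ℝ, ∀ y, ‖K x y‖ ≤ M)
    (hf : Measurable f) (hfi : Integrable f μ) {C1 : ℝ≥0∞}
    (hH : ∀ k y y0, c (k+1) y = c (k+1) y0 →
      ∫⁻ x in (S (k+1) (c (k+1) y))ᶜ, ‖K x y - K x y0‖ₑ ∂μ ≤ C1)
    (hH0 : ∀ y, ∫⁻ x in (S 0 (c 0 y))ᶜ, ‖K x y‖ₑ ∂μ ≤ C1) :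
    ∫⁻ x in (⋃ j : {j // (czP μ c f σ j).Nonempty}, S j.1.1 j.1.2)ᶜ,
      ‖∫ y, K x y * (f y - czg μ c f σ y) ∂μ‖ₑ ∂μ ≤ 2 * C1 * ∫⁻ y, ‖f y‖ₑ ∂μ := by
  set E := (⋃ j : {j // (czP μ c f σ j).Nonempty}, S j.1.1 j.1.2) with hE
  set b : X → ℂ := fun y => f y - czg μ c f σ y with hb
  have hgm : Measurable (czg μ c f σ) := cz_meas_g hcm hf
  have hbm : Measurable b := hf.sub hgm
  have hgi : Integrable (czg μ c f σ) μ := by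
    refine ⟨hgm.aestronglyMeasurable, ?_⟩
    exact (cz_g_L1 hcm hnest hpos hfin).trans_lt hfi.2
  have hbi : Integrable b μ := hfi.sub hgi
  have hPm := cz_meas_P (μ := μ) (f := f) (σ := σ) hcm
  have hKx : ∀ x, Measurable (K x) := fun x => hK.comp (measurable_const.prodMk measurable_id)
  have key : ∀ x, ‖∫ y, K x y * b y ∂μ‖ₑ ≤
      ∑' j, ∫⁻ y in czP μ c f σ j, ‖K x y - czK μ c f σ K j x‖ₑ * ‖b y‖ₑ ∂μ := by
    intro x
    obtain ⟨M, hM⟩ := hKb x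
    have hint : Integrable (fun y => K x y * b y) μ :=
      hbi.bdd_mul (c := M) (hKx x).aestronglyMeasurable (Eventually.of_forall hM)
    have h1 : ∫ y, K x y * b y ∂μ = ∑' j, ∫ y in czP μ c f σ j, K x y * b y ∂μ := by
      rw [← integral_iUnion hPm cz_disj hint.integrableOn, cz_union]
      symm
      apply setIntegral_eq_integral_of_forall_compl_eq_zero
      intro y hy
      simp only [hb, czg]
      rw [if_neg hy, sub_self, mul_zero]
    rw [h1]
    refine enorm_tsum_le_tsum_enorm.trans ?_
    apply ENNReal.tsum_le_tsum
    intro j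
    have h2 : ∫ y in czP μ c f σ j, K x y * b y ∂μ =
        ∫ y in czP μ c f σ j, (K x y - czK μ c f σ K j x) * b y ∂μ := by
      unfold czK
      split_ifs with h
      · have : ∀ y, (K x y - K x h.1.some) * b y = K x y * b y - K x h.1.some * b y := fun y => by ring
        simp only [this]
        rw [integral_sub hint.integrableOn (hbi.const_mul _).integrableOn, integral_const_mul,
          cz_b_cell hcm hnest hpos hfin hfi h.2]
        simp
      · simp
    rw [h2]
    refine (enorm_integral_le_lintegral_enorm _).trans ?_
    simp only [enorm_mul]
    exact le_rfl
  have hEs : ∀ j, (czP μ c f σ j).Nonempty → S j.1 j.2 ⊆ E := fun j hj =>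
    subset_iUnion (fun j : {j // (czP μ c f σ j).Nonempty} => S j.1.1 j.1.2) ⟨j, hj⟩
  have hjm : ∀ j, Measurable (fun p : X × X => ‖K p.1 p.2 - czK μ c f σ K j p.1‖ₑ * ‖b p.2‖ₑ) := fun j =>
    (hK.sub ((czK_meas hK j).comp measurable_fst)).enorm.mul (hbm.comp measurable_snd).enorm
  calc ∫⁻ x in Eᶜ, ‖∫ y, K x y * b y ∂μ‖ₑ ∂μ
      ≤ ∫⁻ x in Eᶜ, ∑' j, ∫⁻ y in czP μ c f σ j, ‖K x y - czK μ c f σ K j x‖ₑ * ‖b y‖ₑ ∂μ ∂μ :=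
        lintegral_mono fun x => key x
    _ = ∑' j, ∫⁻ x in Eᶜ, ∫⁻ y in czP μ c f σ j, ‖K x y - czK μ c f σ K j x‖ₑ * ‖b y‖ₑ ∂μ ∂μ := by
        apply lintegral_tsum
        intro j
        exact (Measurable.lintegral_prod_right (hjm j)).aemeasurable
    _ = ∑' j, ∫⁻ y in czP μ c f σ j, ∫⁻ x in Eᶜ, ‖K x y - czK μ c f σ K j x‖ₑ * ‖b y‖ₑ ∂μ ∂μ := by
        congr 1; ext j
        exact lintegral_lintegral_swap (hjm j).aemeasurable
    _ ≤ ∑' j, ∫⁻ y in czP μ c f σ j, C1 * ‖b y‖ₑ ∂μ := by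
        apply ENNReal.tsum_le_tsum
        intro j
        apply setLIntegral_mono' (hPm j)
        intro y hy
        rw [lintegral_mul_const _ (by
          exact (hK.comp (measurable_id.prodMk measurable_const)).sub (czK_meas hK j) |>.enorm)]
        gcongr
        refine (lintegral_mono_set (compl_subset_compl.2 (hEs j ⟨y, hy⟩))).trans ?_
        have hyj : c j.1 y = j.2 := hy.2.2
        unfold czK
        rcases Nat.eq_zero_or_pos j.1 with h0 | h0
        · simp only [dif_neg (show ¬ ((czP μ c f σ j).Nonempty ∧ j.1 ≠ 0) from fun h => h.2 h0)]
          rw [← hyj, h0]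
          simpa using hH0 y
        · have hne : (czP μ c f σ j).Nonempty ∧ j.1 ≠ 0 := ⟨⟨y, hy⟩, h0.ne'⟩
          simp only [dif_pos hne]
          rw [← hyj]
          have h5 : c j.1 hne.1.some = j.2 := hne.1.some_mem.2.2
          obtain ⟨k, hk⟩ := Nat.exists_eq_succ_of_ne_zero h0.ne'
          rw [Nat.succ_eq_add_one] at hk
          generalize hne.1.some = y0 at h5 ⊢
          rw [← hyj] at h5
          rw [hk] at h5 ⊢
          exact hH k y y0 h5.symm
    _ = C1 * ∑' j, ∫⁻ y in czP μ c f σ j, ‖b y‖ₑ ∂μ := by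
        rw [← ENNReal.tsum_mul_left]
        congr 1; ext j
        rw [lintegral_const_mul _ hbm.enorm]
    _ ≤ C1 * ∫⁻ y, ‖b y‖ₑ ∂μ := by
        gcongr
        rw [← lintegral_iUnion hPm cz_disj]
        exact setLIntegral_le_lintegral _ _
    _ ≤ C1 * (∫⁻ y, ‖f y‖ₑ ∂μ + ∫⁻ y, ‖czg μ c f σ y‖ₑ ∂μ) := by
        gcongr
        rw [← lintegral_add_left hf.enorm]
        exact lintegral_mono fun y => enorm_sub_le
    _ ≤ C1 * (∫⁻ y, ‖f y‖ₑ ∂μ + ∫⁻ y, ‖f y‖ₑ ∂μ) := by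
        exact mul_le_mul_right (add_le_add_right (cz_g_L1 hcm hnest hpos hfin) _) _
    _ = _ := by ring

/-- Abstract Calderón–Zygmund theorem. -/
theorem cz_main [SFinite μ] [Countable ι]
    (hcm : ∀ k i, MeasurableSet (c k ⁻¹' {i}))
    (hnest : ∀ k x y, c (k+1) x = c (k+1) y → c k x = c k y)
    (hpos : ∀ k x, μ (c k ⁻¹' {c k x}) ≠ 0) (hfin : ∀ k x, μ (c k ⁻¹' {c k x}) ≠ ⊤)
    {D : ℝ≥0∞} (hD1 : 1 ≤ D) (hDt : D ≠ ⊤)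
    (hdbl : ∀ k x, μ (c k ⁻¹' {c k x}) ≤ D * μ (c (k+1) ⁻¹' {c (k+1) x}))
    {S : ℕ → ι → Set X} (hSm : ∀ k i, MeasurableSet (S k i))
    (hS : ∀ k x, μ (S k (c k x)) ≤ D * μ (c k ⁻¹' {c k x}))
    {K : X → X → ℂ} (hK : Measurable (Function.uncurry K)) (hKb : ∀ x, ∃ M : ℝ, ∀ y, ‖K x y‖ ≤ M)
    (hf : Measurable f) (hfi : Integrable f μ) {C1 C2 : ℝ≥0∞}
    {F0 : Set ι} (hF : ∀ x, c 0 x ∉ F0 → f x = 0)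
    (hL2 : ∀ g : X → ℂ, Measurable g → (∃ M : ℝ, ∀ x, ‖g x‖ ≤ M) → (∀ x, c 0 x ∉ F0 → g x = 0) →
      Integrable g μ →
      ∫⁻ x, ‖∫ y, K x y * g y ∂μ‖ₑ ^ 2 ∂μ ≤ C2 * ∫⁻ x, ‖g x‖ₑ ^ 2 ∂μ)
    (hH : ∀ k y y0, c (k+1) y = c (k+1) y0 →
      ∫⁻ x in (S (k+1) (c (k+1) y))ᶜ, ‖K x y - K x y0‖ₑ ∂μ ≤ C1)
    (hH0 : ∀ y, ∫⁻ x in (S 0 (c 0 y))ᶜ, ‖K x y‖ₑ ∂μ ≤ C1)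
    (hσt : σ ≠ ⊤)
    (hLeb : ∀ x, (∀ k, ∫⁻ y in c k ⁻¹' {c k x}, ‖f y‖ₑ ∂μ ≤ σ * μ (c k ⁻¹' {c k x})) → ‖f x‖ₑ ≤ σ) :
    σ * μ {x | σ < ‖∫ y, K x y * f y ∂μ‖ₑ} ≤ (4 * C2 * D + 4 * C1 + D) * ∫⁻ y, ‖f y‖ₑ ∂μ := by
  rcases eq_or_ne σ 0 with h0 | hσ0
  · rw [h0, zero_mul]; simp
  set E := (⋃ j : {j // (czP μ c f σ j).Nonempty}, S j.1.1 j.1.2) with hE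
  have hEm : MeasurableSet E := MeasurableSet.iUnion fun j => hSm _ _
  set g := czg μ c f σ with hg
  have hgm : Measurable g := cz_meas_g hcm hf
  have hgL := cz_g_L1 (f := f) (σ := σ) hcm hnest hpos hfin
  have hgi : Integrable g μ := ⟨hgm.aestronglyMeasurable, hgL.trans_lt hfi.2⟩
  have hLeb' : ∀ x, (∀ k, ¬ czBad μ c f σ k (c k x)) → ‖f x‖ₑ ≤ σ := fun x h => hLeb x fun k => by
    have := h k
    unfold czBad czV at this
    push Not at this
    exact this
  have hgb := cz_g_bdd hcm hnest hpos hfin hD1 hdbl hLeb'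
  have hDσ : D * σ ≠ ⊤ := ENNReal.mul_ne_top hDt hσt
  have hgM : ∃ M : ℝ, ∀ x, ‖g x‖ ≤ M := ⟨(D * σ).toReal, fun x => by
    have := ENNReal.toReal_mono hDσ (hgb x)
    simpa using this⟩
  have hgF : ∀ x, c 0 x ∉ F0 → g x = 0 := by
    intro x hx
    by_cases hxB : x ∈ czB μ c f σ
    · have hx' : x ∈ czP μ c f σ (cztau μ c f σ x, c (cztau μ c f σ x) x) := ⟨hxB, rfl, rfl⟩
      rw [hg, cz_g_on hx']
      simp only
      split_ifs with h0
      · rfl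
      · unfold czav
        have : ∫ y in c (cztau μ c f σ x) ⁻¹' {c (cztau μ c f σ x) x}, f y ∂μ = 0 := by
          rw [setIntegral_eq_zero_of_forall_eq_zero]
          intro y hy
          apply hF
          rw [cz_nest hnest (Nat.zero_le _) (show c (cztau μ c f σ x) y = c (cztau μ c f σ x) x from hy)]
          exact hx
        rw [this, smul_zero]
    · rw [hg, czg, if_neg hxB, hF x hx]
  have hL := hL2 g hgm hgM hgF hgi
  have hKx : ∀ x, Measurable (K x) := fun x => hK.comp (measurable_const.prodMk measurable_id)
  have hTm : ∀ u : X → ℂ, Measurable u → Measurable fun x => ∫ y, K x y * u y ∂μ := by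
    intro u hu
    have h1 : Measurable (fun p : X × X => K p.1 p.2 * u p.2) := hK.mul (hu.comp measurable_snd)
    exact h1.stronglyMeasurable.integral_prod_right.measurable
  have hbad := cz_bad_part (σ := σ) hcm hnest hpos hfin hSm hK hKb hf hfi hH hH0
  have hstar := cz_star_le (f := f) (σ := σ) hcm hnest hS
  set A1 := {x | σ / 2 ≤ ‖∫ y, K x y * g y ∂μ‖ₑ} with hA1
  set A2 := {x | x ∈ Eᶜ ∧ σ / 2 ≤ ‖∫ y, K x y * (f y - g y) ∂μ‖ₑ} with hA2
  have hsub : {x | σ < ‖∫ y, K x y * f y ∂μ‖ₑ} ⊆ A1 ∪ E ∪ A2 := by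
    intro x hx
    have hx : σ < ‖∫ y, K x y * f y ∂μ‖ₑ := hx
    by_contra hcon
    simp only [mem_union, not_or] at hcon
    obtain ⟨⟨h1, h2⟩, h3⟩ := hcon
    have h1 : ¬ (σ / 2 ≤ ‖∫ y, K x y * g y ∂μ‖ₑ) := h1
    have h3 : ¬ (σ / 2 ≤ ‖∫ y, K x y * (f y - g y) ∂μ‖ₑ) := fun h => h3 ⟨h2, h⟩
    push Not at h1 h3
    obtain ⟨M, hM⟩ := hKb x
    have e1 : Integrable (fun y => K x y * g y) μ :=
      hgi.bdd_mul (c := M) (hKx x).aestronglyMeasurable (Eventually.of_forall hM)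
    have e2 : Integrable (fun y => K x y * (f y - g y)) μ :=
      (hfi.sub hgi).bdd_mul (c := M) (hKx x).aestronglyMeasurable (Eventually.of_forall hM)
    have : ∫ y, K x y * f y ∂μ = ∫ y, K x y * g y ∂μ + ∫ y, K x y * (f y - g y) ∂μ := by
      rw [← integral_add e1 e2]; congr 1; ext y; ring
    rw [this] at hx
    have := hx.trans_le (enorm_add_le _ _)
    refine absurd this (not_lt.2 ?_)
    calc _ ≤ σ / 2 + σ / 2 := add_le_add h1.le h3.le
      _ = σ := ENNReal.add_halves σ
  have hh0 : σ / 2 ≠ 0 := by simp [hσ0]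
  have hht : σ / 2 ≠ ⊤ := by simp [ENNReal.div_eq_top, hσt]
  have b1 : σ * μ A1 ≤ 4 * C2 * D * ∫⁻ y, ‖f y‖ₑ ∂μ := by
    have m1 : (σ / 2) ^ 2 * μ A1 ≤ ∫⁻ x, ‖∫ y, K x y * g y ∂μ‖ₑ ^ 2 ∂μ := by
      refine le_trans ?_ (mul_meas_ge_le_lintegral₀ ((hTm g hgm).enorm.pow_const 2).aemeasurable ((σ / 2) ^ 2))
      gcongr
      intro x hx
      have hx : σ / 2 ≤ ‖∫ y, K x y * g y ∂μ‖ₑ := hx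
      show (σ / 2) ^ 2 ≤ ‖∫ y, K x y * g y ∂μ‖ₑ ^ 2
      gcongr
    have m2 : ∫⁻ x, ‖g x‖ₑ ^ 2 ∂μ ≤ D * σ * ∫⁻ y, ‖f y‖ₑ ∂μ := by
      calc _ ≤ ∫⁻ x, D * σ * ‖g x‖ₑ ∂μ := by
            apply lintegral_mono; intro x
            simp only
            rw [sq]; gcongr; exact hgb x
        _ = D * σ * ∫⁻ x, ‖g x‖ₑ ∂μ := lintegral_const_mul _ hgm.enorm
        _ ≤ _ := by gcongr
    have m3 : σ * (σ * μ A1) ≤ σ * (4 * C2 * D * ∫⁻ y, ‖f y‖ₑ ∂μ) := by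
      calc σ * (σ * μ A1) = 4 * ((σ / 2) ^ 2 * μ A1) := by
            have : σ = 2 * (σ / 2) := by rw [ENNReal.mul_div_cancel (by simp) (by simp)]
            conv_lhs => rw [this]
            ring
        _ ≤ 4 * (C2 * (D * σ * ∫⁻ y, ‖f y‖ₑ ∂μ)) := by
            exact mul_le_mul_right (m1.trans (hL.trans (mul_le_mul_right m2 _))) _
        _ = _ := by ring
    exact (ENNReal.mul_le_mul_iff_right hσ0 hσt).1 m3
  have b2 : σ * μ A2 ≤ 4 * C1 * ∫⁻ y, ‖f y‖ₑ ∂μ := by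
    have m1 : (σ / 2) * μ A2 ≤ ∫⁻ x in Eᶜ, ‖∫ y, K x y * (f y - g y) ∂μ‖ₑ ∂μ := by
      refine le_trans ?_ (mul_meas_ge_le_lintegral₀ ((hTm _ (hf.sub hgm)).enorm).aemeasurable (σ / 2))
      rw [Measure.restrict_apply' hEm.compl]
      gcongr
      intro x hx
      exact ⟨hx.2, hx.1⟩
    calc σ * μ A2 = 2 * ((σ / 2) * μ A2) := by
          rw [← mul_assoc, ENNReal.mul_div_cancel (by simp) (by simp)]
      _ ≤ 2 * (2 * C1 * ∫⁻ y, ‖f y‖ₑ ∂μ) := mul_le_mul_right (m1.trans hbad) _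
      _ = _ := by ring
  calc σ * μ {x | σ < ‖∫ y, K x y * f y ∂μ‖ₑ} ≤ σ * (μ A1 + μ E + μ A2) := by
        gcongr
        exact (measure_mono hsub).trans ((measure_union_le _ _).trans (by gcongr; exact measure_union_le _ _))
    _ = σ * μ A1 + σ * μ E + σ * μ A2 := by ring
    _ ≤ 4 * C2 * D * ∫⁻ y, ‖f y‖ₑ ∂μ + D * ∫⁻ y, ‖f y‖ₑ ∂μ + 4 * C1 * ∫⁻ y, ‖f y‖ₑ ∂μ := by gcongr
    _ = _ := by ring

end CZ

end GR

namespace GR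

/-! ### Part 9: kernel estimates for small time -/

section KE
open scoped ENNReal
variable {n : ℕ}

lemma lint_gauss {b : ℝ} (hb : 0 < b) (y : EE n) :
    ∫⁻ x : EE n, ENNReal.ofReal (Real.exp (-(b * ‖x - y‖ ^ 2))) = ENNReal.ofReal ((π / b) ^ NN n) := by
  rw [lintegral_sub_right_eq_self (fun x : EE n => ENNReal.ofReal (Real.exp (-(b * ‖x‖ ^ 2)))) y]
  have h := GaussianFourier.integral_rexp_neg_mul_sq_norm (V := EE n) hb
  have h2 : Integrable (fun x : EE n => Real.exp (-b * ‖x‖ ^ 2)) := by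
    by_contra hc
    rw [integral_undef hc] at h
    have : 0 < (π / b) ^ ((Module.finrank ℝ (EE n) : ℝ) / 2) := by positivity
    linarith
  have e : ∀ x : EE n, -(b * ‖x‖ ^ 2) = -b * ‖x‖ ^ 2 := fun x => by ring
  simp only [e]
  rw [← ofReal_integral_eq_lintegral_ofReal h2 (Eventually.of_forall fun x => (Real.exp_pos _).le), h]
  simp [NN]

lemma cau_form {w : ℝ} (hw : 0 < w) (z t : ℝ) : cau w (z / t) = w⁻¹ * (1 + ((w * t)⁻¹ * z) ^ 2)⁻¹ := by
  unfold cau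
  rw [← mul_inv, div_eq_mul_inv, ← inv_inv w, ← mul_inv, inv_inv w]
  congr 1
  have e : (w * t)⁻¹ * z = w⁻¹ * (z / t) := by rw [mul_inv, div_eq_mul_inv]; ring
  rw [e]
  field_simp

lemma lint_cau {w t : ℝ} (hw : 0 < w) (ht : 0 < t) (s : ℝ) :
    ∫⁻ z : ℝ, ENNReal.ofReal (cau w ((z - s) / t)) = ENNReal.ofReal (π * t) := by
  rw [lintegral_sub_right_eq_self (fun z : ℝ => ENNReal.ofReal (cau w (z / t))) s]
  simp only [cau_form hw]
  have hp : 0 < (w * t)⁻¹ := by positivity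
  rw [← ofReal_integral_eq_lintegral_ofReal ((integrable_cau hp).const_mul _)
    (Eventually.of_forall fun x => by positivity), integral_const_mul, integral_cau hp]
  congr 1
  field_simp

lemma measurable_cau : Measurable fun p : ℝ × ℝ => cau p.1 p.2 := by unfold cau; fun_prop

lemma lint_block {b w t : ℝ} (hb : 0 < b) (hw : 0 < w) (ht : 0 < t) (y : EE n) (s : ℝ) :
    ∫⁻ x : EE n × ℝ, ENNReal.ofReal (Real.exp (-(b * ‖x.1 - y‖ ^ 2)) * cau w ((x.2 - s) / t)) =
      ENNReal.ofReal ((π / b) ^ NN n * (π * t)) := by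
  have e : ∀ x : EE n × ℝ, ENNReal.ofReal (Real.exp (-(b * ‖x.1 - y‖ ^ 2)) * cau w ((x.2 - s) / t)) =
      ENNReal.ofReal (Real.exp (-(b * ‖x.1 - y‖ ^ 2))) * ENNReal.ofReal (cau w ((x.2 - s) / t)) :=
    fun x => ENNReal.ofReal_mul (Real.exp_pos _).le
  simp only [e]
  rw [Measure.volume_eq_prod, lintegral_prod_mul (f := fun x : EE n => ENNReal.ofReal (Real.exp (-(b * ‖x - y‖ ^ 2))))
    (g := fun z : ℝ => ENNReal.ofReal (cau w ((z - s) / t))) (by fun_prop) (by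
      apply Measurable.aemeasurable
      exact (measurable_cau.comp (g := fun p : ℝ × ℝ => cau p.1 p.2) (f := fun z : ℝ => (w, (z - s) / t)) (by fun_prop)).ennreal_ofReal),
    lint_gauss hb, lint_cau hw ht, ENNReal.ofReal_mul (p := (π / b) ^ NN n) (by positivity)]

lemma norm_scale {t : ℝ} (ht : 0 < t) (v : EE n) : ‖(√t)⁻¹ • v‖ ^ 2 = ‖v‖ ^ 2 / t := by
  rw [norm_smul, mul_pow, norm_inv, inv_pow, Real.norm_eq_abs, sq_abs, Real.sq_sqrt ht.le]
  field_simp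

lemma norm_scale' {t : ℝ} (v : EE n) : ‖(√t)⁻¹ • v‖ = ‖v‖ / √t := by
  rw [norm_smul, norm_inv, Real.norm_eq_abs, abs_of_nonneg (Real.sqrt_nonneg _)]
  ring

lemma GG_scale {t : ℝ} (ht : 0 < t) (x y : EE n) (z : ℝ) :
    GG ((√t)⁻¹ • x) ((√t)⁻¹ • y) z = Real.exp (-(1 / (16 * t) * ‖x - y‖ ^ 2)) * cau (1 + ‖y‖ / √t) z := by
  unfold GG
  rw [← smul_sub, norm_scale ht, norm_scale']
  congr 3
  field_simp

lemma rr_small (hn : 1 ≤ n) (κ : Kap n) {a : EE n} {t : ℝ} (ht : 0 < t) (hat : ‖√t • a‖ ≤ 1) (x y : EE n) (z : ℝ) :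
    ‖rr κ a t x y z‖ ≤ t ^ (-NN n - 3 / 2) * C1 n *
      (Real.exp (-(1 / (16 * t) * ‖x - y‖ ^ 2)) * cau (1 + ‖y‖ / √t) (z / t)) := by
  unfold rr
  have hp : 0 ≤ t ^ (-NN n - 3 / 2) := (Real.rpow_pos_of_pos ht _).le
  rw [norm_mul, Complex.norm_real, Real.norm_of_nonneg hp, mul_assoc]
  apply mul_le_mul_of_nonneg_left _ hp
  have := rho_small hn κ (√t • a) ((√t)⁻¹ • x) ((√t)⁻¹ • y) (z / t) hat
  rwa [GG_scale ht] at this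

lemma norm_sqrt_smul_le {a : EE n} (ha : ‖a‖ = 1) {t : ℝ} (ht1 : t ≤ 1) : ‖√t • a‖ ≤ 1 := by
  rw [norm_smul, ha, mul_one, Real.norm_of_nonneg (Real.sqrt_nonneg _)]
  exact Real.sqrt_le_one.2 ht1

lemma aux_s {s t l D : ℝ} (hs : 0 < s) (h : s * s = t) : 2 * (s / l) * (D / t) = (2 * D / l) / s := by
  subst h; field_simp

lemma aux_s2 {s t c Y : ℝ} (hs : 0 < s) (h : s * s = t) : c * (t * ((s + Y) / s)) = c * (s + Y) * s := by
  subst h; field_simp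

lemma E1_pt {d w q Z : ℝ} (hd : 0 ≤ d) (hw : 0 < w) (hq : 0 < q)
    (h : 1 ≤ q * d ∨ w ≤ 2 * q * |Z|) :
    Real.exp (-(d ^ 2 / 16)) * cau w Z ≤ 8 * q * (Real.exp (-(d ^ 2 / 32)) * cau w Z +
      Real.exp (-(d ^ 2 / 32)) * cau (w / (2 * q)) Z) := by
  have hE := Real.exp_pos (-(d ^ 2 / 32))
  have hc1 := cau_nonneg hw.le Z
  have hc2 := cau_nonneg (w := w / (2 * q)) (by positivity) Z
  rcases h with h | h
  · have h1 : Real.exp (-(d ^ 2 / 16)) ≤ 8 * q * Real.exp (-(d ^ 2 / 32)) := by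
      have e1 : Real.exp (-(d ^ 2 / 16)) * Real.exp (d ^ 2 / 32) = Real.exp (-(d ^ 2 / 32)) := by
        rw [← Real.exp_add]; congr 1; ring
      have e2 : d ≤ 8 * Real.exp (d ^ 2 / 32) := by
        have := Real.add_one_le_exp (d ^ 2 / 32)
        nlinarith [sq_nonneg (d - 2)]
      rw [← e1]
      have e3 := Real.exp_pos (-(d ^ 2 / 16))
      have : 1 ≤ q * (8 * Real.exp (d ^ 2 / 32)) := h.trans (by gcongr)
      nlinarith
    calc _ ≤ 8 * q * Real.exp (-(d ^ 2 / 32)) * cau w Z := by gcongr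
      _ ≤ _ := by
        have : 0 ≤ 8 * q * (Real.exp (-(d ^ 2 / 32)) * cau (w / (2 * q)) Z) := by positivity
        nlinarith
  · have h1 : Real.exp (-(d ^ 2 / 16)) ≤ Real.exp (-(d ^ 2 / 32)) := by
      apply Real.exp_le_exp.2; nlinarith [sq_nonneg d]
    have hZ : 0 < |Z| := by
      by_contra hc
      have : |Z| = 0 := le_antisymm (not_lt.1 hc) (abs_nonneg _)
      rw [this] at h; linarith
    have hZ2 : 0 < Z ^ 2 := by rw [← sq_abs]; positivity
    have h2 : cau w Z ≤ 8 * q * cau (w / (2 * q)) Z := by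
      unfold cau
      have hW : (w / (2 * q)) ^ 2 ≤ Z ^ 2 := by
        rw [← sq_abs Z]
        apply pow_le_pow_left₀ (by positivity)
        rw [div_le_iff₀ (by positivity)]; linarith
      have e : 8 * q * (w / (2 * q) / ((w / (2 * q)) ^ 2 + Z ^ 2)) = 4 * w / ((w / (2 * q)) ^ 2 + Z ^ 2) := by
        field_simp; ring
      rw [e, div_le_div_iff₀ (by positivity) (by positivity)]
      nlinarith [sq_nonneg w]
    calc _ ≤ Real.exp (-(d ^ 2 / 32)) * (8 * q * cau (w / (2 * q)) Z) := by gcongr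
      _ ≤ _ := by
        have : 0 ≤ 8 * q * (Real.exp (-(d ^ 2 / 32)) * cau w Z) := by positivity
        nlinarith

def C5 (n : ℕ) : ℝ := C1 n * 16 * π * (32 * π) ^ NN n

set_option maxHeartbeats 800000 in
lemma E1 (hn : 1 ≤ n) (κ : Kap n) {a : EE n} (ha : ‖a‖ = 1) {t ℓ L : ℝ} (ht : 0 < t) (ht1 : t ≤ 1)
    (hℓ : 0 < ℓ) (htℓ : t ≤ ℓ ^ 2) (y : EE n × ℝ) (hL : ℓ * (ℓ + ‖y.1‖) ≤ 2 * L) {A : Set (EE n × ℝ)}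
    (hA : MeasurableSet A) (hAs : ∀ x ∈ A, ℓ ≤ ‖x.1 - y.1‖ ∨ L ≤ |x.2 - y.2|) :
    ∫⁻ x in A, ‖rr κ a t x.1 y.1 (x.2 - y.2)‖ₑ ≤ ENNReal.ofReal (C5 n / ℓ) := by
  have hst : 0 < √t := Real.sqrt_pos.2 ht
  have hss : √t * √t = t := Real.mul_self_sqrt ht.le
  have hsl : √t ≤ ℓ := by
    rw [Real.sqrt_le_left hℓ.le]; exact htℓ
  set q := √t / ℓ with hq
  have hq0 : 0 < q := by positivity
  set w := 1 + ‖y.1‖ / √t with hw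
  have hw0 : 0 < w := by positivity
  have hpt : ∀ x ∈ A, ‖rr κ a t x.1 y.1 (x.2 - y.2)‖ₑ ≤
      ENNReal.ofReal (t ^ (-NN n - 3 / 2) * C1 n * (8 * q)) *
      (ENNReal.ofReal (Real.exp (-(1 / (32 * t) * ‖x.1 - y.1‖ ^ 2)) * cau w ((x.2 - y.2) / t)) +
       ENNReal.ofReal (Real.exp (-(1 / (32 * t) * ‖x.1 - y.1‖ ^ 2)) * cau (w / (2 * q)) ((x.2 - y.2) / t))) := by
    intro x hx
    have h1 := rr_small hn κ ht (norm_sqrt_smul_le ha ht1) x.1 y.1 (x.2 - y.2)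
    have hc1 := cau_nonneg hw0.le ((x.2 - y.2) / t)
    have hc2 := cau_nonneg (w := w / (2 * q)) (by positivity) ((x.2 - y.2) / t)
    have hC1 := C1_pos hn
    rw [← ENNReal.ofReal_add (by positivity) (by positivity), ← ENNReal.ofReal_mul (by positivity),
      ← ofReal_norm]
    apply ENNReal.ofReal_le_ofReal
    refine h1.trans ?_
    rw [mul_assoc (t ^ (-NN n - 3 / 2) * C1 n)]
    apply mul_le_mul_of_nonneg_left _ (by positivity)
    have h2 := E1_pt (d := ‖x.1 - y.1‖ / √t) (w := w) (q := q) (Z := (x.2 - y.2) / t) (by positivity) hw0 hq0 (by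
      rcases hAs x hx with h | h
      · left
        rw [hq]; rw [div_mul_div_comm, mul_comm ℓ, mul_div_mul_left _ _ hst.ne', one_le_div hℓ]; exact h
      · right
        rw [abs_div, abs_of_pos ht, hw, hq]
        have : 1 + ‖y.1‖ / √t = (√t + ‖y.1‖) / √t := by field_simp
        rw [this]
        have e2 : 2 * (√t / ℓ) * (|x.2 - y.2| / t) = (2 * |x.2 - y.2| / ℓ) / √t := by
          exact aux_s hst hss
        rw [e2]
        gcongr
        rw [le_div_iff₀ hℓ]
        nlinarith [norm_nonneg y.1])
    have e1 : (‖x.1 - y.1‖ / √t) ^ 2 = ‖x.1 - y.1‖ ^ 2 / t := by rw [div_pow, Real.sq_sqrt ht.le]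
    rw [e1] at h2
    have e7 : 1 / (16 * t) * ‖x.1 - y.1‖ ^ 2 = ‖x.1 - y.1‖ ^ 2 / t / 16 := by field_simp
    have e8 : 1 / (32 * t) * ‖x.1 - y.1‖ ^ 2 = ‖x.1 - y.1‖ ^ 2 / t / 32 := by field_simp
    rw [e7, e8]
    exact h2
  have hm : ∀ w', Measurable fun x : EE n × ℝ => ENNReal.ofReal (Real.exp (-(1 / (32 * t) * ‖x.1 - y.1‖ ^ 2)) * cau w' ((x.2 - y.2) / t)) := by
    intro w'
    unfold cau; fun_prop
  refine (setLIntegral_mono' hA hpt).trans ((setLIntegral_le_lintegral _ _).trans (le_of_eq ?_))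
  have hfin : ∫⁻ x : EE n × ℝ, ENNReal.ofReal (t ^ (-NN n - 3 / 2) * C1 n * (8 * q)) *
      (ENNReal.ofReal (Real.exp (-(1 / (32 * t) * ‖x.1 - y.1‖ ^ 2)) * cau w ((x.2 - y.2) / t)) +
       ENNReal.ofReal (Real.exp (-(1 / (32 * t) * ‖x.1 - y.1‖ ^ 2)) * cau (w / (2 * q)) ((x.2 - y.2) / t)))
      = ENNReal.ofReal (C5 n / ℓ) := by
      have hC1 := C1_pos hn
      rw [lintegral_const_mul' _ _ ENNReal.ofReal_ne_top, lintegral_add_left (hm w), lint_block (by positivity) hw0 ht,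
        lint_block (by positivity) (by positivity) ht, ← ENNReal.ofReal_add (by positivity) (by positivity),
        ← ENNReal.ofReal_mul (by positivity)]
      congr 1
      have e1 : π / (1 / (32 * t)) = (32 * π) * t := by field_simp
      rw [e1, Real.mul_rpow (by positivity) ht.le]
      have e2 : t ^ (-NN n - 3 / 2) * t ^ NN n * t = (√t)⁻¹ := by
        rw [← Real.rpow_add ht, Real.sqrt_eq_rpow, ← Real.rpow_neg ht.le]
        nth_rewrite 2 [← Real.rpow_one t]
        rw [← Real.rpow_add ht]
        congr 1; ring
      have e3 : (√t)⁻¹ * √t = 1 := by field_simp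
      unfold C5
      rw [hq]
      calc _ = C1 n * 16 * π * (32 * π) ^ NN n * (t ^ (-NN n - 3 / 2) * t ^ NN n * t) * √t / ℓ := by ring
        _ = _ := by rw [e2]; field_simp
  exact hfin

def C6 (n : ℕ) : ℝ := C4 n * (5 * n) * π * (16 * π) ^ NN n

set_option maxHeartbeats 800000 in
/-- regularity estimate -/
lemma E2 (hn : 1 ≤ n) (κ : Kap n) {a : EE n} (ha : ‖a‖ = 1) {t ℓ : ℝ} (ht : 0 < t) (ht1 : t ≤ 1)
    (hℓ : 0 < ℓ) (htℓ : ℓ ^ 2 ≤ t) (y y0 : EE n × ℝ) (h1 : ‖y.1 - y0.1‖ ≤ n * ℓ)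
    (h2 : ∀ θ ∈ Ioc (0:ℝ) 1, |y.2 - y0.2| ≤ 4 * n * ℓ * (‖y0.1 + θ • (y.1 - y0.1)‖ + ℓ)) :
    ∫⁻ x : EE n × ℝ, ‖rr κ a t x.1 y.1 (x.2 - y.2) - rr κ a t x.1 y0.1 (x.2 - y0.2)‖ₑ ≤
      ENNReal.ofReal (C6 n * ℓ / t) := by
  have hst : 0 < √t := Real.sqrt_pos.2 ht
  have hss : √t * √t = t := Real.mul_self_sqrt ht.le
  have hsl : ℓ ≤ √t := Real.le_sqrt_of_sq_le htℓ
  have hC4 := C4_pos hn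
  have hn0 : (0:ℝ) < n := by exact_mod_cast hn
  set F : (EE n × ℝ) → ℝ → ℝ := fun x θ =>
    t ^ (-NN n - 3 / 2) * (C4 n * (5 * n * ℓ / √t)) * (Real.exp (-(1 / (16 * t) * ‖x.1 - (y0.1 + θ • (y.1 - y0.1))‖ ^ 2)) *
      cau (1 + ‖y0.1 + θ • (y.1 - y0.1)‖ / √t) ((x.2 - (y0.2 + θ * (y.2 - y0.2))) / t)) with hF
  have hFm : Measurable (Function.uncurry F) := by
    simp only [hF, Function.uncurry_def]
    unfold cau; fun_prop
  have hpt : ∀ x : EE n × ℝ, ‖rr κ a t x.1 y.1 (x.2 - y.2) - rr κ a t x.1 y0.1 (x.2 - y0.2)‖ₑ ≤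
      ∫⁻ θ in Ioc (0:ℝ) 1, ENNReal.ofReal (F x θ) := by
    intro x
    have hd := rho_diff hn κ (√t • a) ((√t)⁻¹ • x.1) ((√t)⁻¹ • y0.1) ((√t)⁻¹ • (y.1 - y0.1)) ((x.2 - y0.2) / t)
      (-((y.2 - y0.2) / t)) (norm_sqrt_smul_le ha ht1)
    have e1 : (√t)⁻¹ • y0.1 + (√t)⁻¹ • (y.1 - y0.1) = (√t)⁻¹ • y.1 := by
      rw [← smul_add]; congr 1; abel
    have e2 : (x.2 - y0.2) / t + -((y.2 - y0.2) / t) = (x.2 - y.2) / t := by ring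
    rw [e1, e2, intervalIntegral.integral_of_le zero_le_one] at hd
    have hp : 0 ≤ t ^ (-NN n - 3 / 2) := (Real.rpow_pos_of_pos ht _).le
    unfold rr
    rw [← mul_sub, enorm_mul, ← ofReal_norm, ← ofReal_norm, Complex.norm_real, Real.norm_of_nonneg hp,
      ← ENNReal.ofReal_mul hp]
    refine (ENNReal.ofReal_le_ofReal (mul_le_mul_of_nonneg_left hd hp)).trans ?_
    rw [← integral_const_mul]
    refine le_trans (Real.ofReal_le_enorm _) ((enorm_integral_le_lintegral_enorm _).trans ?_)
    apply setLIntegral_mono' measurableSet_Ioc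
    intro θ hθ
    have e3 : (√t)⁻¹ • y0.1 + θ • (√t)⁻¹ • (y.1 - y0.1) = (√t)⁻¹ • (y0.1 + θ • (y.1 - y0.1)) := by
      rw [smul_add, smul_comm]
    have e4 : (x.2 - y0.2) / t + θ * -((y.2 - y0.2) / t) = (x.2 - (y0.2 + θ * (y.2 - y0.2))) / t := by ring
    rw [e3, e4]
    set Y := y0.1 + θ • (y.1 - y0.1) with hY
    have hG := GG_nonneg ((√t)⁻¹ • x.1) ((√t)⁻¹ • Y) ((x.2 - (y0.2 + θ * (y.2 - y0.2))) / t)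
    rw [Real.enorm_of_nonneg (by positivity)]
    apply ENNReal.ofReal_le_ofReal
    rw [hF]
    simp only
    rw [← hY, ← GG_scale ht, mul_assoc, mul_assoc (C4 n)]
    apply mul_le_mul_of_nonneg_left _ hp
    apply mul_le_mul_of_nonneg_left _ hC4.le
    apply mul_le_mul_of_nonneg_right _ hG
    rw [norm_scale', norm_scale', abs_neg, abs_div, abs_of_pos ht]
    have b1 : ‖y.1 - y0.1‖ / √t ≤ n * ℓ / √t := by gcongr
    have b2 : |y.2 - y0.2| / t / (1 + ‖Y‖ / √t) ≤ 4 * n * ℓ / √t := by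
      have e5 : (1 + ‖Y‖ / √t) = (√t + ‖Y‖) / √t := by field_simp
      rw [e5, div_div, div_le_div_iff₀ (by positivity) hst]
      have e6 : 4 * n * ℓ * (t * ((√t + ‖Y‖) / √t)) = 4 * n * ℓ * (√t + ‖Y‖) * √t := by
        exact aux_s2 hst hss
      rw [e6]
      have := h2 θ hθ
      rw [← hY] at this
      apply mul_le_mul_of_nonneg_right _ hst.le
      refine this.trans ?_
      apply mul_le_mul_of_nonneg_left _ (by positivity)
      linarith
    calc _ ≤ n * ℓ / √t + 4 * n * ℓ / √t := add_le_add b1 b2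
      _ = _ := by ring
  calc _ ≤ ∫⁻ x : EE n × ℝ, ∫⁻ θ in Ioc (0:ℝ) 1, ENNReal.ofReal (F x θ) := lintegral_mono hpt
    _ = ∫⁻ θ in Ioc (0:ℝ) 1, ∫⁻ x : EE n × ℝ, ENNReal.ofReal (F x θ) :=
        lintegral_lintegral_swap hFm.ennreal_ofReal.aemeasurable
    _ = ∫⁻ θ in Ioc (0:ℝ) 1, ENNReal.ofReal (C6 n * ℓ / t) := by
        congr 1; ext θ
        simp only [hF]
        simp_rw [ENNReal.ofReal_mul (p := t ^ (-NN n - 3 / 2) * (C4 n * (5 * n * ℓ / √t))) (by positivity)]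
        rw [lintegral_const_mul _ (by unfold cau; fun_prop), lint_block (by positivity) (by positivity) ht,
          ← ENNReal.ofReal_mul (by positivity)]
        congr 1
        have e1 : π / (1 / (16 * t)) = (16 * π) * t := by field_simp
        rw [e1, Real.mul_rpow (by positivity) ht.le]
        have e2 : t ^ (-NN n - 3 / 2) * t ^ NN n * t = (√t)⁻¹ := by
          rw [← Real.rpow_add ht, Real.sqrt_eq_rpow, ← Real.rpow_neg ht.le]
          nth_rewrite 2 [← Real.rpow_one t]
          rw [← Real.rpow_add ht]
          congr 1; ring
        unfold C6
        calc _ = C4 n * (5 * n) * π * (16 * π) ^ NN n * (t ^ (-NN n - 3 / 2) * t ^ NN n * t) * ℓ / √t := by ring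
          _ = _ := by
            rw [e2, div_eq_mul_inv, div_eq_mul_inv]
            have : t⁻¹ = (√t)⁻¹ * (√t)⁻¹ := by rw [← mul_inv, hss]
            rw [this]; ring
    _ = _ := by simp

end KE
end GR

namespace GR

/-! ### Part 10: the grid -/

section Grid
open scoped ENNReal
variable {n : ℕ}

abbrev Om (n : ℕ) := EE n × ℝ
abbrev Ix (n : ℕ) := (Fin n → ℤ) × ℤ

def gm (k : ℕ) (x : EE n) : Fin n → ℤ := fun i => ⌊2 ^ k * x i⌋
def MM (m : Fin n → ℤ) : ℕ := ∑ i, (2 * m i + 1).natAbs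
def ee (m : Fin n → ℤ) : ℕ := Nat.clog 2 (MM m)
def LL (k : ℕ) (m : Fin n → ℤ) : ℝ := 2 ^ ee m / 4 ^ k
def code (k : ℕ) (x : Om n) : Ix n := (gm k x.1, ⌊x.2 / LL k (gm k x.1)⌋)

def box (lo : Fin n → ℝ) (s b h : ℝ) : Set (Om n) :=
  {x | (∀ j, lo j ≤ x.1 j ∧ x.1 j < lo j + s) ∧ b ≤ x.2 ∧ x.2 < b + h}

def SS (k : ℕ) (i : Ix n) : Set (Om n) :=
  box (fun j => ((i.1 j : ℝ) - 1) / 2 ^ k) (3 / 2 ^ k) (((i.2 : ℝ) - 1) * LL k i.1) (3 * LL k i.1)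

def muO (a : EE n) : Measure (Om n) :=
  volume.withDensity fun x => ENNReal.ofReal (Real.exp (2 * inner ℝ a x.1))

lemma box_eq (lo : Fin n → ℝ) (s b h : ℝ) : box lo s b h =
    ((WithLp.ofLp ⁻¹' (Set.univ.pi fun i => Ico (lo i) (lo i + s))) : Set (EE n)) ×ˢ Ico b (b + h) := by
  ext x
  simp [box, Set.mem_pi]

lemma box_meas (lo : Fin n → ℝ) (s b h : ℝ) : MeasurableSet (box lo s b h) := by
  rw [box_eq]
  exact ((PiLp.volume_preserving_ofLp (Fin n)).measurable
    (MeasurableSet.univ_pi fun i => measurableSet_Ico)).prod measurableSet_Ico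

lemma box_vol (lo : Fin n → ℝ) {s b h : ℝ} (hs : 0 ≤ s) (hh : 0 ≤ h) :
    volume (box lo s b h) = ENNReal.ofReal (s ^ n * h) := by
  rw [box_eq, Measure.volume_eq_prod, Measure.prod_prod,
    (PiLp.volume_preserving_ofLp (Fin n)).measure_preimage
    (MeasurableSet.univ_pi fun i => measurableSet_Ico).nullMeasurableSet, Real.volume_pi_Ico, Real.volume_Ico]
  simp only [add_sub_cancel_left, Finset.prod_const, Finset.card_univ, Fintype.card_fin]
  rw [← ENNReal.ofReal_pow hs, ← ENNReal.ofReal_mul (by positivity)]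

lemma LL_pos (k : ℕ) (m : Fin n → ℤ) : 0 < LL k m := by unfold LL; positivity

lemma code_cell (k : ℕ) (i : Ix n) : code k ⁻¹' {i} =
    box (fun j => (i.1 j : ℝ) / 2 ^ k) (1 / 2 ^ k) ((i.2 : ℝ) * LL k i.1) (LL k i.1) := by
  have h2 : (0:ℝ) < 2 ^ k := by positivity
  have hx : ∀ x : EE n, gm k x = i.1 ↔ ∀ j, (i.1 j : ℝ) / 2 ^ k ≤ x j ∧ x j < (i.1 j : ℝ) / 2 ^ k + 1 / 2 ^ k := by
    intro x
    rw [funext_iff]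
    apply forall_congr'
    intro j
    unfold gm
    rw [Int.floor_eq_iff, ← add_div, div_le_iff₀ h2, lt_div_iff₀ h2, mul_comm]
  ext x
  have hL := LL_pos k i.1
  simp only [mem_preimage, mem_singleton_iff, code, box, mem_ofPred_eq, Prod.ext_iff]
  constructor
  · rintro ⟨h1, h3⟩
    refine ⟨(hx _).1 h1, ?_⟩
    rw [h1, Int.floor_eq_iff, le_div_iff₀ hL, div_lt_iff₀ hL] at h3
    exact ⟨h3.1, by linarith [h3.2]⟩
  · rintro ⟨h1, h3⟩
    have h4 := (hx _).2 h1
    refine ⟨h4, ?_⟩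
    rw [h4, Int.floor_eq_iff, le_div_iff₀ hL, div_lt_iff₀ hL]
    exact ⟨h3.1, by linarith [h3.2]⟩

lemma code_meas (k : ℕ) (i : Ix n) : MeasurableSet (code k ⁻¹' {i}) := by
  rw [code_cell]; exact box_meas _ _ _ _

lemma gm_succ (k : ℕ) (x : EE n) (i : Fin n) : gm k x i = gm (k+1) x i / 2 := by
  unfold gm
  have := Int.floor_div_natCast (2 ^ (k+1) * x i) 2
  push_cast at this
  rw [← this]
  congr 1
  rw [pow_succ]; ring

lemma MM_le (k : ℕ) (x : EE n) : MM (gm k x) ≤ MM (gm (k+1) x) := by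
  unfold MM
  apply Finset.sum_le_sum
  intro i _
  rw [gm_succ]
  omega

lemma MM_le' (k : ℕ) (x : EE n) : MM (gm (k+1) x) ≤ 4 * MM (gm k x) := by
  unfold MM
  rw [Finset.mul_sum]
  apply Finset.sum_le_sum
  intro i _
  rw [gm_succ k]
  omega

lemma ee_le (k : ℕ) (x : EE n) : ee (gm k x) ≤ ee (gm (k+1) x) := Nat.clog_mono_right _ (MM_le k x)

lemma ee_le' (k : ℕ) (x : EE n) : ee (gm (k+1) x) ≤ ee (gm k x) + 2 := by
  unfold ee
  rw [Nat.clog_le_iff_le_pow (by norm_num), pow_add]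
  have := Nat.le_pow_clog (b := 2) (by norm_num) (MM (gm k x))
  have := MM_le' k x
  omega

lemma LL_succ (k : ℕ) (x : EE n) : ∃ r : ℕ, r ≤ 2 ∧ LL k (gm k x) = LL (k+1) (gm (k+1) x) * ((2 ^ r : ℕ) : ℝ) := by
  refine ⟨ee (gm k x) + 2 - ee (gm (k+1) x), ?_, ?_⟩
  · have := ee_le k x; omega
  · unfold LL
    push_cast
    rw [div_mul_eq_mul_div, ← pow_add]
    have : ee (gm (k+1) x) + (ee (gm k x) + 2 - ee (gm (k+1) x)) = ee (gm k x) + 2 := by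
      have := ee_le' k x; omega
    rw [this, pow_succ 4, pow_add]
    field_simp; norm_num

lemma code_nest (k : ℕ) (x y : Om n) (h : code (k+1) x = code (k+1) y) : code k x = code k y := by
  unfold code at h ⊢
  rw [Prod.mk.injEq] at h
  obtain ⟨h1, h2⟩ := h
  have hg : gm k x.1 = gm k y.1 := by
    ext i; rw [gm_succ k x.1, gm_succ k y.1, h1]
  rw [Prod.mk.injEq]
  refine ⟨hg, ?_⟩
  obtain ⟨r, hr, hL⟩ := LL_succ k x.1
  rw [← hg, hL, ← div_div, ← div_div, Int.floor_div_natCast, Int.floor_div_natCast, h2, h1]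

lemma code_mem {k : ℕ} {x y : Om n} (h : code k y = code k x) (j : Fin n) :
    (gm k x.1 j : ℝ) / 2 ^ k ≤ y.1 j ∧ y.1 j < (gm k x.1 j : ℝ) / 2 ^ k + 1 / 2 ^ k := by
  have : y ∈ code k ⁻¹' {code k x} := h
  rw [code_cell] at this
  exact this.1 j

lemma code_mem2 {k : ℕ} {x y : Om n} (h : code k y = code k x) : |y.2 - x.2| ≤ LL k (gm k x.1) := by
  have h1 : y ∈ code k ⁻¹' {code k x} := h
  have h2 : x ∈ code k ⁻¹' {code k x} := rfl
  rw [code_cell] at h1 h2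
  have h1 := h1.2
  have h2 := h2.2
  simp only [code] at h1 h2
  rw [abs_le]; constructor <;> linarith

lemma norm_le_sum (x : EE n) : ‖x‖ ≤ ∑ i, |x i| := by
  rw [EuclideanSpace.norm_eq]
  apply Real.sqrt_le_iff.2
  refine ⟨Finset.sum_nonneg fun i _ => abs_nonneg _, ?_⟩
  simp only [Real.norm_eq_abs]
  rw [sq (∑ i, |x i|), Finset.sum_mul]
  refine Finset.sum_le_sum fun i _ => ?_
  rw [sq]
  exact mul_le_mul_of_nonneg_left (Finset.single_le_sum (f := fun i => |x i|) (fun i _ => abs_nonneg _) (Finset.mem_univ i)) (abs_nonneg _)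

lemma norm_le_of_coord {x : EE n} {c : ℝ} (h : ∀ i, |x i| ≤ c) : ‖x‖ ≤ n * c := by
  refine (norm_le_sum x).trans ?_
  calc _ ≤ ∑ i : Fin n, c := Finset.sum_le_sum fun i _ => h i
    _ = _ := by simp

lemma LL_lower (hn : 1 ≤ n) (k : ℕ) (x : EE n) : (1 / 2 ^ k) * (1 / 2 ^ k + ‖x‖) ≤ 2 * LL k (gm k x) := by
  have h2 : (0:ℝ) < 2 ^ k := by positivity
  have hM : (MM (gm k x) : ℝ) ≤ 2 ^ ee (gm k x) := by
    exact_mod_cast Nat.le_pow_clog (b := 2) (by norm_num) (MM (gm k x))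
  have e4 : (4:ℝ) ^ k = 2 ^ k * 2 ^ k := by rw [← mul_pow]; norm_num
  have hx : ∀ i, 2 ^ k * |x i| ≤ ((2 * gm k x i + 1).natAbs : ℝ) := by
    intro i
    rw [Nat.cast_natAbs]
    have h3 := Int.floor_le (2 ^ k * x i)
    have h4 := Int.lt_floor_add_one (2 ^ k * x i)
    have e : gm k x i = ⌊2 ^ k * x i⌋ := rfl
    rw [← e] at h3 h4
    generalize gm k x i = m at *
    have e2 : 2 ^ k * |x i| = |2 ^ k * x i| := by rw [abs_mul, abs_of_pos h2]
    rw [e2]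
    push_cast
    rcases le_or_gt 0 m with h | h
    · have h' : (0:ℝ) ≤ m := by exact_mod_cast h
      rw [abs_of_nonneg (by linarith), abs_of_nonneg (by linarith)]; linarith
    · have h' : (m:ℝ) ≤ -1 := by exact_mod_cast (by omega : m ≤ -1)
      rw [abs_of_nonpos (by linarith), abs_of_nonpos (by linarith)]; linarith
  have hs : 2 ^ k * ‖x‖ ≤ (MM (gm k x) : ℝ) := by
    unfold MM
    push_cast
    calc _ ≤ 2 ^ k * ∑ i, |x i| := by gcongr; exact norm_le_sum x
      _ = ∑ i, 2 ^ k * |x i| := Finset.mul_sum _ _ _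
      _ ≤ _ := Finset.sum_le_sum fun i _ => hx i
  have h1 : (1:ℝ) ≤ (MM (gm k x) : ℝ) := by
    have : 1 ≤ MM (gm k x) := by
      unfold MM
      calc 1 ≤ n := hn
        _ = ∑ i : Fin n, 1 := by simp
        _ ≤ _ := Finset.sum_le_sum fun i _ => by omega
    exact_mod_cast this
  unfold LL
  rw [e4]
  have : (1 / 2 ^ k : ℝ) * (1 / 2 ^ k + ‖x‖) = (1 + 2 ^ k * ‖x‖) / (2 ^ k * 2 ^ k) := by field_simp
  rw [this, ← mul_div_assoc]
  gcongr
  linarith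

lemma LL_upper (hn : 1 ≤ n) (k : ℕ) (m : Fin n → ℤ) (y : EE n)
    (hy : ∀ j, (m j : ℝ) / 2 ^ k ≤ y j ∧ y j ≤ (m j : ℝ) / 2 ^ k + 1 / 2 ^ k) :
    LL k m ≤ 4 * n * (1 / 2 ^ k) * (‖y‖ + 1 / 2 ^ k) := by
  have h2 : (0:ℝ) < 2 ^ k := by positivity
  have h1 : 1 ≤ MM m := by
      unfold MM
      calc 1 ≤ n := hn
        _ = ∑ i : Fin n, 1 := by simp
        _ ≤ _ := Finset.sum_le_sum fun i _ => by omega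
  have hE : (2:ℝ) ^ ee m ≤ 2 * MM m := by
    have : 2 ^ ee m ≤ 2 * MM m := by
      unfold ee
      rcases Nat.lt_or_ge 1 (MM m) with h | h
      · have h3 := Nat.pow_pred_clog_lt_self (b := 2) (by norm_num) h
        have h4 := Nat.clog_pos (b := 2) (by norm_num) h
        obtain ⟨r, hr⟩ := Nat.exists_eq_succ_of_ne_zero h4.ne'
        rw [hr] at h3 ⊢
        rw [Nat.pow_succ]
        simp only [Nat.pred_succ] at h3
        omega
      · have : MM m = 1 := by omega
        rw [this]; simp
    exact_mod_cast this
  have e4 : (4:ℝ) ^ k = 2 ^ k * 2 ^ k := by rw [← mul_pow]; norm_num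
  have hx : ∀ i, ((2 * m i + 1).natAbs : ℝ) ≤ 2 * (2 ^ k * ‖y‖) + 1 := by
    intro i
    rw [Nat.cast_natAbs]
    obtain ⟨h3, h4⟩ := hy i
    rw [← add_div] at h4
    rw [div_le_iff₀ h2] at h3
    rw [le_div_iff₀ h2] at h4
    have h5 := coord_le y i
    have h6 : |y i| * 2 ^ k ≤ ‖y‖ * 2 ^ k := by gcongr
    rw [← abs_of_pos h2, ← abs_mul, abs_of_pos h2, abs_le] at h6
    push_cast
    rw [abs_le]
    constructor <;> nlinarith
  have hs : (MM m : ℝ) ≤ n * (2 * (2 ^ k * ‖y‖) + 1) := by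
    unfold MM
    push_cast
    calc _ ≤ ∑ i : Fin n, (2 * (2 ^ k * ‖y‖) + 1) := Finset.sum_le_sum fun i _ => hx i
      _ = _ := by rw [Finset.sum_const, Finset.card_univ, Fintype.card_fin, nsmul_eq_mul]
  unfold LL
  rw [e4]
  have : 4 * (n:ℝ) * (1 / 2 ^ k) * (‖y‖ + 1 / 2 ^ k) = (4 * n * (2 ^ k * ‖y‖ + 1)) / (2 ^ k * 2 ^ k) := by field_simp
  rw [this]
  gcongr
  have hn0 : (0:ℝ) ≤ n := by positivity
  nlinarith

lemma SS_compl {k : ℕ} {x y : Om n} (hx : x ∈ (SS k (code k y))ᶜ) :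
    1 / 2 ^ k ≤ ‖x.1 - y.1‖ ∨ LL k (gm k y.1) ≤ |x.2 - y.2| := by
  by_contra hc
  push Not at hc
  obtain ⟨h1, h2⟩ := hc
  apply hx
  have hL := LL_pos k (gm k y.1)
  have hy : y ∈ code k ⁻¹' {code k y} := rfl
  rw [code_cell] at hy
  obtain ⟨hy1, hy2, hy3⟩ := hy
  simp only [code] at hy1 hy2 hy3
  refine ⟨fun j => ?_, ?_⟩
  · have h3 := (coord_le (x.1 - y.1) j).trans_lt h1
    rw [PiLp.sub_apply, abs_lt] at h3
    obtain ⟨h4, h5⟩ := hy1 j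
    simp only [code]
    have e3 : (3:ℝ) / 2 ^ k = 3 * (1 / 2 ^ k) := by ring
    rw [sub_div, e3]
    constructor <;> linarith
  · rw [abs_lt] at h2
    simp only [code]
    constructor <;> linarith

/-! weights -/
lemma mu_upper {a p : EE n} (ha : ‖a‖ = 1) {R : ℝ} {A : Set (Om n)} (hA : MeasurableSet A)
    (h : ∀ x ∈ A, ‖x.1 - p‖ ≤ R) :
    muO a A ≤ ENNReal.ofReal (Real.exp (2 * inner ℝ a p + 2 * R)) * volume A := by
  unfold muO
  rw [withDensity_apply _ hA, ← setLIntegral_const]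
  apply setLIntegral_mono' hA
  intro x hx
  apply ENNReal.ofReal_le_ofReal
  apply Real.exp_le_exp.2
  have h1 := abs_real_inner_le_norm a (x.1 - p)
  rw [ha, one_mul, inner_sub_right] at h1
  have := abs_le.1 (h1.trans (h x hx))
  linarith [this.2]

lemma mu_lower {a p : EE n} (ha : ‖a‖ = 1) {R : ℝ} {A : Set (Om n)} (hA : MeasurableSet A)
    (h : ∀ x ∈ A, ‖x.1 - p‖ ≤ R) :
    ENNReal.ofReal (Real.exp (2 * inner ℝ a p - 2 * R)) * volume A ≤ muO a A := by
  unfold muO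
  rw [withDensity_apply _ hA, ← setLIntegral_const]
  apply setLIntegral_mono' hA
  intro x hx
  apply ENNReal.ofReal_le_ofReal
  apply Real.exp_le_exp.2
  have h1 := abs_real_inner_le_norm a (x.1 - p)
  rw [ha, one_mul, inner_sub_right] at h1
  have := abs_le.1 (h1.trans (h x hx))
  linarith [this.1]

lemma cell_vol (k : ℕ) (i : Ix n) : volume (code k ⁻¹' {i}) = ENNReal.ofReal ((1 / 2 ^ k) ^ n * LL k i.1) := by
  rw [code_cell, box_vol _ (by positivity) (LL_pos _ _).le]

lemma cell_dist {k : ℕ} {x y : Om n} (h : code k y = code k x) : ‖y.1 - x.1‖ ≤ n * (1 / 2 ^ k) := by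
  apply norm_le_of_coord
  intro i
  have h1 := code_mem h i
  have h2 := code_mem (rfl : code k x = code k x) i
  rw [PiLp.sub_apply, abs_le]
  constructor <;> linarith [h1.1, h1.2, h2.1, h2.2]

lemma inv_two_pow_le (k : ℕ) : (1:ℝ) / 2 ^ k ≤ 1 := by
  rw [div_le_one (by positivity)]; exact one_le_pow₀ (by norm_num)

lemma cell_dist1 {k : ℕ} {x y : Om n} (h : code k y = code k x) : ‖y.1 - x.1‖ ≤ 2 * n := by
  refine (cell_dist h).trans ?_
  have := inv_two_pow_le k
  have hn0 : (0:ℝ) ≤ n := by positivity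
  nlinarith

lemma SS_dist {k : ℕ} {x y : Om n} (h : y ∈ SS k (code k x)) : ‖y.1 - x.1‖ ≤ 2 * n := by
  rw [mul_comm]
  apply norm_le_of_coord
  intro i
  have h1 := h.1 i
  have h2 := code_mem (rfl : code k x = code k x) i
  simp only [code] at h1
  have e3 : (3:ℝ) / 2 ^ k = 3 * (1 / 2 ^ k) := by ring
  rw [sub_div, e3] at h1
  have := inv_two_pow_le k
  rw [PiLp.sub_apply, abs_le]
  constructor <;> linarith [h1.1, h1.2, h2.1, h2.2]

def Dc (n : ℕ) : ℝ := Real.exp (8 * n) * (3 ^ n * 4)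

lemma mu_ne_zero {a : EE n} (ha : ‖a‖ = 1) (k : ℕ) (x : Om n) : muO a (code k ⁻¹' {code k x}) ≠ 0 := by
  have h := mu_lower (p := x.1) ha (code_meas k (code k x)) (fun y hy => cell_dist1 hy)
  rw [cell_vol] at h
  intro h0
  rw [h0, ← ENNReal.ofReal_mul (Real.exp_pos _).le] at h
  have := LL_pos k (code k x).1
  have h3 : 0 < Real.exp (2 * inner ℝ a x.1 - 2 * (2 * n)) * ((1 / 2 ^ k) ^ n * LL k (code k x).1) := by positivity
  have := ENNReal.ofReal_pos.2 h3
  exact absurd h (not_le.2 this)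

lemma mu_ne_top {a : EE n} (ha : ‖a‖ = 1) (k : ℕ) (x : Om n) : muO a (code k ⁻¹' {code k x}) ≠ ⊤ := by
  have h := mu_upper (p := x.1) ha (code_meas k (code k x)) (fun y hy => cell_dist1 hy)
  rw [cell_vol, ← ENNReal.ofReal_mul (Real.exp_pos _).le] at h
  exact (h.trans_lt ENNReal.ofReal_lt_top).ne

lemma ratio_aux {a : EE n} (ha : ‖a‖ = 1) {x : Om n} {A B : Set (Om n)} (hA : MeasurableSet A) (hB : MeasurableSet B)
    (h1 : ∀ y ∈ A, ‖y.1 - x.1‖ ≤ 2 * n) (h2 : ∀ y ∈ B, ‖y.1 - x.1‖ ≤ 2 * n)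
    (h : volume A ≤ ENNReal.ofReal (3 ^ n * 4) * volume B) : muO a A ≤ ENNReal.ofReal (Dc n) * muO a B := by
  refine (mu_upper (p := x.1) ha hA h1).trans ?_
  refine le_trans ?_ (mul_le_mul_right (mu_lower (p := x.1) ha hB h2) _)
  refine (mul_le_mul_right h _).trans (le_of_eq ?_)
  rw [← mul_assoc, ← mul_assoc (ENNReal.ofReal (Dc n)), ← ENNReal.ofReal_mul (by positivity), ← ENNReal.ofReal_mul (by unfold Dc; positivity)]
  congr 2
  unfold Dc
  have : Real.exp (2 * inner ℝ a x.1 + 2 * (2 * ↑n)) = Real.exp (8 * n) * Real.exp (2 * inner ℝ a x.1 - 2 * (2 * ↑n)) := by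
    rw [← Real.exp_add]; congr 1; ring
  rw [this]; ring

lemma SS_meas (k : ℕ) (i : Ix n) : MeasurableSet (SS k i) := box_meas _ _ _ _

lemma mu_SS {a : EE n} (ha : ‖a‖ = 1) (k : ℕ) (x : Om n) :
    muO a (SS k (code k x)) ≤ ENNReal.ofReal (Dc n) * muO a (code k ⁻¹' {code k x}) := by
  apply ratio_aux ha (SS_meas _ _) (code_meas _ _) (fun y hy => SS_dist hy) (fun y hy => cell_dist1 hy)
  have hL := LL_pos k (code k x).1
  unfold SS
  rw [cell_vol, box_vol _ (by positivity) (by positivity), ← ENNReal.ofReal_mul (by positivity)]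
  apply ENNReal.ofReal_le_ofReal
  rw [div_pow, div_pow, one_pow]
  have : 0 ≤ 3 ^ n / (2 ^ k) ^ n * LL k (code k x).1 := by positivity
  calc _ = 3 * (3 ^ n / (2 ^ k) ^ n * LL k (code k x).1) := by ring
    _ ≤ 4 * (3 ^ n / (2 ^ k) ^ n * LL k (code k x).1) := by linarith
    _ = _ := by ring

lemma mu_dbl {a : EE n} (ha : ‖a‖ = 1) (k : ℕ) (x : Om n) :
    muO a (code k ⁻¹' {code k x}) ≤ ENNReal.ofReal (Dc n) * muO a (code (k+1) ⁻¹' {code (k+1) x}) := by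
  apply ratio_aux ha (code_meas _ _) (code_meas _ _) (fun y hy => cell_dist1 hy) (fun y hy => cell_dist1 hy)
  rw [cell_vol, cell_vol, ← ENNReal.ofReal_mul (by positivity)]
  apply ENNReal.ofReal_le_ofReal
  obtain ⟨r, hr, hL⟩ := LL_succ k x.1
  simp only [code]
  rw [hL]
  have hL2 := LL_pos (k+1) (gm (k+1) x.1)
  have h4 : ((2 ^ r : ℕ) : ℝ) ≤ 4 := by
    have : 2 ^ r ≤ 2 ^ 2 := Nat.pow_le_pow_right (by norm_num) hr
    exact_mod_cast this
  have h3 : (1 / 2 ^ k : ℝ) ^ n ≤ 3 ^ n * (1 / 2 ^ (k+1)) ^ n := by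
    rw [← mul_pow]
    apply pow_le_pow_left₀ (by positivity)
    rw [pow_succ, mul_one_div, div_le_div_iff₀ (by positivity) (by positivity)]
    have : (0:ℝ) < 2 ^ k := by positivity
    linarith
  calc _ ≤ (3 ^ n * (1 / 2 ^ (k+1)) ^ n) * (LL (k+1) (gm (k+1) x.1) * 4) := by gcongr
    _ = _ := by ring

lemma one_le_Dc : (1:ℝ≥0∞) ≤ ENNReal.ofReal (Dc n) := by
  rw [← ENNReal.ofReal_one]
  apply ENNReal.ofReal_le_ofReal
  unfold Dc
  have h1 : 1 ≤ Real.exp (8 * n) := Real.one_le_exp (by positivity)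
  have h2 : (1:ℝ) ≤ 3 ^ n := one_le_pow₀ (by norm_num)
  nlinarith

lemma leb (hn : 1 ≤ n) {a : EE n} (ha : ‖a‖ = 1) {f : Om n → ℂ} (hf : Continuous f) {σ : ℝ≥0∞} (x : Om n)
    (h : ∀ k, ∫⁻ y in code k ⁻¹' {code k x}, ‖f y‖ₑ ∂(muO a) ≤ σ * muO a (code k ⁻¹' {code k x})) :
    ‖f x‖ₑ ≤ σ := by
  by_contra hc
  push Not at hc
  obtain ⟨r, hr1, hr2⟩ := exists_between hc
  have hU : ∀ᶠ y in nhds x, r < ‖f y‖ₑ := (hf.enorm.tendsto x).eventually (lt_mem_nhds hr2)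
  obtain ⟨δ, hδ, hball⟩ := Metric.eventually_nhds_iff.1 hU
  have ht : Tendsto (fun k : ℕ => (1:ℝ) / 2 ^ k) atTop (nhds 0) := by
    have := tendsto_pow_atTop_nhds_zero_of_lt_one (r := (1/2:ℝ)) (by norm_num) (by norm_num)
    simpa [div_pow] using this
  have ht1 : Tendsto (fun k : ℕ => (n:ℝ) * (1 / 2 ^ k)) atTop (nhds 0) := by
    simpa using ht.const_mul (n:ℝ)
  have ht2 : Tendsto (fun k : ℕ => 4 * (n:ℝ) * (1 / 2 ^ k) * (‖x.1‖ + 1 / 2 ^ k)) atTop (nhds 0) := by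
    have := (ht.const_mul (4 * (n:ℝ))).mul (ht.const_add ‖x.1‖)
    simpa using this
  obtain ⟨k, hk1, hk2⟩ := ((ht1.eventually (gt_mem_nhds hδ)).and (ht2.eventually (gt_mem_nhds hδ))).exists
  have hsub : ∀ y ∈ code k ⁻¹' {code k x}, r ≤ ‖f y‖ₑ := by
    intro y hy
    apply le_of_lt
    apply hball
    rw [Prod.dist_eq, max_lt_iff]
    constructor
    · rw [dist_eq_norm]; exact (cell_dist hy).trans_lt hk1
    · rw [Real.dist_eq]
      refine ((code_mem2 hy).trans (LL_upper hn k _ x.1 fun j => ?_)).trans_lt hk2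
      have := code_mem (rfl : code k x = code k x) j
      exact ⟨this.1, this.2.le⟩
  have h1 : r * muO a (code k ⁻¹' {code k x}) ≤ ∫⁻ y in code k ⁻¹' {code k x}, ‖f y‖ₑ ∂(muO a) := by
    rw [← setLIntegral_const]
    exact setLIntegral_mono' (code_meas _ _) hsub
  have h2 := h1.trans (h k)
  have := (ENNReal.mul_le_mul_iff_left (mu_ne_zero ha k x) (mu_ne_top ha k x)).1 h2
  exact absurd this (not_le.2 hr1)

end Grid
end GR

namespace GR
open scoped ENNReal
variable {n : ℕ}

/-- truncated kernel (with respect to `muO a`). -/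
def Ke (κ : Kap n) (a : EE n) (ε : ℝ) (x y : Om n) : ℂ :=
  ((Real.exp (-(2 * inner ℝ a x.1)) : ℝ) : ℂ) *
    ∫ t in Ioc ε 1, ((t ^ (-(1/2) : ℝ) : ℝ) : ℂ) * rr κ a t x.1 y.1 (x.2 - y.2)

lemma measurable_rr' (κ : Kap n) (a : EE n) : Measurable fun p : (Om n × Om n) × ℝ =>
    ((p.2 ^ (-(1/2) : ℝ) : ℝ) : ℂ) * rr κ a p.2 p.1.1.1 p.1.2.1 (p.1.1.2 - p.1.2.2) := by
  have h : Measurable fun p : (Om n × Om n) × ℝ =>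
    ((a, p.2, p.1.1.1, p.1.2.1, p.1.1.2 - p.1.2.2) : EE n × ℝ × EE n × EE n × ℝ) := by fun_prop
  have h2 := (measurable_rr κ).comp h
  exact (Complex.measurable_ofReal.comp (by fun_prop)).mul h2

lemma measurable_Ki (κ : Kap n) (a : EE n) (ε : ℝ) : Measurable fun p : Om n × Om n =>
    ∫ t in Ioc ε 1, ((t ^ (-(1/2) : ℝ) : ℝ) : ℂ) * rr κ a t p.1.1 p.2.1 (p.1.2 - p.2.2) := by
  exact ((measurable_rr' κ a).stronglyMeasurable.integral_prod_right (ν := volume.restrict (Ioc ε 1))).measurable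

lemma measurable_Ke (κ : Kap n) (a : EE n) (ε : ℝ) : Measurable (Function.uncurry (Ke κ a ε)) := by
  have h1 : Measurable fun p : Om n × Om n => ((Real.exp (-(2 * inner ℝ a p.1.1)) : ℝ) : ℂ) := by
    apply Complex.measurable_ofReal.comp
    fun_prop
  exact h1.mul (measurable_Ki κ a ε)

lemma rr_bd (hn : 1 ≤ n) (κ : Kap n) {a : EE n} (ha : ‖a‖ = 1) {ε t : ℝ} (hε : 0 < ε) (ht : t ∈ Ioc ε 1)
    (x y : EE n) (z : ℝ) : ‖((t ^ (-(1/2) : ℝ) : ℝ) : ℂ) * rr κ a t x y z‖ ≤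
      ε ^ (-(1/2) : ℝ) * (ε ^ (-NN n - 3 / 2) * C1 n) := by
  have ht0 : 0 < t := hε.trans ht.1
  have hC := C1_pos hn
  have h := rr_small hn κ ht0 (norm_sqrt_smul_le ha ht.2) x y z
  have hN : 1/2 ≤ NN n := half_le_NN hn
  have hw : 1 ≤ 1 + ‖y‖ / √t := by have : 0 ≤ ‖y‖ / √t := by positivity
                                   linarith
  have hc : cau (1 + ‖y‖ / √t) (z / t) ≤ 1 := by
    unfold cau
    rw [div_le_one (by positivity)]
    nlinarith [sq_nonneg (z/t)]
  have he : Real.exp (-(1 / (16 * t) * ‖x - y‖ ^ 2)) ≤ 1 := by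
    rw [Real.exp_le_one_iff]
    have : 0 ≤ 1 / (16 * t) * ‖x - y‖ ^ 2 := by positivity
    linarith
  have hc0 := cau_nonneg (zero_le_one.trans hw) (z / t)
  have h1 : t ^ (-(1/2) : ℝ) ≤ ε ^ (-(1/2) : ℝ) := Real.rpow_le_rpow_of_nonpos hε ht.1.le (by norm_num)
  have h2 : t ^ (-NN n - 3 / 2) ≤ ε ^ (-NN n - 3 / 2) := Real.rpow_le_rpow_of_nonpos hε ht.1.le (by linarith)
  have hp1 : 0 ≤ t ^ (-(1/2) : ℝ) := (Real.rpow_pos_of_pos ht0 _).le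
  have hp2 : 0 ≤ t ^ (-NN n - 3 / 2) := (Real.rpow_pos_of_pos ht0 _).le
  rw [norm_mul, Complex.norm_real, Real.norm_of_nonneg hp1]
  refine mul_le_mul h1 (h.trans ?_) (norm_nonneg _) (Real.rpow_pos_of_pos hε _).le
  calc _ ≤ t ^ (-NN n - 3 / 2) * C1 n * 1 := by
        apply mul_le_mul_of_nonneg_left _ (by positivity)
        exact mul_le_one₀ he hc0 hc
    _ ≤ _ := by rw [mul_one]; exact mul_le_mul_of_nonneg_right h2 hC.le

lemma Ki_bd (hn : 1 ≤ n) (κ : Kap n) {a : EE n} (ha : ‖a‖ = 1) {ε : ℝ} (hε : 0 < ε) :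
    ∃ M : ℝ, 0 ≤ M ∧ ∀ x y : Om n,
      ‖∫ t in Ioc ε 1, ((t ^ (-(1/2) : ℝ) : ℝ) : ℂ) * rr κ a t x.1 y.1 (x.2 - y.2)‖ ≤ M := by
  have hC := C1_pos hn
  refine ⟨ε ^ (-(1/2) : ℝ) * (ε ^ (-NN n - 3 / 2) * C1 n) * (volume.real (Ioc ε 1)), by positivity, fun x y => ?_⟩
  apply norm_setIntegral_le_of_norm_le_const
  · simp
  · intro t ht
    exact rr_bd hn κ ha hε ht _ _ _

lemma int_t (hn : 1 ≤ n) (κ : Kap n) {a : EE n} (ha : ‖a‖ = 1) {ε : ℝ} (hε : 0 < ε) (x y : Om n) :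
    IntegrableOn (fun t : ℝ => ((t ^ (-(1/2) : ℝ) : ℝ) : ℂ) * rr κ a t x.1 y.1 (x.2 - y.2)) (Ioc ε 1) := by
  apply Measure.integrableOn_of_bounded (M := ε ^ (-(1/2) : ℝ) * (ε ^ (-NN n - 3 / 2) * C1 n)) (by simp)
  · exact ((measurable_rr' κ a).comp (measurable_prodMk_left (x := (x, y)))).aestronglyMeasurable
  · filter_upwards [ae_restrict_mem measurableSet_Ioc] with t ht
    exact rr_bd hn κ ha hε ht _ _ _

lemma Ke_bdd (hn : 1 ≤ n) (κ : Kap n) {a : EE n} (ha : ‖a‖ = 1) {ε : ℝ} (hε : 0 < ε) (x : Om n) :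
    ∃ M : ℝ, ∀ y, ‖Ke κ a ε x y‖ ≤ M := by
  obtain ⟨M, hM, h⟩ := Ki_bd hn κ ha hε
  refine ⟨Real.exp (-(2 * inner ℝ a x.1)) * M, fun y => ?_⟩
  unfold Ke
  rw [norm_mul, Complex.norm_real, Real.norm_of_nonneg (Real.exp_pos _).le]
  exact mul_le_mul_of_nonneg_left (h x y) (Real.exp_pos _).le

lemma mu_cancel (a : EE n) {A : Set (Om n)} (hA : MeasurableSet A) {Ψ : Om n → ℂ} (hΨ : Measurable Ψ) :
    ∫⁻ x in A, ‖((Real.exp (-(2 * inner ℝ a x.1)) : ℝ) : ℂ) * Ψ x‖ₑ ∂(muO a) = ∫⁻ x in A, ‖Ψ x‖ₑ := by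
  unfold muO
  have hm : Measurable fun x : Om n => ((Real.exp (-(2 * inner ℝ a x.1)) : ℝ) : ℂ) :=
    Complex.measurable_ofReal.comp (by fun_prop)
  have hm2 : Measurable fun x : Om n => ‖((Real.exp (-(2 * inner ℝ a x.1)) : ℝ) : ℂ) * Ψ x‖ₑ :=
    (hm.mul hΨ).enorm
  rw [setLIntegral_withDensity_eq_setLIntegral_mul _ (by fun_prop) hm2 hA]
  apply lintegral_congr
  intro x
  simp only [Pi.mul_apply]
  rw [enorm_mul, ← mul_assoc, ← ofReal_norm, Complex.norm_real, Real.norm_of_nonneg (Real.exp_pos _).le,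
    ← ENNReal.ofReal_mul (Real.exp_pos _).le, ← Real.exp_add, add_neg_cancel, Real.exp_zero, ENNReal.ofReal_one, one_mul]

lemma swap_le {A : Set (Om n)} {ε : ℝ} {F : Om n × ℝ → ℂ} (hF : Measurable F) :
    ∫⁻ x in A, ‖∫ t in Ioc ε 1, F (x, t)‖ₑ ≤ ∫⁻ t in Ioc ε 1, ∫⁻ x in A, ‖F (x, t)‖ₑ := by
  rw [lintegral_lintegral_swap (f := fun t x => ‖F (x, t)‖ₑ)]
  · exact lintegral_mono fun x => enorm_integral_le_lintegral_enorm _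
  · exact (hF.comp measurable_swap).enorm.aemeasurable

lemma lint_near {ℓ c : ℝ} (hℓ : 0 < ℓ) (hc : 0 ≤ c) :
    ∫⁻ t in Ioc 0 (ℓ ^ 2), ENNReal.ofReal (t ^ (-(1/2) : ℝ)) * ENNReal.ofReal (c / ℓ) = ENNReal.ofReal (2 * c) := by
  rw [lintegral_mul_const _ (by fun_prop)]
  have hi : IntegrableOn (fun t : ℝ => t ^ (-(1/2) : ℝ)) (Ioc 0 (ℓ ^ 2)) := by
    have := intervalIntegral.intervalIntegrable_rpow' (a := 0) (b := ℓ ^ 2) (r := -(1/2)) (by norm_num)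
    rwa [intervalIntegrable_iff_integrableOn_Ioc_of_le (by positivity)] at this
  rw [← ofReal_integral_eq_lintegral_ofReal hi, ← intervalIntegral.integral_of_le (by positivity),
    integral_rpow (by left; norm_num), ← ENNReal.ofReal_mul]
  · congr 1
    have : (ℓ ^ 2) ^ (-(1 / 2) + 1 : ℝ) = ℓ := by
      rw [← Real.rpow_natCast, ← Real.rpow_mul hℓ.le]; norm_num
    rw [this, Real.zero_rpow (by norm_num)]
    field_simp; norm_num
  · rw [Real.zero_rpow (by norm_num)]
    have : 0 ≤ (ℓ ^ 2) ^ (-(1 / 2) + 1 : ℝ) := by positivity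
    apply div_nonneg <;> linarith
  · filter_upwards [ae_restrict_mem measurableSet_Ioc] with t ht
    exact (Real.rpow_pos_of_pos ht.1 _).le

lemma lint_far {ℓ c : ℝ} (hℓ : 0 < ℓ) (hc : 0 ≤ c) :
    ∫⁻ t in Ioi (ℓ ^ 2), ENNReal.ofReal (t ^ (-(1/2) : ℝ)) * ENNReal.ofReal (c * ℓ / t) = ENNReal.ofReal (2 * c) := by
  have h : ∀ t ∈ Ioi (ℓ ^ 2), ENNReal.ofReal (t ^ (-(1/2) : ℝ)) * ENNReal.ofReal (c * ℓ / t) =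
      ENNReal.ofReal (t ^ (-(3/2) : ℝ)) * ENNReal.ofReal (c * ℓ) := by
    intro t ht
    have ht0 : 0 < t := lt_trans (by positivity) ht
    rw [← ENNReal.ofReal_mul (by positivity), ← ENNReal.ofReal_mul (by positivity)]
    congr 1
    have : t ^ (-(1/2) : ℝ) = t ^ (-(3/2) : ℝ) * t := by
      nth_rewrite 3 [← Real.rpow_one t]
      rw [← Real.rpow_add ht0]; norm_num
    rw [this]; field_simp
  rw [setLIntegral_congr_fun measurableSet_Ioi h, lintegral_mul_const _ (by fun_prop)]
  have hl2 : 0 < ℓ ^ 2 := by positivity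
  rw [← ofReal_integral_eq_lintegral_ofReal (integrableOn_Ioi_rpow_of_lt (by norm_num) hl2),
    integral_Ioi_rpow_of_lt (by norm_num) hl2, ← ENNReal.ofReal_mul]
  · congr 1
    have : (ℓ ^ 2) ^ (-(3 / 2) + 1 : ℝ) = ℓ⁻¹ := by
      rw [← Real.rpow_natCast, ← Real.rpow_mul hℓ.le, ← Real.rpow_neg_one]; norm_num
    rw [this]
    field_simp; norm_num
  · have : 0 ≤ (ℓ ^ 2) ^ (-(3 / 2) + 1 : ℝ) := by positivity
    apply div_nonneg_of_nonpos <;> linarith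
  · filter_upwards [ae_restrict_mem measurableSet_Ioi] with t ht
    have ht0 : 0 < t := lt_trans (by positivity) ht
    exact (Real.rpow_pos_of_pos ht0 _).le

lemma core_t {ℓ c ε : ℝ} (hℓ : 0 < ℓ) (hc : 0 ≤ c) (hε : 0 < ε) {G : ℝ → ℝ≥0∞}
    (h1 : ∀ t, 0 < t → t ≤ 1 → t ≤ ℓ ^ 2 → G t ≤ ENNReal.ofReal (c / ℓ))
    (h2 : ∀ t, 0 < t → t ≤ 1 → ℓ ^ 2 < t → G t ≤ ENNReal.ofReal (c * ℓ / t)) :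
    ∫⁻ t in Ioc ε 1, ENNReal.ofReal (t ^ (-(1/2) : ℝ)) * G t ≤ ENNReal.ofReal (4 * c) := by
  have e : ENNReal.ofReal (4 * c) = ENNReal.ofReal (2 * c) + ENNReal.ofReal (2 * c) := by
    rw [← ENNReal.ofReal_add (by positivity) (by positivity)]; congr 1; ring
  have e' : ENNReal.ofReal (4 * c) =
      (∫⁻ t in Ioc 0 (ℓ ^ 2), ENNReal.ofReal (t ^ (-(1/2) : ℝ)) * ENNReal.ofReal (c / ℓ)) +
      ∫⁻ t in Ioi (ℓ ^ 2), ENNReal.ofReal (t ^ (-(1/2) : ℝ)) * ENNReal.ofReal (c * ℓ / t) := by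
    rw [lint_near hℓ hc, lint_far hℓ hc, e]
  rw [e']
  have hsub : Ioc ε 1 ⊆ (Ioc 0 (ℓ ^ 2) ∩ Iic 1) ∪ (Ioi (ℓ ^ 2) ∩ Iic 1) := by
    intro t ht
    have : 0 < t := hε.trans ht.1
    rcases le_or_gt t (ℓ ^ 2) with h | h
    · left; exact ⟨⟨this, h⟩, ht.2⟩
    · right; exact ⟨h, ht.2⟩
  refine (lintegral_mono_set hsub).trans ((lintegral_union_le _ _ _).trans (add_le_add ?_ ?_))
  · refine le_trans ?_ (lintegral_mono_set (inter_subset_left (t := Iic (1:ℝ))))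
    refine setLIntegral_mono' (measurableSet_Ioc.inter measurableSet_Iic) fun t ht => ?_
    exact mul_le_mul_right (h1 t ht.1.1 ht.2 ht.1.2) _
  · refine le_trans ?_ (lintegral_mono_set (inter_subset_left (t := Iic (1:ℝ))))
    refine setLIntegral_mono' (measurableSet_Ioi.inter measurableSet_Iic) fun t ht => ?_
    exact mul_le_mul_right (h2 t (lt_trans (by positivity) ht.1) ht.2 ht.1) _

lemma C5_nonneg (hn : 1 ≤ n) : 0 ≤ C5 n := by
  have := C1_pos hn
  unfold C5; positivity
lemma C6_nonneg (hn : 1 ≤ n) : 0 ≤ C6 n := by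
  have := C4_pos hn
  unfold C6; positivity

lemma enorm_tmul {t : ℝ} (ht : 0 < t) (w : ℂ) : ‖((t ^ (-(1/2) : ℝ) : ℝ) : ℂ) * w‖ₑ =
    ENNReal.ofReal (t ^ (-(1/2) : ℝ)) * ‖w‖ₑ := by
  rw [enorm_mul, ← ofReal_norm, Complex.norm_real, Real.norm_of_nonneg (Real.rpow_pos_of_pos ht _).le]

lemma Hgen {A : Set (Om n)} {ℓ c ε : ℝ} (hℓ : 0 < ℓ) (hc : 0 ≤ c) (hε : 0 < ε) {Φ : ℝ → Om n → ℂ}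
    (hΦ : Measurable (Function.uncurry Φ))
    (h1 : ∀ t, 0 < t → t ≤ 1 → t ≤ ℓ ^ 2 → ∫⁻ x in A, ‖Φ t x‖ₑ ≤ ENNReal.ofReal (c / ℓ))
    (h2 : ∀ t, 0 < t → t ≤ 1 → ℓ ^ 2 < t → ∫⁻ x in A, ‖Φ t x‖ₑ ≤ ENNReal.ofReal (c * ℓ / t)) :
    ∫⁻ x in A, ‖∫ t in Ioc ε 1, ((t ^ (-(1/2) : ℝ) : ℝ) : ℂ) * Φ t x‖ₑ ≤ ENNReal.ofReal (4 * c) := by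
  have hF : Measurable fun p : Om n × ℝ => ((p.2 ^ (-(1/2) : ℝ) : ℝ) : ℂ) * Φ p.2 p.1 :=
    (Complex.measurable_ofReal.comp (by fun_prop)).mul (hΦ.comp measurable_swap)
  refine (swap_le hF).trans ?_
  have he : ∀ t ∈ Ioc ε 1, (∫⁻ x in A, ‖((t ^ (-(1/2) : ℝ) : ℝ) : ℂ) * Φ t x‖ₑ) =
      ENNReal.ofReal (t ^ (-(1/2) : ℝ)) * ∫⁻ x in A, ‖Φ t x‖ₑ := by
    intro t ht
    rw [← lintegral_const_mul' _ _ ENNReal.ofReal_ne_top]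
    exact lintegral_congr fun x => enorm_tmul (hε.trans ht.1) _
  refine (le_of_eq (setLIntegral_congr_fun measurableSet_Ioc he)).trans ?_
  exact core_t hℓ hc hε h1 h2

lemma meas_rr_tx (κ : Kap n) (a : EE n) (y : Om n) :
    Measurable (Function.uncurry fun (t : ℝ) (x : Om n) => rr κ a t x.1 y.1 (x.2 - y.2)) := by
  have h : Measurable fun p : ℝ × Om n =>
    ((a, p.1, p.2.1, y.1, p.2.2 - y.2) : EE n × ℝ × EE n × EE n × ℝ) := by fun_prop
  exact (measurable_rr κ).comp h

lemma measurable_Ki1 (κ : Kap n) (a : EE n) (ε : ℝ) (y : Om n) : Measurable fun x : Om n =>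
    ∫ t in Ioc ε 1, ((t ^ (-(1/2) : ℝ) : ℝ) : ℂ) * rr κ a t x.1 y.1 (x.2 - y.2) := by
  have h : Measurable fun x : Om n => ((x, y) : Om n × Om n) := by fun_prop
  have h2 := (measurable_Ki κ a ε).comp h
  simpa only [Function.comp_def] using h2

lemma H0 (hn : 1 ≤ n) (κ : Kap n) {a : EE n} (ha : ‖a‖ = 1) {ε : ℝ} (hε : 0 < ε) (y : Om n) :
    ∫⁻ x in (SS 0 (code 0 y))ᶜ, ‖Ke κ a ε x y‖ₑ ∂(muO a) ≤ ENNReal.ofReal (4 * (2 * C5 n + C6 n)) := by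
  have hA := (SS_meas 0 (code 0 y)).compl
  have h5 := C5_nonneg hn
  have h6 := C6_nonneg hn
  unfold Ke
  have hm := measurable_Ki1 κ a ε y
  rw [mu_cancel a hA hm]
  refine Hgen (ℓ := 1) one_pos (by positivity) hε (meas_rr_tx κ a y) ?_ ?_
  · intro t ht ht1 ht2
    refine (E1 hn κ ha ht ht1 one_pos ht2 y (L := LL 0 (gm 0 y.1)) ?_ hA ?_).trans ?_
    · have := LL_lower hn 0 y.1; simpa using this
    · intro x hx; have := SS_compl hx; simpa using this
    · apply ENNReal.ofReal_le_ofReal; rw [div_one, div_one]; linarith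
  · intro t ht ht1 ht2; rw [one_pow] at ht2; linarith

lemma Hk (hn : 1 ≤ n) (κ : Kap n) {a : EE n} (ha : ‖a‖ = 1) {ε : ℝ} (hε : 0 < ε) (k : ℕ) (y y0 : Om n)
    (hy : code k y = code k y0) :
    ∫⁻ x in (SS k (code k y))ᶜ, ‖Ke κ a ε x y - Ke κ a ε x y0‖ₑ ∂(muO a) ≤
      ENNReal.ofReal (4 * (2 * C5 n + C6 n)) := by
  have hA := (SS_meas k (code k y)).compl
  have h5 := C5_nonneg hn
  have h6 := C6_nonneg hn
  unfold Ke
  have hm := measurable_Ki1 κ a ε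
  simp_rw [← mul_sub]
  have hms := (hm y).sub (hm y0)
  simp only [Pi.sub_def] at hms
  rw [mu_cancel a hA hms]
  have he0 : ∀ x : Om n, (∫ t in Ioc ε 1, ((t ^ (-(1/2) : ℝ) : ℝ) : ℂ) * rr κ a t x.1 y.1 (x.2 - y.2)) -
      (∫ t in Ioc ε 1, ((t ^ (-(1/2) : ℝ) : ℝ) : ℂ) * rr κ a t x.1 y0.1 (x.2 - y0.2)) =
      ∫ t in Ioc ε 1, ((t ^ (-(1/2) : ℝ) : ℝ) : ℂ) * (rr κ a t x.1 y.1 (x.2 - y.2) - rr κ a t x.1 y0.1 (x.2 - y0.2)) := by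
    intro x
    rw [← integral_sub (int_t hn κ ha hε x y) (int_t hn κ ha hε x y0)]
    simp_rw [mul_sub]
  simp_rw [he0]
  have hl : (0:ℝ) < 1 / 2 ^ k := by positivity
  refine Hgen (ℓ := 1 / 2 ^ k) hl (by positivity) hε ((meas_rr_tx κ a y).sub (meas_rr_tx κ a y0)) ?_ ?_
  · intro t ht ht1 ht2
    have e1 := E1 hn κ ha ht ht1 hl ht2 y (L := LL k (gm k y.1)) (LL_lower hn k y.1) hA (fun x hx => SS_compl hx)
    have e2 := E1 hn κ ha ht ht1 hl ht2 y0 (L := LL k (gm k y0.1)) (LL_lower hn k y0.1) hA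
      (fun x hx => by rw [hy] at hx; exact SS_compl hx)
    have hmm : Measurable fun x : Om n => ‖rr κ a t x.1 y.1 (x.2 - y.2)‖ₑ := by
      have h : Measurable fun p : Om n => ((a, t, p.1, y.1, p.2 - y.2) : EE n × ℝ × EE n × EE n × ℝ) := by fun_prop
      exact ((measurable_rr κ).comp h).enorm
    calc _ ≤ (∫⁻ x in (SS k (code k y))ᶜ, (‖rr κ a t x.1 y.1 (x.2 - y.2)‖ₑ + ‖rr κ a t x.1 y0.1 (x.2 - y0.2)‖ₑ)) :=
          lintegral_mono fun x => enorm_sub_le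
      _ ≤ ENNReal.ofReal (C5 n / (1 / 2 ^ k)) + ENNReal.ofReal (C5 n / (1 / 2 ^ k)) := by
          rw [lintegral_add_left hmm]
          exact add_le_add e1 e2
      _ ≤ _ := by
          rw [← ENNReal.ofReal_add (by positivity) (by positivity)]
          apply ENNReal.ofReal_le_ofReal
          rw [← add_div]
          apply div_le_div_of_nonneg_right _ hl.le
          linarith
  · intro t ht ht1 ht2
    refine (setLIntegral_le_lintegral _ _).trans ((E2 hn κ ha ht ht1 hl ht2.le y y0 (cell_dist hy) ?_).trans ?_)
    · intro θ hθ
      refine (code_mem2 hy).trans (LL_upper hn k _ _ ?_)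
      intro j
      have h1 := code_mem hy j
      have h2 := code_mem (rfl : code k y0 = code k y0) j
      have hj : (y0.1 + θ • (y.1 - y0.1)) j = y0.1 j + θ * (y.1 j - y0.1 j) := by simp
      rw [hj]
      constructor <;> nlinarith [hθ.1, hθ.2, h1.1, h1.2, h2.1, h2.2]
    · apply ENNReal.ofReal_le_ofReal
      apply div_le_div_of_nonneg_right _ ht.le
      apply mul_le_mul_of_nonneg_right _ hl.le
      linarith
end GR

namespace GR
open scoped ENNReal ComplexConjugate

/-! ### Part 12: TT* and the Plancherel inequality -/

lemma ttstar_int {X Z : Type*} [MeasurableSpace X] [MeasurableSpace Z] {μ : Measure X} {ν : Measure Z}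
    [SFinite μ] [SFinite ν] {F : X × Z → ℂ} (hF : Measurable F) {G1 : X → ℝ} {G2 : Z → ℝ}
    (hG : ∀ x z, ‖F (x, z)‖ ≤ G1 x * G2 z) (h1 : Integrable (fun x => G1 x ^ 2) μ) (h2 : Integrable G2 ν) :
    Integrable (fun p : X × (Z × Z) => F (p.1, p.2.1) * conj (F (p.1, p.2.2))) (μ.prod (ν.prod ν)) := by
  have hi := h1.mul_prod (h2.mul_prod h2)
  refine hi.mono' ?_ (ae_of_all _ fun p => ?_)
  · have e1 : Measurable fun p : X × (Z × Z) => ((p.1, p.2.1) : X × Z) := by fun_prop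
    have e2 : Measurable fun p : X × (Z × Z) => ((p.1, p.2.2) : X × Z) := by fun_prop
    exact ((hF.comp e1).mul (Complex.continuous_conj.measurable.comp (hF.comp e2))).aestronglyMeasurable
  · rw [norm_mul, RCLike.norm_conj]
    have a1 := hG p.1 p.2.1
    have a2 := hG p.1 p.2.2
    calc _ ≤ (G1 p.1 * G2 p.2.1) * (G1 p.1 * G2 p.2.2) := mul_le_mul a1 a2 (norm_nonneg _) ((norm_nonneg _).trans a1)
      _ = _ := by ring

lemma ttstar {X Z : Type*} [MeasurableSpace X] [MeasurableSpace Z] {μ : Measure X} {ν : Measure Z}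
    [SFinite μ] [SFinite ν] {F : X × Z → ℂ} (hF : Measurable F) {G1 : X → ℝ} {G2 : Z → ℝ}
    (hG : ∀ x z, ‖F (x, z)‖ ≤ G1 x * G2 z) (h1 : Integrable (fun x => G1 x ^ 2) μ) (h2 : Integrable G2 ν) :
    Integrable (fun x => ‖∫ z, F (x, z) ∂ν‖ ^ 2) μ ∧
    ((∫ x, ‖∫ z, F (x, z) ∂ν‖ ^ 2 ∂μ : ℝ) : ℂ) =
      ∫ p : Z × Z, (∫ x, F (x, p.1) * conj (F (x, p.2)) ∂μ) ∂(ν.prod ν) := by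
  have hi := ttstar_int hF hG h1 h2
  have e : ∀ x, (((‖∫ z, F (x, z) ∂ν‖ ^ 2 : ℝ)) : ℂ) = ∫ p : Z × Z, F (x, p.1) * conj (F (x, p.2)) ∂(ν.prod ν) := by
    intro x
    rw [integral_prod_mul (fun z => F (x, z)) (fun z => conj (F (x, z))), integral_conj, Complex.mul_conj,
      Complex.normSq_eq_norm_sq]
  have hi2 : Integrable (fun x => (((‖∫ z, F (x, z) ∂ν‖ ^ 2 : ℝ)) : ℂ)) μ := by
    simp_rw [e]
    exact hi.integral_prod_left
  constructor
  · have := hi2.re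
    refine this.congr (ae_of_all _ fun x => ?_)
    exact RCLike.ofReal_re (K := ℂ) _
  · rw [← integral_complex_ofReal]
    simp_rw [e]
    exact integral_integral_swap hi

lemma gauss_ft {δ : ℝ} (hδ : 0 < δ) (u : ℝ) :
    ∫ x : ℝ, ((Real.exp (-(δ * x ^ 2)) : ℝ) : ℂ) * Complex.exp (-Complex.I * (u * x)) =
      ((√(π / δ) * Real.exp (-(u ^ 2 / (4 * δ))) : ℝ) : ℂ) := by
  have h := fourierIntegral_gaussian (b := δ) (by simpa using hδ) (-u)
  have e : ∀ x : ℝ, ((Real.exp (-(δ * x ^ 2)) : ℝ) : ℂ) * Complex.exp (-Complex.I * (u * x)) =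
      Complex.exp (Complex.I * (-u : ℂ) * x) * Complex.exp (-(δ:ℂ) * x ^ 2) := by
    intro x
    push_cast
    rw [mul_comm]; congr 2 <;> ring
  simp_rw [e]
  rw [h]
  push_cast
  rw [← Complex.ofReal_div, show (1/2 : ℂ) = ((1/2 : ℝ) : ℂ) by push_cast; rfl, ← Complex.ofReal_cpow (by positivity), ← Real.sqrt_eq_rpow]
  congr 2
  ring

lemma planch_reg {U : ℝ → ℂ} (hUm : Measurable U) (hU : Integrable U) (h2 : Integrable fun l => ‖U l‖ ^ 2) {δ : ℝ} (hδ : 0 < δ) :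
    Integrable (fun x : ℝ => Real.exp (-(δ * x ^ 2)) * ‖∫ l : ℝ, U l * Complex.exp (-Complex.I * (l * x))‖ ^ 2) ∧
    ∫ x : ℝ, Real.exp (-(δ * x ^ 2)) * ‖∫ l : ℝ, U l * Complex.exp (-Complex.I * (l * x))‖ ^ 2 ≤
      2 * π * ∫ l, ‖U l‖ ^ 2 := by
  have hpi := Real.pi_pos
  set F : ℝ × ℝ → ℂ := fun p => ((Real.exp (-(δ / 2 * p.1 ^ 2)) : ℝ) : ℂ) * (U p.2 * Complex.exp (-Complex.I * (p.2 * p.1))) with hF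
  have nexp : ∀ r s : ℝ, ‖Complex.exp (-Complex.I * (r * s))‖ = 1 := by
    intro r s
    rw [Complex.norm_exp]; simp
  have hFm : Measurable F := by
    refine (Complex.measurable_ofReal.comp (by fun_prop)).mul ((hUm.comp measurable_snd).mul ?_)
    fun_prop
  have hgs : Integrable fun x : ℝ => Real.exp (-(δ / 2 * x ^ 2)) ^ 2 := by
    have := integrable_exp_neg_mul_sq hδ
    refine this.congr (ae_of_all _ fun x => ?_)
    simp only
    rw [← Real.exp_nat_mul]; congr 1; push_cast; ring
  have hG : ∀ x l, ‖F (x, l)‖ ≤ Real.exp (-(δ / 2 * x ^ 2)) * ‖U l‖ := by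
    intro x l
    rw [hF]
    simp only
    rw [norm_mul, norm_mul, nexp, mul_one, Complex.norm_real, Real.norm_of_nonneg (Real.exp_pos _).le]
  obtain ⟨i1, i2⟩ := ttstar hFm hG hgs hU.norm
  have e1 : ∀ x : ℝ, ‖∫ l, F (x, l)‖ ^ 2 = Real.exp (-(δ * x ^ 2)) * ‖∫ l : ℝ, U l * Complex.exp (-Complex.I * (l * x))‖ ^ 2 := by
    intro x
    simp only [hF]
    rw [integral_const_mul, norm_mul, mul_pow, Complex.norm_real, Real.norm_of_nonneg (Real.exp_pos _).le, ← Real.exp_nat_mul]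
    congr 2; push_cast; ring
  simp_rw [e1] at i1 i2
  refine ⟨i1, ?_⟩
  have e2 : ∀ p : ℝ × ℝ, ∫ x, F (x, p.1) * conj (F (x, p.2)) = U p.1 * conj (U p.2) *
      ((√(π / δ) * Real.exp (-((p.1 - p.2) ^ 2 / (4 * δ))) : ℝ) : ℂ) := by
    intro p
    rw [← gauss_ft hδ (p.1 - p.2), ← integral_const_mul]
    congr 1
    funext x
    simp only [hF, map_mul, Complex.conj_ofReal, ← Complex.exp_conj, map_neg, Complex.conj_I]
    have q1 : ((Real.exp (-(δ * x ^ 2)) : ℝ) : ℂ) = ((Real.exp (-(δ / 2 * x ^ 2)) : ℝ) : ℂ) * ((Real.exp (-(δ / 2 * x ^ 2)) : ℝ) : ℂ) := by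
      rw [← Complex.ofReal_mul, ← Real.exp_add]; congr 2; ring
    have q2 : Complex.exp (-Complex.I * (((p.1 - p.2 : ℝ) : ℂ) * x)) = Complex.exp (-Complex.I * (p.1 * x)) * Complex.exp (- -Complex.I * (p.2 * x)) := by
      rw [← Complex.exp_add]; congr 1; push_cast; ring
    rw [q1, q2]
    ring
  simp_rw [e2] at i2
  have e3 : ∀ l : ℝ, ∫ l' : ℝ, √(π / δ) * Real.exp (-((l - l') ^ 2 / (4 * δ))) = 2 * π := by
    intro l
    rw [integral_const_mul, integral_sub_left_eq_self (fun w => Real.exp (-(w ^ 2 / (4 * δ)))) volume l]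
    have := integral_gaussian (1 / (4 * δ))
    have q : ∀ w : ℝ, Real.exp (-(w ^ 2 / (4 * δ))) = Real.exp (-(1 / (4 * δ)) * w ^ 2) := by
      intro w; congr 1; ring
    simp_rw [q]
    rw [this, ← Real.sqrt_mul (by positivity)]
    have : π / δ * (π / (1 / (4 * δ))) = (2 * π) ^ 2 := by field_simp; ring
    rw [this, Real.sqrt_sq (by positivity)]
  have e3i : Integrable (fun w : ℝ => √(π / δ) * Real.exp (-(w ^ 2 / (4 * δ)))) := by
    have := (integrable_exp_neg_mul_sq (b := 1 / (4 * δ)) (by positivity)).const_mul (√(π / δ))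
    refine this.congr (ae_of_all _ fun w => ?_)
    simp only
    congr 2; ring
  set g : ℝ → ℝ := fun w => √(π / δ) * Real.exp (-(w ^ 2 / (4 * δ))) with hg
  have hg0 : ∀ w, 0 ≤ g w := fun w => by positivity
  have hge : ∀ w, g (-w) = g w := fun w => by simp only [hg, neg_sq]
  -- product integrability of ‖U l‖² g(l - l')
  have j1 : Integrable (fun p : ℝ × ℝ => ‖U p.1‖ ^ 2 * g (p.1 - p.2)) (volume.prod volume) := by
    have hm : Measurable fun p : ℝ × ℝ => ‖U p.1‖ ^ 2 * g (p.1 - p.2) := by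
      have : Measurable g := by fun_prop
      exact ((hUm.comp measurable_fst).norm.pow_const 2).mul (this.comp (measurable_fst.sub measurable_snd))
    rw [integrable_prod_iff hm.aestronglyMeasurable]
    constructor
    · exact ae_of_all _ fun l => (e3i.comp_sub_left l).const_mul (‖U l‖ ^ 2)
    · have : ∀ l, ∫ l', ‖‖U l‖ ^ 2 * g (l - l')‖ = ‖U l‖ ^ 2 * (2 * π) := by
        intro l
        rw [← e3 l, ← integral_const_mul]
        congr 1; funext l'
        rw [Real.norm_of_nonneg]
        have := hg0 (l - l')
        positivity
      simp_rw [this]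
      exact h2.mul_const _
  have j2 : Integrable (fun p : ℝ × ℝ => ‖U p.2‖ ^ 2 * g (p.1 - p.2)) (volume.prod volume) := by
    have := j1.swap
    refine this.congr (ae_of_all _ fun p => ?_)
    simp only [Function.comp_apply, Prod.fst_swap, Prod.snd_swap]
    rw [← hge, neg_sub]
  have v1 : ∫ p : ℝ × ℝ, ‖U p.1‖ ^ 2 * g (p.1 - p.2) ∂(volume.prod volume) = 2 * π * ∫ l, ‖U l‖ ^ 2 := by
    rw [integral_prod _ j1]
    simp_rw [integral_const_mul]
    have : ∀ x, ∫ y, g (x - y) = 2 * π := e3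
    simp_rw [this]
    rw [integral_mul_const, mul_comm]
  have v2 : ∫ p : ℝ × ℝ, ‖U p.2‖ ^ 2 * g (p.1 - p.2) ∂(volume.prod volume) = 2 * π * ∫ l, ‖U l‖ ^ 2 := by
    rw [← v1, ← integral_prod_swap]
    congr 1; funext p
    simp only [Prod.fst_swap, Prod.snd_swap]
    rw [← hge, neg_sub]
  have fin : ‖((∫ x : ℝ, Real.exp (-(δ * x ^ 2)) * ‖∫ l : ℝ, U l * Complex.exp (-Complex.I * (l * x))‖ ^ 2 : ℝ) : ℂ)‖ ≤
      2 * π * ∫ l, ‖U l‖ ^ 2 := by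
    rw [i2]
    calc _ ≤ ∫ p : ℝ × ℝ, (1/2) * (‖U p.1‖ ^ 2 * g (p.1 - p.2) + ‖U p.2‖ ^ 2 * g (p.1 - p.2)) ∂(volume.prod volume) := by
          apply norm_integral_le_of_norm_le ((j1.add j2).const_mul _)
          refine ae_of_all _ fun p => ?_
          rw [norm_mul, norm_mul, RCLike.norm_conj, Complex.norm_real, Real.norm_of_nonneg (hg0 (p.1 - p.2))]
          have := hg0 (p.1 - p.2)
          simp only [Pi.add_apply]
          nlinarith [mul_nonneg this (sq_nonneg (‖U p.1‖ - ‖U p.2‖))]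
      _ = _ := by
          rw [integral_const_mul, integral_add j1 j2, v1, v2]; ring
  rw [Complex.norm_real] at fin
  exact (le_abs_self _).trans fin

/-- Plancherel inequality. -/
lemma planch {U : ℝ → ℂ} (hUm : Measurable U) (hU : Integrable U) :
    ∫⁻ x : ℝ, ‖∫ l : ℝ, U l * Complex.exp (-Complex.I * (l * x))‖ₑ ^ 2 ≤ ENNReal.ofReal (2 * π) * ∫⁻ l, ‖U l‖ₑ ^ 2 := by
  have hpi := Real.pi_pos
  have hU2e : ∀ l, ‖U l‖ₑ ^ 2 = ENNReal.ofReal (‖U l‖ ^ 2) := fun l => by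
    rw [ENNReal.ofReal_pow (norm_nonneg _), ofReal_norm]
  by_cases htop : ∫⁻ l, ‖U l‖ₑ ^ 2 = ⊤
  · rw [htop, ENNReal.mul_top (by simpa using hpi)]; exact le_top
  have h2 : Integrable fun l => ‖U l‖ ^ 2 := by
    refine ⟨(hUm.norm.pow_const 2).aestronglyMeasurable, ?_⟩
    rw [hasFiniteIntegral_iff_ofReal (ae_of_all _ fun l => by positivity)]
    simp_rw [← hU2e]
    exact lt_top_iff_ne_top.2 htop
  set V : ℝ → ℂ := fun x => ∫ l : ℝ, U l * Complex.exp (-Complex.I * (l * x)) with hV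
  have hVm : Measurable V := by
    have : Measurable fun p : ℝ × ℝ => U p.2 * Complex.exp (-Complex.I * (p.2 * p.1)) :=
      (hUm.comp measurable_snd).mul (by fun_prop)
    exact this.stronglyMeasurable.integral_prod_right.measurable
  have key : ∀ k : ℕ, ∫⁻ x, ENNReal.ofReal (Real.exp (-(1 / ((k:ℝ) + 1) * x ^ 2)) * ‖V x‖ ^ 2) ≤
      ENNReal.ofReal (2 * π) * ∫⁻ l, ‖U l‖ₑ ^ 2 := by
    intro k
    obtain ⟨q1, q2⟩ := planch_reg hUm hU h2 (δ := 1 / ((k:ℝ) + 1)) (by positivity)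
    rw [← ofReal_integral_eq_lintegral_ofReal q1 (ae_of_all _ fun x => by positivity)]
    simp_rw [hU2e]
    rw [← ofReal_integral_eq_lintegral_ofReal h2 (ae_of_all _ fun x => by positivity), ← ENNReal.ofReal_mul (by positivity)]
    exact ENNReal.ofReal_le_ofReal q2
  have hlim : ∀ x, Tendsto (fun k : ℕ => ENNReal.ofReal (Real.exp (-(1 / ((k:ℝ) + 1) * x ^ 2)) * ‖V x‖ ^ 2)) atTop
      (nhds (‖V x‖ₑ ^ 2)) := by
    intro x
    have : ‖V x‖ₑ ^ 2 = ENNReal.ofReal (Real.exp (-(0 * x ^ 2)) * ‖V x‖ ^ 2) := by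
      rw [zero_mul, neg_zero, Real.exp_zero, one_mul, ENNReal.ofReal_pow (norm_nonneg _), ofReal_norm]
    rw [this]
    apply ENNReal.tendsto_ofReal
    apply Tendsto.mul_const
    apply (Real.continuous_exp.tendsto _).comp
    apply Tendsto.neg
    exact tendsto_one_div_add_atTop_nhds_zero_nat.mul_const _
  calc _ = ∫⁻ x, liminf (fun k : ℕ => ENNReal.ofReal (Real.exp (-(1 / ((k:ℝ) + 1) * x ^ 2)) * ‖V x‖ ^ 2)) atTop :=
        lintegral_congr fun x => (hlim x).liminf_eq.symm
    _ ≤ liminf (fun k : ℕ => ∫⁻ x, ENNReal.ofReal (Real.exp (-(1 / ((k:ℝ) + 1) * x ^ 2)) * ‖V x‖ ^ 2)) atTop :=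
        lintegral_liminf_le fun k => by fun_prop
    _ ≤ _ := by
        refine (liminf_le_liminf (Eventually.of_forall key)).trans ?_
        simp
end GR

namespace GR
open scoped ENNReal
variable {n : ℕ}

/-! ### Part 13: Gaussian calculus at a fixed frequency -/

lemma integrable_gauss {b : ℝ} (hb : 0 < b) : Integrable fun x : EE n => Real.exp (-(b * ‖x‖ ^ 2)) := by
  refine ⟨(by fun_prop : Continuous _).aestronglyMeasurable, ?_⟩
  rw [hasFiniteIntegral_iff_ofReal (ae_of_all _ fun x => (Real.exp_pos _).le)]
  have := lint_gauss (n := n) hb 0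
  simp only [sub_zero] at this
  rw [this]
  exact ENNReal.ofReal_lt_top

lemma integral_gauss {b : ℝ} (hb : 0 < b) : ∫ x : EE n, Real.exp (-(b * ‖x‖ ^ 2)) = (π / b) ^ NN n := by
  have := lint_gauss (n := n) hb 0
  simp only [sub_zero] at this
  rw [← ofReal_integral_eq_lintegral_ofReal (integrable_gauss hb) (ae_of_all _ fun x => (Real.exp_pos _).le)] at this
  rwa [ENNReal.ofReal_eq_ofReal_iff (integral_nonneg fun x => (Real.exp_pos _).le)] at this
  have := Real.pi_pos
  positivity

lemma sq_exp_le {b s : ℝ} (hb : 0 < b) : s * Real.exp (-(b * s)) ≤ 2 / b * Real.exp (-(b / 2 * s)) := by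
  have e : Real.exp (-(b * s)) = Real.exp (-(b / 2 * s)) * Real.exp (-(b / 2 * s)) := by
    rw [← Real.exp_add]; congr 1; ring
  have h := Real.add_one_le_exp (b / 2 * s)
  have h2 : s ≤ 2 / b * Real.exp (b / 2 * s) := by
    rw [div_mul_eq_mul_div, le_div_iff₀ hb]; linarith
  rw [e, ← mul_assoc]
  apply mul_le_mul_of_nonneg_right _ (Real.exp_pos _).le
  calc _ ≤ 2 / b * Real.exp (b / 2 * s) * Real.exp (-(b / 2 * s)) := mul_le_mul_of_nonneg_right h2 (Real.exp_pos _).le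
    _ = _ := by rw [mul_assoc, ← Real.exp_add, add_neg_cancel, Real.exp_zero, mul_one]

lemma integrable_gauss2 {b : ℝ} (hb : 0 < b) : Integrable fun x : EE n => ‖x‖ ^ 2 * Real.exp (-(b * ‖x‖ ^ 2)) := by
  refine ((integrable_gauss (n := n) (half_pos hb)).const_mul (2 / b)).mono'
    (by fun_prop : Continuous _).aestronglyMeasurable (ae_of_all _ fun x => ?_)
  rw [Real.norm_of_nonneg (by positivity)]
  exact sq_exp_le hb

lemma integral_gauss2 {b : ℝ} (hb : 0 < b) :
    ∫ x : EE n, ‖x‖ ^ 2 * Real.exp (-(b * ‖x‖ ^ 2)) = NN n / b * (π / b) ^ NN n := by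
  have hpi := Real.pi_pos
  have h := hasDerivAt_integral_of_dominated_loc_of_deriv_le (μ := (volume : Measure (EE n)))
    (F := fun c x => Real.exp (-(c * ‖x‖ ^ 2))) (F' := fun c x => -(‖x‖ ^ 2 * Real.exp (-(c * ‖x‖ ^ 2)))) (x₀ := b)
    (s := Ioi (b / 2)) (bound := fun x => ‖x‖ ^ 2 * Real.exp (-(b / 2 * ‖x‖ ^ 2))) (Ioi_mem_nhds (by linarith))
    (Eventually.of_forall fun c => (by fun_prop : Continuous _).aestronglyMeasurable) (integrable_gauss hb)
    (by fun_prop : Continuous _).aestronglyMeasurable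
    (ae_of_all _ fun x c hc => by
      rw [norm_neg, Real.norm_of_nonneg (by positivity)]
      apply mul_le_mul_of_nonneg_left _ (by positivity)
      apply Real.exp_le_exp.2
      have : b / 2 * ‖x‖ ^ 2 ≤ c * ‖x‖ ^ 2 := mul_le_mul_of_nonneg_right (le_of_lt hc) (by positivity)
      linarith)
    (integrable_gauss2 (half_pos hb))
    (ae_of_all _ fun x c _ => by
      have := (((hasDerivAt_id c).mul_const (‖x‖ ^ 2)).neg).exp
      refine this.congr_deriv ?_
      simp; ring)
  have h2 : HasDerivAt (fun c : ℝ => (π / c) ^ NN n) (-(NN n / b * (π / b) ^ NN n)) b := by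
    have h0 : HasDerivAt (fun c : ℝ => π / c) (-(π / b ^ 2)) b := by
      have := (hasDerivAt_inv hb.ne').const_mul π
      refine this.congr_deriv ?_
      field_simp
    refine (h0.rpow_const (Or.inl (by positivity))).congr_deriv ?_
    rw [Real.rpow_sub_one (by positivity)]
    field_simp
  have h3 : (fun c : ℝ => ∫ x : EE n, Real.exp (-(c * ‖x‖ ^ 2))) =ᶠ[nhds b] fun c => (π / c) ^ NN n := by
    filter_upwards [Ioi_mem_nhds hb] with c hc using integral_gauss hc
  have h4 := (h.2.congr_of_eventuallyEq h3.symm).unique h2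
  rw [integral_neg] at h4
  linarith

lemma integrable_gauss1 {b : ℝ} (hb : 0 < b) (v : EE n) :
    Integrable fun x : EE n => inner ℝ v x * Real.exp (-(b * ‖x‖ ^ 2)) := by
  refine (((integrable_gauss (n := n) hb).add (integrable_gauss2 hb)).const_mul ‖v‖).mono'
    (by fun_prop : Continuous _).aestronglyMeasurable (ae_of_all _ fun x => ?_)
  rw [norm_mul, Real.norm_of_nonneg (Real.exp_pos _).le]
  have h1 : ‖inner ℝ v x‖ ≤ ‖v‖ * ‖x‖ := norm_inner_le_norm v x
  have h2 : ‖x‖ ≤ 1 + ‖x‖ ^ 2 := by nlinarith [sq_nonneg (‖x‖ - 1/2)]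
  have h3 : ‖inner ℝ v x‖ ≤ ‖v‖ * (1 + ‖x‖ ^ 2) := h1.trans (mul_le_mul_of_nonneg_left h2 (norm_nonneg _))
  calc _ ≤ ‖v‖ * (1 + ‖x‖ ^ 2) * Real.exp (-(b * ‖x‖ ^ 2)) := mul_le_mul_of_nonneg_right h3 (Real.exp_pos _).le
    _ = _ := by simp only [Pi.add_apply]; ring

lemma integral_gauss1 {b : ℝ} (v : EE n) : ∫ x : EE n, inner ℝ v x * Real.exp (-(b * ‖x‖ ^ 2)) = 0 := by
  have h := integral_neg_eq_self (fun x : EE n => inner ℝ v x * Real.exp (-(b * ‖x‖ ^ 2))) volume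
  simp only [norm_neg, inner_neg_right, neg_mul] at h
  rw [integral_neg] at h
  linarith

lemma gauss_quad {b : ℝ} (hb : 0 < b) (M q : ℝ) (v w : EE n) :
    Integrable (fun x : EE n => (M * ‖x - w‖ ^ 2 + inner ℝ v (x - w) + q) * Real.exp (-(b * ‖x - w‖ ^ 2))) ∧
    ∫ x : EE n, (M * ‖x - w‖ ^ 2 + inner ℝ v (x - w) + q) * Real.exp (-(b * ‖x - w‖ ^ 2)) =
      (M * (NN n / b) + q) * (π / b) ^ NN n := by
  have i2 := (integrable_gauss2 (n := n) hb).const_mul M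
  have i1 := integrable_gauss1 hb v
  have i0 := (integrable_gauss (n := n) hb).const_mul q
  have e : (fun x : EE n => (M * ‖x‖ ^ 2 + inner ℝ v x + q) * Real.exp (-(b * ‖x‖ ^ 2))) =
    fun x => (M * (‖x‖ ^ 2 * Real.exp (-(b * ‖x‖ ^ 2))) + inner ℝ v x * Real.exp (-(b * ‖x‖ ^ 2))) + q * Real.exp (-(b * ‖x‖ ^ 2)) := by
    funext x; ring
  have i : Integrable (fun x : EE n => (M * ‖x‖ ^ 2 + inner ℝ v x + q) * Real.exp (-(b * ‖x‖ ^ 2))) := by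
    rw [e]; exact (i2.add i1).add i0
  refine ⟨i.comp_sub_right w, ?_⟩
  have i21 := i2.add i1
  simp only [Pi.add_def] at i21
  rw [integral_sub_right_eq_self (fun x : EE n => (M * ‖x‖ ^ 2 + inner ℝ v x + q) * Real.exp (-(b * ‖x‖ ^ 2))) w, e,
    integral_add i21 i0, integral_add i2 i1, integral_const_mul, integral_const_mul, integral_gauss2 hb, integral_gauss hb,
    integral_gauss1]
  ring

def bb (l t : ℝ) : ℝ := 1 / (4 * t * hh (l * t))
def pp (l t : ℝ) : ℝ := bb l t + cc (l * t) / (2 * t)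

lemma cc_nonneg (u : ℝ) : 0 ≤ cc u := le_trans (by positivity) (cc_lower u)
lemma bb_pos (l : ℝ) {t : ℝ} (ht : 0 < t) : 0 < bb l t := by
  have := hh_pos (l * t); unfold bb; positivity
lemma bb_le_pp (l : ℝ) {t : ℝ} (ht : 0 < t) : bb l t ≤ pp l t := by
  unfold pp
  have := div_nonneg (cc_nonneg (l * t)) (by positivity : 0 ≤ 2 * t)
  linarith
lemma pp_pos (l : ℝ) {t : ℝ} (ht : 0 < t) : 0 < pp l t := (bb_pos l ht).trans_le (bb_le_pp l ht)

lemma bb_eq {l t : ℝ} (hl : l ≠ 0) (ht : 0 < t) : bb l t = (l / 2) / Real.sinh (2 * (l * t)) := by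
  unfold bb
  have : l * t ≠ 0 := mul_ne_zero hl ht.ne'
  have hs : Real.sinh (2 * (l * t)) ≠ 0 := by simpa using ⟨hl, ht.ne'⟩
  rw [hh_eq this]
  field_simp; norm_num

lemma pp_eq {l t : ℝ} (hl : l ≠ 0) (ht : 0 < t) : pp l t = (l / 2) * Real.cosh (2 * (l * t)) / Real.sinh (2 * (l * t)) := by
  unfold pp
  rw [bb_eq hl ht]
  unfold cc
  have h0 : l * t ≠ 0 := mul_ne_zero hl ht.ne'
  have hs : Real.sinh (l * t) ≠ 0 := by simpa using ⟨hl, ht.ne'⟩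
  have hc := (Real.cosh_pos (l * t)).ne'
  have h1 := Real.cosh_sq (l * t)
  rw [Real.sinh_two_mul, Real.cosh_two_mul, h1]
  field_simp
  ring

lemma sh_ne {l t : ℝ} (hl : l ≠ 0) (ht : 0 < t) : Real.sinh (2 * (l * t)) ≠ 0 := by simpa using ⟨hl, ht.ne'⟩

lemma pb_sq {l t : ℝ} (hl : l ≠ 0) (ht : 0 < t) : pp l t ^ 2 - bb l t ^ 2 = l ^ 2 / 4 := by
  rw [bb_eq hl ht, pp_eq hl ht]
  have hs := sh_ne hl ht
  have h1 := Real.cosh_sq (2 * (l * t))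
  generalize Real.sinh (2 * (l * t)) = S at *
  generalize Real.cosh (2 * (l * t)) = C at *
  field_simp
  rw [h1]; ring

lemma pp_add {l t s : ℝ} (hl : l ≠ 0) (ht : 0 < t) (hs : 0 < s) :
    pp l t * pp l s + l ^ 2 / 4 = pp l (t + s) * (pp l t + pp l s) := by
  have h1 := sh_ne hl ht
  have h2 := sh_ne hl hs
  have h3 := sh_ne hl (add_pos ht hs)
  rw [pp_eq hl ht, pp_eq hl hs, pp_eq hl (add_pos ht hs)]
  rw [show 2 * (l * (t + s)) = 2 * (l * t) + 2 * (l * s) by ring] at h3 ⊢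
  rw [Real.sinh_add] at h3 ⊢
  rw [Real.cosh_add]
  generalize Real.sinh (2 * (l * t)) = S at *
  generalize Real.cosh (2 * (l * t)) = C at *
  generalize Real.sinh (2 * (l * s)) = S' at *
  generalize Real.cosh (2 * (l * s)) = C' at *
  field_simp
  ring

lemma bb_add {l t s : ℝ} (hl : l ≠ 0) (ht : 0 < t) (hs : 0 < s) :
    bb l t * bb l s = bb l (t + s) * (pp l t + pp l s) := by
  have h1 := sh_ne hl ht
  have h2 := sh_ne hl hs
  have h3 := sh_ne hl (add_pos ht hs)
  rw [pp_eq hl ht, pp_eq hl hs, bb_eq hl ht, bb_eq hl hs, bb_eq hl (add_pos ht hs)]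
  rw [show 2 * (l * (t + s)) = 2 * (l * t) + 2 * (l * s) by ring] at h3 ⊢
  rw [Real.sinh_add] at h3 ⊢
  generalize Real.sinh (2 * (l * t)) = S at *
  generalize Real.cosh (2 * (l * t)) = C at *
  generalize Real.sinh (2 * (l * s)) = S' at *
  generalize Real.cosh (2 * (l * s)) = C' at *
  generalize l / 2 = m
  rw [div_mul_div_comm, div_add_div _ _ h1 h2, div_mul_div_comm, div_eq_div_iff (mul_ne_zero h1 h2) (mul_ne_zero h3 (mul_ne_zero h1 h2))]
  ring

lemma hasDerivAt_bb {l t : ℝ} (hl : l ≠ 0) (ht : 0 < t) : HasDerivAt (bb l) (-(4 * pp l t * bb l t)) t := by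
  have hs := sh_ne hl ht
  have h1 : HasDerivAt (fun r : ℝ => 2 * (l * r)) (2 * l) t := by
    have := ((hasDerivAt_id t).const_mul l).const_mul 2
    refine this.congr_deriv ?_; simp
  have h2 : HasDerivAt (fun r => (l / 2) / Real.sinh (2 * (l * r))) (-(4 * pp l t * bb l t)) t := by
    refine ((hasDerivAt_const t (l / 2)).fun_div h1.sinh hs).congr_deriv ?_
    rw [bb_eq hl ht, pp_eq hl ht]
    field_simp; ring
  apply h2.congr_of_eventuallyEq
  filter_upwards [Ioi_mem_nhds ht] with r hr using bb_eq hl hr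

lemma hasDerivAt_pp {l t : ℝ} (hl : l ≠ 0) (ht : 0 < t) : HasDerivAt (pp l) (-(4 * bb l t ^ 2)) t := by
  have hs := sh_ne hl ht
  have h1 : HasDerivAt (fun r : ℝ => 2 * (l * r)) (2 * l) t := by
    have := ((hasDerivAt_id t).const_mul l).const_mul 2
    refine this.congr_deriv ?_; simp
  have h2 : HasDerivAt (fun r => (l / 2) * Real.cosh (2 * (l * r)) / Real.sinh (2 * (l * r))) (-(4 * bb l t ^ 2)) t := by
    refine ((h1.cosh.const_mul (l / 2)).fun_div h1.sinh hs).congr_deriv ?_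
    rw [bb_eq hl ht]
    have h1 := Real.cosh_sq (2 * (l * t))
    generalize Real.sinh (2 * (l * t)) = S at *
    generalize Real.cosh (2 * (l * t)) = C at *
    field_simp
    linear_combination (-4) * h1
  apply h2.congr_of_eventuallyEq
  filter_upwards [Ioi_mem_nhds ht] with r hr using pp_eq hl hr

/-- drifted Mehler kernel -/
def kk (a : EE n) (l t : ℝ) (x y : EE n) : ℝ :=
  Real.exp (-(‖a‖ ^ 2 * t)) * (bb l t / π) ^ NN n * Real.exp (-(pp l t * (‖x‖ ^ 2 + ‖y‖ ^ 2)) + 2 * bb l t * inner ℝ x y)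

def DK (a : EE n) (l t : ℝ) (x y : EE n) : ℝ :=
  kk a l t x y * (‖a‖ ^ 2 + 4 * NN n * pp l t - 4 * bb l t ^ 2 * (‖x‖ ^ 2 + ‖y‖ ^ 2) + 8 * pp l t * bb l t * inner ℝ x y)

def sg (κ : Kap n) (a : EE n) (l t : ℝ) (x y : EE n) : ℝ :=
  match κ with
  | Sum.inl j => -(2 * pp l t * x j - 2 * bb l t * y j) - a j
  | Sum.inr j => l * x j.1

lemma hasDerivAt_kk (a : EE n) {l t : ℝ} (hl : l ≠ 0) (ht : 0 < t) (x y : EE n) :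
    HasDerivAt (fun r => kk a l r x y) (-(DK a l t x y)) t := by
  have hb := hasDerivAt_bb hl ht
  have hp := hasDerivAt_pp hl ht
  have hb0 := bb_pos l ht
  have hpi := Real.pi_pos
  have h1 : HasDerivAt (fun r : ℝ => Real.exp (-(‖a‖ ^ 2 * r))) (Real.exp (-(‖a‖ ^ 2 * t)) * (-(‖a‖ ^ 2))) t := by
    have := (((hasDerivAt_id t).const_mul (‖a‖ ^ 2)).neg).exp
    refine this.congr_deriv ?_
    simp
  have h2 : HasDerivAt (fun r : ℝ => (bb l r / π) ^ NN n) ((bb l t / π) ^ NN n * (-(4 * NN n * pp l t))) t := by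
    refine ((hb.div_const π).rpow_const (Or.inl (by positivity))).congr_deriv ?_
    rw [Real.rpow_sub_one (by positivity)]
    field_simp
  have h3 : HasDerivAt (fun r : ℝ => Real.exp (-(pp l r * (‖x‖ ^ 2 + ‖y‖ ^ 2)) + 2 * bb l r * inner ℝ x y))
      (Real.exp (-(pp l t * (‖x‖ ^ 2 + ‖y‖ ^ 2)) + 2 * bb l t * inner ℝ x y) *
        (-(-(4 * bb l t ^ 2) * (‖x‖ ^ 2 + ‖y‖ ^ 2)) + 2 * -(4 * pp l t * bb l t) * inner ℝ x y)) t :=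
    (((hp.mul_const _).neg).add ((hb.const_mul 2).mul_const _)).exp
  refine ((h1.fun_mul h2).fun_mul h3).congr_deriv ?_
  unfold DK kk
  ring

lemma sg_sum (a : EE n) (l t s : ℝ) (x y y' : EE n) :
    ∑ κ : Kap n, sg κ a l t x y * sg κ a l s x y' =
      (4 * pp l t * pp l s + l ^ 2) * ‖x‖ ^ 2 - 4 * pp l t * bb l s * inner ℝ x y' - 4 * pp l s * bb l t * inner ℝ x y
      + 4 * bb l t * bb l s * inner ℝ y y' + 2 * (pp l t + pp l s) * inner ℝ a x
      - 2 * (bb l t * inner ℝ a y + bb l s * inner ℝ a y') + ‖a‖ ^ 2 := by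
  have hin : ∀ u v : EE n, inner ℝ u v = ∑ j, u j * v j := by
    intro u v
    simp only [PiLp.inner_apply]
    refine Finset.sum_congr rfl fun j _ => ?_
    simp [mul_comm]
  have hnm : ∀ u : EE n, ‖u‖ ^ 2 = ∑ j, u j * u j := by
    intro u
    rw [← real_inner_self_eq_norm_sq, hin]
  rw [Fintype.sum_sum_type]
  simp only [sg]
  rw [Fintype.sum_prod_type]
  simp only [Fin.sum_univ_one, Finset.univ_unique, Finset.sum_singleton]
  rw [hin, hin, hin, hin, hin, hin, hnm, hnm]
  simp only [Finset.mul_sum, mul_add (2:ℝ), ← Finset.sum_add_distrib, ← Finset.sum_sub_distrib]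
  refine Finset.sum_congr rfl fun j _ => ?_
  ring

end GR

namespace GR
open scoped ENNReal ComplexConjugate
variable {n : ℕ}

/-! ### Part 14: the T T* identity at a fixed frequency -/

lemma quad_shift (M e : ℝ) (v w x : EE n) :
    M * ‖x‖ ^ 2 + inner ℝ v x + e =
      M * ‖x - w‖ ^ 2 + inner ℝ ((2 * M) • w + v) (x - w) + (M * ‖w‖ ^ 2 + inner ℝ v w + e) := by
  rw [norm_sub_sq_real, inner_sub_right, inner_add_left, inner_add_left, real_inner_smul_left, real_inner_smul_left,
    real_inner_self_eq_norm_sq, real_inner_comm w x]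
  ring

/-- the frequency-`l` composition data -/
lemma pp_sub {l t s : ℝ} (hl : l ≠ 0) (ht : 0 < t) (hs : 0 < s) :
    (pp l t - pp l (t + s)) * (pp l t + pp l s) = bb l t ^ 2 := by
  have h1 := pp_add hl ht hs
  have h2 := pb_sq hl ht
  linarith [h1, h2, sq (pp l t), mul_comm (pp l t) (pp l s)]

lemma pp_sub' {l t s : ℝ} (hl : l ≠ 0) (ht : 0 < t) (hs : 0 < s) :
    (pp l s - pp l (t + s)) * (pp l t + pp l s) = bb l s ^ 2 := by
  have := pp_sub hl hs ht
  rw [add_comm s t, add_comm (pp l s)] at this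
  exact this

lemma alg_exp {p p' b b' pr br Y Y' Z : ℝ} (hP : 0 < p + p') (h1 : b * b' = br * (p + p'))
    (h2 : (p - pr) * (p + p') = b ^ 2) (h3 : (p' - pr) * (p + p') = b' ^ 2) :
    -(p * Y) - p' * Y' + (b ^ 2 * Y + 2 * (b * b') * Z + b' ^ 2 * Y') / (p + p') =
      -(pr * (Y + Y')) + 2 * br * Z := by
  rw [← h2, ← h3, h1]
  field_simp
  ring

lemma alg_q {p p' b b' pr br Y Y' Z A L : ℝ} (hP : 0 < p + p') (h1 : b * b' = br * (p + p'))
    (h2 : (p - pr) * (p + p') = b ^ 2) (h3 : (p' - pr) * (p + p') = b' ^ 2)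
    (h4 : p * p' + L / 4 = pr * (p + p')) :
    (4 * p * p' + L) * ((b ^ 2 * Y + 2 * (b * b') * Z + b' ^ 2 * Y') / (p + p') ^ 2)
      + (-(4 * p * b' * (b * Z + b' * Y')) - 4 * p' * b * (b * Y + b' * Z)) / (p + p')
      + (4 * b * b' * Z + A) = A - 4 * br ^ 2 * (Y + Y') + 8 * pr * br * Z := by
  have e : 4 * p * p' + L = 4 * (pr * (p + p')) := by linarith
  have h5 : (p' - pr) * b ^ 2 = br ^ 2 * (p + p') := by
    have : (p' - pr) * b ^ 2 * (p + p') = br ^ 2 * (p + p') * (p + p') := by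
      calc _ = ((p' - pr) * (p + p')) * b ^ 2 := by ring
        _ = (b * b') ^ 2 := by rw [h3]; ring
        _ = _ := by rw [h1]; ring
    exact mul_right_cancel₀ hP.ne' this
  have h6 : (p - pr) * b' ^ 2 = br ^ 2 * (p + p') := by
    have : (p - pr) * b' ^ 2 * (p + p') = br ^ 2 * (p + p') * (p + p') := by
      calc _ = ((p - pr) * (p + p')) * b' ^ 2 := by ring
        _ = (b * b') ^ 2 := by rw [h2]; ring
        _ = _ := by rw [h1]; ring
    exact mul_right_cancel₀ hP.ne' this
  rw [e]
  generalize hPd : p + p' = P at *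
  have hP0 := hP.ne'
  field_simp
  have hp : p' = P - p := by linarith
  linear_combination (8 * pr * Z) * h1 - (4 * Y) * h5 - (4 * Y') * h6 - (4 * Z * b * b') * hp

lemma kk_prod (a : EE n) {l t s : ℝ} (ht : 0 < t) (hs : 0 < s) (x y y' : EE n) :
    kk a l t x y * kk a l s x y' =
      (Real.exp (-(‖a‖ ^ 2 * (t + s))) * (bb l t * bb l s / π ^ 2) ^ NN n *
        Real.exp (-(pp l t * ‖y‖ ^ 2) - pp l s * ‖y'‖ ^ 2 + ‖bb l t • y + bb l s • y'‖ ^ 2 / (pp l t + pp l s))) *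
      Real.exp (-((pp l t + pp l s) * ‖x - (pp l t + pp l s)⁻¹ • (bb l t • y + bb l s • y')‖ ^ 2)) := by
  have hpi := Real.pi_pos
  have hb := bb_pos l ht
  have hb' := bb_pos l hs
  have hP : 0 < pp l t + pp l s := add_pos (pp_pos l ht) (pp_pos l hs)
  have e1 : (bb l t * bb l s / π ^ 2) ^ NN n = (bb l t / π) ^ NN n * (bb l s / π) ^ NN n := by
    rw [← Real.mul_rpow (by positivity) (by positivity)]; congr 1; field_simp
  have e2 : Real.exp (-(‖a‖ ^ 2 * (t + s))) = Real.exp (-(‖a‖ ^ 2 * t)) * Real.exp (-(‖a‖ ^ 2 * s)) := by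
    rw [← Real.exp_add]; congr 1; ring
  have e3 : Real.exp (-(pp l t * ‖y‖ ^ 2) - pp l s * ‖y'‖ ^ 2 + ‖bb l t • y + bb l s • y'‖ ^ 2 / (pp l t + pp l s)) *
      Real.exp (-((pp l t + pp l s) * ‖x - (pp l t + pp l s)⁻¹ • (bb l t • y + bb l s • y')‖ ^ 2)) =
      Real.exp (-(pp l t * (‖x‖ ^ 2 + ‖y‖ ^ 2)) + 2 * bb l t * inner ℝ x y) *
      Real.exp (-(pp l s * (‖x‖ ^ 2 + ‖y'‖ ^ 2)) + 2 * bb l s * inner ℝ x y') := by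
    rw [← Real.exp_add, ← Real.exp_add]
    congr 1
    rw [norm_sub_sq_real, real_inner_smul_right, inner_add_right, real_inner_smul_right, real_inner_smul_right,
      norm_smul, Real.norm_of_nonneg (inv_nonneg.2 hP.le)]
    field_simp
    ring
  unfold kk
  rw [e1, e2]
  linear_combination (-(Real.exp (-(‖a‖ ^ 2 * t)) * Real.exp (-(‖a‖ ^ 2 * s)) * (bb l t / π) ^ NN n * (bb l s / π) ^ NN n)) * e3

lemma tt_id (a : EE n) {l t s : ℝ} (hl : l ≠ 0) (ht : 0 < t) (hs : 0 < s) (y y' : EE n) :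
    ∫ x : EE n, ∑ κ : Kap n, (sg κ a l t x y * kk a l t x y) * (sg κ a l s x y' * kk a l s x y') =
      DK a l (t + s) y y' := by
  have hpi := Real.pi_pos
  have hb := bb_pos l ht
  have hb' := bb_pos l hs
  have hbr := bb_pos l (add_pos ht hs)
  have hP : 0 < pp l t + pp l s := add_pos (pp_pos l ht) (pp_pos l hs)
  set P := pp l t + pp l s with hPd
  set c := bb l t • y + bb l s • y' with hc
  set w := P⁻¹ • c with hw
  set M := 4 * pp l t * pp l s + l ^ 2 with hM
  set v : EE n := (2 * P) • a - (4 * pp l t * bb l s) • y' - (4 * pp l s * bb l t) • y with hv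
  set e := 4 * bb l t * bb l s * inner ℝ y y' - 2 * inner ℝ a c + ‖a‖ ^ 2 with he
  set K := Real.exp (-(‖a‖ ^ 2 * (t + s))) * (bb l t * bb l s / π ^ 2) ^ NN n *
        Real.exp (-(pp l t * ‖y‖ ^ 2) - pp l s * ‖y'‖ ^ 2 + ‖c‖ ^ 2 / P) with hK
  have key : ∀ x : EE n, ∑ κ : Kap n, (sg κ a l t x y * kk a l t x y) * (sg κ a l s x y' * kk a l s x y') =
      K * ((M * ‖x - w‖ ^ 2 + inner ℝ ((2 * M) • w + v) (x - w) + (M * ‖w‖ ^ 2 + inner ℝ v w + e)) *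
        Real.exp (-(P * ‖x - w‖ ^ 2))) := by
    intro x
    rw [← quad_shift]
    have h1 : ∑ κ : Kap n, (sg κ a l t x y * kk a l t x y) * (sg κ a l s x y' * kk a l s x y') =
        (∑ κ : Kap n, sg κ a l t x y * sg κ a l s x y') * (kk a l t x y * kk a l s x y') := by
      rw [Finset.sum_mul]
      exact Finset.sum_congr rfl fun κ _ => by ring
    have h2 : ∑ κ : Kap n, sg κ a l t x y * sg κ a l s x y' = M * ‖x‖ ^ 2 + inner ℝ v x + e := by
      rw [sg_sum, hv, he, hc, inner_sub_left, inner_sub_left, real_inner_smul_left, real_inner_smul_left,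
        real_inner_smul_left, inner_add_right, real_inner_smul_right, real_inner_smul_right, real_inner_comm x y,
        real_inner_comm x y', hM, hPd]
      ring
    rw [h1, h2, kk_prod a ht hs]
    ring
  simp_rw [key]
  rw [integral_const_mul, (gauss_quad hP M _ _ w).2]
  have r1 := bb_add hl ht hs
  have r2 := pp_sub hl ht hs
  have r3 := pp_sub' hl ht hs
  have r4 := pp_add hl ht hs
  have nc : ‖c‖ ^ 2 = bb l t ^ 2 * ‖y‖ ^ 2 + 2 * (bb l t * bb l s) * inner ℝ y y' + bb l s ^ 2 * ‖y'‖ ^ 2 := by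
    rw [hc, norm_add_sq_real, norm_smul, norm_smul, real_inner_smul_left, real_inner_smul_right,
      Real.norm_of_nonneg hb.le, Real.norm_of_nonneg hb'.le]
    ring
  have hex : -(pp l t * ‖y‖ ^ 2) - pp l s * ‖y'‖ ^ 2 + ‖c‖ ^ 2 / P =
      -(pp l (t + s) * (‖y‖ ^ 2 + ‖y'‖ ^ 2)) + 2 * bb l (t + s) * inner ℝ y y' := by
    rw [nc]; exact alg_exp hP r1 r2 r3
  have hq : M * ‖w‖ ^ 2 + inner ℝ v w + e = ‖a‖ ^ 2 - 4 * bb l (t + s) ^ 2 * (‖y‖ ^ 2 + ‖y'‖ ^ 2) +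
      8 * pp l (t + s) * bb l (t + s) * inner ℝ y y' := by
    rw [← alg_q (A := ‖a‖ ^ 2) (L := l ^ 2) (Y := ‖y‖ ^ 2) (Y' := ‖y'‖ ^ 2) (Z := inner ℝ y y') hP r1 r2 r3 r4]
    have w2 : ‖w‖ ^ 2 = ‖c‖ ^ 2 / P ^ 2 := by
      rw [hw, norm_smul, Real.norm_of_nonneg (inv_nonneg.2 hP.le)]; field_simp
    have vc : inner ℝ v c = 2 * P * inner ℝ a c + (-(4 * pp l t * bb l s * (bb l t * inner ℝ y y' + bb l s * ‖y'‖ ^ 2)) -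
        4 * pp l s * bb l t * (bb l t * ‖y‖ ^ 2 + bb l s * inner ℝ y y')) := by
      rw [hv, inner_sub_left, inner_sub_left, real_inner_smul_left, real_inner_smul_left, real_inner_smul_left]
      have c1 : inner ℝ y' c = bb l t * inner ℝ y y' + bb l s * ‖y'‖ ^ 2 := by
        rw [hc, inner_add_right, real_inner_smul_right, real_inner_smul_right, real_inner_self_eq_norm_sq, real_inner_comm]
      have c2 : inner ℝ y c = bb l t * ‖y‖ ^ 2 + bb l s * inner ℝ y y' := by
        rw [hc, inner_add_right, real_inner_smul_right, real_inner_smul_right, real_inner_self_eq_norm_sq]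
      rw [c1, c2]; ring
    have vw : inner ℝ v w = 2 * inner ℝ a c + (-(4 * pp l t * bb l s * (bb l t * inner ℝ y y' + bb l s * ‖y'‖ ^ 2)) -
        4 * pp l s * bb l t * (bb l t * ‖y‖ ^ 2 + bb l s * inner ℝ y y')) / P := by
      rw [hw, real_inner_smul_right, vc]; field_simp
    rw [w2, vw, nc, he]; ring
  have hpre : (bb l t * bb l s / π ^ 2) ^ NN n * (π / P) ^ NN n = (bb l (t + s) / π) ^ NN n := by
    rw [← Real.mul_rpow (by positivity) (by positivity), r1, ← hPd]
    congr 1; field_simp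
  have hMP : M * (NN n / P) = 4 * NN n * pp l (t + s) := by
    have : M = 4 * (pp l (t + s) * P) := by rw [← r4]; ring
    rw [this]; field_simp
  rw [hK, hex, hq, hMP]
  unfold DK kk
  rw [← hpre]
  ring

end GR

namespace GR
open scoped ENNReal ComplexConjugate
variable {n : ℕ}

/-! ### Part 15: square function estimate at a fixed frequency -/

lemma bb_le (l : ℝ) {ε t : ℝ} (hε : 0 < ε) (ht : ε ≤ t) : bb l t ≤ 1 / (4 * ε) := by
  unfold bb
  apply one_div_le_one_div_of_le (by positivity)
  have h1 := one_le_hh (l * t)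
  nlinarith

lemma pp_le (l : ℝ) {ε t : ℝ} (hε : 0 < ε) (ht : ε ≤ t) : pp l t ≤ 1 / (4 * ε) + |l| / 2 := by
  unfold pp
  have h1 := bb_le l hε ht
  have h2 : cc (l * t) / (2 * t) ≤ |l| / 2 := by
    have h0 : 0 < t := hε.trans_le ht
    rw [div_le_iff₀ (by positivity)]
    have := (le_abs_self _).trans (cc_abs_le (l * t))
    rw [abs_mul, abs_of_pos h0] at this
    linarith
  linarith

lemma pb_lower {l ε t : ℝ} (hε : 0 < ε) (ht : ε ≤ t) (ht2 : t ≤ 2) :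
    l ^ 2 * ε / (2 * (1 + 2 * |l|)) ≤ pp l t - bb l t := by
  unfold pp
  have h0 : 0 < t := hε.trans_le ht
  have h1 := cc_lower (l * t)
  have h2 : l ^ 2 * ε / (2 * (1 + 2 * |l|)) ≤ ((l * t) ^ 2 / (1 + |l * t|)) / (2 * t) := by
    rw [abs_mul, abs_of_pos h0, div_div, div_le_div_iff₀ (by positivity) (by positivity)]
    have e1 : 1 + |l| * t ≤ 1 + 2 * |l| := by nlinarith [abs_nonneg l]
    calc l ^ 2 * ε * ((1 + |l| * t) * (2 * t)) ≤ l ^ 2 * t * ((1 + 2 * |l|) * (2 * t)) := by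
          gcongr
      _ = _ := by ring
  have h3 := div_le_div_of_nonneg_right h1 (by positivity : 0 ≤ 2 * t)
  linarith

lemma kk_pos (a : EE n) (l : ℝ) {t : ℝ} (ht : 0 < t) (x y : EE n) : 0 < kk a l t x y := by
  unfold kk
  have := bb_pos l ht
  have := Real.pi_pos
  positivity

lemma cross_le {b p X Y Z : ℝ} (hb : 0 ≤ b) (hZ : 2 * Z ≤ X + Y) :
    -(p * (X + Y)) + 2 * b * Z ≤ -((p - b) * (X + Y)) := by nlinarith

lemma two_inner_le (x y : EE n) : 2 * inner ℝ x y ≤ ‖x‖ ^ 2 + ‖y‖ ^ 2 := by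
  have := norm_sub_sq_real x y
  have h := sq_nonneg ‖x - y‖
  linarith

lemma two_inner_abs_le (x y : EE n) : 2 * |inner ℝ x y| ≤ ‖x‖ ^ 2 + ‖y‖ ^ 2 := by
  have := abs_real_inner_le_norm x y
  nlinarith [sq_nonneg (‖x‖ - ‖y‖)]

set_option maxHeartbeats 1000000 in
/-- Gaussian domination of the frequency-`l` kernels on `[ε,2]` -/
lemma dom (a : EE n) {l ε : ℝ} (hl : l ≠ 0) (hε : 0 < ε) : ∃ C δ : ℝ, 0 ≤ C ∧ 0 < δ ∧ ∀ t ∈ Icc ε 2, ∀ x y : EE n,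
    |kk a l t x y| ≤ C * (Real.exp (-(δ * ‖x‖ ^ 2)) * Real.exp (-(δ * ‖y‖ ^ 2))) ∧
    (∀ κ, |sg κ a l t x y * kk a l t x y| ≤ C * (Real.exp (-(δ * ‖x‖ ^ 2)) * Real.exp (-(δ * ‖y‖ ^ 2)))) ∧
    |DK a l t x y| ≤ C * (Real.exp (-(δ * ‖x‖ ^ 2)) * Real.exp (-(δ * ‖y‖ ^ 2))) := by
  have hpi := Real.pi_pos
  have hl2 : 0 < l ^ 2 := by positivity
  set D := l ^ 2 * ε / (2 * (1 + 2 * |l|)) with hD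
  have hD0 : 0 < D := by positivity
  set b0 := 1 / (4 * ε) with hb0
  have hb00 : 0 < b0 := by positivity
  set p0 := b0 + |l| / 2 with hp0
  have hp00 : 0 < p0 := by positivity
  set K0 := (b0 / π) ^ NN n with hK0
  have hK00 : 0 ≤ K0 := by positivity
  have hN : 0 ≤ NN n := by unfold NN; positivity
  set C0 := 2 * p0 + 2 * b0 + ‖a‖ + |l| + (‖a‖ ^ 2 + 4 * NN n * p0 + 4 * b0 ^ 2 + 4 * p0 * b0) + 1 with hC0
  have hC00 : 1 ≤ C0 := by
    have : 0 ≤ 2 * p0 + 2 * b0 + ‖a‖ + |l| + (‖a‖ ^ 2 + 4 * NN n * p0 + 4 * b0 ^ 2 + 4 * p0 * b0) := by positivity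
    linarith
  refine ⟨K0 * (C0 * (1 + 2 / D)), D / 2, by positivity, by positivity, ?_⟩
  intro t ht x y
  have ht0 : 0 < t := hε.trans_le ht.1
  have hb := bb_pos l ht0
  have hp := pp_pos l ht0
  have hb1 : bb l t ≤ b0 := bb_le l hε ht.1
  have hp1 : pp l t ≤ p0 := pp_le l hε ht.1
  set s := ‖x‖ ^ 2 + ‖y‖ ^ 2 with hs
  have hs0 : 0 ≤ s := by positivity
  have hkk : |kk a l t x y| ≤ K0 * Real.exp (-(D * s)) := by
    rw [abs_of_pos (kk_pos a l ht0 x y)]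
    unfold kk
    have h1 : Real.exp (-(‖a‖ ^ 2 * t)) ≤ 1 := Real.exp_le_one_iff.2 (neg_nonpos.2 (by positivity))
    have h2 : (bb l t / π) ^ NN n ≤ K0 := Real.rpow_le_rpow (by positivity) (by gcongr) hN
    have h3 : Real.exp (-(pp l t * (‖x‖ ^ 2 + ‖y‖ ^ 2)) + 2 * bb l t * inner ℝ x y) ≤ Real.exp (-(D * s)) := by
      apply Real.exp_le_exp.2
      refine (cross_le hb.le (two_inner_le x y)).trans ?_
      have := mul_le_mul_of_nonneg_right (pb_lower (l := l) hε ht.1 ht.2) hs0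
      linarith
    calc _ ≤ 1 * K0 * Real.exp (-(D * s)) := by gcongr
      _ = _ := by ring
  have hgen : ∀ q : ℝ, |q| ≤ C0 * (1 + s) → |kk a l t x y * q| ≤
      K0 * (C0 * (1 + 2 / D)) * (Real.exp (-(D / 2 * ‖x‖ ^ 2)) * Real.exp (-(D / 2 * ‖y‖ ^ 2))) := by
    intro q hq
    rw [← Real.exp_add, abs_mul]
    have e : -(D / 2 * ‖x‖ ^ 2) + -(D / 2 * ‖y‖ ^ 2) = -(D / 2 * s) := by rw [hs]; ring
    rw [e]
    have h1 := sq_exp_le (s := s) hD0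
    have h2 : Real.exp (-(D * s)) ≤ Real.exp (-(D / 2 * s)) := Real.exp_le_exp.2 (by nlinarith)
    calc |kk a l t x y| * |q| ≤ (K0 * Real.exp (-(D * s))) * (C0 * (1 + s)) := by gcongr
      _ = K0 * C0 * (Real.exp (-(D * s)) + s * Real.exp (-(D * s))) := by ring
      _ ≤ K0 * C0 * (Real.exp (-(D / 2 * s)) + 2 / D * Real.exp (-(D / 2 * s))) := by gcongr
      _ = _ := by ring
  refine ⟨?_, ?_, ?_⟩
  · have := hgen 1 (by rw [abs_one]; nlinarith)
    rwa [mul_one] at this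
  · intro κ
    rw [mul_comm]
    apply hgen
    have hx : ∀ j, |x j| ≤ 1 + s := fun j => by
      have h1 : |x j| ≤ ‖x‖ := by simpa using PiLp.norm_apply_le x j
      nlinarith [sq_nonneg (‖x‖ - 1 / 2), sq_nonneg ‖y‖]
    have hy : ∀ j, |y j| ≤ 1 + s := fun j => by
      have h1 : |y j| ≤ ‖y‖ := by simpa using PiLp.norm_apply_le y j
      nlinarith [sq_nonneg (‖y‖ - 1 / 2), sq_nonneg ‖x‖]
    have hrest : 0 ≤ (‖a‖ ^ 2 + 4 * NN n * p0 + 4 * b0 ^ 2 + 4 * p0 * b0) + 1 := by positivity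
    rcases κ with j | j
    · have ha : |a j| ≤ ‖a‖ := by simpa using PiLp.norm_apply_le a j
      simp only [sg]
      calc |-(2 * pp l t * x j - 2 * bb l t * y j) - a j| ≤ |2 * pp l t * x j| + |2 * bb l t * y j| + |a j| := by
            refine (abs_sub _ _).trans ?_
            rw [abs_neg]
            linarith [abs_sub (2 * pp l t * x j) (2 * bb l t * y j)]
        _ = 2 * pp l t * |x j| + 2 * bb l t * |y j| + |a j| := by
            rw [abs_mul (2 * pp l t), abs_mul (2 * bb l t), abs_of_pos (by positivity : 0 < 2 * pp l t), abs_of_pos (by positivity : 0 < 2 * bb l t)]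
        _ ≤ 2 * p0 * (1 + s) + 2 * b0 * (1 + s) + ‖a‖ * (1 + s) := by
            have := hx j
            have := hy j
            have : |a j| ≤ ‖a‖ * (1 + s) := ha.trans (le_mul_of_one_le_right (norm_nonneg a) (by linarith))
            gcongr
        _ ≤ C0 * (1 + s) := by
            rw [hC0]
            have : 0 ≤ (|l| + ((‖a‖ ^ 2 + 4 * NN n * p0 + 4 * b0 ^ 2 + 4 * p0 * b0) + 1)) * (1 + s) := by positivity
            linarith
    · simp only [sg]
      rw [abs_mul]
      have := hx j.1
      calc |l| * |x j.1| ≤ |l| * (1 + s) := by gcongr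
        _ ≤ C0 * (1 + s) := by
            gcongr
            have : 0 ≤ 2 * p0 + 2 * b0 + ‖a‖ := by positivity
            linarith
  · unfold DK
    apply hgen
    have hz : 2 * |inner ℝ x y| ≤ s := two_inner_abs_le x y
    have c1 : |8 * pp l t * bb l t * inner ℝ x y| ≤ 4 * p0 * b0 * s := by
      rw [abs_mul, abs_of_pos (by positivity : 0 < 8 * pp l t * bb l t)]
      calc _ = 4 * pp l t * bb l t * (2 * |inner ℝ x y|) := by ring
        _ ≤ _ := by gcongr
    have c2 : |4 * bb l t ^ 2 * (‖x‖ ^ 2 + ‖y‖ ^ 2)| ≤ 4 * b0 ^ 2 * s := by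
      rw [abs_of_nonneg (by positivity)]
      gcongr
    have c3 : |‖a‖ ^ 2 + 4 * NN n * pp l t| ≤ ‖a‖ ^ 2 + 4 * NN n * p0 := by
      rw [abs_of_nonneg (by positivity)]
      gcongr
    have c4 := abs_add_le (‖a‖ ^ 2 + 4 * NN n * pp l t - 4 * bb l t ^ 2 * (‖x‖ ^ 2 + ‖y‖ ^ 2)) (8 * pp l t * bb l t * inner ℝ x y)
    have c5 := abs_sub (‖a‖ ^ 2 + 4 * NN n * pp l t) (4 * bb l t ^ 2 * (‖x‖ ^ 2 + ‖y‖ ^ 2))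
    have c6 : (‖a‖ ^ 2 + 4 * NN n * p0) + 4 * b0 ^ 2 * s + 4 * p0 * b0 * s ≤ C0 * (1 + s) := by
      rw [hC0]
      have : 0 ≤ (2 * p0 + 2 * b0 + ‖a‖ + |l| + 1) * (1 + s) + (‖a‖ ^ 2 + 4 * NN n * p0) * s + 4 * b0 ^ 2 + 4 * p0 * b0 := by positivity
      linarith
    linarith

lemma kk_le_gauss (a : EE n) (l : ℝ) {t : ℝ} (ht : 0 < t) (x y : EE n) :
    kk a l t x y ≤ (bb l t / π) ^ NN n * Real.exp (-(bb l t * ‖y - x‖ ^ 2)) := by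
  have hb := bb_pos l ht
  have hpi := Real.pi_pos
  unfold kk
  have h1 : Real.exp (-(‖a‖ ^ 2 * t)) ≤ 1 := Real.exp_le_one_iff.2 (neg_nonpos.2 (by positivity))
  have h3 : Real.exp (-(pp l t * (‖x‖ ^ 2 + ‖y‖ ^ 2)) + 2 * bb l t * inner ℝ x y) ≤ Real.exp (-(bb l t * ‖y - x‖ ^ 2)) := by
    apply Real.exp_le_exp.2
    rw [norm_sub_sq_real, real_inner_comm]
    have := mul_le_mul_of_nonneg_right (bb_le_pp l ht) (by positivity : 0 ≤ ‖x‖ ^ 2 + ‖y‖ ^ 2)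
    linarith
  calc _ ≤ 1 * (bb l t / π) ^ NN n * Real.exp (-(bb l t * ‖y - x‖ ^ 2)) := by gcongr
    _ = _ := by ring

lemma lint_kk (a : EE n) (l : ℝ) {t : ℝ} (ht : 0 < t) (x : EE n) : ∫⁻ y, ENNReal.ofReal (kk a l t x y) ≤ 1 := by
  have hb := bb_pos l ht
  have hpi := Real.pi_pos
  calc _ ≤ ∫⁻ y : EE n, ENNReal.ofReal ((bb l t / π) ^ NN n) * ENNReal.ofReal (Real.exp (-(bb l t * ‖y - x‖ ^ 2))) := by
        refine lintegral_mono fun y => ?_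
        rw [← ENNReal.ofReal_mul (by positivity)]
        exact ENNReal.ofReal_le_ofReal (kk_le_gauss a l ht x y)
    _ = 1 := by
        rw [lintegral_const_mul' _ _ ENNReal.ofReal_ne_top, lint_gauss hb, ← ENNReal.ofReal_mul (by positivity),
          ← Real.mul_rpow (by positivity) (by positivity)]
        have : bb l t / π * (π / bb l t) = 1 := by field_simp
        rw [this]; simp

lemma kk_symm (a : EE n) (l t : ℝ) (x y : EE n) : kk a l t x y = kk a l t y x := by
  unfold kk
  rw [real_inner_comm, add_comm (‖x‖ ^ 2)]

end GR

namespace GR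
open scoped ENNReal ComplexConjugate
variable {n : ℕ}

/-! ### Part 16: preparation for the frequency-side square function -/

lemma ttstar2 {X Z : Type*} [MeasurableSpace X] [MeasurableSpace Z] {μ : Measure X} {ν : Measure Z}
    [SFinite μ] [SFinite ν] {F F' : X × Z → ℂ} (hF : Measurable F) (hF' : Measurable F') {G1 : X → ℝ} {G2 : Z → ℝ}
    (hG : ∀ x z, ‖F (x, z)‖ ≤ G1 x * G2 z) (hG' : ∀ x z, ‖F' (x, z)‖ ≤ G1 x * G2 z)
    (h1 : Integrable (fun x => G1 x ^ 2) μ) (h2 : Integrable G2 ν) :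
    Integrable (fun p : X × (Z × Z) => F (p.1, p.2.1) * conj (F' (p.1, p.2.2))) (μ.prod (ν.prod ν)) ∧
    ∫ x, (∫ z, F (x, z) ∂ν) * conj (∫ z, F' (x, z) ∂ν) ∂μ =
      ∫ p : Z × Z, (∫ x, F (x, p.1) * conj (F' (x, p.2)) ∂μ) ∂(ν.prod ν) := by
  have hi : Integrable (fun p : X × (Z × Z) => F (p.1, p.2.1) * conj (F' (p.1, p.2.2))) (μ.prod (ν.prod ν)) := by
    have hi := h1.mul_prod (h2.mul_prod h2)
    refine hi.mono' ?_ (ae_of_all _ fun p => ?_)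
    · have e1 : Measurable fun p : X × (Z × Z) => ((p.1, p.2.1) : X × Z) := by fun_prop
      have e2 : Measurable fun p : X × (Z × Z) => ((p.1, p.2.2) : X × Z) := by fun_prop
      exact ((hF.comp e1).mul (Complex.continuous_conj.measurable.comp (hF'.comp e2))).aestronglyMeasurable
    · rw [norm_mul, RCLike.norm_conj]
      have a1 := hG p.1 p.2.1
      have a2 := hG' p.1 p.2.2
      calc _ ≤ (G1 p.1 * G2 p.2.1) * (G1 p.1 * G2 p.2.2) := mul_le_mul a1 a2 (norm_nonneg _) ((norm_nonneg _).trans a1)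
        _ = _ := by ring
  refine ⟨hi, ?_⟩
  have e : ∀ x, (∫ z, F (x, z) ∂ν) * conj (∫ z, F' (x, z) ∂ν) = ∫ p : Z × Z, F (x, p.1) * conj (F' (x, p.2)) ∂(ν.prod ν) := by
    intro x
    rw [integral_prod_mul (fun z => F (x, z)) (fun z => conj (F' (x, z))), integral_conj]
  simp_rw [e]
  exact integral_integral_swap hi

lemma half_split {s r : ℝ} (hs : 0 < s) (hr : s < r) :
    s ^ (-(1/2):ℝ) * (r - s) ^ (-(1/2):ℝ) ≤ (r / 2) ^ (-(1/2):ℝ) * (s ^ (-(1/2):ℝ) + (r - s) ^ (-(1/2):ℝ)) := by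
  have h0 : 0 < r - s := by linarith
  have hr0 : 0 < r := by linarith
  have p1 : 0 < s ^ (-(1/2):ℝ) := by positivity
  have p2 : 0 < (r - s) ^ (-(1/2):ℝ) := by positivity
  have p3 : 0 < (r / 2) ^ (-(1/2):ℝ) := by positivity
  rcases le_total s (r / 2) with h | h
  · have : (r - s) ^ (-(1/2):ℝ) ≤ (r / 2) ^ (-(1/2):ℝ) :=
      Real.rpow_le_rpow_of_nonpos (by positivity) (by linarith) (by norm_num)
    nlinarith
  · have : s ^ (-(1/2):ℝ) ≤ (r / 2) ^ (-(1/2):ℝ) :=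
      Real.rpow_le_rpow_of_nonpos (by positivity) h (by norm_num)
    nlinarith

lemma lint_half {r : ℝ} (hr : 0 < r) : ∫⁻ s in Ioo 0 r, ENNReal.ofReal (s ^ (-(1/2):ℝ)) = ENNReal.ofReal (2 * r ^ (1/2:ℝ)) := by
  rw [← setLIntegral_congr Ioo_ae_eq_Ioc.symm]
  have hi : IntervalIntegrable (fun s : ℝ => s ^ (-(1/2):ℝ)) volume 0 r := intervalIntegral.intervalIntegrable_rpow' (by norm_num)
  rw [intervalIntegrable_iff_integrableOn_Ioc_of_le hr.le] at hi
  rw [← ofReal_integral_eq_lintegral_ofReal hi, ← intervalIntegral.integral_of_le hr.le, integral_rpow (by left; norm_num)]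
  · congr 1
    norm_num
    ring
  · filter_upwards [ae_restrict_mem measurableSet_Ioc] with s hs
    have := hs.1
    positivity

lemma lint_half' {r : ℝ} (hr : 0 < r) : ∫⁻ s in Ioo 0 r, ENNReal.ofReal ((r - s) ^ (-(1/2):ℝ)) = ENNReal.ofReal (2 * r ^ (1/2:ℝ)) := by
  rw [← lint_half hr, ← lintegral_indicator measurableSet_Ioo, ← lintegral_indicator measurableSet_Ioo,
    ← lintegral_sub_left_eq_self _ r]
  refine lintegral_congr fun s => ?_
  by_cases h : s ∈ Ioo 0 r
  · have h' : r - s ∈ Ioo 0 r := ⟨by linarith [h.2], by linarith [h.1]⟩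
    rw [indicator_of_mem h, indicator_of_mem h', sub_sub_cancel]
  · rw [indicator_of_notMem h, indicator_of_notMem]
    intro h2
    exact h ⟨by linarith [h2.2], by linarith [h2.1]⟩

lemma time_conv {ε : ℝ} (hε : 0 < ε) {Ψ : ℝ → ℝ≥0∞} (hΨ : Measurable Ψ) :
    ∫⁻ p : ℝ × ℝ, (Ioc ε 1).indicator (fun s => ENNReal.ofReal (s ^ (-(1/2):ℝ))) p.1 *
      ((Ioc ε 1).indicator (fun s => ENNReal.ofReal (s ^ (-(1/2):ℝ))) p.2 * Ψ (p.1 + p.2)) ≤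
      6 * ∫⁻ r in Ioc (2 * ε) 2, Ψ r := by
  set I : ℝ → ℝ≥0∞ := (Ioc ε 1).indicator (fun s => ENNReal.ofReal (s ^ (-(1/2):ℝ))) with hI
  have hIm : Measurable I := (by fun_prop : Measurable _).indicator measurableSet_Ioc
  have hm : Measurable fun p : ℝ × ℝ => I p.1 * (I p.2 * Ψ (p.1 + p.2)) := by fun_prop
  have hm2 : Measurable fun p : ℝ × ℝ => I p.1 * (I (p.2 - p.1) * Ψ p.2) := by fun_prop
  rw [Measure.volume_eq_prod, lintegral_prod _ hm.aemeasurable]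
  have e : ∀ s, ∫⁻ t, I s * (I t * Ψ (s + t)) = ∫⁻ r, I s * (I (r - s) * Ψ r) := by
    intro s
    rw [← lintegral_sub_right_eq_self (fun t => I s * (I t * Ψ (s + t))) s]
    simp
  simp_rw [e]
  rw [lintegral_lintegral_swap hm2.aemeasurable, ← lintegral_indicator measurableSet_Ioc,
    ← lintegral_const_mul' _ _ (by norm_num)]
  refine lintegral_mono fun r => ?_
  by_cases hr : r ∈ Ioc (2 * ε) 2
  · rw [indicator_of_mem hr]
    have hr0 : 0 < r := by linarith [hr.1]
    have hb : ∀ s, I s * (I (r - s) * Ψ r) ≤ Ψ r * (Ioo 0 r).indicator (fun s => ENNReal.ofReal ((r / 2) ^ (-(1/2):ℝ)) *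
        (ENNReal.ofReal (s ^ (-(1/2):ℝ)) + ENNReal.ofReal ((r - s) ^ (-(1/2):ℝ)))) s := by
      intro s
      by_cases h1 : s ∈ Ioc ε 1
      swap
      · simp [hI, indicator_of_notMem h1]
      by_cases h2 : r - s ∈ Ioc ε 1
      swap
      · simp [hI, indicator_of_notMem h2]
      have hs0 : 0 < s := by linarith [h1.1]
      have hsr : s < r := by linarith [h2.1]
      have hsr' : 0 < r - s := by linarith
      have hso : s ∈ Ioo 0 r := ⟨hs0, hsr⟩
      rw [hI, indicator_of_mem h1, indicator_of_mem h2, indicator_of_mem hso, ← mul_assoc, mul_comm _ (Ψ r)]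
      refine mul_le_mul_right ?_ _
      rw [← ENNReal.ofReal_mul (by positivity), ← ENNReal.ofReal_add (by positivity) (by positivity),
        ← ENNReal.ofReal_mul (by positivity)]
      exact ENNReal.ofReal_le_ofReal (half_split hs0 hsr)
    refine (lintegral_mono hb).trans ?_
    rw [lintegral_const_mul _ (by apply Measurable.indicator _ measurableSet_Ioo; fun_prop), lintegral_indicator measurableSet_Ioo,
      lintegral_const_mul' _ _ ENNReal.ofReal_ne_top, lintegral_add_left (by fun_prop), lint_half hr0, lint_half' hr0, mul_comm]
    refine mul_le_mul_left ?_ _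
    rw [← ENNReal.ofReal_add (by positivity) (by positivity), ← ENNReal.ofReal_mul (by positivity)]
    rw [show (6:ℝ≥0∞) = ENNReal.ofReal 6 by norm_num]
    apply ENNReal.ofReal_le_ofReal
    have h3 : (r / 2) ^ (-(1/2):ℝ) * r ^ (1/2:ℝ) = √2 := by
      rw [Real.rpow_neg (by positivity), Real.div_rpow (by positivity) (by positivity), ← Real.sqrt_eq_rpow, ← Real.sqrt_eq_rpow]
      have := Real.sqrt_pos.2 hr0
      field_simp
    have h4 : √2 ≤ 1.5 := by
      rw [Real.sqrt_le_left (by norm_num)]; norm_num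
    calc _ = 4 * ((r / 2) ^ (-(1/2):ℝ) * r ^ (1/2:ℝ)) := by ring
      _ ≤ 6 := by rw [h3]; linarith
  · rw [indicator_of_notMem hr, mul_zero]
    refine le_of_eq (lintegral_eq_zero_of_ae_eq_zero (ae_of_all _ fun s => ?_))
    by_cases h1 : s ∈ Ioc ε 1
    swap
    · simp [hI, indicator_of_notMem h1]
    by_cases h2 : r - s ∈ Ioc ε 1
    swap
    · simp [hI, indicator_of_notMem h2]
    exact absurd ⟨by linarith [h1.1, h2.1], by linarith [h1.2, h2.2]⟩ hr

lemma measurable_bb {X : Type*} [MeasurableSpace X] {l t : X → ℝ} (hl : Measurable l) (ht : Measurable t) :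
    Measurable fun p => bb (l p) (t p) := by
  unfold bb
  have := continuous_hh.measurable.comp (hl.mul ht)
  simp only [Function.comp_def] at this
  exact measurable_const.div ((ht.const_mul 4).mul this)

lemma measurable_pp {X : Type*} [MeasurableSpace X] {l t : X → ℝ} (hl : Measurable l) (ht : Measurable t) :
    Measurable fun p => pp (l p) (t p) := by
  unfold pp
  have := continuous_cc.measurable.comp (hl.mul ht)
  simp only [Function.comp_def] at this
  exact (measurable_bb hl ht).add (this.div (ht.const_mul 2))

lemma measurable_kk {X : Type*} [MeasurableSpace X] (a : EE n) {l t : X → ℝ} {x y : X → EE n} (hl : Measurable l)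
    (ht : Measurable t) (hx : Measurable x) (hy : Measurable y) : Measurable fun p => kk a (l p) (t p) (x p) (y p) := by
  unfold kk
  have h1 := measurable_bb hl ht
  have h2 := measurable_pp hl ht
  have h3 : Measurable fun p => inner ℝ (x p) (y p) := hx.inner hy
  have h4 := hx.norm
  have h5 := hy.norm
  fun_prop

lemma measurable_DK {X : Type*} [MeasurableSpace X] (a : EE n) {l t : X → ℝ} {x y : X → EE n} (hl : Measurable l)
    (ht : Measurable t) (hx : Measurable x) (hy : Measurable y) : Measurable fun p => DK a (l p) (t p) (x p) (y p) := by
  unfold DK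
  have h0 := measurable_kk a hl ht hx hy
  have h1 := measurable_bb hl ht
  have h2 := measurable_pp hl ht
  have h3 : Measurable fun p => inner ℝ (x p) (y p) := hx.inner hy
  have h4 := hx.norm
  have h5 := hy.norm
  fun_prop

lemma measurable_sg {X : Type*} [MeasurableSpace X] (κ : Kap n) (a : EE n) {l t : X → ℝ} {x y : X → EE n} (hl : Measurable l)
    (ht : Measurable t) (hx : Measurable x) (hy : Measurable y) : Measurable fun p => sg κ a (l p) (t p) (x p) (y p) := by
  have h1 := measurable_bb hl ht
  have h2 := measurable_pp hl ht
  have h4 : ∀ j, Measurable fun p => (x p) j := fun j => (EuclideanSpace.proj (𝕜 := ℝ) j).measurable.comp hx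
  have h5 : ∀ j, Measurable fun p => (y p) j := fun j => (EuclideanSpace.proj (𝕜 := ℝ) j).measurable.comp hy
  rcases κ with j | j
  · simp only [sg]
    have := h4 j
    have := h5 j
    fun_prop
  · simp only [sg]
    have := h4 j.1
    fun_prop

end GR

namespace GR
open scoped ENNReal ComplexConjugate
variable {n : ℕ}

/-! ### Part 17: square function estimate at a fixed frequency -/

def Gf (κ : Kap n) (a : EE n) (l : ℝ) (h : EE n → ℂ) (t : ℝ) (x : EE n) : ℂ :=
  ∫ y, ((sg κ a l t x y * kk a l t x y : ℝ) : ℂ) * h y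

def Phi (a : EE n) (l : ℝ) (h : EE n → ℂ) (r : ℝ) : ℂ :=
  ∫ p : EE n × EE n, ((DK a l r p.1 p.2 : ℝ) : ℂ) * (h p.1 * conj (h p.2))

def Nk (a : EE n) (l : ℝ) (h : EE n → ℂ) (r : ℝ) : ℂ :=
  ∫ p : EE n × EE n, ((kk a l r p.1 p.2 : ℝ) : ℂ) * (h p.1 * conj (h p.2))

section Freq
variable {a : EE n} {l ε B : ℝ} {h : EE n → ℂ}

lemma integrable_g2 {δ : ℝ} (hδ : 0 < δ) (C : ℝ) : Integrable fun x : EE n => (C * Real.exp (-(δ * ‖x‖ ^ 2))) ^ 2 := by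
  have e : (fun x : EE n => (C * Real.exp (-(δ * ‖x‖ ^ 2))) ^ 2) = fun x => C ^ 2 * Real.exp (-(2 * δ * ‖x‖ ^ 2)) := by
    funext x
    rw [mul_pow, ← Real.exp_nat_mul]
    congr 2; push_cast; ring
  rw [e]
  exact (integrable_gauss (by positivity)).const_mul _

lemma Gf_inner (hl : l ≠ 0) (hε : 0 < ε) (hm : Measurable h) (hB : ∀ y, ‖h y‖ ≤ B) {t s : ℝ} (ht : t ∈ Icc ε 1) (hs : s ∈ Icc ε 1) :
    ∑ κ : Kap n, ∫ x, Gf κ a l h t x * conj (Gf κ a l h s x) = Phi a l h (t + s) := by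
  obtain ⟨C, δ, hC, hδ, hd⟩ := dom a hl hε
  have hB0 : 0 ≤ B := (norm_nonneg _).trans (hB 0)
  have ht2 : t ∈ Icc ε 2 := ⟨ht.1, by linarith [ht.2]⟩
  have hs2 : s ∈ Icc ε 2 := ⟨hs.1, by linarith [hs.2]⟩
  let F : Kap n → ℝ → EE n × EE n → ℂ := fun κ r q => ((sg κ a l r q.1 q.2 * kk a l r q.1 q.2 : ℝ) : ℂ) * h q.2
  have hFm : ∀ κ r, Measurable (F κ r) := fun κ r => by
    have h1 := measurable_sg (X := EE n × EE n) κ a (measurable_const (a := l)) (measurable_const (a := r)) measurable_fst measurable_snd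
    have h2 := measurable_kk (X := EE n × EE n) a (measurable_const (a := l)) (measurable_const (a := r)) measurable_fst measurable_snd
    exact (Complex.measurable_ofReal.comp (h1.mul h2)).mul (hm.comp measurable_snd)
  have hFb : ∀ κ r, r ∈ Icc ε 2 → ∀ x y, ‖F κ r (x, y)‖ ≤ C * Real.exp (-(δ * ‖x‖ ^ 2)) * (Real.exp (-(δ * ‖y‖ ^ 2)) * B) := by
    intro κ r hr x y
    simp only [F]
    rw [norm_mul, Complex.norm_real, Real.norm_eq_abs]
    calc _ ≤ C * (Real.exp (-(δ * ‖x‖ ^ 2)) * Real.exp (-(δ * ‖y‖ ^ 2))) * B :=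
          mul_le_mul ((hd r hr x y).2.1 κ) (hB y) (norm_nonneg _) (by positivity)
      _ = _ := by ring
  have key := fun κ => ttstar2 (μ := volume) (ν := volume) (hFm κ t) (hFm κ s) (hFb κ t ht2) (hFb κ s hs2) (integrable_g2 hδ C)
    ((integrable_gauss hδ).mul_const B)
  have e1 : ∀ κ, ∫ x, Gf κ a l h t x * conj (Gf κ a l h s x) =
      ∫ p : EE n × EE n, (∫ x, F κ t (x, p.1) * conj (F κ s (x, p.2))) ∂((volume : Measure (EE n)).prod volume) := fun κ => (key κ).2
  simp_rw [e1]
  rw [← integral_finset_sum _ fun κ _ => (key κ).1.integral_prod_right]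
  unfold Phi
  rw [Measure.volume_eq_prod]
  refine integral_congr_ae (ae_of_all _ fun p => ?_)
  simp only
  rw [← integral_finset_sum]
  · rw [← tt_id a hl (hε.trans_le ht.1) (hε.trans_le hs.1), ← integral_complex_ofReal, ← integral_mul_const]
    refine integral_congr_ae (ae_of_all _ fun x => ?_)
    simp only [F]
    push_cast
    rw [Finset.sum_mul]
    refine Finset.sum_congr rfl fun κ _ => ?_
    rw [map_mul, map_mul, Complex.conj_ofReal, Complex.conj_ofReal]
    ring
  · intro κ _
    have i1 := (integrable_g2 (n := n) hδ C).mul_const ((Real.exp (-(δ * ‖p.1‖ ^ 2)) * B) * (Real.exp (-(δ * ‖p.2‖ ^ 2)) * B))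
    refine i1.mono' ?_ (ae_of_all _ fun x => ?_)
    · have m1 : Measurable fun x : EE n => ((x, p.1) : EE n × EE n) := by fun_prop
      have m2 : Measurable fun x : EE n => ((x, p.2) : EE n × EE n) := by fun_prop
      exact (((hFm κ t).comp m1).mul (Complex.continuous_conj.measurable.comp ((hFm κ s).comp m2))).aestronglyMeasurable
    · rw [norm_mul, RCLike.norm_conj]
      calc _ ≤ _ := mul_le_mul (hFb κ t ht2 x p.1) (hFb κ s hs2 x p.2) (norm_nonneg _) (by positivity)
        _ = _ := by ring

lemma Phi_nonneg (hl : l ≠ 0) (hε : 0 < ε) (hm : Measurable h) (hB : ∀ y, ‖h y‖ ≤ B) {r : ℝ} (hr : r ∈ Icc (2 * ε) 2) :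
    ∃ q : ℝ, 0 ≤ q ∧ Phi a l h r = (q : ℂ) := by
  have hr2 : r / 2 ∈ Icc ε 1 := ⟨by linarith [hr.1], by linarith [hr.2]⟩
  have key := Gf_inner (a := a) hl hε hm hB hr2 hr2
  rw [add_halves] at key
  refine ⟨∑ κ : Kap n, ∫ x, ‖Gf κ a l h (r / 2) x‖ ^ 2, Finset.sum_nonneg fun κ _ => integral_nonneg fun x => by positivity, ?_⟩
  rw [← key]
  push_cast
  refine Finset.sum_congr rfl fun κ _ => ?_
  rw [← integral_complex_ofReal]
  refine integral_congr_ae (ae_of_all _ fun x => ?_)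
  simp only
  rw [Complex.mul_conj, Complex.normSq_eq_norm_sq]

lemma Nk_le (hm : Measurable h) {r : ℝ} (hr : 0 < r) : ‖Nk a l h r‖ₑ ≤ ∫⁻ y, ‖h y‖ₑ ^ 2 := by
  unfold Nk
  have hk : ∀ p : EE n × EE n, ‖((kk a l r p.1 p.2 : ℝ) : ℂ) * (h p.1 * conj (h p.2))‖ₑ ≤
      2⁻¹ * (ENNReal.ofReal (kk a l r p.1 p.2) * ‖h p.1‖ₑ ^ 2) + 2⁻¹ * (ENNReal.ofReal (kk a l r p.1 p.2) * ‖h p.2‖ₑ ^ 2) := by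
    intro p
    have hp := (kk_pos a l hr p.1 p.2).le
    rw [← ofReal_norm, norm_mul, norm_mul, RCLike.norm_conj, Complex.norm_real, Real.norm_of_nonneg hp, ENNReal.ofReal_mul hp,
      ← ofReal_norm, ← ofReal_norm, ← ENNReal.ofReal_pow (norm_nonneg _), ← ENNReal.ofReal_pow (norm_nonneg _)]
    rw [show (2:ℝ≥0∞)⁻¹ = ENNReal.ofReal (2⁻¹) by rw [ENNReal.ofReal_inv_of_pos (by norm_num)]; norm_num]
    rw [← ENNReal.ofReal_mul hp, ← ENNReal.ofReal_mul hp, ← ENNReal.ofReal_mul hp, ← ENNReal.ofReal_mul (by norm_num),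
      ← ENNReal.ofReal_mul (by norm_num), ← ENNReal.ofReal_add (by positivity) (by positivity)]
    apply ENNReal.ofReal_le_ofReal
    have := mul_le_mul_of_nonneg_left (two_mul_le_add_sq ‖h p.1‖ ‖h p.2‖) hp
    linarith
  have mk : Measurable fun p : EE n × EE n => ENNReal.ofReal (kk a l r p.1 p.2) :=
    (measurable_kk (X := EE n × EE n) a (measurable_const (a := l)) (measurable_const (a := r)) measurable_fst measurable_snd).ennreal_ofReal
  have m1 : Measurable fun p : EE n × EE n => ENNReal.ofReal (kk a l r p.1 p.2) * ‖h p.1‖ₑ ^ 2 := by fun_prop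
  have m2 : Measurable fun p : EE n × EE n => ENNReal.ofReal (kk a l r p.1 p.2) * ‖h p.2‖ₑ ^ 2 := by fun_prop
  have b1 : ∫⁻ p : EE n × EE n, ENNReal.ofReal (kk a l r p.1 p.2) * ‖h p.1‖ₑ ^ 2 ≤ ∫⁻ y, ‖h y‖ₑ ^ 2 := by
    rw [Measure.volume_eq_prod, lintegral_prod _ m1.aemeasurable]
    refine lintegral_mono fun x => ?_
    have mx : Measurable fun y => ENNReal.ofReal (kk a l r x y) :=
      (measurable_kk a (measurable_const (a := l)) (measurable_const (a := r)) measurable_const measurable_id).ennreal_ofReal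
    simp only
    rw [lintegral_mul_const _ mx]
    exact (mul_le_mul_left (lint_kk a l hr x) _).trans (by rw [one_mul])
  have b2 : ∫⁻ p : EE n × EE n, ENNReal.ofReal (kk a l r p.1 p.2) * ‖h p.2‖ₑ ^ 2 ≤ ∫⁻ y, ‖h y‖ₑ ^ 2 := by
    rw [Measure.volume_eq_prod, lintegral_prod_symm _ m2.aemeasurable]
    refine lintegral_mono fun x => ?_
    have mx : Measurable fun y => ENNReal.ofReal (kk a l r y x) :=
      (measurable_kk a (measurable_const (a := l)) (measurable_const (a := r)) measurable_id measurable_const).ennreal_ofReal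
    simp only
    rw [lintegral_mul_const _ mx]
    simp_rw [kk_symm a l r _ x]
    exact (mul_le_mul_left (lint_kk a l hr x) _).trans (by rw [one_mul])
  refine (enorm_integral_le_lintegral_enorm _).trans ((lintegral_mono hk).trans ?_)
  rw [lintegral_add_left (m1.const_mul _), lintegral_const_mul _ m1, lintegral_const_mul _ m2]
  calc _ ≤ 2⁻¹ * (∫⁻ y, ‖h y‖ₑ ^ 2) + 2⁻¹ * ∫⁻ y, ‖h y‖ₑ ^ 2 := by gcongr
    _ = _ := by rw [← add_mul, ENNReal.inv_two_add_inv_two, one_mul]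

lemma measurable_Phi (hm : Measurable h) : Measurable (Phi a l h) := by
  unfold Phi
  have h1 : Measurable fun q : ℝ × (EE n × EE n) => ((DK a l q.1 q.2.1 q.2.2 : ℝ) : ℂ) * (h q.2.1 * conj (h q.2.2)) := by
    have k1 := measurable_DK (X := ℝ × (EE n × EE n)) a (measurable_const (a := l)) measurable_fst
      (measurable_fst.comp measurable_snd) (measurable_snd.comp measurable_snd)
    refine (Complex.measurable_ofReal.comp k1).mul ((hm.comp (measurable_fst.comp measurable_snd)).mul ?_)
    exact Complex.continuous_conj.measurable.comp (hm.comp (measurable_snd.comp measurable_snd))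
  exact (h1.stronglyMeasurable.integral_prod_right (ν := volume)).measurable

lemma continuousOn_DK (a : EE n) {l : ℝ} (hl : l ≠ 0) (x y : EE n) : ContinuousOn (fun r => DK a l r x y) (Ioi 0) := by
  intro t ht
  apply ContinuousAt.continuousWithinAt
  unfold DK
  have h1 := (hasDerivAt_bb hl ht).continuousAt
  have h2 := (hasDerivAt_pp hl ht).continuousAt
  have h3 := (hasDerivAt_kk a hl ht x y).continuousAt
  fun_prop

lemma int_Phi (hl : l ≠ 0) (hε : 0 < ε) (hε1 : ε ≤ 1) (hm : Measurable h) (hB : ∀ y, ‖h y‖ ≤ B) :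
    ∫⁻ r in Ioc (2 * ε) 2, ‖Phi a l h r‖ₑ ≤ 2 * ∫⁻ y, ‖h y‖ₑ ^ 2 := by
  have hε2 : 2 * ε ≤ 2 := by linarith
  obtain ⟨C, δ, hC, hδ, hd⟩ := dom a hl hε
  have hB0 : 0 ≤ B := (norm_nonneg _).trans (hB 0)
  have h1 : Measurable fun q : ℝ × (EE n × EE n) => ((DK a l q.1 q.2.1 q.2.2 : ℝ) : ℂ) * (h q.2.1 * conj (h q.2.2)) := by
    have k1 := measurable_DK (X := ℝ × (EE n × EE n)) a (measurable_const (a := l)) measurable_fst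
      (measurable_fst.comp measurable_snd) (measurable_snd.comp measurable_snd)
    refine (Complex.measurable_ofReal.comp k1).mul ((hm.comp (measurable_fst.comp measurable_snd)).mul ?_)
    exact Complex.continuous_conj.measurable.comp (hm.comp (measurable_snd.comp measurable_snd))
  have hi : Integrable (fun q : ℝ × (EE n × EE n) => ((DK a l q.1 q.2.1 q.2.2 : ℝ) : ℂ) * (h q.2.1 * conj (h q.2.2)))
      ((volume.restrict (Ioc (2 * ε) 2)).prod (volume.prod volume)) := by
    have g := (integrable_const (μ := volume.restrict (Ioc (2 * ε) 2)) (C * B ^ 2)).mul_prod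
      ((integrable_gauss (n := n) hδ).mul_prod (integrable_gauss (n := n) hδ))
    refine g.mono' h1.aestronglyMeasurable ?_
    have hr : ∀ᵐ q : ℝ × (EE n × EE n) ∂((volume.restrict (Ioc (2 * ε) 2)).prod (volume.prod volume)), q.1 ∈ Ioc (2 * ε) 2 :=
      Measure.quasiMeasurePreserving_fst.ae (ae_restrict_mem measurableSet_Ioc)
    filter_upwards [hr] with q hq
    have hq2 : q.1 ∈ Icc ε 2 := ⟨by linarith [hq.1], hq.2⟩
    rw [norm_mul, norm_mul, RCLike.norm_conj, Complex.norm_real, Real.norm_eq_abs]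
    calc _ ≤ (C * (Real.exp (-(δ * ‖q.2.1‖ ^ 2)) * Real.exp (-(δ * ‖q.2.2‖ ^ 2)))) * (B * B) :=
          mul_le_mul (hd _ hq2 _ _).2.2 (mul_le_mul (hB _) (hB _) (norm_nonneg _) hB0) (by positivity) (by positivity)
      _ = _ := by ring
  have hk : ∀ r ∈ Icc ε 2, Integrable (fun p : EE n × EE n => ((kk a l r p.1 p.2 : ℝ) : ℂ) * (h p.1 * conj (h p.2))) (volume.prod volume) := by
    intro r hr
    have g := (((integrable_gauss (n := n) hδ).mul_prod (integrable_gauss (n := n) hδ)).const_mul (C * B ^ 2))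
    refine g.mono' ?_ (ae_of_all _ fun q => ?_)
    · have k1 := measurable_kk (X := EE n × EE n) a (measurable_const (a := l)) (measurable_const (a := r)) measurable_fst measurable_snd
      refine ((Complex.measurable_ofReal.comp k1).mul ((hm.comp measurable_fst).mul ?_)).aestronglyMeasurable
      exact Complex.continuous_conj.measurable.comp (hm.comp measurable_snd)
    rw [norm_mul, norm_mul, RCLike.norm_conj, Complex.norm_real, Real.norm_eq_abs]
    calc _ ≤ (C * (Real.exp (-(δ * ‖q.1‖ ^ 2)) * Real.exp (-(δ * ‖q.2‖ ^ 2)))) * (B * B) :=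
          mul_le_mul (hd _ hr _ _).1 (mul_le_mul (hB _) (hB _) (norm_nonneg _) hB0) (by positivity) (by positivity)
      _ = _ := by ring
  have m2 : 2 * ε ∈ Icc ε 2 := ⟨by linarith, hε2⟩
  have m3 : (2:ℝ) ∈ Icc ε 2 := ⟨by linarith, le_refl _⟩
  -- the integral of Phi
  have hint : ∫ r in Ioc (2 * ε) 2, Phi a l h r = Nk a l h (2 * ε) - Nk a l h 2 := by
    unfold Phi Nk
    rw [Measure.volume_eq_prod, integral_integral_swap hi, ← integral_sub (hk _ m2) (hk _ m3)]
    refine integral_congr_ae (ae_of_all _ fun p => ?_)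
    simp only
    rw [integral_mul_const, integral_complex_ofReal, ← intervalIntegral.integral_of_le hε2]
    have hftc : ∫ r in (2 * ε)..2, DK a l r p.1 p.2 = -(kk a l 2 p.1 p.2) - -(kk a l (2 * ε) p.1 p.2) := by
      apply intervalIntegral.integral_eq_sub_of_hasDerivAt (f := fun r => -(kk a l r p.1 p.2))
      · intro r hr
        rw [uIcc_of_le hε2] at hr
        have := (hasDerivAt_kk a hl (by linarith [hr.1] : 0 < r) p.1 p.2).fun_neg
        rwa [neg_neg] at this
      · apply ContinuousOn.intervalIntegrable
        apply (continuousOn_DK a hl p.1 p.2).mono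
        intro r hr
        rw [uIcc_of_le hε2] at hr
        simp only [mem_Ioi]
        linarith [hr.1]
    rw [hftc]
    push_cast
    ring
  have hPi : IntegrableOn (Phi a l h) (Ioc (2 * ε) 2) := hi.integral_prod_left
  have e1 : ∫⁻ r in Ioc (2 * ε) 2, ‖Phi a l h r‖ₑ = ENNReal.ofReal (∫ r in Ioc (2 * ε) 2, (Phi a l h r).re) := by
    have hPr : Integrable (fun r => (Phi a l h r).re) (volume.restrict (Ioc (2 * ε) 2)) := hPi.re
    rw [ofReal_integral_eq_lintegral_ofReal hPr]
    · refine setLIntegral_congr_fun measurableSet_Ioc fun r hr => ?_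
      obtain ⟨q, hq, e⟩ := Phi_nonneg (a := a) hl hε hm hB ⟨hr.1.le, hr.2⟩
      rw [e, ← ofReal_norm, Complex.norm_real, Real.norm_of_nonneg hq, Complex.ofReal_re]
    · filter_upwards [ae_restrict_mem measurableSet_Ioc] with r hr
      obtain ⟨q, hq, e⟩ := Phi_nonneg (a := a) hl hε hm hB ⟨hr.1.le, hr.2⟩
      simpa [e] using hq
  rw [e1]
  have e2 : ∫ r in Ioc (2 * ε) 2, (Phi a l h r).re = (∫ r in Ioc (2 * ε) 2, Phi a l h r).re := integral_re hPi
  rw [e2, hint]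
  calc _ ≤ ENNReal.ofReal ‖Nk a l h (2 * ε) - Nk a l h 2‖ := ENNReal.ofReal_le_ofReal (Complex.re_le_norm _)
    _ = ‖Nk a l h (2 * ε) - Nk a l h 2‖ₑ := ofReal_norm _
    _ ≤ ‖Nk a l h (2 * ε)‖ₑ + ‖Nk a l h 2‖ₑ := enorm_sub_le
    _ ≤ (∫⁻ y, ‖h y‖ₑ ^ 2) + ∫⁻ y, ‖h y‖ₑ ^ 2 := add_le_add (Nk_le hm (by linarith)) (Nk_le hm (by norm_num))
    _ = _ := by rw [two_mul]

lemma measurable_Gf (κ : Kap n) (hm : Measurable h) : Measurable fun q : EE n × ℝ => Gf κ a l h q.2 q.1 := by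
  unfold Gf
  have h1 : Measurable fun q : (EE n × ℝ) × EE n => ((sg κ a l q.1.2 q.1.1 q.2 * kk a l q.1.2 q.1.1 q.2 : ℝ) : ℂ) * h q.2 := by
    have k0 := measurable_sg (X := (EE n × ℝ) × EE n) κ a (measurable_const (a := l)) (measurable_snd.comp measurable_fst)
      (measurable_fst.comp measurable_fst) measurable_snd
    have k1 := measurable_kk (X := (EE n × ℝ) × EE n) a (measurable_const (a := l)) (measurable_snd.comp measurable_fst)
      (measurable_fst.comp measurable_fst) measurable_snd
    exact (Complex.measurable_ofReal.comp (k0.mul k1)).mul (hm.comp measurable_snd)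
  exact (h1.stronglyMeasurable.integral_prod_right (ν := volume)).measurable

lemma freq_est (hl : l ≠ 0) (hε : 0 < ε) (hε1 : ε ≤ 1) (hm : Measurable h) (hB : ∀ y, ‖h y‖ ≤ B) (κ : Kap n) :
    ∫⁻ x, ‖∫ t in Ioc ε 1, ((t ^ (-(1/2):ℝ) : ℝ) : ℂ) * Gf κ a l h t x‖ₑ ^ 2 ≤ 12 * ∫⁻ y, ‖h y‖ₑ ^ 2 := by
  obtain ⟨C, δ, hC, hδ, hd⟩ := dom a hl hε
  have hB0 : 0 ≤ B := (norm_nonneg _).trans (hB 0)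
  set M := C * (∫ y : EE n, Real.exp (-(δ * ‖y‖ ^ 2))) * B with hM
  have hM0 : 0 ≤ M := by
    have : 0 ≤ ∫ y : EE n, Real.exp (-(δ * ‖y‖ ^ 2)) := integral_nonneg fun y => (Real.exp_pos _).le
    positivity
  have hG : ∀ κ, ∀ t ∈ Icc ε 1, ∀ x, ‖Gf κ a l h t x‖ ≤ M * Real.exp (-(δ * ‖x‖ ^ 2)) := by
    intro κ t ht x
    unfold Gf
    have ht2 : t ∈ Icc ε 2 := ⟨ht.1, by linarith [ht.2]⟩
    have i1 := ((integrable_gauss (n := n) hδ).const_mul (C * Real.exp (-(δ * ‖x‖ ^ 2)) * B))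
    refine (norm_integral_le_of_norm_le i1 (ae_of_all _ fun y => ?_)).trans ?_
    · rw [norm_mul, Complex.norm_real, Real.norm_eq_abs]
      calc _ ≤ C * (Real.exp (-(δ * ‖x‖ ^ 2)) * Real.exp (-(δ * ‖y‖ ^ 2))) * B :=
            mul_le_mul ((hd t ht2 x y).2.1 κ) (hB y) (norm_nonneg _) (by positivity)
        _ = _ := by ring
    · rw [integral_const_mul, hM]
      apply le_of_eq; ring
  set I : ℝ → ℝ := (Ioc ε 1).indicator (fun s => s ^ (-(1/2):ℝ)) with hI
  have hIm : Measurable I := (by fun_prop : Measurable _).indicator measurableSet_Ioc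
  have hI0 : ∀ t, 0 ≤ I t := fun t => indicator_nonneg (fun s hs => by have := hε.trans hs.1; positivity) t
  have hIi : Integrable I := by
    rw [hI, integrable_indicator_iff measurableSet_Ioc]
    have hi : IntervalIntegrable (fun s : ℝ => s ^ (-(1/2):ℝ)) volume ε 1 := intervalIntegral.intervalIntegrable_rpow' (by norm_num)
    rwa [intervalIntegrable_iff_integrableOn_Ioc_of_le hε1] at hi
  let F : Kap n → EE n × ℝ → ℂ := fun κ q => ((I q.2 : ℝ) : ℂ) * Gf κ a l h q.2 q.1
  have hFm : ∀ κ, Measurable (F κ) := fun κ =>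
    (Complex.measurable_ofReal.comp (hIm.comp measurable_snd)).mul (measurable_Gf κ hm)
  have hFb : ∀ κ, ∀ x t, ‖F κ (x, t)‖ ≤ (M * Real.exp (-(δ * ‖x‖ ^ 2))) * I t := by
    intro κ x t
    simp only [F]
    rw [norm_mul, Complex.norm_real, Real.norm_of_nonneg (hI0 t), mul_comm]
    by_cases ht : t ∈ Ioc ε 1
    · exact mul_le_mul_of_nonneg_right (hG κ t ⟨ht.1.le, ht.2⟩ x) (hI0 t)
    · simp [hI, indicator_of_notMem ht]
  have hW : ∀ κ x, ∫ t, F κ (x, t) = ∫ t in Ioc ε 1, ((t ^ (-(1/2):ℝ) : ℝ) : ℂ) * Gf κ a l h t x := by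
    intro κ x
    rw [← integral_indicator measurableSet_Ioc]
    refine integral_congr_ae (ae_of_all _ fun t => ?_)
    simp only [F]
    by_cases ht : t ∈ Ioc ε 1
    · rw [indicator_of_mem ht, hI, indicator_of_mem ht]
    · rw [indicator_of_notMem ht, hI, indicator_of_notMem ht]; simp
  have tt := fun κ => ttstar (μ := (volume : Measure (EE n))) (ν := (volume : Measure ℝ)) (hFm κ) (hFb κ) (integrable_g2 hδ M) hIi
  have tti := fun κ => ttstar_int (μ := (volume : Measure (EE n))) (ν := (volume : Measure ℝ)) (hFm κ) (hFb κ) (integrable_g2 hδ M) hIi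
  -- the sum over all fields
  have hsum : ((∑ κ : Kap n, ∫ x, ‖∫ t, F κ (x, t)‖ ^ 2 : ℝ) : ℂ) =
      ∫ p : ℝ × ℝ, (((I p.1 * I p.2 : ℝ)) : ℂ) * Phi a l h (p.1 + p.2) := by
    push_cast
    simp_rw [(tt _).2]
    rw [← integral_finset_sum _ fun κ _ => (tti κ).integral_prod_right, Measure.volume_eq_prod]
    refine integral_congr_ae (ae_of_all _ fun p => ?_)
    simp only
    by_cases h1 : p.1 ∈ Ioc ε 1
    swap
    · simp [F, hI, indicator_of_notMem h1]
    by_cases h2 : p.2 ∈ Ioc ε 1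
    swap
    · simp [F, hI, indicator_of_notMem h2]
    rw [← Gf_inner (a := a) hl hε hm hB ⟨h1.1.le, h1.2⟩ ⟨h2.1.le, h2.2⟩, Finset.mul_sum]
    refine Finset.sum_congr rfl fun κ _ => ?_
    rw [← integral_const_mul]
    refine integral_congr_ae (ae_of_all _ fun x => ?_)
    simp only [F]
    rw [map_mul, Complex.conj_ofReal]
    push_cast
    ring
  have hbd : ENNReal.ofReal (∑ κ : Kap n, ∫ x, ‖∫ t, F κ (x, t)‖ ^ 2) ≤ 12 * ∫⁻ y, ‖h y‖ₑ ^ 2 := by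
    have hs0 : 0 ≤ ∑ κ : Kap n, ∫ x, ‖∫ t, F κ (x, t)‖ ^ 2 :=
      Finset.sum_nonneg fun κ _ => integral_nonneg fun x => by positivity
    have e1 : ENNReal.ofReal (∑ κ : Kap n, ∫ x, ‖∫ t, F κ (x, t)‖ ^ 2) =
        ‖∫ p : ℝ × ℝ, (((I p.1 * I p.2 : ℝ)) : ℂ) * Phi a l h (p.1 + p.2)‖ₑ := by
      rw [← hsum, ← ofReal_norm, Complex.norm_real, Real.norm_of_nonneg hs0]
    rw [e1]
    refine (enorm_integral_le_lintegral_enorm _).trans ?_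
    have e2 : ∀ p : ℝ × ℝ, ‖(((I p.1 * I p.2 : ℝ)) : ℂ) * Phi a l h (p.1 + p.2)‖ₑ =
        (Ioc ε 1).indicator (fun s => ENNReal.ofReal (s ^ (-(1/2):ℝ))) p.1 *
      ((Ioc ε 1).indicator (fun s => ENNReal.ofReal (s ^ (-(1/2):ℝ))) p.2 * ‖Phi a l h (p.1 + p.2)‖ₑ) := by
      intro p
      have e3 : ∀ t, ENNReal.ofReal (I t) = (Ioc ε 1).indicator (fun s => ENNReal.ofReal (s ^ (-(1/2):ℝ))) t := by
        intro t
        by_cases ht : t ∈ Ioc ε 1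
        · rw [indicator_of_mem ht, hI, indicator_of_mem ht]
        · rw [indicator_of_notMem ht, hI, indicator_of_notMem ht]; simp
      rw [← e3, ← e3, ← ofReal_norm, norm_mul, Complex.norm_real, Real.norm_of_nonneg (mul_nonneg (hI0 _) (hI0 _)),
        ENNReal.ofReal_mul (mul_nonneg (hI0 _) (hI0 _)), ENNReal.ofReal_mul (hI0 _), ofReal_norm, mul_assoc]
    simp_rw [e2]
    have hPm : Measurable fun r => ‖Phi a l h r‖ₑ := (measurable_Phi hm).enorm
    refine (time_conv hε hPm).trans ?_
    calc _ ≤ 6 * (2 * ∫⁻ y, ‖h y‖ₑ ^ 2) := mul_le_mul_right (int_Phi hl hε hε1 hm hB) _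
      _ = _ := by rw [← mul_assoc]; norm_num
  refine le_trans ?_ hbd
  simp_rw [← hW]
  calc ∫⁻ x, ‖∫ t, F κ (x, t)‖ₑ ^ 2 = ∫⁻ x, ENNReal.ofReal (‖∫ t, F κ (x, t)‖ ^ 2) := by
        refine lintegral_congr fun x => ?_
        rw [ENNReal.ofReal_pow (norm_nonneg _), ofReal_norm]
    _ = ENNReal.ofReal (∫ x, ‖∫ t, F κ (x, t)‖ ^ 2) := by
        rw [ofReal_integral_eq_lintegral_ofReal (tt κ).1 (ae_of_all _ fun x => by positivity)]
    _ ≤ _ := by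
        apply ENNReal.ofReal_le_ofReal
        exact Finset.single_le_sum (f := fun κ => ∫ x, ‖∫ t, F κ (x, t)‖ ^ 2)
          (fun κ _ => integral_nonneg fun x => by positivity) (Finset.mem_univ κ)

end Freq
end GR

namespace GR
open scoped ENNReal ComplexConjugate
variable {n : ℕ}

/-! ### Part 18: global `L²` estimate -/

lemma sykk (κ : Kap n) (a : EE n) {t : ℝ} (ht : 0 < t) (l : ℝ) (x y : EE n) :
    t ^ (-NN n - 1/2) * (4 * π) ^ (-NN n) * Real.exp (-(‖a‖ ^ 2 * t)) *
      (sy κ (√t • a) ((√t)⁻¹ • x) ((√t)⁻¹ • y) (t * l) *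
        Bf (NN n) ‖(√t)⁻¹ • x - (√t)⁻¹ • y‖ ‖(√t)⁻¹ • x + (√t)⁻¹ • y‖ (t * l)) = sg κ a l t x y * kk a l t x y := by
  have hpi := Real.pi_pos
  have hs : 0 < √t := Real.sqrt_pos.2 ht
  have hss : √t ^ 2 = t := Real.sq_sqrt ht.le
  have hh0 := hh_pos (t * l)
  have e1 : t ^ (-(1/2):ℝ) * sy κ (√t • a) ((√t)⁻¹ • x) ((√t)⁻¹ • y) (t * l) = sg κ a l t x y := by
    have : t ^ (-(1/2):ℝ) = (√t)⁻¹ := by rw [Real.rpow_neg ht.le, Real.sqrt_eq_rpow]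
    rw [this]
    rcases κ with j | j
    · simp only [sy, sg, pp, bb, PiLp.smul_apply, smul_eq_mul, mul_comm l t]
      generalize cc (t * l) = c at *
      generalize hh (t * l) = g at *
      generalize √t = q at *
      subst hss
      field_simp
      ring
    · simp only [sy, sg, PiLp.smul_apply, smul_eq_mul]
      field_simp
      rw [hss]
      
  have e2 : t ^ (-NN n) * (4 * π) ^ (-NN n) * Real.exp (-(‖a‖ ^ 2 * t)) *
      Bf (NN n) ‖(√t)⁻¹ • x - (√t)⁻¹ • y‖ ‖(√t)⁻¹ • x + (√t)⁻¹ • y‖ (t * l) = kk a l t x y := by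
    unfold Bf Ph kk
    rw [neg_add, Real.exp_add, ← mul_neg, mul_comm (NN n), ]
    have h1 : Real.exp (-Real.log (hh (t * l)) * NN n) = (hh (t * l)) ^ (-NN n) := by
      rw [Real.rpow_def_of_pos hh0]; congr 1; ring
    rw [← smul_sub, ← smul_add, norm_smul, norm_smul, norm_inv, Real.norm_of_nonneg hs.le]
    have h2 : Real.exp (-(NN n) * -(-Real.log (hh (t * l)))) = (hh (t * l)) ^ (-NN n) := by
      rw [Real.rpow_def_of_pos hh0]; congr 1; ring
    have h3 : (bb l t / π) ^ NN n = t ^ (-NN n) * (4 * π) ^ (-NN n) * (hh (t * l)) ^ (-NN n) := by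
      rw [← Real.mul_rpow ht.le (by positivity), ← Real.mul_rpow (by positivity) hh0.le, Real.rpow_neg (by positivity),
        ← Real.inv_rpow (by positivity)]
      congr 1
      unfold bb
      rw [mul_comm l t]
      field_simp
    have h4 : -(((1 / hh (t * l) + cc (t * l)) * ((√t)⁻¹ * ‖x - y‖) ^ 2 + cc (t * l) * ((√t)⁻¹ * ‖x + y‖) ^ 2) / 4) =
        -(pp l t * (‖x‖ ^ 2 + ‖y‖ ^ 2)) + 2 * bb l t * inner ℝ x y := by
      rw [mul_pow, mul_pow, inv_pow, hss, norm_sub_sq_real, norm_add_sq_real]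
      unfold pp bb
      rw [mul_comm l t]
      field_simp
      ring
    rw [h3, h4]
    have h5 : Real.exp (Real.log (hh (t * l)) * -NN n) = (hh (t * l)) ^ (-NN n) := by
      rw [Real.rpow_def_of_pos hh0]
    simp only [mul_neg] at h5 ⊢
    rw [h5]
    ring
  rw [← e1, ← e2, sub_eq_add_neg (-NN n), Real.rpow_add ht]
  ring

lemma rr_freq (κ : Kap n) (a : EE n) {t : ℝ} (ht : 0 < t) (x y : EE n) (z : ℝ) :
    ((Real.exp (-inner ℝ a (x - y)) : ℝ) : ℂ) * rr κ a t x y z = om κ * (((2 * π)⁻¹ : ℝ) : ℂ) *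
      ∫ l : ℝ, ((sg κ a l t x y * kk a l t x y : ℝ) : ℂ) * Complex.exp (-Complex.I * ((l * z : ℝ) : ℂ)) := by
  have hs : 0 < √t := Real.sqrt_pos.2 ht
  have hss : √t ^ 2 = t := Real.sq_sqrt ht.le
  simp_rw [← sykk κ a ht]
  unfold rr rho osI
  have h := Measure.integral_comp_mul_left (fun u : ℝ => ((sy κ (√t • a) ((√t)⁻¹ • x) ((√t)⁻¹ • y) u * Bf (NN n) ‖(√t)⁻¹ • x - (√t)⁻¹ • y‖ ‖(√t)⁻¹ • x + (√t)⁻¹ • y‖ u : ℝ) : ℂ) *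
    Complex.exp (-Complex.I * ((u * (z / t) : ℝ) : ℂ))) t
  have e : ∀ l : ℝ, t * l * (z / t) = l * z := fun l => by field_simp
  simp only [e] at h
  have h' : (∫ l : ℝ, ((t ^ (-NN n - 1/2) * (4 * π) ^ (-NN n) * Real.exp (-(‖a‖ ^ 2 * t)) *
      (sy κ (√t • a) ((√t)⁻¹ • x) ((√t)⁻¹ • y) (t * l) *
        Bf (NN n) ‖(√t)⁻¹ • x - (√t)⁻¹ • y‖ ‖(√t)⁻¹ • x + (√t)⁻¹ • y‖ (t * l)) : ℝ) : ℂ) * Complex.exp (-Complex.I * ((l * z : ℝ) : ℂ)))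
      = ((t ^ (-NN n - 1/2) * (4 * π) ^ (-NN n) * Real.exp (-(‖a‖ ^ 2 * t)) : ℝ) : ℂ) * ∫ l : ℝ, ((sy κ (√t • a) ((√t)⁻¹ • x) ((√t)⁻¹ • y) (t * l) *
        Bf (NN n) ‖(√t)⁻¹ • x - (√t)⁻¹ • y‖ ‖(√t)⁻¹ • x + (√t)⁻¹ • y‖ (t * l) : ℝ) : ℂ) * Complex.exp (-Complex.I * ((l * z : ℝ) : ℂ)) := by
    rw [← integral_const_mul]
    congr 1; ext l
    push_cast; ring
  rw [h', h, abs_of_pos (inv_pos.2 ht), Complex.real_smul]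
  set J := ∫ u : ℝ, ((sy κ (√t • a) ((√t)⁻¹ • x) ((√t)⁻¹ • y) u * Bf (NN n) ‖(√t)⁻¹ • x - (√t)⁻¹ • y‖ ‖(√t)⁻¹ • x + (√t)⁻¹ • y‖ u : ℝ) : ℂ) *
    Complex.exp (-Complex.I * ((u * (z / t) : ℝ) : ℂ))
  have e2 : -‖√t • a‖ ^ 2 + inner ℝ (√t • a) ((√t)⁻¹ • x - (√t)⁻¹ • y) = -(‖a‖ ^ 2 * t) + inner ℝ a (x - y) := by
    rw [← smul_sub, inner_smul_left, inner_smul_right, norm_smul, Real.norm_of_nonneg hs.le, mul_pow, hss]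
    simp only [conj_trivial]
    field_simp
  rw [e2, Real.exp_add]
  have e3 : t ^ (-NN n - 3/2) = t ^ (-NN n - 1/2) * t⁻¹ := by
    rw [← Real.rpow_neg_one t, ← Real.rpow_add ht]; congr 1; ring
  rw [e3, Real.exp_neg (inner ℝ a (x - y))]
  unfold cn
  have : Real.exp (inner ℝ a (x - y)) ≠ 0 := (Real.exp_pos _).ne'
  have : ((Real.exp (inner ℝ a (x - y)) : ℝ) : ℂ) ≠ 0 := by exact_mod_cast this
  push_cast at this ⊢
  field_simp

lemma sgkk_bd (hn : 1 ≤ n) (κ : Kap n) (a : EE n) {ε : ℝ} (hε : 0 < ε) : ∃ C : ℝ, 0 ≤ C ∧ ∀ t ∈ Ioc ε 1, ∀ l x y,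
    |sg κ a l t x y * kk a l t x y| ≤ C * (1 + (ε * l) ^ 2)⁻¹ := by
  have hpi := Real.pi_pos
  refine ⟨ε ^ (-NN n - 1/2) * (4 * π) ^ (-NN n) * (6 * (3 + ‖a‖) * Kc 1), by have := Kc_pos 1; positivity, ?_⟩
  rintro t ⟨ht1, ht2⟩ l x y
  have ht : 0 < t := hε.trans ht1
  have hN := half_le_NN hn
  rw [← sykk κ a ht, abs_mul, abs_of_pos (by positivity), abs_mul, abs_of_pos (Bf_pos _ _ _ _)]
  set X := (√t)⁻¹ • x
  set Y := (√t)⁻¹ • y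
  obtain ⟨P1, P2, -, -, h3⟩ := isSym_sy κ (√t • a) X Y
  have h3 := (h3 (t * l)).1
  have h4 := decay hN (norm_nonneg (X - Y)) (norm_nonneg (X + Y)) 1 (t * l)
  have hB := (Bf_pos (NN n) ‖X - Y‖ ‖X + Y‖ (t * l)).le
  have ha : ‖√t • a‖ ≤ ‖a‖ := by
    rw [norm_smul, Real.norm_of_nonneg (Real.sqrt_nonneg _)]
    have : √t ≤ 1 := Real.sqrt_le_iff.2 ⟨by norm_num, by simpa using ht2⟩
    nlinarith [norm_nonneg a]
  set d := ‖X - Y‖ with hd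
  have hd0 : 0 ≤ d := norm_nonneg _
  have h5 : (1 + d + ‖√t • a‖) * Real.exp (-(d ^ 2 / 4)) ≤ 3 + ‖a‖ := by
    have k1 : Real.exp (-(d ^ 2 / 4)) ≤ 1 := Real.exp_le_one_iff.2 (by nlinarith)
    have k2 : (1 + d) * Real.exp (-(d ^ 2 / 4)) ≤ 3 := by
      have := Real.add_one_le_exp (d ^ 2 / 4)
      rw [Real.exp_neg, ← div_eq_mul_inv, div_le_iff₀ (Real.exp_pos _)]
      nlinarith [sq_nonneg (d - 1)]
    have k3 : ‖√t • a‖ * Real.exp (-(d ^ 2 / 4)) ≤ ‖a‖ * 1 := by gcongr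
    linarith
  have h6 : (1 + ((1 + d + ‖X + Y‖) * (t * l)) ^ 2)⁻¹ ≤ (1 + (ε * l) ^ 2)⁻¹ := by
    apply inv_anti₀ (by positivity)
    have : |ε * l| ≤ |(1 + d + ‖X + Y‖) * (t * l)| := by
      rw [← mul_assoc, abs_mul, abs_mul]
      apply mul_le_mul_of_nonneg_right _ (abs_nonneg _)
      rw [abs_of_pos hε, abs_of_nonneg (by positivity)]
      nlinarith [norm_nonneg (X + Y), mul_nonneg (add_nonneg hd0 (norm_nonneg (X + Y))) ht.le]
    have := sq_le_sq.2 this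
    linarith
  have h7 : |sy κ (√t • a) X Y (t * l)| * Bf (NN n) d ‖X + Y‖ (t * l) ≤ 6 * (3 + ‖a‖) * Kc 1 * (1 + (ε * l) ^ 2)⁻¹ := by
    have hK := Kc_pos 1
    calc _ ≤ (6 * (1 + d + ‖√t • a‖) * (1 + (1 + d + ‖X + Y‖) * |t * l|) ^ 1) * Bf (NN n) d ‖X + Y‖ (t * l) := by gcongr
      _ = 6 * (1 + d + ‖√t • a‖) * ((1 + (1 + d + ‖X + Y‖) * |t * l|) ^ 1 * Bf (NN n) d ‖X + Y‖ (t * l)) := by ring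
      _ ≤ 6 * (1 + d + ‖√t • a‖) * (Kc 1 * Real.exp (-(d ^ 2 / 4)) * (1 + (ε * l) ^ 2)⁻¹) := by
        exact mul_le_mul_of_nonneg_left (h4.trans (by gcongr)) (by positivity)
      _ = 6 * ((1 + d + ‖√t • a‖) * Real.exp (-(d ^ 2 / 4))) * Kc 1 * (1 + (ε * l) ^ 2)⁻¹ := by ring
      _ ≤ _ := by gcongr
  have h8 : t ^ (-NN n - 1/2) * (4 * π) ^ (-NN n) * Real.exp (-(‖a‖ ^ 2 * t)) ≤ ε ^ (-NN n - 1/2) * (4 * π) ^ (-NN n) * 1 := by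
    have : t ^ (-NN n - 1/2) ≤ ε ^ (-NN n - 1/2) := Real.rpow_le_rpow_of_nonpos hε ht1.le (by linarith)
    have k1 : Real.exp (-(‖a‖ ^ 2 * t)) ≤ 1 := Real.exp_le_one_iff.2 (by nlinarith [sq_nonneg ‖a‖, mul_nonneg (sq_nonneg ‖a‖) ht.le])
    gcongr
  calc _ ≤ (ε ^ (-NN n - 1/2) * (4 * π) ^ (-NN n) * 1) * (6 * (3 + ‖a‖) * Kc 1 * (1 + (ε * l) ^ 2)⁻¹) := by
        gcongr
    _ = _ := by ring

end GR

namespace GR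
open scoped ENNReal ComplexConjugate
variable {n : ℕ}

/-! ### Part 19: global `L²` estimate, continued -/

/-- integrand of the three-fold integral -/
def Th0 (κ : Kap n) (a : EE n) (h : Om n → ℂ) (x : EE n) (l : ℝ) (p : Om n × ℝ) : ℂ :=
  ((sg κ a l p.2 x p.1.1 * kk a l p.2 x p.1.1 : ℝ) : ℂ) * (((p.2 ^ (-(1/2):ℝ) : ℝ) : ℂ) *
    (h p.1 * Complex.exp (Complex.I * ((l * p.1.2 : ℝ) : ℂ))))

def mT (n : ℕ) (ε : ℝ) : Measure (Om n × ℝ) := (volume : Measure (Om n)).prod (volume.restrict (Ioc ε 1))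

instance (ε : ℝ) : SFinite (mT n ε) := by unfold mT; infer_instance

def Vf (κ : Kap n) (a : EE n) (ε : ℝ) (h : Om n → ℂ) (x : EE n) (l : ℝ) : ℂ := ∫ p, Th0 κ a h x l p ∂(mT n ε)

def hatf (h : Om n → ℂ) (l : ℝ) (y : EE n) : ℂ := ∫ s : ℝ, h (y, s) * Complex.exp (Complex.I * ((l * s : ℝ) : ℂ))

lemma norm_expI (r : ℝ) : ‖Complex.exp (Complex.I * (r : ℂ))‖ = 1 := by
  rw [mul_comm]; exact Complex.norm_exp_ofReal_mul_I r

lemma norm_expnI (r : ℝ) : ‖Complex.exp (-Complex.I * (r : ℂ))‖ = 1 := by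
  have := norm_expI (-r)
  push_cast at this
  rwa [mul_neg, ← neg_mul] at this

lemma meas_expI {X : Type*} [MeasurableSpace X] {f : X → ℝ} (hf : Measurable f) :
    Measurable fun q => Complex.exp (Complex.I * ((f q : ℝ) : ℂ)) :=
  Complex.measurable_exp.comp ((Complex.measurable_ofReal.comp hf).const_mul _)

lemma measurable_Th0 (κ : Kap n) (a : EE n) {h : Om n → ℂ} (hm : Measurable h) :
    Measurable fun q : (EE n × ℝ) × (Om n × ℝ) => Th0 κ a h q.1.1 q.1.2 q.2 := by
  unfold Th0
  have hl : Measurable fun q : (EE n × ℝ) × (Om n × ℝ) => q.1.2 := by fun_prop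
  have ht : Measurable fun q : (EE n × ℝ) × (Om n × ℝ) => q.2.2 := by fun_prop
  have hx : Measurable fun q : (EE n × ℝ) × (Om n × ℝ) => q.1.1 := by fun_prop
  have hy : Measurable fun q : (EE n × ℝ) × (Om n × ℝ) => q.2.1.1 := by fun_prop
  have k0 := measurable_sg κ a hl ht hx hy
  have k1 := measurable_kk a hl ht hx hy
  refine (Complex.measurable_ofReal.comp (k0.mul k1)).mul ((Complex.measurable_ofReal.comp (by fun_prop)).mul
    ((hm.comp (by fun_prop)).mul (meas_expI (by fun_prop))))

lemma measurable_Vf (κ : Kap n) (a : EE n) (ε : ℝ) {h : Om n → ℂ} (hm : Measurable h) :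
    Measurable fun q : EE n × ℝ => Vf κ a ε h q.1 q.2 := by
  unfold Vf
  exact ((measurable_Th0 κ a hm).stronglyMeasurable.integral_prod_right (ν := mT n ε)).measurable

lemma int_thalf {ε : ℝ} (hε : 0 < ε) : Integrable (fun t : ℝ => t ^ (-(1/2):ℝ)) (volume.restrict (Ioc ε 1)) := by
  have : IntegrableOn (fun t : ℝ => t ^ (-(1/2):ℝ)) (Icc ε 1) := by
    apply ContinuousOn.integrableOn_Icc
    intro t ht
    exact (Real.continuousAt_rpow_const _ _ (Or.inl (hε.trans_le ht.1).ne')).continuousWithinAt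
  exact this.mono_set Ioc_subset_Icc_self

lemma ae_mT (n : ℕ) (ε : ℝ) : ∀ᵐ p ∂(mT n ε), p.2 ∈ Ioc ε 1 :=
  Measure.quasiMeasurePreserving_snd.ae (ae_restrict_mem measurableSet_Ioc)

lemma Th0_bd (hn : 1 ≤ n) (κ : Kap n) (a : EE n) {ε : ℝ} (hε : 0 < ε) (h : Om n → ℂ) : ∃ C : ℝ, 0 ≤ C ∧ ∀ x l, ∀ p : Om n × ℝ,
    p.2 ∈ Ioc ε 1 → ‖Th0 κ a h x l p‖ ≤ (C * (1 + (ε * l) ^ 2)⁻¹) * (‖h p.1‖ * p.2 ^ (-(1/2):ℝ)) := by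
  obtain ⟨C, hC, hb⟩ := sgkk_bd hn κ a hε
  refine ⟨C, hC, fun x l p hp => ?_⟩
  have ht : 0 < p.2 := hε.trans hp.1
  unfold Th0
  rw [norm_mul, norm_mul, norm_mul, norm_expI, Complex.norm_real, Complex.norm_real, Real.norm_eq_abs,
    Real.norm_of_nonneg (by positivity), mul_one, mul_comm ‖h p.1‖]
  gcongr
  exact hb _ hp _ _ _

lemma int_Th0 (hn : 1 ≤ n) (κ : Kap n) (a : EE n) {ε : ℝ} (hε : 0 < ε) {h : Om n → ℂ} (hm : Measurable h) (hi : Integrable h) (x : EE n) :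
    (∀ l, Integrable (Th0 κ a h x l) (mT n ε)) ∧
    Integrable (fun q : ℝ × (Om n × ℝ) => Th0 κ a h x q.1 q.2) (volume.prod (mT n ε)) := by
  obtain ⟨C, hC, hb⟩ := Th0_bd hn κ a hε h
  have h2 : Integrable (fun p : Om n × ℝ => ‖h p.1‖ * p.2 ^ (-(1/2):ℝ)) (mT n ε) := hi.norm.mul_prod (int_thalf hε)
  have h3 := ((integrable_cau hε).const_mul C).mul_prod h2
  have hM := measurable_Th0 κ a hm
  constructor
  · intro l
    have k : Measurable fun p : Om n × ℝ => (((x, l), p) : (EE n × ℝ) × (Om n × ℝ)) := by fun_prop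
    have k2 := hM.comp k
    simp only [Function.comp_def] at k2
    refine (h2.const_mul (C * (1 + (ε * l) ^ 2)⁻¹)).mono' k2.aestronglyMeasurable ?_
    filter_upwards [ae_mT n ε] with p hp using hb x l p hp
  · have k : Measurable fun q : ℝ × (Om n × ℝ) => (((x, q.1), q.2) : (EE n × ℝ) × (Om n × ℝ)) := by fun_prop
    have k2 := hM.comp k
    simp only [Function.comp_def] at k2
    refine h3.mono' k2.aestronglyMeasurable ?_
    filter_upwards [Measure.quasiMeasurePreserving_snd.ae (ae_mT n ε)] with q hq using hb x q.1 q.2 hq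

lemma Vf_eq (hn : 1 ≤ n) (κ : Kap n) (a : EE n) {ε : ℝ} (hε : 0 < ε) {h : Om n → ℂ} (hm : Measurable h) (hi : Integrable h) (x : EE n) (l : ℝ) :
    Vf κ a ε h x l = ∫ t in Ioc ε 1, ((t ^ (-(1/2):ℝ) : ℝ) : ℂ) * Gf κ a l (hatf h l) t x := by
  have h1 := (int_Th0 hn κ a hε hm hi x).1 l
  unfold Vf
  unfold mT at h1 ⊢
  rw [integral_prod_symm _ h1]
  apply setIntegral_congr_fun measurableSet_Ioc
  intro t ht
  obtain ⟨C, hC, hb⟩ := sgkk_bd hn κ a hε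
  have hi2 : Integrable fun y : Om n => h y * Complex.exp (Complex.I * ((l * y.2 : ℝ) : ℂ)) := by
    refine hi.mul_bdd (c := 1) (meas_expI (by fun_prop)).aestronglyMeasurable (ae_of_all _ fun y => (norm_expI _).le)
  have hi3 : Integrable fun y : Om n => ((sg κ a l t x y.1 * kk a l t x y.1 : ℝ) : ℂ) * (h y * Complex.exp (Complex.I * ((l * y.2 : ℝ) : ℂ))) := by
    refine hi2.bdd_mul (c := C * (1 + (ε * l) ^ 2)⁻¹) ?_ (ae_of_all _ fun y => ?_)
    · have hl : Measurable fun q : Om n => l := by fun_prop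
      have ht : Measurable fun q : Om n => t := by fun_prop
      have hx : Measurable fun q : Om n => x := by fun_prop
      have hy : Measurable fun q : Om n => q.1 := by fun_prop
      exact (Complex.measurable_ofReal.comp ((measurable_sg κ a hl ht hx hy).mul (measurable_kk a hl ht hx hy))).aestronglyMeasurable
    · rw [Complex.norm_real, Real.norm_eq_abs]; exact hb t ht _ _ _
  have e : ∀ y : Om n, Th0 κ a h x l (y, t) = ((t ^ (-(1/2):ℝ) : ℝ) : ℂ) * (((sg κ a l t x y.1 * kk a l t x y.1 : ℝ) : ℂ) * (h y * Complex.exp (Complex.I * ((l * y.2 : ℝ) : ℂ)))) := by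
    intro y; unfold Th0; simp only; ring
  simp only [e]
  rw [integral_const_mul]
  congr 1
  rw [Measure.volume_eq_prod] at hi3 ⊢
  rw [integral_prod _ hi3]
  unfold Gf hatf
  congr 1; ext y
  rw [← integral_const_mul]

lemma Vf_int (hn : 1 ≤ n) (κ : Kap n) (a : EE n) {ε : ℝ} (hε : 0 < ε) {h : Om n → ℂ} (hm : Measurable h) (hi : Integrable h) (x : EE n) :
    Integrable (Vf κ a ε h x) := (int_Th0 hn κ a hε hm hi x).2.integral_prod_left

lemma Ke_freq (hn : 1 ≤ n) (κ : Kap n) (a : EE n) {ε : ℝ} (hε : 0 < ε) {h : Om n → ℂ} (hm : Measurable h) (hi : Integrable h) (x : Om n) :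
    ∫ y, (∫ t in Ioc ε 1, ((t ^ (-(1/2):ℝ) : ℝ) : ℂ) * (((Real.exp (-inner ℝ a (x.1 - y.1)) : ℝ) : ℂ) * rr κ a t x.1 y.1 (x.2 - y.2))) * h y
    = om κ * (((2 * π)⁻¹ : ℝ) : ℂ) * ∫ l, Vf κ a ε h x.1 l * Complex.exp (-Complex.I * (l * x.2)) := by
  have h2 := (int_Th0 hn κ a hε hm hi x.1).2
  have h3 : Integrable (fun q : ℝ × (Om n × ℝ) => Th0 κ a h x.1 q.1 q.2 * Complex.exp (-Complex.I * (q.1 * x.2))) (volume.prod (mT n ε)) := by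
    refine h2.mul_bdd (c := 1) ?_ (ae_of_all _ fun q => ?_)
    · have : Continuous fun q : ℝ × (Om n × ℝ) => Complex.exp (-Complex.I * (q.1 * x.2)) := by fun_prop
      exact this.aestronglyMeasurable
    · have := norm_expnI (q.1 * x.2)
      push_cast at this
      exact this.le
  have e1 : ∀ l : ℝ, Vf κ a ε h x.1 l * Complex.exp (-Complex.I * (l * x.2)) = ∫ p, Th0 κ a h x.1 l p * Complex.exp (-Complex.I * (l * x.2)) ∂(mT n ε) := by
    intro l; unfold Vf; rw [integral_mul_const]
  simp only [e1]
  rw [integral_integral_swap h3, ← integral_const_mul]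
  have h4 := (h3.swap.integral_prod_left).const_mul (om κ * (((2 * π)⁻¹ : ℝ) : ℂ))
  simp only [Function.comp_apply, Prod.swap_prod_mk, Prod.fst_swap, Prod.snd_swap] at h4
  unfold mT at h4 ⊢
  rw [integral_prod _ h4]
  congr 1; ext y
  rw [← integral_mul_const]
  apply setIntegral_congr_fun measurableSet_Ioc
  intro t ht
  simp only
  rw [rr_freq κ a (hε.trans ht.1)]
  rw [mul_comm _ (h y), ← mul_assoc, ← mul_assoc, mul_comm (h y * _), mul_assoc, ← integral_const_mul]
  congr 2; ext l
  unfold Th0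
  simp only
  have : Complex.exp (-Complex.I * ((l * (x.2 - y.2) : ℝ) : ℂ)) = Complex.exp (Complex.I * ((l * y.2 : ℝ) : ℂ)) * Complex.exp (-Complex.I * (l * x.2)) := by
    rw [← Complex.exp_add]; congr 1; push_cast; ring
  rw [this]; ring

lemma hat_planch {h : Om n → ℂ} (hm : Measurable h) {y : EE n} (hi : Integrable fun s => h (y, s)) :
    ∫⁻ l, ‖hatf h l y‖ₑ ^ 2 ≤ ENNReal.ofReal (2 * π) * ∫⁻ s, ‖h (y, s)‖ₑ ^ 2 := by
  have h1 : Measurable fun s => h (y, s) := hm.comp (by fun_prop)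
  have h2 := planch h1 hi
  refine le_trans (le_of_eq ?_) h2
  rw [← lintegral_neg_eq_self]
  congr 1; ext l
  unfold hatf
  congr 3; ext s
  congr 2
  push_cast; ring

set_option maxHeartbeats 1000000 in
lemma L2_flat (hn : 1 ≤ n) (κ : Kap n) (a : EE n) {ε : ℝ} (hε : 0 < ε) (hε1 : ε ≤ 1) {h : Om n → ℂ} (hm : Measurable h) (hi : Integrable h)
    {B : ℝ} (hB : ∀ y, Integrable (fun s => h (y, s)) ∧ ∫ s, ‖h (y, s)‖ ≤ B) :
    ∫⁻ x : Om n, ‖om κ * (((2 * π)⁻¹ : ℝ) : ℂ) * ∫ l, Vf κ a ε h x.1 l * Complex.exp (-Complex.I * (l * x.2))‖ₑ ^ 2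
      ≤ 12 * ∫⁻ y, ‖h y‖ₑ ^ 2 := by
  have hpi := Real.pi_pos
  have hV := measurable_Vf κ a ε hm
  set c : ℝ≥0∞ := ENNReal.ofReal ((2 * π)⁻¹) with hc
  have hcc : c * ENNReal.ofReal (2 * π) = 1 := by
    rw [hc, ← ENNReal.ofReal_mul (by positivity), inv_mul_cancel₀ (by positivity), ENNReal.ofReal_one]
  have hnorm : ∀ J : ℂ, ‖om κ * (((2 * π)⁻¹ : ℝ) : ℂ) * J‖ₑ ^ 2 = c ^ 2 * ‖J‖ₑ ^ 2 := by
    intro J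
    have e1 : ‖om κ‖ₑ = 1 := by rw [← ofReal_norm, norm_om, ENNReal.ofReal_one]
    have e2 : ‖(((2 * π)⁻¹ : ℝ) : ℂ)‖ₑ = c := by
      rw [← ofReal_norm, Complex.norm_real, Real.norm_of_nonneg (by positivity)]
    rw [enorm_mul, enorm_mul, e1, e2, one_mul, mul_pow]
  have hmI : Measurable fun x : Om n => ∫ l : ℝ, Vf κ a ε h x.1 l * Complex.exp (-Complex.I * (l * x.2)) := by
    have : Measurable fun q : Om n × ℝ => Vf κ a ε h q.1.1 q.2 * Complex.exp (-Complex.I * (q.2 * q.1.2)) := by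
      have k : Measurable fun q : Om n × ℝ => (q.1.1, q.2) := by fun_prop
      have k3 := hV.comp k
      have k2 : Continuous fun q : Om n × ℝ => Complex.exp (-Complex.I * (q.2 * q.1.2)) := by fun_prop
      exact k3.mul k2.measurable
    exact (this.stronglyMeasurable.integral_prod_right (ν := volume)).measurable
  simp only [hnorm]
  rw [Measure.volume_eq_prod, lintegral_prod _ ((hmI.enorm.pow_const 2).const_mul _).aemeasurable]
  simp only
  have hVl : ∀ᵐ l : ℝ, ∫⁻ x, ‖Vf κ a ε h x l‖ₑ ^ 2 ≤ 12 * ∫⁻ y, ‖hatf h l y‖ₑ ^ 2 := by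
    have : ∀ᵐ l : ℝ, l ≠ 0 := by simp [ae_iff]
    filter_upwards [this] with l hl
    simp only [Vf_eq hn κ a hε hm hi]
    refine freq_est (B := B) hl hε hε1 ?_ (fun y => ?_) κ
    · unfold hatf
      have k2 : Measurable fun q : EE n × ℝ => h (q.1, q.2) * Complex.exp (Complex.I * ((l * q.2 : ℝ) : ℂ)) :=
        (hm.comp (by fun_prop)).mul (meas_expI (by fun_prop))
      exact (k2.stronglyMeasurable.integral_prod_right (ν := volume)).measurable
    · unfold hatf
      refine (norm_integral_le_integral_norm _).trans (le_of_eq_of_le ?_ (hB y).2)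
      congr 1; ext s
      rw [norm_mul, norm_expI, mul_one]
  have hmh : Measurable fun q : ℝ × EE n => hatf h q.1 q.2 := by
    unfold hatf
    have k2 : Measurable fun q : (ℝ × EE n) × ℝ => h (q.1.2, q.2) * Complex.exp (Complex.I * ((q.1.1 * q.2 : ℝ) : ℂ)) :=
      (hm.comp (by fun_prop)).mul (meas_expI (by fun_prop))
    exact (k2.stronglyMeasurable.integral_prod_right (ν := volume)).measurable
  have hhe : Measurable fun y : EE n × ℝ => ‖h y‖ₑ ^ 2 := hm.enorm.pow_const 2
  calc _ ≤ ∫⁻ x : EE n, c * ∫⁻ l, ‖Vf κ a ε h x l‖ₑ ^ 2 := by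
        apply lintegral_mono
        intro x
        have k : Measurable fun l : ℝ => Vf κ a ε h x l := by
          have k : Measurable fun l : ℝ => (x, l) := by fun_prop
          have k2 := hV.comp k
          simpa only [Function.comp_def] using k2
        beta_reduce
        rw [lintegral_const_mul' _ _ (by simp [hc])]
        refine (mul_le_mul_right (planch k (Vf_int hn κ a hε hm hi x)) _).trans ?_
        rw [← mul_assoc, pow_two, mul_assoc c, hcc, mul_one]
    _ = c * ∫⁻ l, ∫⁻ x : EE n, ‖Vf κ a ε h x l‖ₑ ^ 2 := by
        rw [lintegral_const_mul' _ _ (by simp [hc]), lintegral_lintegral_swap (hV.enorm.pow_const 2).aemeasurable]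
    _ ≤ c * ∫⁻ l, 12 * ∫⁻ y, ‖hatf h l y‖ₑ ^ 2 := mul_le_mul_right (lintegral_mono_ae hVl) _
    _ = c * (12 * ∫⁻ y, ∫⁻ l, ‖hatf h l y‖ₑ ^ 2) := by
        rw [lintegral_const_mul' _ _ (by simp), lintegral_lintegral_swap (hmh.enorm.pow_const 2).aemeasurable]
    _ ≤ c * (12 * ∫⁻ y : EE n, ENNReal.ofReal (2 * π) * ∫⁻ s, ‖h (y, s)‖ₑ ^ 2) :=
        mul_le_mul_right (mul_le_mul_right (lintegral_mono fun y => hat_planch hm (hB y).1) _) _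
    _ = _ := by
        rw [lintegral_const_mul' _ _ ENNReal.ofReal_ne_top, lintegral_prod _ hhe.aemeasurable, mul_left_comm, ← mul_assoc c, hcc, one_mul]

lemma int_muO (a : EE n) (F : Om n → ℂ) : ∫ y, F y ∂(muO a) = ∫ y : Om n, ((Real.exp (2 * inner ℝ a y.1) : ℝ) : ℂ) * F y := by
  unfold muO
  rw [integral_withDensity_eq_integral_toReal_smul (by fun_prop) (ae_of_all _ fun _ => ENNReal.ofReal_lt_top)]
  congr 1; ext y
  rw [ENNReal.toReal_ofReal (Real.exp_pos _).le, Complex.real_smul]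

lemma lint_muO (a : EE n) {F : Om n → ℝ≥0∞} (hF : Measurable F) :
    ∫⁻ y, F y ∂(muO a) = ∫⁻ y : Om n, ENNReal.ofReal (Real.exp (2 * inner ℝ a y.1)) * F y := by
  unfold muO
  rw [lintegral_withDensity_eq_lintegral_mul _ (by fun_prop) hF]
  rfl

lemma lint_muO_sq (a : EE n) {T : Om n → ℂ} (hT : Measurable T) :
    ∫⁻ x, ‖T x‖ₑ ^ 2 ∂(muO a) = ∫⁻ x, ‖((Real.exp (inner ℝ a x.1) : ℝ) : ℂ) * T x‖ₑ ^ 2 := by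
  rw [lint_muO a (hT.enorm.pow_const 2)]
  congr 1; ext x
  rw [enorm_mul, mul_pow, ← ofReal_norm ((Real.exp (inner ℝ a x.1) : ℝ) : ℂ), Complex.norm_real, Real.norm_of_nonneg (Real.exp_pos _).le,
    ← ENNReal.ofReal_pow (Real.exp_pos _).le, ← Real.exp_nat_mul]
  norm_num

lemma L2_Ke (hn : 1 ≤ n) (κ : Kap n) (a : EE n) {ε : ℝ} (hε : 0 < ε) (hε1 : ε ≤ 1) {g : Om n → ℂ} (hm : Measurable g)
    {M R : ℝ} (hM : ∀ x, ‖g x‖ ≤ M) (hR : 0 ≤ R) (hs : ∀ x : Om n, g x ≠ 0 → ‖x.1‖ ≤ R ∧ |x.2| ≤ R) :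
    ∫⁻ x, ‖∫ y, Ke κ a ε x y * g y ∂(muO a)‖ₑ ^ 2 ∂(muO a) ≤ 12 * ∫⁻ y, ‖g y‖ₑ ^ 2 ∂(muO a) := by
  have hM0 : 0 ≤ M := (norm_nonneg _).trans (hM 0)
  set h : Om n → ℂ := fun y => ((Real.exp (inner ℝ a y.1) : ℝ) : ℂ) * g y with hh
  have hhm : Measurable h := (Complex.measurable_ofReal.comp (by fun_prop)).mul hm
  set B := Real.exp (‖a‖ * R) * M with hB
  have hB0 : 0 ≤ B := by positivity
  have hbd : ∀ y, ‖h y‖ ≤ B := by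
    intro y
    by_cases hy : g y = 0
    · simp [hh, hy, hB0]
    · rw [hh]; simp only
      rw [norm_mul, Complex.norm_real, Real.norm_of_nonneg (Real.exp_pos _).le]
      exact mul_le_mul (Real.exp_le_exp.2 ((real_inner_le_norm _ _).trans (mul_le_mul_of_nonneg_left (hs y hy).1 (norm_nonneg _))))
        (hM y) (norm_nonneg _) (Real.exp_pos _).le
  have hz : ∀ y, y ∉ Metric.closedBall (0 : EE n) R ×ˢ Icc (-R) R → h y = 0 := by
    intro y hy
    by_contra hc
    have : g y ≠ 0 := fun h0 => hc (by simp [hh, h0])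
    exact hy ⟨by simpa using (hs y this).1, abs_le.1 (hs y this).2⟩
  have hi : Integrable h := by
    have h1 : IntegrableOn h (Metric.closedBall (0 : EE n) R ×ˢ Icc (-R) R) := by
      refine IntegrableOn.of_bound ?_ hhm.aestronglyMeasurable B (ae_of_all _ hbd)
      exact ((isCompact_closedBall _ _).prod isCompact_Icc).measure_lt_top
    exact h1.integrable_of_forall_notMem_eq_zero hz
  have hsec : ∀ y, Integrable (fun s => h (y, s)) ∧ ∫ s, ‖h (y, s)‖ ≤ B * (2 * R) := by
    intro y
    have hz' : ∀ s, s ∉ Icc (-R) R → h (y, s) = 0 := fun s hs' => hz _ (fun h' => hs' h'.2)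
    have hmy : Measurable fun s => h (y, s) := hhm.comp (by fun_prop)
    have h1 : IntegrableOn (fun s => h (y, s)) (Icc (-R) R) :=
      IntegrableOn.of_bound isCompact_Icc.measure_lt_top hmy.aestronglyMeasurable B (ae_of_all _ fun s => hbd _)
    refine ⟨h1.integrable_of_forall_notMem_eq_zero hz', ?_⟩
    rw [← setIntegral_eq_integral_of_forall_compl_eq_zero (s := Icc (-R) R) (fun s hs => by rw [hz' s hs, norm_zero])]
    refine (setIntegral_mono_on h1.norm (integrableOn_const (by simp)) measurableSet_Icc (fun s _ => hbd _)).trans ?_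
    simp [Measure.real]
    rw [ENNReal.toReal_ofReal (by linarith)]; linarith
  have hKm := measurable_Ke κ a ε
  have hTm : Measurable fun x => ∫ y, Ke κ a ε x y * g y ∂(muO a) := by
    have hK2 : Measurable fun q : Om n × Om n => Ke κ a ε q.1 q.2 * g q.2 := hKm.mul (hm.comp measurable_snd)
    have : SFinite (muO a) := by unfold muO; infer_instance
    exact (hK2.stronglyMeasurable.integral_prod_right (ν := muO a)).measurable
  rw [lint_muO_sq a hTm, lint_muO_sq a hm]
  refine le_of_eq_of_le ?_ (L2_flat hn κ a hε hε1 hhm hi hsec)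
  congr 1; ext x
  rw [← Ke_freq hn κ a hε hhm hi, int_muO, ← integral_const_mul]
  congr 3; ext y
  have e : ∀ t : ℝ, ((t ^ (-(1/2):ℝ) : ℝ) : ℂ) * (((Real.exp (-inner ℝ a (x.1 - y.1)) : ℝ) : ℂ) * rr κ a t x.1 y.1 (x.2 - y.2)) =
    ((Real.exp (-inner ℝ a (x.1 - y.1)) : ℝ) : ℂ) * (((t ^ (-(1/2):ℝ) : ℝ) : ℂ) * rr κ a t x.1 y.1 (x.2 - y.2)) := fun t => by ring
  simp only [e]
  rw [integral_const_mul]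
  unfold Ke
  rw [hh]; simp only
  set J := ∫ t in Ioc ε 1, ((t ^ (-(1/2):ℝ) : ℝ) : ℂ) * rr κ a t x.1 y.1 (x.2 - y.2)
  have e2 : Real.exp (inner ℝ a x.1) * (Real.exp (2 * inner ℝ a y.1) * Real.exp (-(2 * inner ℝ a x.1))) =
      Real.exp (-inner ℝ a (x.1 - y.1)) * Real.exp (inner ℝ a y.1) := by
    rw [← Real.exp_add, ← Real.exp_add, ← Real.exp_add, inner_sub_right]; congr 1; ring
  have e3 : ((Real.exp (inner ℝ a x.1) : ℝ) : ℂ) * (((Real.exp (2 * inner ℝ a y.1) : ℝ) : ℂ) * ((Real.exp (-(2 * inner ℝ a x.1)) : ℝ) : ℂ)) =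
      ((Real.exp (-inner ℝ a (x.1 - y.1)) : ℝ) : ℂ) * ((Real.exp (inner ℝ a y.1) : ℝ) : ℂ) := by exact_mod_cast e2
  linear_combination (J * g y) * e3

def Cz (n : ℕ) : ℝ≥0∞ := 4 * 12 * ENNReal.ofReal (Dc n) + 4 * ENNReal.ofReal (4 * (2 * C5 n + C6 n)) + ENNReal.ofReal (Dc n)

/-- uniform weak type (1,1) of the truncated local operators -/
lemma weak_local (hn : 1 ≤ n) (κ : Kap n) {a : EE n} (ha : ‖a‖ = 1) {ε : ℝ} (hε : 0 < ε) (hε1 : ε ≤ 1) {f : Om n → ℂ}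
    (hf : Continuous f) (hc : HasCompactSupport f) {σ : ℝ≥0∞} (hσ : σ ≠ ⊤) :
    σ * muO a {x | σ < ‖∫ y, Ke κ a ε x y * f y ∂(muO a)‖ₑ} ≤ Cz n * ∫⁻ y, ‖f y‖ₑ ∂(muO a) := by
  have : SFinite (muO a) := by unfold muO; infer_instance
  have : IsLocallyFiniteMeasure (muO a) := by
    unfold muO
    exact IsLocallyFiniteMeasure.withDensity_ofReal (by fun_prop)
  have hfi : Integrable f (muO a) := hf.integrable_of_hasCompactSupport hc
  obtain ⟨R, hR⟩ := hc.isCompact.isBounded.subset_closedBall (0 : Om n)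
  set R' := max R 0
  have hR' : 0 ≤ R' := le_max_right _ _
  set Q := R' + 2 * n + 4 * n * (R' + 1) with hQ
  have hQ0 : 0 ≤ Q := by positivity
  refine cz_main (c := code) (S := SS) (D := ENNReal.ofReal (Dc n)) (F0 := code 0 '' (Metric.closedBall (0 : Om n) R'))
    code_meas code_nest (mu_ne_zero ha) (mu_ne_top ha) one_le_Dc ENNReal.ofReal_ne_top
    (mu_dbl ha) SS_meas (mu_SS ha) (measurable_Ke κ a ε) (Ke_bdd hn κ ha hε) hf.measurable hfi ?_ ?_
    (fun k y y0 h => Hk hn κ ha hε (k+1) y y0 h) (H0 hn κ ha hε) hσ (fun x h => leb hn ha hf x h)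
  · intro x hx
    by_contra h0
    exact hx ⟨x, Metric.closedBall_subset_closedBall (le_max_left _ _) (hR (subset_tsupport f h0)), rfl⟩
  · rintro g hgm ⟨M, hM⟩ hz -
    refine L2_Ke hn κ a hε hε1 hgm hM hQ0 (fun x hx => ?_)
    have : code 0 x ∈ code 0 '' (Metric.closedBall (0 : Om n) R') := by
      by_contra h0; exact hx (hz x h0)
    obtain ⟨y, hy, hyx⟩ := this
    rw [mem_closedBall_zero_iff, Prod.norm_def, sup_le_iff] at hy
    have h1 := cell_dist1 hyx.symm
    have h2 := code_mem2 hyx.symm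
    have h3 := LL_upper hn 0 (gm 0 y.1) y.1 (fun j => ⟨(code_mem rfl j).1, (code_mem rfl j).2.le⟩)
    have h4 := norm_le_norm_add_norm_sub' x.1 y.1
    have h5 : |x.2| ≤ |y.2| + |x.2 - y.2| := by
      have := abs_add_le y.2 (x.2 - y.2); simpa using this
    have h6 := hy.2
    rw [Real.norm_eq_abs] at h6
    have hn0 : (0:ℝ) ≤ n := by positivity
    simp only [pow_zero, div_one, mul_one] at h3
    have h7 : 4 * (n:ℝ) * (‖y.1‖ + 1) ≤ 4 * n * (R' + 1) := by
      have := hy.1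
      gcongr
    have h8 : 0 ≤ 4 * (n:ℝ) * (R' + 1) := by positivity
    constructor <;> rw [hQ] <;> linarith [hy.1]

end GR

namespace GR
open scoped ENNReal
variable {n : ℕ}

/-! ### Part 20: large times -/

def cf (t Y z : ℝ) : ℝ := √t ^ 4 * (√t + Y) / (√t ^ 3 * (√t + Y) ^ 2 + z ^ 2)

lemma cf_nonneg {t Y : ℝ} (hY : 0 ≤ Y) (z : ℝ) : 0 ≤ cf t Y z := by
  have := Real.sqrt_nonneg t
  unfold cf; positivity

lemma cf_eq {t Y : ℝ} (ht : 0 < t) (z : ℝ) : cf t Y z = √√t * cau (√√t * (1 + Y / √t)) (z / t) := by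
  have hq : 0 < √√t := Real.sqrt_pos.2 (Real.sqrt_pos.2 ht)
  have h1 : √√t ^ 2 = √t := Real.sq_sqrt (Real.sqrt_nonneg t)
  have h2 : √t ^ 2 = t := Real.sq_sqrt ht.le
  unfold cf cau
  rw [mul_pow, h1]
  rw [← mul_div_assoc, ← mul_assoc, ← pow_two, h1]
  have hs : 0 < √t := Real.sqrt_pos.2 ht
  generalize √t = p at *
  have e : p * (1 + Y / p) ^ 2 + (z / t) ^ 2 = (p ^ 3 * (p + Y) ^ 2 + z ^ 2) / p ^ 4 := by
    rw [← h2]; field_simp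
  have e2 : p * (1 + Y / p) = p + Y := by field_simp
  rw [e, e2, div_div_eq_mul_div]
  ring

lemma cf_block {t τ Y z : ℝ} (ht : 0 < t) (h1 : t ≤ τ) (h2 : τ ≤ 2 * t) (hY : 0 ≤ Y) : cf t Y z ≤ 8 * cf τ Y z := by
  unfold cf
  have hp : 0 < √t := Real.sqrt_pos.2 ht
  have hP : 0 < √τ := Real.sqrt_pos.2 (ht.trans_le h1)
  have e1 : √t ^ 2 = t := Real.sq_sqrt ht.le
  have e2 : √τ ^ 2 = τ := Real.sq_sqrt (ht.trans_le h1).le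
  have h3 : √t ≤ √τ := Real.sqrt_le_sqrt h1
  have h4 : √τ ^ 2 ≤ 2 * √t ^ 2 := by rw [e1, e2]; exact h2
  clear e1 e2
  generalize √t = p at *
  generalize √τ = P at *
  have h5 : P ≤ 3 / 2 * p := abs_le_of_sq_le_sq' (by nlinarith) (by positivity) |>.2
  have h6 : (P + Y) ^ 2 ≤ 2 * (p + Y) ^ 2 := by nlinarith [mul_nonneg hp.le hY, mul_nonneg (sub_nonneg.2 h5) hY]
  have h7 : P ^ 3 * (P + Y) ^ 2 ≤ 8 * (p ^ 3 * (p + Y) ^ 2) := by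
    calc P ^ 3 * (P + Y) ^ 2 = P ^ 2 * P * (P + Y) ^ 2 := by ring
      _ ≤ (2 * p ^ 2) * (3 / 2 * p) * (2 * (p + Y) ^ 2) := by gcongr
      _ ≤ _ := by nlinarith [mul_nonneg (pow_pos hp 3).le (sq_nonneg (p + Y))]
  rw [← mul_div_assoc, div_le_div_iff₀ (by positivity) (by positivity)]
  calc p ^ 4 * (p + Y) * (P ^ 3 * (P + Y) ^ 2 + z ^ 2) ≤ P ^ 4 * (P + Y) * (8 * (p ^ 3 * (p + Y) ^ 2) + 8 * z ^ 2) := by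
        gcongr
        nlinarith [sq_nonneg z]
    _ = _ := by ring

/-- majorant -/
def gk (n : ℕ) (τ : ℝ) (v : EE n) (Y z : ℝ) : ℝ :=
  τ ^ (-NN n - 5 / 2) * Real.exp (-(1 / (8 * τ) * ‖v‖ ^ 2)) * cf τ Y z

lemma rr_large (hn : 1 ≤ n) (κ : Kap n) {a : EE n} (ha : ‖a‖ = 1) {t : ℝ} (ht : 1 ≤ t) (x y : EE n) (z : ℝ) :
    t ^ (-(1/2):ℝ) * ‖rr κ a t x y z‖ ≤ C2 n * (t ^ (-NN n - 3/2) * Real.exp (-(1 / (8 * t) * ‖(x - y) - (2 * t) • a‖ ^ 2)) * cf t ‖y‖ z) := by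
  have ht0 : 0 < t := by linarith
  have hs : 0 < √t := Real.sqrt_pos.2 ht0
  have hss : √t ^ 2 = t := Real.sq_sqrt ht0.le
  have hna : ‖√t • a‖ = √t := by rw [norm_smul, ha, mul_one, Real.norm_of_nonneg hs.le]
  have h := rho_large hn κ (√t • a) ((√t)⁻¹ • x) ((√t)⁻¹ • y) (z / t) (by rw [hna]; exact Real.one_le_sqrt.2 ht)
  rw [hna] at h
  have e1 : ‖(√t)⁻¹ • x - (√t)⁻¹ • y - (2:ℝ) • (√t • a)‖ ^ 2 / 8 = 1 / (8 * t) * ‖(x - y) - (2 * t) • a‖ ^ 2 := by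
    have : (√t)⁻¹ • x - (√t)⁻¹ • y - (2:ℝ) • (√t • a) = (√t)⁻¹ • ((x - y) - (2 * t) • a) := by
      rw [smul_sub, smul_sub, smul_smul, smul_smul]
      congr 2
      nth_rewrite 3 [← hss]
      field_simp
    rw [this, norm_smul, norm_inv, Real.norm_of_nonneg hs.le, mul_pow, inv_pow, hss]
    field_simp
  have e2 : √t * (1 + ‖(√t)⁻¹ • y‖) / (√t * (1 + ‖(√t)⁻¹ • y‖) ^ 2 + (z / t) ^ 2) = cf t ‖y‖ z := by
    rw [norm_smul, norm_inv, Real.norm_of_nonneg hs.le]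
    unfold cf
    clear e1 h hna
    generalize √t = p at *
    generalize ‖y‖ = Y
    have e : p * (1 + p⁻¹ * Y) ^ 2 + (z / t) ^ 2 = (p ^ 3 * (p + Y) ^ 2 + z ^ 2) / p ^ 4 := by
      rw [← hss]; field_simp
    have e2 : p * (1 + p⁻¹ * Y) = p + Y := by field_simp
    rw [e, e2, div_div_eq_mul_div]
    ring
  rw [e1, e2] at h
  unfold rr
  rw [norm_mul, Complex.norm_real, Real.norm_of_nonneg (Real.rpow_pos_of_pos ht0 _).le]
  have e3 : t ^ (-(1/2):ℝ) * √t = 1 := by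
    rw [Real.sqrt_eq_rpow, ← Real.rpow_add ht0]; norm_num
  have hp : 0 < t ^ (-NN n - 3/2) := Real.rpow_pos_of_pos ht0 _
  have hp2 : 0 < t ^ (-(1/2):ℝ) := Real.rpow_pos_of_pos ht0 _
  calc _ ≤ t ^ (-(1/2):ℝ) * (t ^ (-NN n - 3/2) * (C2 n * (√t * Real.exp (-(1 / (8 * t) * ‖(x - y) - (2 * t) • a‖ ^ 2)) * cf t ‖y‖ z))) := by gcongr
    _ = (t ^ (-(1/2):ℝ) * √t) * (C2 n * (t ^ (-NN n - 3/2) * Real.exp (-(1 / (8 * t) * ‖(x - y) - (2 * t) • a‖ ^ 2)) * cf t ‖y‖ z)) := by ring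
    _ = _ := by rw [e3, one_mul]

def Psi (n : ℕ) (v : EE n) (Y z : ℝ) : ℝ≥0∞ := ∫⁻ τ in Ioi (1:ℝ), ENNReal.ofReal (gk n τ v Y z)

def C7 (n : ℕ) : ℝ := 2 * (2 ^ (NN n + 3/2) * 8)

lemma gk_block {t Y z : ℝ} (ht : 1 ≤ t) (hY : 0 ≤ Y) (v : EE n) :
    ENNReal.ofReal (t ^ (-NN n - 3/2) * Real.exp (-(1 / (8 * t) * ‖v‖ ^ 2)) * cf t Y z) ≤ ENNReal.ofReal (C7 n) * Psi n v Y z := by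
  have ht0 : 0 < t := by linarith
  set G := t ^ (-NN n - 3/2) * Real.exp (-(1 / (8 * t) * ‖v‖ ^ 2)) * cf t Y z with hG
  have hN : 0 ≤ NN n := by unfold NN; positivity
  have hG0 : 0 ≤ G := by have := cf_nonneg (t := t) hY z; positivity
  have key : ∀ τ ∈ Ioc t (2 * t), G ≤ C7 n * t * gk n τ v Y z := by
    rintro τ ⟨h1, h2⟩
    have hτ : 0 < τ := ht0.trans h1
    have k1 : t ^ (-NN n - 3/2) ≤ 2 ^ (NN n + 3/2) * τ ^ (-NN n - 3/2) := by
      have e : (2:ℝ) ^ (NN n + 3/2) = 2⁻¹ ^ (-NN n - 3/2) := by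
        rw [Real.inv_rpow (by norm_num), ← Real.rpow_neg (by norm_num)]; congr 1; ring
      rw [e, ← Real.mul_rpow (by norm_num) hτ.le]
      exact Real.rpow_le_rpow_of_nonpos (by positivity) (by linarith) (by linarith)
    have k2 : Real.exp (-(1 / (8 * t) * ‖v‖ ^ 2)) ≤ Real.exp (-(1 / (8 * τ) * ‖v‖ ^ 2)) := by
      gcongr
    have k3 := cf_block (z := z) ht0 h1.le h2 hY
    have k4 : τ ^ (-NN n - 3/2) = τ * τ ^ (-NN n - 5/2) := by
      have : -NN n - 3/2 = 1 + (-NN n - 5/2) := by ring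
      rw [this, Real.rpow_add hτ, Real.rpow_one]
    have k5 := cf_nonneg (t := τ) hY z
    have k6 : 0 < τ ^ (-NN n - 5/2) := Real.rpow_pos_of_pos hτ _
    rw [hG]
    have k0 := cf_nonneg (t := t) hY z
    calc _ ≤ (2 ^ (NN n + 3/2) * (2 * t * τ ^ (-NN n - 5/2))) * Real.exp (-(1 / (8 * τ) * ‖v‖ ^ 2)) * (8 * cf τ Y z) := by
          refine mul_le_mul (mul_le_mul (k1.trans ?_) k2 (Real.exp_pos _).le (by positivity)) k3 k0 (by positivity)
          rw [k4]; gcongr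
      _ = _ := by unfold C7 gk; ring
  have h7 : 0 < C7 n := by unfold C7; positivity
  have : ENNReal.ofReal G ≤ ∫⁻ τ in Ioc t (2 * t), ENNReal.ofReal (C7 n * gk n τ v Y z) := by
    calc ENNReal.ofReal G = ∫⁻ τ in Ioc t (2 * t), ENNReal.ofReal (G / t) := by
          rw [setLIntegral_const, Real.volume_Ioc, ← ENNReal.ofReal_mul (by positivity)]
          congr 1; field_simp; ring
      _ ≤ _ := by
          refine setLIntegral_mono' measurableSet_Ioc fun τ hτ => ENNReal.ofReal_le_ofReal ?_
          rw [div_le_iff₀ ht0]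
          linarith [key τ hτ]
  refine this.trans ?_
  unfold Psi
  rw [← lintegral_const_mul' _ _ ENNReal.ofReal_ne_top]
  simp only [ENNReal.ofReal_mul h7.le]
  exact lintegral_mono_set fun τ hτ => ht.trans_lt hτ.1

lemma measurable_Psi : Measurable fun q : EE n × ℝ × ℝ => Psi n q.1 q.2.1 q.2.2 := by
  unfold Psi
  have : Measurable fun q : (EE n × ℝ × ℝ) × ℝ => ENNReal.ofReal (gk n q.2 q.1.1 q.1.2.1 q.1.2.2) := by
    unfold gk cf
    fun_prop
  exact this.lintegral_prod_right'

def C8 (n : ℕ) : ℝ := 4 * ((8 * π) ^ NN n * π)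

lemma int_Psi (y : EE n) (s : ℝ) : ∫⁻ x : Om n, Psi n (x.1 - y) ‖y‖ (x.2 - s) ≤ ENNReal.ofReal (C8 n) := by
  have hpi := Real.pi_pos
  unfold Psi
  have hm : Measurable fun q : Om n × ℝ => ENNReal.ofReal (gk n q.2 (q.1.1 - y) ‖y‖ (q.1.2 - s)) := by
    unfold gk cf
    fun_prop
  rw [lintegral_lintegral_swap hm.aemeasurable]
  have h1 : ∀ τ ∈ Ioi (1:ℝ), ∫⁻ x : Om n, ENNReal.ofReal (gk n τ (x.1 - y) ‖y‖ (x.2 - s)) = ENNReal.ofReal ((8 * π) ^ NN n * π * τ ^ (-(5/4):ℝ)) := by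
    intro τ hτ
    have hτ0 : (0:ℝ) < τ := lt_trans one_pos hτ
    have hs : 0 < √τ := Real.sqrt_pos.2 hτ0
    have hq : 0 < √√τ := Real.sqrt_pos.2 hs
    have e : ∀ x : Om n, ENNReal.ofReal (gk n τ (x.1 - y) ‖y‖ (x.2 - s)) = ENNReal.ofReal (τ ^ (-NN n - 5/2) * √√τ) *
        ENNReal.ofReal (Real.exp (-(1 / (8 * τ) * ‖x.1 - y‖ ^ 2)) * cau (√√τ * (1 + ‖y‖ / √τ)) ((x.2 - s) / τ)) := by
      intro x
      rw [← ENNReal.ofReal_mul (by positivity)]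
      unfold gk
      rw [cf_eq hτ0]
      congr 1; ring
    simp only [e]
    rw [lintegral_const_mul' _ _ ENNReal.ofReal_ne_top, lint_block (by positivity) (by positivity) hτ0, ← ENNReal.ofReal_mul (by positivity)]
    congr 1
    have e1 : π / (1 / (8 * τ)) = (8 * π) * τ := by field_simp
    have e2 : √√τ = τ ^ (1/4:ℝ) := by
      rw [Real.sqrt_eq_rpow, Real.sqrt_eq_rpow, ← Real.rpow_mul hτ0.le]; norm_num
    have e3 : τ ^ (-(5/4):ℝ) = τ ^ (-NN n - 5/2) * τ ^ (1/4:ℝ) * τ ^ NN n * τ := by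
      rw [← Real.rpow_add hτ0, ← Real.rpow_add hτ0, ← Real.rpow_add_one hτ0.ne']; congr 1; ring
    rw [e1, Real.mul_rpow (by positivity) hτ0.le, e2, e3]
    ring
  rw [setLIntegral_congr_fun measurableSet_Ioi h1]
  simp only [ENNReal.ofReal_mul (show (0:ℝ) ≤ (8 * π) ^ NN n * π by positivity)]
  rw [lintegral_const_mul' _ _ ENNReal.ofReal_ne_top, ← ofReal_integral_eq_lintegral_ofReal
    (integrableOn_Ioi_rpow_of_lt (by norm_num) one_pos)
    ((ae_restrict_mem measurableSet_Ioi).mono fun τ hτ => Real.rpow_nonneg (le_trans zero_le_one (le_of_lt hτ)) _),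
    integral_Ioi_rpow_of_lt (by norm_num) one_pos, ← ENNReal.ofReal_mul (by positivity)]
  apply ENNReal.ofReal_le_ofReal
  unfold C8
  rw [Real.one_rpow]
  apply le_of_eq
  norm_num
  ring

end GR

namespace GR
open scoped ENNReal
variable {n : ℕ}

/-! ### Part 21: weak type bound for large times -/

/-- flow along the drift -/
def sh (a : EE n) (ρ : ℝ) (x : Om n) : Om n := x - ((2 * ρ) • a, 0)

lemma measurable_sh (a : EE n) : Measurable fun p : Om n × ℝ => sh a p.2 p.1 := by
  unfold sh; fun_prop

lemma sh_sh (a : EE n) (ρ ρ' : ℝ) (x : Om n) : sh a ρ' (sh a ρ x) = sh a (ρ + ρ') x := by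
  unfold sh
  ext1
  · simp only [Prod.fst_sub]; rw [sub_sub, ← add_smul]; congr 2; ring
  · simp

lemma inner_sh {a : EE n} (ha : ‖a‖ = 1) (ρ : ℝ) (x : Om n) : inner ℝ a (sh a ρ x).1 = inner ℝ a x.1 - 2 * ρ := by
  unfold sh
  simp only [Prod.fst_sub]
  rw [inner_sub_right, inner_smul_right, real_inner_self_eq_norm_sq, ha]; ring

def S0 (a : EE n) : Set (Om n) := {x | inner ℝ a x.1 ∈ Ico (0:ℝ) 2}

lemma measurableSet_S0 (a : EE n) : MeasurableSet (S0 a) := by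
  have : Measurable fun x : Om n => inner ℝ a x.1 := by fun_prop
  exact this measurableSet_Ico

lemma disint {a : EE n} (ha : ‖a‖ = 1) {Φ : Om n → ℝ≥0∞} (hΦ : Measurable Φ) :
    ∫⁻ x, Φ x = ∫⁻ x, (S0 a).indicator 1 x * ∫⁻ ρ, Φ (sh a ρ x) := by
  have hi : Measurable ((S0 a).indicator (1 : Om n → ℝ≥0∞)) := measurable_one.indicator (measurableSet_S0 a)
  have hms := measurable_sh a
  have hms2 : Measurable fun p : Om n × ℝ => sh a (-p.2) p.1 := by unfold sh; fun_prop
  have e1 : ∀ x : Om n, (S0 a).indicator 1 x * ∫⁻ ρ, Φ (sh a ρ x) = ∫⁻ ρ, (S0 a).indicator 1 x * Φ (sh a ρ x) := by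
    intro x
    rw [lintegral_const_mul']
    by_cases h : x ∈ S0 a <;> simp [h]
  simp only [e1]
  have hm1 : Measurable fun p : Om n × ℝ => (S0 a).indicator 1 p.1 * Φ (sh a p.2 p.1) :=
    (hi.comp measurable_fst).mul (hΦ.comp hms)
  have hm2 : Measurable fun p : Om n × ℝ => (S0 a).indicator 1 (sh a (-p.2) p.1) * Φ p.1 :=
    (hi.comp hms2).mul (hΦ.comp measurable_fst)
  rw [lintegral_lintegral_swap hm1.aemeasurable]
  have e2 : ∀ ρ : ℝ, ∫⁻ x : Om n, (S0 a).indicator 1 x * Φ (sh a ρ x) = ∫⁻ x : Om n, (S0 a).indicator 1 (sh a (-ρ) x) * Φ x := by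
    intro ρ
    have hI : (volume : Measure (Om n)).IsAddRightInvariant :=
      inferInstanceAs ((volume : Measure (EE n)).prod (volume : Measure ℝ)).IsAddRightInvariant
    have := lintegral_sub_right_eq_self (μ := (volume : Measure (Om n))) (fun x => (S0 a).indicator 1 (sh a (-ρ) x) * Φ x) ((2 * ρ) • a, (0:ℝ))
    rw [← this]
    apply lintegral_congr; intro x
    change _ = (S0 a).indicator 1 (sh a (-ρ) (sh a ρ x)) * Φ (sh a ρ x)
    rw [sh_sh, add_neg_cancel]
    congr 2
    simp only [sh, mul_zero, zero_smul]
    exact (sub_zero x).symm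
  simp only [e2]
  rw [← lintegral_lintegral_swap hm2.aemeasurable]
  apply lintegral_congr; intro x
  have hm3 : Measurable fun ρ : ℝ => (S0 a).indicator (1 : Om n → ℝ≥0∞) (sh a (-ρ) x) := by
    have h : Measurable fun ρ : ℝ => ((x, ρ) : Om n × ℝ) := by fun_prop
    exact hi.comp (hms2.comp h)
  rw [lintegral_mul_const _ hm3]
  have e3 : ∀ ρ : ℝ, (S0 a).indicator (1 : Om n → ℝ≥0∞) (sh a (-ρ) x) = (Ico (-(inner ℝ a x.1) / 2) (1 - (inner ℝ a x.1) / 2)).indicator 1 ρ := by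
    intro ρ
    have : sh a (-ρ) x ∈ S0 a ↔ ρ ∈ Ico (-(inner ℝ a x.1) / 2) (1 - (inner ℝ a x.1) / 2) := by
      unfold S0
      rw [mem_ofPred_eq, inner_sh ha, mem_Ico, mem_Ico]
      constructor <;> rintro ⟨h1, h2⟩ <;> constructor <;> linarith
    by_cases h : sh a (-ρ) x ∈ S0 a
    · rw [indicator_of_mem h, indicator_of_mem (this.1 h)]; rfl
    · rw [indicator_of_notMem h, indicator_of_notMem (fun h' => h (this.2 h'))]
  simp only [e3]
  rw [lintegral_indicator_one measurableSet_Ico, Real.volume_Ico]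
  have : 1 - inner ℝ a x.1 / 2 - -(inner ℝ a x.1) / 2 = 1 := by ring
  rw [this, ENNReal.ofReal_one, one_mul]

lemma exp_level (r : ℝ) (B : ℝ) :
    ∫⁻ ρ, ({ρ | Real.exp (2 * r - 4 * ρ) < B} : Set ℝ).indicator (fun ρ => ENNReal.ofReal (Real.exp (2 * r - 4 * ρ))) ρ ≤ ENNReal.ofReal B := by
  rcases le_or_gt B 0 with hB | hB
  · have : ({ρ | Real.exp (2 * r - 4 * ρ) < B} : Set ℝ) = ∅ := by
      ext ρ; simp only [mem_ofPred_eq, mem_empty_iff_false, iff_false, not_lt]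
      exact hB.trans (Real.exp_pos _).le
    rw [this]; simp
  have hs : ({ρ | Real.exp (2 * r - 4 * ρ) < B} : Set ℝ) = Ioi ((2 * r - Real.log B) / 4) := by
    ext ρ
    rw [mem_ofPred_eq, ← Real.lt_log_iff_exp_lt hB, mem_Ioi]
    constructor <;> intro h <;> linarith
  rw [hs, lintegral_indicator measurableSet_Ioi]
  have e : ∀ ρ, Real.exp (2 * r - 4 * ρ) = Real.exp (2 * r) * Real.exp (-4 * ρ) := by
    intro ρ; rw [← Real.exp_add]; congr 1; ring
  simp only [e, ENNReal.ofReal_mul (Real.exp_pos _).le]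
  rw [lintegral_const_mul' _ _ ENNReal.ofReal_ne_top, ← ofReal_integral_eq_lintegral_ofReal (integrableOn_exp_mul_Ioi (by norm_num) _)
    (ae_of_all _ fun _ => (Real.exp_pos _).le), integral_exp_mul_Ioi (by norm_num), ← ENNReal.ofReal_mul (Real.exp_pos _).le]
  apply ENNReal.ofReal_le_ofReal
  have : Real.exp (2 * r) * Real.exp (-4 * ((2 * r - Real.log B) / 4)) = B := by
    rw [← Real.exp_add]
    have : 2 * r + -4 * ((2 * r - Real.log B) / 4) = Real.log B := by ring
    rw [this, Real.exp_log hB]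
  linarith

lemma weak_flow {a : EE n} (ha : ‖a‖ = 1) {Ψ : Om n → ℝ≥0∞} (hΨ : Measurable Ψ) {σ : ℝ≥0∞} (hσ : σ ≠ ⊤) :
    σ * muO a {x | σ < ENNReal.ofReal (Real.exp (-(2 * inner ℝ a x.1))) * ∫⁻ ρ, Ψ (sh a ρ x)} ≤ ∫⁻ x, Ψ x := by
  set F : Om n → ℝ≥0∞ := fun x => ∫⁻ ρ, Ψ (sh a ρ x) with hF
  have hFm : Measurable F := by
    have := hΨ.comp (measurable_sh a)
    exact this.lintegral_prod_right'
  have hinv : ∀ x ρ, F (sh a ρ x) = F x := by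
    intro x ρ
    simp only [hF, sh_sh]
    exact lintegral_add_left_eq_self (fun ρ' => Ψ (sh a ρ' x)) ρ
  rcases eq_or_ne σ 0 with h0 | h0
  · rw [h0, zero_mul]; exact zero_le
  set E : Set (Om n) := {x | σ < ENNReal.ofReal (Real.exp (-(2 * inner ℝ a x.1))) * F x} with hE
  have hEm : MeasurableSet E := measurableSet_lt measurable_const (Measurable.mul (by fun_prop) hFm)
  change σ * muO a E ≤ _
  have hg : Measurable fun y : Om n => ENNReal.ofReal (Real.exp (2 * inner ℝ a y.1)) * E.indicator 1 y :=
    Measurable.mul (by fun_prop) (measurable_one.indicator hEm)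
  rw [← lintegral_indicator_one hEm, lint_muO a (measurable_one.indicator hEm), disint ha hg, disint ha hΨ,
    ← lintegral_const_mul' _ _ hσ]
  apply lintegral_mono; intro x
  beta_reduce
  rw [mul_left_comm]
  gcongr
  change _ ≤ F x
  rcases eq_or_ne (F x) ⊤ with hT | hT
  · rw [hT]; exact le_top
  have key : ∀ ρ, ENNReal.ofReal (Real.exp (2 * inner ℝ a (sh a ρ x).1)) * E.indicator 1 (sh a ρ x) ≤
      ({ρ | Real.exp (2 * inner ℝ a x.1 - 4 * ρ) < (F x / σ).toReal} : Set ℝ).indicator (fun ρ => ENNReal.ofReal (Real.exp (2 * inner ℝ a x.1 - 4 * ρ))) ρ := by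
    intro ρ
    have e : 2 * inner ℝ a (sh a ρ x).1 = 2 * inner ℝ a x.1 - 4 * ρ := by rw [inner_sh ha]; ring
    by_cases h : sh a ρ x ∈ E
    · rw [indicator_of_mem h, Pi.one_apply, mul_one, e, indicator_of_mem]
      rw [hE, mem_ofPred_eq, hinv, e] at h
      rw [mem_ofPred_eq, ← ENNReal.ofReal_lt_iff_lt_toReal (Real.exp_pos _).le (ENNReal.div_ne_top hT h0),
        ENNReal.lt_div_iff_mul_lt (Or.inl h0) (Or.inl hσ)]
      have hp : ENNReal.ofReal (Real.exp (2 * inner ℝ a x.1 - 4 * ρ)) ≠ 0 := by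
        rw [Ne, ENNReal.ofReal_eq_zero, not_le]; exact Real.exp_pos _
      calc _ < ENNReal.ofReal (Real.exp (2 * inner ℝ a x.1 - 4 * ρ)) * (ENNReal.ofReal (Real.exp (-(2 * inner ℝ a x.1 - 4 * ρ))) * F x) :=
            (ENNReal.mul_lt_mul_iff_right hp ENNReal.ofReal_ne_top).2 h
        _ = F x := by
            rw [← mul_assoc, ← ENNReal.ofReal_mul (Real.exp_pos _).le, ← Real.exp_add, add_neg_cancel, Real.exp_zero, ENNReal.ofReal_one, one_mul]
    · rw [indicator_of_notMem h, mul_zero]; exact zero_le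
  calc _ ≤ σ * ENNReal.ofReal ((F x / σ).toReal) := by
        gcongr
        exact (lintegral_mono key).trans (exp_level _ _)
    _ = F x := by
        rw [ENNReal.ofReal_toReal (ENNReal.div_ne_top hT h0), ENNReal.mul_div_cancel h0 hσ]

/-- density of `f` with respect to Lebesgue measure -/
def phi (a : EE n) (f : Om n → ℂ) (y : Om n) : ℝ≥0∞ := ENNReal.ofReal (Real.exp (2 * inner ℝ a y.1)) * ‖f y‖ₑ

def Ptot (a : EE n) (f : Om n → ℂ) (x : Om n) : ℝ≥0∞ :=
  ∫⁻ y : Om n, phi a f y * (ENNReal.ofReal (C2 n * C7 n) * Psi n (x.1 - y.1) ‖y.1‖ (x.2 - y.2))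

def Lop (κ : Kap n) (a : EE n) (f : Om n → ℂ) (x : Om n) : ℝ≥0∞ := ENNReal.ofReal (Real.exp (-(2 * inner ℝ a x.1))) *
  ∫⁻ t in Ioi (1:ℝ), ENNReal.ofReal (t ^ (-(1/2):ℝ)) * ∫⁻ y : Om n, ‖rr κ a t x.1 y.1 (x.2 - y.2)‖ₑ * phi a f y

lemma weak_large (hn : 1 ≤ n) (κ : Kap n) {a : EE n} (ha : ‖a‖ = 1) {f : Om n → ℂ} (hf : Continuous f) {σ : ℝ≥0∞} (hσ : σ ≠ ⊤) :
    σ * muO a {x | σ < Lop κ a f x} ≤ ENNReal.ofReal (C2 n * C7 n) * ENNReal.ofReal (C8 n) * ∫⁻ y, ‖f y‖ₑ ∂(muO a) := by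
  have hfm : Measurable fun y : Om n => ‖f y‖ₑ := hf.measurable.enorm
  have hφ : Measurable (phi a f) := by unfold phi; exact Measurable.mul (by fun_prop) hfm
  have hP : Measurable fun p : Om n × Om n => Psi n (p.1.1 - p.2.1) ‖p.2.1‖ (p.1.2 - p.2.2) := by
    have h : Measurable fun p : Om n × Om n => ((p.1.1 - p.2.1, ‖p.2.1‖, p.1.2 - p.2.2) : EE n × ℝ × ℝ) := by fun_prop
    have h2 := (measurable_Psi (n := n)).comp h
    simpa only [Function.comp_def] using h2
  have hM : Measurable fun p : Om n × Om n => phi a f p.2 * (ENNReal.ofReal (C2 n * C7 n) * Psi n (p.1.1 - p.2.1) ‖p.2.1‖ (p.1.2 - p.2.2)) :=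
    (hφ.comp measurable_snd).mul (hP.const_mul _)
  have hΨ : Measurable (Ptot a f) := hM.lintegral_prod_right'
  have hpt : ∀ x, Lop κ a f x ≤ ENNReal.ofReal (Real.exp (-(2 * inner ℝ a x.1))) * ∫⁻ ρ, Ptot a f (sh a ρ x) := by
    intro x
    unfold Lop
    refine mul_le_mul_right ?_ _
    refine le_trans (setLIntegral_mono' measurableSet_Ioi fun t ht => ?_) (setLIntegral_le_lintegral (Ioi 1) _)
    rw [← lintegral_const_mul' _ _ ENNReal.ofReal_ne_top]
    unfold Ptot
    apply lintegral_mono; intro y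
    beta_reduce
    rw [← mul_assoc, mul_comm]
    refine mul_le_mul_right ?_ _
    have h1 : (1:ℝ) ≤ t := le_of_lt ht
    have hb := rr_large hn κ ha h1 x.1 y.1 (x.2 - y.2)
    have hg := gk_block (z := x.2 - y.2) h1 (norm_nonneg y.1) ((x.1 - y.1) - (2 * t) • a)
    rw [← ofReal_norm, ← ENNReal.ofReal_mul (Real.rpow_nonneg (by linarith) _)]
    refine (ENNReal.ofReal_le_ofReal hb).trans ?_
    rw [ENNReal.ofReal_mul (C2_pos hn).le, ENNReal.ofReal_mul (C2_pos hn).le, mul_assoc (ENNReal.ofReal (C2 n)) (ENNReal.ofReal (C7 n))]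
    refine mul_le_mul_right ?_ _
    have e : (sh a t x).1 - y.1 = (x.1 - y.1) - (2 * t) • a := by simp only [sh, Prod.fst_sub]; abel
    have e2 : (sh a t x).2 - y.2 = x.2 - y.2 := by simp [sh]
    rw [e, e2]
    exact hg
  refine le_trans ?_ ((weak_flow ha hΨ hσ).trans ?_)
  · gcongr
    exact hpt _
  · unfold Ptot
    rw [lintegral_lintegral_swap hM.aemeasurable, lint_muO a hfm, ← lintegral_const_mul' _ _ (ENNReal.mul_ne_top ENNReal.ofReal_ne_top ENNReal.ofReal_ne_top)]
    apply lintegral_mono; intro y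
    beta_reduce
    have hs : Measurable fun x : Om n => Psi n (x.1 - y.1) ‖y.1‖ (x.2 - y.2) := by
      have h : Measurable fun x : Om n => ((x, y) : Om n × Om n) := by fun_prop
      have h2 := hP.comp h
      simpa only [Function.comp_def] using h2
    rw [lintegral_const_mul _ (hs.const_mul _), lintegral_const_mul _ hs, mul_comm]
    change _ ≤ _ * phi a f y
    gcongr
    exact int_Psi y.1 y.2

end GR

namespace GR
open scoped ENNReal
variable {n : ℕ}

/-! ### Part 22: unit drift -/

def Qop (κ : Kap n) (a : EE n) (f : Om n → ℂ) (t : ℝ) (x : Om n) : ℂ := ((Real.exp (-(2 * inner ℝ a x.1)) : ℝ) : ℂ) *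
  ∫ y : Om n, rr κ a t x.1 y.1 (x.2 - y.2) * (f y * ((Real.exp (2 * inner ℝ a y.1) : ℝ) : ℂ))

def Rop (κ : Kap n) (a : EE n) (f : Om n → ℂ) (x : Om n) : ℂ :=
  ∫ t in Ioi (0:ℝ), ((t ^ (-(1/2) : ℝ) : ℝ) : ℂ) * Qop κ a f t x

lemma trunc_eq (hn : 1 ≤ n) (κ : Kap n) {a : EE n} (ha : ‖a‖ = 1) {f : Om n → ℂ} (hf : Continuous f) (hc : HasCompactSupport f)
    {ε : ℝ} (hε : 0 < ε) (x : Om n) :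
    ∫ t in Ioc ε 1, ((t ^ (-(1/2) : ℝ) : ℝ) : ℂ) * Qop κ a f t x = ∫ y, Ke κ a ε x y * f y ∂(muO a) := by
  rw [int_muO]
  have hφ : Integrable fun y : Om n => f y * ((Real.exp (2 * inner ℝ a y.1) : ℝ) : ℂ) :=
    Continuous.integrable_of_hasCompactSupport (hf.mul (by fun_prop)) hc.mul_right
  have hG : Integrable (Function.uncurry fun (t : ℝ) (y : Om n) => (((t ^ (-(1/2) : ℝ) : ℝ) : ℂ) * rr κ a t x.1 y.1 (x.2 - y.2)) *
      (f y * ((Real.exp (2 * inner ℝ a y.1) : ℝ) : ℂ))) ((volume.restrict (Ioc ε 1)).prod volume) := by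
    refine Integrable.bdd_mul (c := ε ^ (-(1/2) : ℝ) * (ε ^ (-NN n - 3 / 2) * C1 n)) (hφ.comp_snd (volume.restrict (Ioc ε 1))) ?_ ?_
    · have h : Measurable fun p : ℝ × Om n => (((x, p.2), p.1) : (Om n × Om n) × ℝ) := by fun_prop
      have h2 := (measurable_rr' κ a).comp h
      exact h2.aestronglyMeasurable
    · have := (Measure.quasiMeasurePreserving_fst (μ := volume.restrict (Ioc ε 1)) (ν := (volume : Measure (Om n)))).ae (ae_restrict_mem measurableSet_Ioc)
      filter_upwards [this] with p hp
      exact rr_bd hn κ ha hε hp _ _ _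
  calc _ = ∫ t in Ioc ε 1, ((Real.exp (-(2 * inner ℝ a x.1)) : ℝ) : ℂ) * ∫ y : Om n, (((t ^ (-(1/2) : ℝ) : ℝ) : ℂ) * rr κ a t x.1 y.1 (x.2 - y.2)) *
      (f y * ((Real.exp (2 * inner ℝ a y.1) : ℝ) : ℂ)) := by
        congr 1; ext t
        unfold Qop
        rw [mul_left_comm, ← integral_const_mul]
        congr 2; ext y; ring
    _ = ((Real.exp (-(2 * inner ℝ a x.1)) : ℝ) : ℂ) * ∫ y : Om n, ∫ t in Ioc ε 1, (((t ^ (-(1/2) : ℝ) : ℝ) : ℂ) * rr κ a t x.1 y.1 (x.2 - y.2)) *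
      (f y * ((Real.exp (2 * inner ℝ a y.1) : ℝ) : ℂ)) := by
        rw [integral_const_mul, integral_integral_swap hG]
    _ = _ := by
        rw [← integral_const_mul]
        congr 1; ext y
        unfold Ke
        rw [integral_mul_const]
        ring

lemma enorm_real_nonneg {r : ℝ} (hr : 0 ≤ r) : ‖((r : ℝ) : ℂ)‖ₑ = ENNReal.ofReal r := by
  rw [← ofReal_norm, Complex.norm_real, Real.norm_of_nonneg hr]

lemma large_le (κ : Kap n) (a : EE n) (f : Om n → ℂ) (x : Om n) :
    ‖∫ t in Ioi (1:ℝ), ((t ^ (-(1/2) : ℝ) : ℝ) : ℂ) * Qop κ a f t x‖ₑ ≤ Lop κ a f x := by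
  refine (enorm_integral_le_lintegral_enorm _).trans ?_
  unfold Lop
  rw [← lintegral_const_mul' _ _ ENNReal.ofReal_ne_top]
  refine setLIntegral_mono' measurableSet_Ioi fun t ht => ?_
  rw [enorm_tmul (lt_trans one_pos ht), mul_left_comm]
  refine mul_le_mul_right ?_ _
  unfold Qop
  rw [enorm_mul, enorm_real_nonneg (Real.exp_pos _).le]
  refine mul_le_mul_right ((enorm_integral_le_lintegral_enorm _).trans (le_of_eq ?_)) _
  congr 1; ext y
  rw [enorm_mul, enorm_mul, enorm_real_nonneg (Real.exp_pos _).le, mul_comm ‖f y‖ₑ]; rfl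

def Cw (n : ℕ) : ℝ≥0∞ := 2 * (Cz n + ENNReal.ofReal (C2 n * C7 n) * ENNReal.ofReal (C8 n))

lemma Cw_ne_top (n : ℕ) : Cw n ≠ ⊤ := by
  unfold Cw Cz
  have h1 : (4 : ℝ≥0∞) ≠ ⊤ := by norm_num
  have h2 : (12 : ℝ≥0∞) ≠ ⊤ := by norm_num
  have h3 : (2 : ℝ≥0∞) ≠ ⊤ := by norm_num
  have h4 := fun x : ℝ => ENNReal.ofReal_ne_top (r := x)
  have hm := fun {x y : ℝ≥0∞} => ENNReal.mul_ne_top (a := x) (b := y)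
  refine hm h3 (ENNReal.add_ne_top.2 ⟨ENNReal.add_ne_top.2 ⟨ENNReal.add_ne_top.2 ⟨hm (hm h1 h2) (h4 _), hm h1 (h4 _)⟩, h4 _⟩, hm (h4 _) (h4 _)⟩)

lemma weak_unit (hn : 1 ≤ n) (κ : Kap n) {a : EE n} (ha : ‖a‖ = 1) {f : Om n → ℂ} (hf : Continuous f) (hc : HasCompactSupport f)
    {σ : ℝ≥0∞} (hσ : σ ≠ ⊤) : σ * muO a {x | σ < ‖Rop κ a f x‖ₑ} ≤ Cw n * ∫⁻ y, ‖f y‖ₑ ∂(muO a) := by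
  set ε : ℕ → ℝ := fun k => 1 / ((k:ℝ) + 1) with hεd
  have hε : ∀ k, 0 < ε k := fun k => Nat.one_div_pos_of_nat
  have hε1 : ∀ k, ε k ≤ 1 := fun k => by
    rw [hεd]; beta_reduce; rw [div_le_one (by positivity)]; linarith [Nat.cast_nonneg (α := ℝ) k]
  have hanti : Antitone ε := fun i j hij => Nat.one_div_le_one_div hij
  set A : ℕ → Set (Om n) := fun k => {x | σ / 2 < ‖∫ y, Ke κ a (ε k) x y * f y ∂(muO a)‖ₑ} with hA
  set B : ℕ → Set (Om n) := fun K => ⋂ k ∈ Ici K, A k with hB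
  have hσ2 : σ / 2 ≠ ⊤ := ENNReal.div_ne_top hσ (by norm_num)
  set I := ∫⁻ y, ‖f y‖ₑ ∂(muO a)
  have hsub : {x | σ < ‖Rop κ a f x‖ₑ} ⊆ (⋃ K, B K) ∪ {x | σ / 2 < Lop κ a f x} := by
    intro x hx
    have hx : σ < ‖Rop κ a f x‖ₑ := hx
    by_cases hI : IntegrableOn (fun t : ℝ => ((t ^ (-(1/2) : ℝ) : ℝ) : ℂ) * Qop κ a f t x) (Ioi 0)
    swap
    · unfold Rop at hx
      rw [integral_undef hI, enorm_zero] at hx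
      exact absurd hx not_lt_zero
    by_contra hcon
    rw [mem_union, not_or] at hcon
    obtain ⟨h1, h2⟩ := hcon
    have h2 : Lop κ a f x ≤ σ / 2 := not_lt.1 h2
    have hU : ⋃ k, Ioc (ε k) 1 = Ioc (0:ℝ) 1 := by
      ext t
      simp only [mem_iUnion, mem_Ioc]
      constructor
      · rintro ⟨k, h, h'⟩; exact ⟨(hε k).trans h, h'⟩
      · rintro ⟨h, h'⟩
        obtain ⟨k, hk⟩ := exists_nat_one_div_lt h
        exact ⟨k, hk, h'⟩
    have hlim := tendsto_setIntegral_of_monotone (μ := volume) (f := fun t : ℝ => ((t ^ (-(1/2) : ℝ) : ℝ) : ℂ) * Qop κ a f t x)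
      (s := fun k => Ioc (ε k) 1) (fun k => measurableSet_Ioc)
      (fun i j hij => Ioc_subset_Ioc_left (hanti hij)) (by rw [hU]; exact hI.mono_set Ioc_subset_Ioi_self)
    rw [hU] at hlim
    simp only [trunc_eq hn κ ha hf hc (hε _)] at hlim
    have h3 : ‖∫ t in Ioc (0:ℝ) 1, ((t ^ (-(1/2) : ℝ) : ℝ) : ℂ) * Qop κ a f t x‖ₑ ≤ σ / 2 := by
      by_contra h4
      push Not at h4
      have h5 := ((continuous_enorm.tendsto _).comp hlim).eventually (lt_mem_nhds h4)
      obtain ⟨K, hK⟩ := eventually_atTop.1 h5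
      apply h1
      rw [mem_iUnion]
      exact ⟨K, mem_iInter₂.2 fun k hk => hK k hk⟩
    have h4 : Rop κ a f x = (∫ t in Ioc (0:ℝ) 1, ((t ^ (-(1/2) : ℝ) : ℝ) : ℂ) * Qop κ a f t x) +
        ∫ t in Ioi (1:ℝ), ((t ^ (-(1/2) : ℝ) : ℝ) : ℂ) * Qop κ a f t x := by
      unfold Rop
      rw [← Ioc_union_Ioi_eq_Ioi (zero_le_one (α := ℝ))]
      exact setIntegral_union (Ioc_disjoint_Ioi le_rfl) measurableSet_Ioi (hI.mono_set Ioc_subset_Ioi_self)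
        (hI.mono_set (Ioi_subset_Ioi zero_le_one))
    rw [h4] at hx
    refine absurd hx (not_lt.2 ?_)
    calc _ ≤ σ / 2 + σ / 2 := (enorm_add_le _ _).trans (add_le_add h3 ((large_le κ a f x).trans h2))
      _ = σ := ENNReal.add_halves σ
  have hBm : Monotone B := fun i j hij => biInter_subset_biInter_left (Ici_subset_Ici.2 hij)
  have hU2 : σ / 2 * muO a (⋃ K, B K) ≤ Cz n * I := by
    rw [hBm.measure_iUnion, ENNReal.mul_iSup]
    refine iSup_le fun K => ?_
    refine le_trans ?_ (weak_local hn κ ha (hε K) (hε1 K) hf hc hσ2)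
    refine mul_le_mul_right (measure_mono ?_) _
    exact biInter_subset_of_mem (mem_Ici.2 le_rfl)
  have hL := weak_large hn κ ha hf hσ2
  calc _ ≤ σ * (muO a (⋃ K, B K) + muO a {x | σ / 2 < Lop κ a f x}) :=
        mul_le_mul_right ((measure_mono hsub).trans (measure_union_le _ _)) _
    _ = 2 * (σ / 2 * muO a (⋃ K, B K) + σ / 2 * muO a {x | σ / 2 < Lop κ a f x}) := by
        rw [← mul_add, ← mul_assoc, ENNReal.mul_div_cancel (by norm_num) (by norm_num)]
    _ ≤ 2 * (Cz n * I + ENNReal.ofReal (C2 n * C7 n) * ENNReal.ofReal (C8 n) * I) :=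
        mul_le_mul_right (add_le_add hU2 hL) _
    _ = _ := by unfold Cw; ring

end GR

namespace GR
open scoped ENNReal
variable {n : ℕ}

/-! ### Part 23: scaling and transfer -/

lemma map_dens {X Y : Type*} [MeasurableSpace X] [MeasurableSpace Y] (E : X ≃ᵐ Y) {μ : Measure X} {ν : Measure Y} {c : ℝ≥0∞}
    (h : Measure.map E μ = c • ν) {w : Y → ℝ≥0∞} (hw : Measurable w) :
    Measure.map E (μ.withDensity fun x => w (E x)) = c • ν.withDensity w := by
  ext S hS
  rw [E.map_apply, withDensity_apply _ (E.measurable hS), ← setLIntegral_map hS hw E.measurable, h, Measure.restrict_smul,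
    lintegral_smul_measure, Measure.smul_apply, withDensity_apply _ hS]

def dil (A : ℝ) (hA : A ≠ 0) : Om n ≃ₜ Om n :=
  (Homeomorph.smulOfNeZero A hA).prodCongr (Homeomorph.smulOfNeZero (A ^ 2) (pow_ne_zero 2 hA))

lemma dil_fst (A : ℝ) (hA : A ≠ 0) (x : Om n) : (dil A hA x).1 = A • x.1 := rfl
lemma dil_snd (A : ℝ) (hA : A ≠ 0) (x : Om n) : (dil A hA x).2 = A ^ 2 * x.2 := rfl

lemma map_dil {A : ℝ} (hA : 0 < A) : Measure.map (dil A hA.ne' : Om n → Om n) volume = ENNReal.ofReal ((A ^ (n + 2))⁻¹) • volume := by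
  have h1 := Measure.map_addHaar_smul (volume : Measure (EE n)) hA.ne'
  have h2 := Measure.map_addHaar_smul (volume : Measure ℝ) (pow_ne_zero 2 hA.ne')
  have h3 := Measure.map_prod_map (volume : Measure (EE n)) (volume : Measure ℝ) (measurable_const_smul A) (measurable_const_smul (A ^ 2))
  rw [h1, h2, Measure.prod_smul_left, Measure.prod_smul_right, smul_smul, ← ENNReal.ofReal_mul (abs_nonneg _), ← abs_mul] at h3
  have e : |(A ^ Module.finrank ℝ (EE n))⁻¹ * ((A ^ 2) ^ Module.finrank ℝ ℝ)⁻¹| = (A ^ (n + 2))⁻¹ := by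
    rw [abs_of_pos (by positivity), finrank_euclideanSpace_fin, Module.finrank_self, pow_one, pow_add, mul_inv]
  rw [e] at h3
  exact h3.symm

lemma rr_scale (κ : Kap n) {a : EE n} {A t : ℝ} (hA : 0 < A) (ht : 0 < t) (x y : EE n) (z : ℝ) :
    rr κ a t x y z = ((A ^ (n + 3) : ℝ) : ℂ) * rr κ (A⁻¹ • a) (A ^ 2 * t) (A • x) (A • y) (A ^ 2 * z) := by
  have hs : √(A ^ 2 * t) = A * √t := by rw [Real.sqrt_mul (by positivity), Real.sqrt_sq hA.le]
  have ht' : 0 < √t := Real.sqrt_pos.2 ht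
  unfold rr
  rw [hs, smul_smul, smul_smul, smul_smul]
  have e1 : A * √t * A⁻¹ = √t := by field_simp
  have e2 : (A * √t)⁻¹ * A = (√t)⁻¹ := by field_simp
  have e3 : A ^ 2 * z / (A ^ 2 * t) = z / t := by field_simp
  have e4 : t ^ (-NN n - 3 / 2) = A ^ (n + 3) * (A ^ 2 * t) ^ (-NN n - 3 / 2) := by
    rw [Real.mul_rpow (by positivity) ht.le, ← mul_assoc, ← Real.rpow_natCast, ← Real.rpow_natCast, ← Real.rpow_mul hA.le, ← Real.rpow_add hA]
    have : ((n + 3 : ℕ) : ℝ) + (2 : ℕ) * (-NN n - 3 / 2) = 0 := by unfold NN; push_cast; ring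
    rw [this, Real.rpow_zero, one_mul]
  rw [e1, e2, e3, e4, Complex.ofReal_mul, mul_assoc]

lemma inner_dil {a : EE n} {A : ℝ} (hA : A ≠ 0) (x : Om n) : inner ℝ (A⁻¹ • a) (dil A hA x).1 = inner ℝ a x.1 := by
  rw [dil_fst, inner_smul_left, inner_smul_right]
  simp [hA]

lemma Qop_scale (κ : Kap n) {a : EE n} {A t : ℝ} (hA : 0 < A) (ht : 0 < t) (f : Om n → ℂ) (x : Om n) :
    Qop κ a f t x = (A : ℂ) * Qop κ (A⁻¹ • a) (f ∘ (dil A hA.ne').symm) (A ^ 2 * t) (dil A hA.ne' x) := by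
  unfold Qop
  set δ := dil (n := n) A hA.ne'
  have h := (δ.measurableEmbedding).integral_map (μ := volume) (fun w : Om n => rr κ (A⁻¹ • a) (A ^ 2 * t) (δ x).1 w.1 ((δ x).2 - w.2) *
    ((f ∘ δ.symm) w * ((Real.exp (2 * inner ℝ (A⁻¹ • a) w.1) : ℝ) : ℂ)))
  rw [map_dil hA, integral_smul_measure, ENNReal.toReal_ofReal (by positivity)] at h
  have h2 : ∫ y : Om n, rr κ a t x.1 y.1 (x.2 - y.2) * (f y * ((Real.exp (2 * inner ℝ a y.1) : ℝ) : ℂ)) = ((A ^ (n + 3) : ℝ) : ℂ) *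
      ∫ y : Om n, rr κ (A⁻¹ • a) (A ^ 2 * t) (δ x).1 (δ y).1 ((δ x).2 - (δ y).2) *
    ((f ∘ δ.symm) (δ y) * ((Real.exp (2 * inner ℝ (A⁻¹ • a) (δ y).1) : ℝ) : ℂ)) := by
    rw [← integral_const_mul]
    congr 1; ext y
    rw [inner_dil, rr_scale κ hA ht, dil_fst, dil_fst, dil_snd, dil_snd, ← mul_sub, Function.comp_apply, δ.symm_apply_apply, mul_assoc]
  rw [h2, ← h, inner_dil, Complex.real_smul, mul_left_comm (A : ℂ)]
  congr 1
  rw [← mul_assoc, ← Complex.ofReal_mul]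
  congr 2
  have : A ^ (n + 3) = A ^ (n + 2) * A := by ring
  rw [this]; field_simp

lemma Rop_scale (κ : Kap n) {a : EE n} {A : ℝ} (hA : 0 < A) (f : Om n → ℂ) (x : Om n) :
    Rop κ a f x = Rop κ (A⁻¹ • a) (f ∘ (dil A hA.ne').symm) (dil A hA.ne' x) := by
  unfold Rop
  obtain ⟨G, hG⟩ : ∃ G : ℝ → ℂ, G = fun τ => ((τ ^ (-(1/2) : ℝ) : ℝ) : ℂ) * Qop κ (A⁻¹ • a) (f ∘ (dil A hA.ne').symm) τ (dil A hA.ne' x) := ⟨_, rfl⟩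
  have h := integral_comp_mul_left_Ioi (fun τ : ℝ => ((A ^ 2 : ℝ) : ℂ) * G τ) 0 (b := A ^ 2) (by positivity)
  rw [mul_zero, integral_const_mul _ G, Complex.real_smul, ← mul_assoc, ← Complex.ofReal_mul, inv_mul_cancel₀ (by positivity), Complex.ofReal_one, one_mul] at h
  rw [hG] at h
  rw [← h]
  refine setIntegral_congr_fun measurableSet_Ioi fun t ht => ?_
  have ht : 0 < t := ht
  beta_reduce
  rw [Qop_scale κ hA ht, ← mul_assoc, ← mul_assoc, ← Complex.ofReal_mul, ← Complex.ofReal_mul]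
  congr 2
  rw [Real.mul_rpow (by positivity) ht.le, ← Real.rpow_natCast A 2, ← Real.rpow_mul hA.le, ← mul_assoc, ← Real.rpow_add hA]
  have : ((2:ℕ):ℝ) + (2:ℕ) * (-(1/2)) = 1 := by norm_num
  rw [this, Real.rpow_one, mul_comm]

lemma map_muO {a : EE n} {A : ℝ} (hA : 0 < A) :
    Measure.map (dil A hA.ne' : Om n → Om n) (muO a) = ENNReal.ofReal ((A ^ (n + 2))⁻¹) • muO (A⁻¹ • a) := by
  have h := map_dens (dil (n := n) A hA.ne').toMeasurableEquiv (map_dil hA)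
    (w := fun x => ENNReal.ofReal (Real.exp (2 * inner ℝ (A⁻¹ • a) x.1))) (by fun_prop)
  simp only [Homeomorph.toMeasurableEquiv_coe, inner_dil] at h
  exact h

lemma weak_all (hn : 1 ≤ n) (κ : Kap n) {a : EE n} (ha : a ≠ 0) {f : Om n → ℂ} (hf : Continuous f) (hc : HasCompactSupport f)
    {σ : ℝ≥0∞} (hσ : σ ≠ ⊤) : σ * muO a {x | σ < ‖Rop κ a f x‖ₑ} ≤ Cw n * ∫⁻ y, ‖f y‖ₑ ∂(muO a) := by
  have hA : 0 < ‖a‖ := norm_pos_iff.2 ha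
  set δ := dil (n := n) ‖a‖ hA.ne'
  have hb : ‖‖a‖⁻¹ • a‖ = 1 := norm_smul_inv_norm (𝕜 := ℝ) ha
  have h := weak_unit hn κ hb (hf.comp δ.symm.continuous) (hc.comp_homeomorph δ.symm) hσ
  have hm := map_muO (a := a) hA
  set c := ENNReal.ofReal ((‖a‖ ^ (n + 2))⁻¹)
  have e1 : muO a {x | σ < ‖Rop κ a f x‖ₑ} = c * muO (‖a‖⁻¹ • a) {x | σ < ‖Rop κ (‖a‖⁻¹ • a) (f ∘ δ.symm) x‖ₑ} := by
    have : {x | σ < ‖Rop κ a f x‖ₑ} = δ ⁻¹' {x | σ < ‖Rop κ (‖a‖⁻¹ • a) (f ∘ δ.symm) x‖ₑ} := by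
      ext x
      rw [mem_ofPred_eq, Rop_scale κ hA]; rfl
    rw [this, ← δ.measurableEmbedding.map_apply, hm, Measure.smul_apply, smul_eq_mul]
  have e2 : ∫⁻ y, ‖f y‖ₑ ∂(muO a) = c * ∫⁻ y, ‖(f ∘ δ.symm) y‖ₑ ∂(muO (‖a‖⁻¹ • a)) := by
    have := δ.measurableEmbedding.lintegral_map (μ := muO a) (fun y => ‖(f ∘ δ.symm) y‖ₑ)
    rw [hm, lintegral_smul_measure, smul_eq_mul] at this
    rw [this]
    simp
  rw [e1, e2, mul_left_comm, mul_left_comm (Cw n)]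
  exact mul_le_mul_right h c

def e2h : EuclideanSpace ℝ (Fin 1) ≃ₜ ℝ := (EuclideanSpace.equiv (Fin 1) ℝ).toHomeomorph.trans (Homeomorph.funUnique (Fin 1) ℝ)

def Eh (n : ℕ) : Ep n 1 ≃ₜ Om n := (Homeomorph.refl (EE n)).prodCongr e2h

lemma Eh_fst (x : Ep n 1) : (Eh n x).1 = x.1 := rfl
lemma Eh_snd (x : Ep n 1) : (Eh n x).2 = x.2 0 := rfl

lemma mp_Eh : MeasurePreserving (Eh n) :=
  (MeasurePreserving.id (volume : Measure (EE n))).prod mp_e1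

lemma map_muG (a : EE n) : Measure.map (Eh n) (muG a) = muO a := by
  have h := map_dens (Eh n).toMeasurableEquiv (μ := volume) (ν := volume) (c := 1) (by rw [one_smul]; exact mp_Eh.map_eq)
    (w := fun x => ENNReal.ofReal (Real.exp (2 * inner ℝ a x.1))) (by fun_prop)
  rw [one_smul] at h
  unfold muG
  simp only [dotp_eq]
  exact h

open Classical in
lemma Xalpha_one {α : Kap n → ℕ} {κ : Kap n} (h1 : α κ = 1) (h0 : ∀ j, j ≠ κ → α j = 0) : Xalpha α = vf κ := by
  have key : ∀ l : List (Kap n), l.Nodup → l.foldr (fun i F => (vf i)^[α i] ∘ F) id = if κ ∈ l then vf κ else id := by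
    intro l
    induction l with
    | nil => intro _; simp
    | cons i l ih =>
      intro hl
      rw [List.nodup_cons] at hl
      rw [List.foldr_cons, ih hl.2]
      by_cases hi : i = κ
      · subst hi
        simp [h1, hl.1]
      · have : κ ≠ i := fun h => hi h.symm
        simp [h0 i hi, this]
  unfold Xalpha
  rw [key _ (Finset.nodup_toList _)]
  simp

lemma exists_kap {α : Kap n → ℕ} (hα : ∑ i, α i = 1) : ∃ κ, α κ = 1 ∧ ∀ j, j ≠ κ → α j = 0 := by
  obtain ⟨κ, -, hκ⟩ := Finset.exists_ne_zero_of_sum_ne_zero (hα.trans_ne one_ne_zero)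
  have h := Finset.add_sum_erase Finset.univ α (Finset.mem_univ κ)
  rw [hα] at h
  refine ⟨κ, by omega, fun j hj => ?_⟩
  have h2 : ∑ i ∈ Finset.univ.erase κ, α i = 0 := by omega
  exact (Finset.sum_eq_zero_iff.1 h2) j (Finset.mem_erase.2 ⟨hj, Finset.mem_univ j⟩)

lemma riesz_eq (hn : 1 ≤ n) {α : Kap n → ℕ} (hα : ∑ i, α i = 1) {κ : Kap n} (hX : Xalpha α = vf κ) (a : EE n) {f : Ep n 1 → ℂ}
    (hf : Continuous f) (hc : HasCompactSupport f) (x : Ep n 1) :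
    grushinRiesz a α f x = (((√π)⁻¹ : ℝ) : ℂ) * Rop κ a (f ∘ (Eh n).symm) (Eh n x) := by
  unfold grushinRiesz Rop
  rw [hα, hX, Nat.cast_one, Real.Gamma_one_half_eq]
  congr 1
  refine setIntegral_congr_fun measurableSet_Ioi fun t ht => ?_
  rw [vf_heat hn κ ht a x hf hc]
  have e : (1:ℝ) / 2 - 1 = -(1/2) := by norm_num
  rw [e]
  unfold Qop
  rw [Eh_fst, Eh_snd]
  congr 2
  rw [← mp_Eh.integral_comp (Eh n).measurableEmbedding]
  congr 1; ext y
  rw [Eh_fst, Eh_snd, Function.comp_apply, (Eh n).symm_apply_apply]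

end GR

open GR

/-- **Theorem (weak type (1,1), `m = 1`)** -/
theorem grushinRiesz_weak11 (n : ℕ) (hn : 1 ≤ n)
    (α : Fin n ⊕ Fin n × Fin 1 → ℕ) (hα : ∑ i, α i = 1) :
    ∃ C : ℝ, 0 < C ∧
      ∀ a : EuclideanSpace ℝ (Fin n), a ≠ 0 →
        ∀ f : Ep n 1 → ℂ, ContDiff ℝ (⊤ : ℕ∞) f → HasCompactSupport f →
          ∀ s : ℝ, 0 < s →
            muG a {x : Ep n 1 | s < ‖grushinRiesz a α f x‖} ≤
              ENNReal.ofReal C * eLpNorm f 1 (muG a) / ENNReal.ofReal s := by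
  obtain ⟨κ, h1, h0⟩ := exists_kap hα
  have hX := Xalpha_one h1 h0
  refine ⟨(Cw n).toReal + 1, by positivity, fun a ha f hfs hc s hs => ?_⟩
  have hf : Continuous f := hfs.continuous
  have h := weak_all hn κ ha (hf.comp (Eh n).symm.continuous) (hc.comp_homeomorph (Eh n).symm) (σ := ENNReal.ofReal s) ENNReal.ofReal_ne_top
  have e1 : muG a {x : Ep n 1 | s < ‖grushinRiesz a α f x‖} ≤ muO a {x | ENNReal.ofReal s < ‖Rop κ a (f ∘ (Eh n).symm) x‖ₑ} := by
    rw [← map_muG, (Eh n).measurableEmbedding.map_apply]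
    apply measure_mono
    intro x hx
    have hx : s < ‖grushinRiesz a α f x‖ := hx
    rw [riesz_eq hn hα hX a hf hc, norm_mul, Complex.norm_real, Real.norm_of_nonneg (by positivity)] at hx
    have hp : (√π)⁻¹ ≤ 1 := inv_le_one_of_one_le₀ (Real.one_le_sqrt.2 (by linarith [Real.pi_gt_three]))
    change ENNReal.ofReal s < ‖Rop κ a (f ∘ (Eh n).symm) (Eh n x)‖ₑ
    rw [← ofReal_norm]
    refine (ENNReal.ofReal_lt_ofReal_iff_of_nonneg hs.le).2 (hx.trans_le ?_)
    exact mul_le_of_le_one_left (norm_nonneg _) hp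
  have e2 : ∫⁻ y, ‖(f ∘ (Eh n).symm) y‖ₑ ∂(muO a) = eLpNorm f 1 (muG a) := by
    rw [← map_muG, (Eh n).measurableEmbedding.lintegral_map, eLpNorm_one_eq_lintegral_enorm]
    simp
  rw [e2] at h
  rw [ENNReal.le_div_iff_mul_le (Or.inl (by rw [Ne, ENNReal.ofReal_eq_zero]; exact not_le.2 hs)) (Or.inl ENNReal.ofReal_ne_top), mul_comm]
  refine (mul_le_mul_right e1 _).trans (h.trans (mul_le_mul_left ?_ _))
  rw [← ENNReal.ofReal_toReal (Cw_ne_top n)]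
  apply ENNReal.ofReal_le_ofReal
  rw [ENNReal.ofReal_toReal (Cw_ne_top n)]
  linarith
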